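/- For any partitions λ₁,…,λ_k, there exists a polynomial Q ∈ ℚ[X,Y] in two variables with rational coefficients such that for every integer m ≥ 0 the m-th derivative at q = 0 of the function q ↦ Q(q, tanh q) equals s^even_{λ₁,…,λ_k}(m). In other words, the exponential generating series F^even_{λ₁,…,λ_k}(q) = Σ_m s^even(m) q^m/m! of s-numbers of even-degree real polynomials is a polynomial in q and f(q) = tanh(q) with rational coefficients. -/

import Mathlib

open Polynomial
open scoped Classical

/-- The ramification type of `w` for a real polynomial `P`: the multiset of
multiplicities of the complex roots of `P - w`. -/
noncomputable def ramType (P : Polynomial ℝ) (w : ℝ) : Multiset ℕ :=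
  ((P.map (algebraMap ℝ ℂ) - Polynomial.C (w : ℂ)).roots.toFinset.val).map
    fun z => (P.map (algebraMap ℝ ℂ) - Polynomial.C (w : ℂ)).rootMultiplicity z

/-- A disorder of `P`: a pair `x₁ < x₂` with `P x₁ = P x₂` and the multiplicity of `x₁`
as a root of `P - P x₁` strictly greater than that of `x₂`. -/
def disorders (P : Polynomial ℝ) : Set (ℝ × ℝ) :=
  {p | p.1 < p.2 ∧ P.eval p.1 = P.eval p.2 ∧
    (P - Polynomial.C (P.eval p.2)).rootMultiplicity p.2
      < (P - Polynomial.C (P.eval p.1)).rootMultiplicity p.1}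

/-- The sign `ε(P) = (-1)^{number of disorders}`. -/
noncomputable def epsilonP (P : Polynomial ℝ) : ℤ := (-1) ^ Nat.card (disorders P)

/-- `P = X^n + a₂ X^(n-2) + ⋯ + a_n`: monic of degree `n` with vanishing coefficient
of `X^(n-1)`. -/
def IsNormalized (n : ℕ) (P : Polynomial ℝ) : Prop :=
  P.natDegree = n ∧ P.Monic ∧ P.coeff (n - 1) = 0

/-- A multiset of positive integers summing to `n`. -/
def IsPartitionOf (n : ℕ) (Λ : Multiset ℕ) : Prop := Λ.sum = n ∧ 0 ∉ Λ

/-- The reduced ramification type: subtract 1 from every part of the ramification type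
and delete the zeros. -/
noncomputable def redRamType (P : Polynomial ℝ) (w : ℝ) : Multiset ℕ :=
  ((ramType P w).map fun a => a - 1).filter fun a => a ≠ 0

/-- The s-number of normalized real polynomials of degree `n = m + Σ|λᵢ| + 1` with
reduced ramification type `λ i` at the point `-(i+1)` for `i = 0,…,k-1`, and a simple
branch point at `-(k+j+1)` for `j = 0,…,m-1`. -/
noncomputable def sNum {k : ℕ} (lam : Fin k → Multiset ℕ) (m : ℕ) : ℤ :=
  ∑ᶠ P ∈ {P : Polynomial ℝ |
      IsNormalized (m + (∑ i, (lam i).sum) + 1) P ∧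
      (∀ i : Fin k, redRamType P (-(((i : ℕ) + 1 : ℕ) : ℝ)) = lam i) ∧
      ∀ j : Fin m, redRamType P (-((k + (j : ℕ) + 1 : ℕ) : ℝ)) = ({1} : Multiset ℕ)},
    epsilonP P

/-- `s^even(m)`: the s-number if the degree `n = m + Σ|λᵢ| + 1` is even, `0` otherwise. -/
noncomputable def sEven {k : ℕ} (lam : Fin k → Multiset ℕ) (m : ℕ) : ℤ :=
  if Even (m + (∑ i, (lam i).sum) + 1) then sNum lam m else 0

/-- `s^odd(m)`: the s-number if the degree `n = m + Σ|λᵢ| + 1` is odd, `0` otherwise. -/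
noncomputable def sOdd {k : ℕ} (lam : Fin k → Multiset ℕ) (m : ℕ) : ℤ :=
  if Odd (m + (∑ i, (lam i).sum) + 1) then sNum lam m else 0

noncomputable section

/-- formal antiderivative -/
def antider (p : ℂ[X]) : ℂ[X] := p.sum fun j a => Polynomial.monomial (j+1) (a / ((j:ℂ)+1))

lemma antider_coeff_zero (p : ℂ[X]) : (antider p).coeff 0 = 0 := by
  simp [antider, Polynomial.sum_def, Polynomial.finsetSum_coeff, Polynomial.coeff_monomial]

lemma antider_coeff_succ (p : ℂ[X]) (j : ℕ) : (antider p).coeff (j+1) = p.coeff j / ((j:ℂ)+1) := by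
  simp only [antider, Polynomial.sum_def, Polynomial.finsetSum_coeff, Polynomial.coeff_monomial]
  simp only [add_left_inj]
  rw [Finset.sum_ite_eq' p.support j]
  split_ifs with h
  · rfl
  · rw [Polynomial.notMem_support_iff.1 h]; simp

lemma derivative_antider (p : ℂ[X]) : derivative (antider p) = p := by
  ext j
  rw [Polynomial.coeff_derivative, antider_coeff_succ]
  have : (j:ℂ)+1 ≠ 0 := by exact_mod_cast Nat.succ_ne_zero j
  field_simp

lemma antider_eval_zero (p : ℂ[X]) : (antider p).eval 0 = 0 := by
  rw [← Polynomial.coeff_zero_eq_eval_zero, antider_coeff_zero]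

lemma natDegree_antider_le (p : ℂ[X]) (N : ℕ) (h : p.natDegree ≤ N) :
    (antider p).natDegree ≤ N + 1 := by
  rw [Polynomial.natDegree_le_iff_coeff_eq_zero]
  intro j hj
  obtain ⟨j, rfl⟩ : ∃ i, j = i + 1 := ⟨j-1, by omega⟩
  rw [antider_coeff_succ, Polynomial.coeff_eq_zero_of_natDegree_lt (by omega)]
  simp

lemma eq_add_C_of_derivative_eq {p q : ℂ[X]} (h : derivative p = derivative q) :
    p = q + C (p.eval 0 - q.eval 0) := by
  have h1 : derivative (p - q) = 0 := by simp [h]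
  have h2 := Polynomial.derivative_eq_zero.1 h1
  rw [Polynomial.natDegree_eq_zero] at h2
  obtain ⟨x, hx⟩ := h2
  have : p = q + C x := by rw [hx]; ring
  rw [this]; simp

lemma eval_sub_eq_of_derivative_eq {p q : ℂ[X]} (h : derivative p = derivative q) (z w : ℂ) :
    p.eval z - p.eval w = q.eval z - q.eval w := by
  rw [eq_add_C_of_derivative_eq h]; simp

variable {ι : Type*} [Fintype ι]

/-- product polynomial -/
def bp (μ : ι → ℕ) (a b : ι → ℂ) : ℂ[X] := ∏ i, (C (a i) * X + C (b i)) ^ μ i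

/-- primitive of the product polynomial -/
def prim (μ : ι → ℕ) (a b : ι → ℂ) (z : ℂ) : ℂ := (antider (bp μ a b)).eval z

lemma natDegree_bp_le (μ : ι → ℕ) (a b : ι → ℂ) : (bp μ a b).natDegree ≤ ∑ i, μ i := by
  unfold bp
  refine (Polynomial.natDegree_prod_le _ _).trans (Finset.sum_le_sum fun i _ => ?_)
  refine (Polynomial.natDegree_pow_le).trans ?_
  have : (C (a i) * X + C (b i)).natDegree ≤ 1 := Polynomial.natDegree_linear_le
  nlinarith

/-- coefficientwise smooth family -/
def CD {V : Type*} [NormedAddCommGroup V] [NormedSpace ℝ V] (f : V → ℂ[X]) : Prop :=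
  ∀ j, ContDiff ℝ 1 fun c => (f c).coeff j

section CD
variable {V : Type*} [NormedAddCommGroup V] [NormedSpace ℝ V]

lemma CD.mul {f g : V → ℂ[X]} (hf : CD f) (hg : CD g) : CD fun c => f c * g c := by
  intro j
  simp only [Polynomial.coeff_mul]
  exact ContDiff.sum fun x _ => (hf x.1).mul (hg x.2)

lemma CD.const (p : ℂ[X]) : CD fun _ : V => p := fun _ => contDiff_const

lemma CD.C {g : V → ℂ} (hg : ContDiff ℝ 1 g) : CD fun c => C (g c) := by
  intro j
  simp only [Polynomial.coeff_C]
  split_ifs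
  · exact hg
  · exact contDiff_const

lemma CD.add {f g : V → ℂ[X]} (hf : CD f) (hg : CD g) : CD fun c => f c + g c := by
  intro j
  simp only [Polynomial.coeff_add]
  exact (hf j).add (hg j)

lemma CD.pow {f : V → ℂ[X]} (hf : CD f) (n : ℕ) : CD fun c => f c ^ n := by
  induction n with
  | zero => simpa using CD.const 1
  | succ n ih => simp only [pow_succ]; exact ih.mul hf

lemma CD.prod {κ : Type*} {f : κ → V → ℂ[X]} (s : Finset κ) (hf : ∀ i, CD (f i)) :
    CD fun c => ∏ i ∈ s, f i c := by
  classical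
  induction s using Finset.induction_on with
  | empty => simpa using CD.const 1
  | insert i s hi ih => simp only [Finset.prod_insert hi]; exact (hf i).mul ih

end CD

lemma contDiff_prim (μ : ι → ℕ) :
    ContDiff ℝ 1 (fun p : (ι → ℂ) × (ι → ℂ) × ℂ => prim μ p.1 p.2.1 p.2.2) := by
  have h1 : CD (fun p : (ι → ℂ) × (ι → ℂ) × ℂ => bp μ p.1 p.2.1) := by
    unfold bp
    refine CD.prod _ fun i => CD.pow (CD.add (CD.mul (CD.C ?_) (CD.const X)) (CD.C ?_)) _
    · fun_prop
    · fun_prop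
  have h2 : CD (fun p : (ι → ℂ) × (ι → ℂ) × ℂ => antider (bp μ p.1 p.2.1)) := by
    intro j
    cases j with
    | zero => simp only [antider_coeff_zero]; exact contDiff_const
    | succ j => simp only [antider_coeff_succ]; exact (h1 j).div_const _
  unfold prim
  have h3 : (fun p : (ι → ℂ) × (ι → ℂ) × ℂ => (antider (bp μ p.1 p.2.1)).eval p.2.2) =
      fun p => ∑ j ∈ Finset.range (∑ i, μ i + 2), (antider (bp μ p.1 p.2.1)).coeff j * p.2.2 ^ j := by
    funext p
    exact Polynomial.eval_eq_sum_range' (lt_of_le_of_lt (natDegree_antider_le _ _ (natDegree_bp_le μ _ _)) (by omega)) _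
  rw [h3]
  refine ContDiff.sum fun j _ => (h2 j).mul ?_
  fun_prop

lemma ContDiff.prim' {V : Type*} [NormedAddCommGroup V] [NormedSpace ℝ V] (μ : ι → ℕ)
    {a b : V → ι → ℂ} {z : V → ℂ} (ha : ContDiff ℝ 1 a) (hb : ContDiff ℝ 1 b)
    (hz : ContDiff ℝ 1 z) : ContDiff ℝ 1 fun v => prim μ (a v) (b v) (z v) :=
  (contDiff_prim μ).comp (ha.prodMk (hb.prodMk hz))

lemma continuous_prim (μ : ι → ℕ) :
    Continuous (fun p : (ι → ℂ) × (ι → ℂ) × ℂ => prim μ p.1 p.2.1 p.2.2) :=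
  (contDiff_prim μ).continuous

lemma tendsto_prim {T : Type*} {l : Filter T} (μ : ι → ℕ) {a b : T → ι → ℂ} {z : T → ℂ}
    {a0 b0 : ι → ℂ} {z0 : ℂ} (ha : Filter.Tendsto a l (nhds a0)) (hb : Filter.Tendsto b l (nhds b0))
    (hz : Filter.Tendsto z l (nhds z0)) :
    Filter.Tendsto (fun t => prim μ (a t) (b t) (z t)) l (nhds (prim μ a0 b0 z0)) :=
  ((continuous_prim μ).tendsto (a0, b0, z0)).comp (ha.prodMk_nhds (hb.prodMk_nhds hz))

/-- the primitive of `∏ (X - x_i)^{μ_i}` -/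
def primX (μ : ι → ℕ) (x : ι → ℂ) (z : ℂ) : ℂ := prim μ (fun _ => 1) (fun i => - x i) z

lemma bp_one (μ : ι → ℕ) (x : ι → ℂ) :
    bp μ (fun _ => 1) (fun i => - x i) = ∏ i, (X - C (x i)) ^ μ i := by
  unfold bp
  refine Finset.prod_congr rfl fun i _ => ?_
  simp [sub_eq_add_neg]

/-- the blow-up identity -/
lemma blow_identity (μ : ι → ℕ) (S : Finset ι) (x y : ι → ℂ) (X0 s Y : ℂ)
    (hx : ∀ i ∈ S, x i = X0 + s * y i) :
    primX μ x (X0 + s * Y) - primX μ x X0 =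
      s ^ ((∑ i ∈ S, μ i) + 1) * prim μ (fun i => if i ∈ S then 1 else s)
        (fun i => if i ∈ S then - y i else X0 - x i) Y := by
  unfold primX prim
  set G := antider (bp μ (fun _ => 1) fun i => -x i) with hG
  set H := antider (bp μ (fun i => if i ∈ S then 1 else s)
        (fun i => if i ∈ S then - y i else X0 - x i)) with hH
  have key : derivative (G.comp (C s * X + C X0)) = derivative (C (s ^ ((∑ i ∈ S, μ i) + 1)) * H) := by
    rw [Polynomial.derivative_comp, hG, hH, Polynomial.derivative_C_mul, derivative_antider, derivative_antider]
    unfold bp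
    rw [Polynomial.prod_comp]
    have h1 : derivative (C s * X + C X0) = C s := by simp
    rw [h1]
    have h2 : ∀ i, ((C (1:ℂ) * X + C (- x i)) ^ μ i).comp (C s * X + C X0) =
        (if i ∈ S then C s ^ μ i else 1) * (C (if i ∈ S then 1 else s) * X + C (if i ∈ S then - y i else X0 - x i)) ^ μ i := by
      intro i
      rw [Polynomial.pow_comp]
      split_ifs with h
      · rw [← mul_pow]; congr 1; rw [hx i h]; simp; ring
      · rw [one_mul]; congr 1; simp; ring
    simp only [h2]
    rw [Finset.prod_mul_distrib, ← Finset.prod_filter]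
    rw [Finset.prod_pow_eq_pow_sum]
    simp only [Finset.filter_mem_eq_inter, Finset.univ_inter]
    rw [C_pow]; ring
  have := eval_sub_eq_of_derivative_eq key Y 0
  have h0 : H.eval 0 = 0 := antider_eval_zero _
  simp only [Polynomial.eval_comp, Polynomial.eval_mul, Polynomial.eval_C, Polynomial.eval_add,
    Polynomial.eval_X, h0, mul_zero, zero_add, sub_zero] at this
  rw [← this]; ring_nf

/-- multiplicity lemma -/
lemma mult_lemma {κ : Type*} (S : Finset κ) (μ : κ → ℕ) (y : κ → ℂ) (hμ : ∀ i ∈ S, 1 ≤ μ i) (d : ℂ) (hd : d ≠ 0)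
    (G : ℂ[X]) (hG : derivative G = C d * ∏ i ∈ S, (X - C (y i)) ^ μ i)
    (h0 : ∀ i ∈ S, G.eval (y i) = 0) :
    ∃ Q : ℂ[X], G = (∏ i ∈ S, (X - C (y i)) ^ μ i) * Q ∧ ∀ i ∈ S, Q.eval (y i) = 0 := by
  set W := ∏ i ∈ S, (X - C (y i)) ^ μ i with hW
  have hWm : W.Monic := Polynomial.monic_prod_of_monic _ _ fun i _ => (Polynomial.monic_X_sub_C _).pow _
  have hW0 : W ≠ 0 := hWm.ne_zero
  have hG0 : G ≠ 0 := by
    rintro rfl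
    simp at hG
    rcases hG with h | h
    · exact hd h
    · exact hW0 h
  have hm : ∀ i ∈ S, G.rootMultiplicity (y i) = W.rootMultiplicity (y i) + 1 := by
    intro i hi
    have h1 := Polynomial.derivative_rootMultiplicity_of_root (p := G) (t := y i) (h0 i hi)
    rw [hG, Polynomial.rootMultiplicity_mul (mul_ne_zero (C_ne_zero.2 hd) hW0), Polynomial.rootMultiplicity_C, zero_add] at h1
    have h2 : 0 < G.rootMultiplicity (y i) := (Polynomial.rootMultiplicity_pos hG0).2 (h0 i hi)
    omega
  have hdvd : W ∣ G := by
    have hs : W.Splits := IsAlgClosed.splits W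
    have hle : W.roots ≤ G.roots := by
      rw [Multiset.le_iff_count]
      intro z
      rw [Polynomial.count_roots, Polynomial.count_roots]
      by_cases hz : ∃ i ∈ S, y i = z
      · obtain ⟨i, hi, rfl⟩ := hz
        rw [hm i hi]; omega
      · have : W.rootMultiplicity z = 0 := by
          rw [Polynomial.rootMultiplicity_eq_zero]
          rw [hW, Polynomial.IsRoot, Polynomial.eval_prod, Finset.prod_eq_zero_iff]
          rintro ⟨i, hi, h⟩
          simp at h
          exact hz ⟨i, hi, by linear_combination - h.1⟩
        omega
    have h3 := (Multiset.prod_X_sub_C_dvd_iff_le_roots hG0 W.roots).2 hle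
    have h4 : W = (W.roots.map fun a => X - C a).prod := by
      have := hs.eq_prod_roots
      rw [hWm.leadingCoeff, C_1, one_mul] at this
      exact this
    rw [h4]; exact h3
  obtain ⟨Q, hQ⟩ := hdvd
  refine ⟨Q, hQ, fun i hi => ?_⟩
  have hQ0 : Q ≠ 0 := by rintro rfl; simp at hQ; exact hG0 hQ
  have h5 := hm i hi
  rw [hQ, Polynomial.rootMultiplicity_mul (mul_ne_zero hW0 hQ0)] at h5
  have : 0 < Q.rootMultiplicity (y i) := by omega
  exact (Polynomial.rootMultiplicity_pos hQ0).1 this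

lemma natDegree_prodS {κ : Type*} (S : Finset κ) (μ : κ → ℕ) (y : κ → ℂ) :
    (∏ i ∈ S, (X - C (y i)) ^ μ i).natDegree = ∑ i ∈ S, μ i := by
  rw [Polynomial.natDegree_prod_of_monic _ _ fun i _ => (Polynomial.monic_X_sub_C _).pow _]
  simp

/-- natural degree from derivative -/
lemma natDegree_of_derivative {κ : Type*} (S : Finset κ) (μ : κ → ℕ) (y : κ → ℂ) (d : ℂ) (hd : d ≠ 0)
    (G : ℂ[X]) (hG : derivative G = C d * ∏ i ∈ S, (X - C (y i)) ^ μ i) :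
    G.natDegree = (∑ i ∈ S, μ i) + 1 := by
  have h1 : (derivative G).natDegree = ∑ i ∈ S, μ i := by
    rw [hG, Polynomial.natDegree_C_mul hd, natDegree_prodS]
  have h2 := Polynomial.natDegree_derivative G
  have h3 : derivative G ≠ 0 := by
    rw [hG]
    exact mul_ne_zero (C_ne_zero.2 hd) (Polynomial.monic_prod_of_monic _ _ fun i _ => (Polynomial.monic_X_sub_C _).pow _).ne_zero
  have h4 : G.natDegree ≠ 0 := by
    intro h
    rw [Polynomial.natDegree_eq_zero] at h
    obtain ⟨x, rfl⟩ := h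
    simp at h3
  omega

/-- Lemma A5: all critical points at the same level implies only one critical point. -/
lemma all_eq_lemma {κ : Type*} (S : Finset κ) (μ : κ → ℕ) (y : κ → ℂ) (hμ : ∀ i ∈ S, 1 ≤ μ i) (d : ℂ) (hd : d ≠ 0)
    (G : ℂ[X]) (hG : derivative G = C d * ∏ i ∈ S, (X - C (y i)) ^ μ i) (w : ℂ)
    (h0 : ∀ i ∈ S, G.eval (y i) = w) : ∀ i ∈ S, ∀ j ∈ S, y i = y j := by
  have hG' : derivative (G - C w) = C d * ∏ i ∈ S, (X - C (y i)) ^ μ i := by simp [hG]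
  obtain ⟨Q, hQ, hQ0⟩ := mult_lemma S μ y hμ d hd (G - C w) hG' (by intro i hi; simp [h0 i hi])
  have hn := natDegree_of_derivative S μ y d hd _ hG'
  have hQne : Q ≠ 0 := by rintro rfl; rw [hQ] at hn; simp at hn
  have hWm : (∏ i ∈ S, (X - C (y i)) ^ μ i).Monic := Polynomial.monic_prod_of_monic _ _ fun i _ => (Polynomial.monic_X_sub_C _).pow _
  rw [hQ, Polynomial.natDegree_mul hWm.ne_zero hQne, natDegree_prodS] at hn
  have hQ1 : Q.natDegree = 1 := by omega
  intro i hi j hj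
  have hroots : Q.roots.toFinset.card ≤ 1 := (Multiset.toFinset_card_le _).trans ((Polynomial.card_roots' Q).trans hQ1.le)
  rw [Finset.card_le_one] at hroots
  exact hroots _ (by simp [hQne, hQ0 i hi]) _ (by simp [hQne, hQ0 j hj])

end

noncomputable section

/-- coefficientwise derivative at 0 of a path of polynomials -/
def HD (f : ℝ → ℂ[X]) (df : ℂ[X]) : Prop := ∀ j, HasDerivAt (fun s => (f s).coeff j) (df.coeff j) 0

lemma HD.mul {f g : ℝ → ℂ[X]} {df dg : ℂ[X]} (hf : HD f df) (hg : HD g dg) :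
    HD (fun s => f s * g s) (df * g 0 + f 0 * dg) := by
  intro j
  simp only [Polynomial.coeff_mul, Polynomial.coeff_add]
  rw [← Finset.sum_add_distrib]
  exact HasDerivAt.fun_sum fun x _ => (hf x.1).mul (hg x.2)

lemma HD.congr {f : ℝ → ℂ[X]} {df df' : ℂ[X]} (hf : HD f df) (h : df = df') : HD f df' := h ▸ hf

lemma HD.const (p : ℂ[X]) : HD (fun _ => p) 0 := by
  intro j; simpa using hasDerivAt_const (0:ℝ) (p.coeff j)

lemma HD.add {f g : ℝ → ℂ[X]} {df dg : ℂ[X]} (hf : HD f df) (hg : HD g dg) :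
    HD (fun s => f s + g s) (df + dg) := by
  intro j
  simp only [Polynomial.coeff_add]
  exact (hf j).add (hg j)

lemma HD.C {g : ℝ → ℂ} {dg : ℂ} (hg : HasDerivAt g dg 0) : HD (fun s => C (g s)) (C dg) := by
  intro j
  simp only [Polynomial.coeff_C]
  split_ifs
  · exact hg
  · exact hasDerivAt_const _ _

lemma HD.pow {f : ℝ → ℂ[X]} {df : ℂ[X]} (hf : HD f df) (n : ℕ) :
    HD (fun s => f s ^ n) ((n:ℂ[X]) * f 0 ^ (n-1) * df) := by
  induction n with
  | zero => simpa using HD.const 1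
  | succ n ih =>
    simp only [pow_succ]
    refine (ih.mul hf).congr ?_
    cases n with
    | zero => simp
    | succ n => simp; ring

lemma HD.prod {κ : Type*} {f : κ → ℝ → ℂ[X]} {df : κ → ℂ[X]} (s : Finset κ) (hf : ∀ i, HD (f i) (df i)) :
    HD (fun c => ∏ i ∈ s, f i c) (∑ i ∈ s, (∏ j ∈ s.erase i, f j 0) * df i) := by
  induction s using Finset.induction_on with
  | empty => simpa using HD.const 1
  | insert i s hi ih =>
    simp only [Finset.prod_insert hi]
    refine ((hf i).mul ih).congr ?_
    rw [Finset.sum_insert hi, Finset.erase_insert hi, mul_comm, Finset.mul_sum]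
    congr 1
    refine Finset.sum_congr rfl fun j hj => ?_
    have hij : i ≠ j := by rintro rfl; exact hi hj
    rw [Finset.erase_insert_of_ne hij, Finset.prod_insert (by simp [hi])]
    ring

lemma HD.antider {f : ℝ → ℂ[X]} {df : ℂ[X]} (hf : HD f df) :
    HD (fun s => antider (f s)) (antider df) := by
  intro j
  cases j with
  | zero => simpa only [antider_coeff_zero] using hasDerivAt_const _ _
  | succ j => simpa only [antider_coeff_succ] using (hf j).div_const _

lemma HD.natDegree_le {f : ℝ → ℂ[X]} {df : ℂ[X]} (hf : HD f df) (N : ℕ) (hN : ∀ s, (f s).natDegree ≤ N) :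
    df.natDegree ≤ N := by
  rw [Polynomial.natDegree_le_iff_coeff_eq_zero]
  intro j hj
  have h1 := hf j
  have h2 : (fun s => (f s).coeff j) = fun _ => 0 := by
    funext s; exact Polynomial.coeff_eq_zero_of_natDegree_lt (lt_of_le_of_lt (hN s) hj)
  rw [h2] at h1
  exact h1.unique (hasDerivAt_const _ _)

lemma HD.eval {f : ℝ → ℂ[X]} {df : ℂ[X]} (hf : HD f df) (N : ℕ) (hN : ∀ s, (f s).natDegree ≤ N)
    {z : ℝ → ℂ} {dz : ℂ} (hz : HasDerivAt z dz 0) :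
    HasDerivAt (fun s => (f s).eval (z s)) (df.eval (z 0) + (derivative (f 0)).eval (z 0) * dz) 0 := by
  have h1 : (fun s => (f s).eval (z s)) = fun s => ∑ j ∈ Finset.range (N+1), (f s).coeff j * z s ^ j := by
    funext s; exact Polynomial.eval_eq_sum_range' (by have := hN s; omega) _
  rw [h1]
  have h2 : df.eval (z 0) = ∑ j ∈ Finset.range (N+1), df.coeff j * z 0 ^ j :=
    Polynomial.eval_eq_sum_range' (by have := hf.natDegree_le N hN; omega) _
  have h3 : (derivative (f 0)).eval (z 0) = ∑ j ∈ Finset.range (N+1), (f 0).coeff j * ((j:ℂ) * z 0 ^ (j-1)) := by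
    conv_lhs => rw [(f 0).as_sum_range' (N+1) (by have := hN 0; omega)]
    rw [Polynomial.derivative_sum, Polynomial.eval_finsetSum]
    refine Finset.sum_congr rfl fun j _ => ?_
    rw [Polynomial.derivative_monomial, Polynomial.eval_monomial]; ring
  rw [h2, h3, Finset.sum_mul, ← Finset.sum_add_distrib]
  refine HasDerivAt.fun_sum fun j _ => ?_
  have := (hf j).mul (hz.pow j)
  refine this.congr_deriv ?_
  simp; ring

/-- Jacobian lemma -/
lemma jac_lemma {κ : Type*} (S : Finset κ) (hS : S.Nonempty) (μ : κ → ℕ) (y δ : κ → ℂ) (hμ : ∀ i ∈ S, 1 ≤ μ i)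
    (hy : Set.InjOn y S) (d : ℂ) (hd : d ≠ 0) (C0 δC : ℂ)
    (hsum : ∑ i ∈ S, (μ i : ℂ) * δ i = 0)
    (h : ∀ i ∈ S, HasDerivAt (fun s : ℝ => (C0 + s * δC) +
        d * (antider (∏ j ∈ S, (X - C (y j + s * δ j)) ^ μ j)).eval (y i + s * δ i)) 0 0) :
    (∀ i ∈ S, δ i = 0) ∧ δC = 0 := by
  set f : κ → ℝ → ℂ[X] := fun j s => (X - C (y j + s * δ j)) ^ μ j with hf
  set W : κ → ℂ[X] := fun i => (∏ j ∈ S.erase i, (X - C (y j)) ^ μ j) * (X - C (y i)) ^ (μ i - 1) with hW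
  have hlin : ∀ (u w : ℂ), HasDerivAt (fun s : ℝ => u + s * w) w 0 := by
    intro u w
    have h1 : HasDerivAt (fun s : ℝ => (s:ℂ)) 1 0 := by
      simpa using (hasDerivAt_id (0:ℝ)).ofReal_comp
    have := (h1.mul_const w).const_add u
    simpa using this
  have hfd : ∀ j, HD (f j) ((μ j : ℂ[X]) * (X - C (y j)) ^ (μ j - 1) * C (- δ j)) := by
    intro j
    have h1 : HD (fun s : ℝ => X - C (y j + s * δ j)) (C (- δ j)) := by
      have := (HD.const X).add (HD.C (hlin (- y j) (- δ j)))
      simp only [zero_add] at this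
      convert this using 2 with s
      rw [sub_eq_add_neg, ← C_neg]; congr 2; ring
    have := h1.pow (μ j)
    rw [Complex.ofReal_zero, zero_mul, add_zero] at this
    exact this
  have hp := HD.prod S hfd
  set dp : ℂ[X] := ∑ i ∈ S, C (- (μ i * δ i)) * W i with hdp
  have hp' : HD (fun s => ∏ i ∈ S, f i s) dp := by
    refine hp.congr (Finset.sum_congr rfl fun i _ => ?_)
    simp only [hf, hW]
    simp
    ring
  have hG := ((HD.const (C d)).mul hp'.antider).add (HD.C (hlin C0 δC))
  simp only [zero_mul, zero_add] at hG
  set dG := C d * antider dp + C δC with hdG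
  set N := (∑ i ∈ S, μ i) + 1 with hN
  have hdeg : ∀ s : ℝ, (C d * antider (∏ i ∈ S, f i s) + C (C0 + s * δC)).natDegree ≤ N := by
    intro s
    refine (Polynomial.natDegree_add_le _ _).trans (max_le ?_ (by rw [Polynomial.natDegree_C]; omega))
    refine (Polynomial.natDegree_C_mul_le _ _).trans (natDegree_antider_le _ _ ?_)
    exact (natDegree_prodS S μ fun j => y j + s * δ j).le
  have hcr : ∀ i ∈ S, (∏ j ∈ S, (X - C (y j)) ^ μ j).eval (y i) = 0 := by
    intro i hi
    rw [Polynomial.eval_prod]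
    refine Finset.prod_eq_zero hi ?_
    have := hμ i hi
    simp; omega
  have hval : ∀ i ∈ S, dG.eval (y i) = 0 := by
    intro i hi
    have h1 := hG.eval N hdeg (hlin (y i) (δ i))
    have h2 := h i hi
    have h3 : (fun s : ℝ => (C0 + s * δC) +
        d * (antider (∏ j ∈ S, (X - C (y j + s * δ j)) ^ μ j)).eval (y i + s * δ i)) =
        fun s : ℝ => (C d * antider (∏ i ∈ S, f i s) + C (C0 + s * δC)).eval (y i + s * δ i) := by
      funext s; simp [hf]; ring
    rw [h3] at h2
    have h4 := h1.unique h2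
    simp only [Complex.ofReal_zero, zero_mul, add_zero, Polynomial.derivative_add,
      Polynomial.derivative_C, Polynomial.derivative_C_mul, derivative_antider, Polynomial.eval_mul] at h4
    have h5 : (∏ j ∈ S, f j 0).eval (y i) = 0 := by simpa [hf] using hcr i hi
    rw [h5] at h4
    simpa using h4
  have hdGd : derivative dG = C d * dp := by
    simp [hdG, derivative_antider]
  -- divisibility
  have hWdvd : ∀ i ∈ S, ∀ j ∈ S, (X - C (y i)) ^ (μ i - 1) ∣ W j := by
    intro i hi j hj
    by_cases hij : i = j
    · subst hij; exact Dvd.intro_left _ rfl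
    · refine Dvd.dvd.mul_right ?_ _
      refine (pow_dvd_pow _ (Nat.sub_le _ 1)).trans ?_
      exact Finset.dvd_prod_of_mem (fun j => (X - C (y j)) ^ μ j) (Finset.mem_erase.2 ⟨hij, hi⟩)
  have hdGdvd : ∀ i ∈ S, (X - C (y i)) ^ (μ i) ∣ dG := by
    intro i hi
    by_cases h0 : dG = 0
    · rw [h0]; exact dvd_zero _
    rw [← Polynomial.le_rootMultiplicity_iff h0]
    have h1 := Polynomial.derivative_rootMultiplicity_of_root (p := dG) (t := y i) (hval i hi)
    have h2 : 0 < dG.rootMultiplicity (y i) := (Polynomial.rootMultiplicity_pos h0).2 (hval i hi)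
    have h3 : (X - C (y i)) ^ (μ i - 1) ∣ derivative dG := by
      rw [hdGd]
      exact Dvd.dvd.mul_left (Finset.dvd_sum fun j hj => Dvd.dvd.mul_left (hWdvd i hi j hj) _) _
    have h4 : derivative dG ≠ 0 := by
      intro h5
      obtain ⟨x, hx⟩ := Polynomial.natDegree_eq_zero.1 (Polynomial.derivative_eq_zero.1 h5)
      have := hval i hi
      rw [← hx] at this h0
      simp at this
      simp [this] at h0
    rw [← Polynomial.le_rootMultiplicity_iff h4] at h3
    omega
  have hprod : (∏ i ∈ S, (X - C (y i)) ^ μ i) ∣ dG := by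
    refine Finset.prod_dvd_of_coprime ?_ hdGdvd
    intro i hi j hj hij
    refine IsCoprime.pow ?_
    exact Polynomial.isCoprime_X_sub_C_of_isUnit_sub (sub_ne_zero.2 fun h => hij (hy hi hj h)).isUnit
  -- degree
  have hWm : ∀ i ∈ S, (W i).Monic ∧ (W i).natDegree = (∑ j ∈ S, μ j) - 1 := by
    intro i hi
    have m1 : (∏ j ∈ S.erase i, (X - C (y j)) ^ μ j).Monic := Polynomial.monic_prod_of_monic _ _ fun i _ => (Polynomial.monic_X_sub_C _).pow _
    have m2 : ((X - C (y i)) ^ (μ i - 1)).Monic := (Polynomial.monic_X_sub_C _).pow _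
    refine ⟨m1.mul m2, ?_⟩
    rw [hW]
    simp only
    rw [m1.natDegree_mul m2, natDegree_prodS, Polynomial.natDegree_pow, Polynomial.natDegree_X_sub_C, mul_one,
      ← Finset.add_sum_erase S μ hi]
    have := hμ i hi
    omega
  have hsumpos : 1 ≤ ∑ j ∈ S, μ j := by
    obtain ⟨i, hi⟩ := hS
    exact (hμ i hi).trans (Finset.single_le_sum (f := μ) (fun _ _ => Nat.zero_le _) hi)
  have hdpcoeff : ∀ j, (∑ j ∈ S, μ j) - 1 ≤ j → dp.coeff j = 0 := by
    intro j hj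
    rw [hdp, Polynomial.finsetSum_coeff]
    rcases hj.eq_or_lt with hj | hj
    · have : ∀ i ∈ S, (C (-(↑(μ i) * δ i)) * W i).coeff j = - (μ i * δ i) := by
        intro i hi
        rw [Polynomial.coeff_C_mul]
        obtain ⟨a1, a2⟩ := hWm i hi
        have : (W i).coeff j = 1 := by rw [← hj, ← a2]; exact a1.coeff_natDegree
        rw [this, mul_one]
      rw [Finset.sum_congr rfl this, Finset.sum_neg_distrib, hsum, neg_zero]
    · refine Finset.sum_eq_zero fun i hi => ?_
      rw [Polynomial.coeff_C_mul, Polynomial.coeff_eq_zero_of_natDegree_lt (by rw [(hWm i hi).2]; exact hj), mul_zero]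
  have hdG0 : dG = 0 := by
    by_contra h0
    have h1 := Polynomial.natDegree_le_of_dvd hprod h0
    rw [natDegree_prodS] at h1
    have h2 : dG.coeff dG.natDegree ≠ 0 := by simpa using h0
    apply h2
    obtain ⟨j, hj⟩ : ∃ j, dG.natDegree = j + 1 := ⟨dG.natDegree - 1, by omega⟩
    rw [hj, hdG, Polynomial.coeff_add, Polynomial.coeff_C_mul, antider_coeff_succ, hdpcoeff j (by omega)]
    simp [Polynomial.coeff_C]
  have hdp0 : dp = 0 := by
    rw [hdG0] at hdGd
    simp at hdGd
    rcases hdGd with h | h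
    · exact absurd h hd
    · exact h
  refine ⟨fun i hi => ?_, ?_⟩
  · have h1 : (X - C (y i)) ^ μ i ∣ C (-(↑(μ i) * δ i)) * W i := by
      have h2 : C (-(↑(μ i) * δ i)) * W i = - ∑ j ∈ S.erase i, C (- (μ j * δ j)) * W j := by
        rw [hdp, ← Finset.add_sum_erase S _ hi] at hdp0
        exact eq_neg_of_add_eq_zero_left hdp0
      rw [h2, dvd_neg]
      refine Finset.dvd_sum fun j hj => Dvd.dvd.mul_left (Dvd.dvd.mul_right ?_ _) _
      rw [Finset.mem_erase] at hj
      exact Finset.dvd_prod_of_mem (fun j => (X - C (y j)) ^ μ j) (Finset.mem_erase.2 ⟨hj.1.symm, hi⟩)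
    have hμi := hμ i hi
    obtain ⟨m, hm⟩ : ∃ m, μ i = m + 1 := ⟨μ i - 1, by omega⟩
    have h3 : (X - C (y i)) ∣ C (-(↑(μ i) * δ i)) * (∏ j ∈ S.erase i, (X - C (y j)) ^ μ j) := by
      have h4 : (X - C (y i)) ^ m * (X - C (y i)) ∣ (X - C (y i)) ^ m * (C (-(↑(μ i) * δ i)) * (∏ j ∈ S.erase i, (X - C (y j)) ^ μ j)) := by
        rw [← pow_succ, ← hm]
        convert h1 using 1
        simp only [hW, hm, Nat.add_sub_cancel]; ring
      exact (mul_dvd_mul_iff_left (pow_ne_zero _ (Polynomial.X_sub_C_ne_zero _))).1 h4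
    rw [Polynomial.dvd_iff_isRoot, Polynomial.IsRoot, Polynomial.eval_mul, Polynomial.eval_C, Polynomial.eval_prod] at h3
    rcases mul_eq_zero.1 h3 with h5 | h5
    · have : (μ i : ℂ) ≠ 0 := by exact_mod_cast (by omega : μ i ≠ 0)
      simpa [this] using h5
    · rw [Finset.prod_eq_zero_iff] at h5
      obtain ⟨j, hj, h6⟩ := h5
      rw [Finset.mem_erase] at hj
      simp at h6
      exact absurd (hy hj.2 hi (by linear_combination - h6.1)) hj.1
  · rw [hdp0] at hdG
    have : antider 0 = 0 := by simp [antider]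
    rw [this, hdG0, mul_zero, zero_add] at hdG
    exact (C_eq_zero.1 hdG.symm)

end

noncomputable section

lemma local_inv {E : Type*} [NormedAddCommGroup E] [NormedSpace ℝ E] [FiniteDimensional ℝ E]
    (Ψ : ℝ × E → E) (hΨ : ContDiff ℝ 1 Ψ) (t0 : ℝ) (c0 : E) (h0 : Ψ (t0, c0) = 0)
    (H1 : ∀ δ : E, HasDerivAt (fun s : ℝ => Ψ (t0, c0 + s • δ)) 0 0 → δ = 0) :
    ∃ U ∈ nhds (t0, c0), (∀ t c c', (t, c) ∈ U → (t, c') ∈ U → Ψ (t, c) = 0 → Ψ (t, c') = 0 → c = c') ∧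
      ∃ g : ℝ → E, Filter.Tendsto g (nhds t0) (nhds c0) ∧ ∀ᶠ t in nhds t0, Ψ (t, g t) = 0 := by
  haveI : CompleteSpace E := FiniteDimensional.complete ℝ E
  have hs : HasStrictFDerivAt Ψ (fderiv ℝ Ψ (t0, c0)) (t0, c0) :=
    (hΨ.contDiffAt).hasStrictFDerivAt (by simp)
  set A := fderiv ℝ Ψ (t0, c0) with hA
  have hΦ : HasStrictFDerivAt (fun p : ℝ × E => (p.1, Ψ p)) ((ContinuousLinearMap.fst ℝ ℝ E).prod A) (t0, c0) :=
    hasStrictFDerivAt_fst.prodMk hs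
  have hinj : Function.Injective ((ContinuousLinearMap.fst ℝ ℝ E).prod A : (ℝ × E) →ₗ[ℝ] (ℝ × E)) := by
    rw [← LinearMap.ker_eq_bot, LinearMap.ker_eq_bot']
    rintro ⟨dt, dc⟩ h
    simp only [ContinuousLinearMap.coe_coe, ContinuousLinearMap.prod_apply, ContinuousLinearMap.coe_fst', Prod.mk_eq_zero] at h
    obtain ⟨rfl, h2⟩ := h
    have : dc = 0 := by
      apply H1
      have hl : HasDerivAt (fun s : ℝ => (t0, c0 + s • dc)) ((0:ℝ), dc) 0 := by
        refine (hasDerivAt_const _ _).prodMk ?_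
        have := ((hasDerivAt_id (0:ℝ)).smul_const dc).const_add c0
        simpa using this
      have hs' : HasFDerivAt Ψ A (t0, c0 + (0:ℝ) • dc) := by simpa using hs.hasFDerivAt
      have := hs'.comp_hasDerivAt (0:ℝ) hl
      rw [h2] at this
      exact this
    rw [this]; rfl
  set e := (LinearEquiv.ofInjectiveEndo _ hinj).toContinuousLinearEquiv with he
  have hee : ((e : (ℝ × E) ≃L[ℝ] (ℝ × E)) : (ℝ × E) →L[ℝ] (ℝ × E)) = (ContinuousLinearMap.fst ℝ ℝ E).prod A := by
    ext x <;> rfl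
  rw [← hee] at hΦ
  set H := hΦ.toOpenPartialHomeomorph with hH
  have hmem : (t0, c0) ∈ H.source := hΦ.mem_toOpenPartialHomeomorph_source
  have hcoe : ∀ p, H p = (p.1, Ψ p) := fun p => by rw [hH, hΦ.toOpenPartialHomeomorph_coe]
  refine ⟨H.source, H.open_source.mem_nhds hmem, ?_, fun t => (H.symm (t, 0)).2, ?_, ?_⟩
  · intro t c c' hc hc' h1 h2
    have := H.injOn hc hc' (by rw [hcoe, hcoe, h1, h2])
    exact (Prod.mk.inj this).2
  · have h3 : Filter.Tendsto H.symm (nhds (H (t0, c0))) (nhds (t0, c0)) := H.tendsto_symm hmem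
    rw [hcoe, h0] at h3
    have h4 : Filter.Tendsto (fun t : ℝ => (t, (0:E))) (nhds t0) (nhds (t0, 0)) :=
      (Continuous.prodMk_left (0:E)).tendsto t0
    exact (continuous_snd.tendsto (t0, c0)).comp (h3.comp h4)
  · have h5 : ∀ᶠ p in nhds (H (t0, c0)), H (H.symm p) = p := H.eventually_right_inverse' hmem
    rw [hcoe, h0] at h5
    have h4 : Filter.Tendsto (fun t : ℝ => (t, (0:E))) (nhds t0) (nhds (t0, 0)) :=
      (Continuous.prodMk_left (0:E)).tendsto t0
    filter_upwards [h4.eventually h5] with t ht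
    rw [hcoe] at ht
    obtain ⟨a, b⟩ := Prod.mk.inj ht
    have : H.symm (t, 0) = (t, (H.symm (t, 0)).2) := Prod.ext a rfl
    rw [← this]; exact b

/-- abstract counting lemma -/
theorem count_lemma {E 𝒲 : Type*} [NormedAddCommGroup E] [NormedSpace ℝ E] [FiniteDimensional ℝ E]
    (Ψ : ℝ × E → E) (hΨ : ContDiff ℝ 1 Ψ) (t0 : ℝ) (D : Set ℝ) (Θ : ℝ → E → 𝒲)
    (Z : Set E) (hZ : Z.Finite) (hZ0 : ∀ c ∈ Z, Ψ (t0, c) = 0)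
    (𝒮 : ℝ → Set 𝒲) (wt : ℝ → 𝒲 → ℤ) (wt0 : E → ℤ)
    (H1 : ∀ c0 ∈ Z, ∀ δ : E, HasDerivAt (fun s : ℝ => Ψ (t0, c0 + s • δ)) 0 0 → δ = 0)
    (H2 : ∀ (l : Ultrafilter ℝ), (l : Filter ℝ) ≤ nhdsWithin t0 D → ∀ w : ℝ → 𝒲, (∀ᶠ t in l, w t ∈ 𝒮 t) →
      ∃ c0 ∈ Z, ∃ c : ℝ → E, Filter.Tendsto c l (nhds c0) ∧ ∀ᶠ t in l, Ψ (t, c t) = 0 ∧ Θ t (c t) = w t)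
    (H3 : ∀ c0 ∈ Z, ∀ᶠ p in nhds (t0, c0), p.1 ∈ D → Ψ p = 0 → Θ p.1 p.2 ∈ 𝒮 p.1 ∧ wt p.1 (Θ p.1 p.2) = wt0 c0)
    (H4 : ∀ t ∈ D, ∀ c c', Ψ (t, c) = 0 → Ψ (t, c') = 0 → Θ t c = Θ t c' → c = c') :
    ∀ᶠ t in nhdsWithin t0 D, (𝒮 t).Finite ∧ ∑ᶠ w ∈ 𝒮 t, wt t w = ∑ᶠ c ∈ Z, wt0 c := by
  choose! U hU hUq g hg hg0 using fun c (hc : c ∈ Z) => local_inv Ψ hΨ t0 c (hZ0 c hc) (H1 c hc)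
  have hD : ∀ᶠ t in nhdsWithin t0 D, t ∈ D := eventually_mem_nhdsWithin
  have hgg : ∀ c ∈ Z, Filter.Tendsto (fun t => (t, g c t)) (nhds t0) (nhds (t0, c)) :=
    fun c hc => Filter.tendsto_id.prodMk_nhds (hg c hc)
  have e1 : ∀ᶠ t in nhdsWithin t0 D, ∀ c ∈ Z, Ψ (t, g c t) = 0 :=
    nhdsWithin_le_nhds ((Filter.eventually_all_finite hZ).2 fun c hc => hg0 c hc)
  have e2 : ∀ᶠ t in nhdsWithin t0 D, ∀ c ∈ Z, t ∈ D → Ψ (t, g c t) = 0 → Θ t (g c t) ∈ 𝒮 t ∧ wt t (Θ t (g c t)) = wt0 c :=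
    nhdsWithin_le_nhds ((Filter.eventually_all_finite hZ).2 fun c hc => (hgg c hc).eventually (H3 c hc))
  have e3 : ∀ᶠ t in nhdsWithin t0 D, ∀ c ∈ Z, ∀ c' ∈ Z, c ≠ c' → g c t ≠ g c' t := by
    refine nhdsWithin_le_nhds ((Filter.eventually_all_finite hZ).2 fun c hc => (Filter.eventually_all_finite hZ).2 fun c' hc' => ?_)
    by_cases hcc : c = c'
    · simp [hcc]
    · obtain ⟨V, V', hV, hV', hVV⟩ := t2_separation_nhds hcc
      filter_upwards [(hg c hc).eventually hV, (hg c' hc').eventually hV'] with t ht ht' _ heq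
      exact Set.disjoint_left.1 hVV ht (heq ▸ ht')
  have e4 : ∀ᶠ t in nhdsWithin t0 D, ∀ w ∈ 𝒮 t, ∃ c ∈ Z, Θ t (g c t) = w := by
    by_contra hcon
    have hcon' : ∃ᶠ t in nhdsWithin t0 D, ∃ w ∈ 𝒮 t, ∀ c ∈ Z, Θ t (g c t) ≠ w := by
      intro h
      apply hcon
      filter_upwards [h] with t ht
      push Not at ht
      exact ht
    have hne : (nhdsWithin t0 D ⊓ Filter.principal {t | ∃ w ∈ 𝒮 t, ∀ c ∈ Z, Θ t (g c t) ≠ w}).NeBot :=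
      Filter.frequently_mem_iff_neBot.1 hcon'
    set l := Ultrafilter.of (nhdsWithin t0 D ⊓ Filter.principal {t | ∃ w ∈ 𝒮 t, ∀ c ∈ Z, Θ t (g c t) ≠ w}) with hl
    have hle := Ultrafilter.of_le (nhdsWithin t0 D ⊓ Filter.principal {t | ∃ w ∈ 𝒮 t, ∀ c ∈ Z, Θ t (g c t) ≠ w})
    have hl1 : (l : Filter ℝ) ≤ nhdsWithin t0 D := hle.trans inf_le_left
    have hl2 : ∀ᶠ t in (l : Filter ℝ), ∃ w ∈ 𝒮 t, ∀ c ∈ Z, Θ t (g c t) ≠ w :=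
      hle.trans inf_le_right (Filter.mem_principal_self _)
    obtain ⟨t1, ht1⟩ := hl2.exists
    obtain ⟨w1, _⟩ := ht1
    haveI : Nonempty 𝒲 := ⟨w1⟩
    choose! w hw hw' using fun t (h : ∃ w ∈ 𝒮 t, ∀ c ∈ Z, Θ t (g c t) ≠ w) => h
    obtain ⟨c0, hc0, c, hc, hcc⟩ := H2 l hl1 w (hl2.mono fun t ht => hw t ht)
    have hl3 : (l : Filter ℝ) ≤ nhds t0 := hl1.trans nhdsWithin_le_nhds
    have f1 : ∀ᶠ t in (l : Filter ℝ), (t, c t) ∈ U c0 :=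
      ((Filter.tendsto_id.mono_left hl3).prodMk_nhds hc).eventually (hU c0 hc0)
    have f2 : ∀ᶠ t in (l : Filter ℝ), (t, g c0 t) ∈ U c0 :=
      ((hgg c0 hc0).mono_left hl3).eventually (hU c0 hc0)
    have f3 := (hg0 c0 hc0).filter_mono hl3
    obtain ⟨t, a1, a2, a3, a4, a5⟩ := (f1.and (f2.and (f3.and (hcc.and hl2)))).exists
    have := hUq c0 hc0 t _ _ a1 a2 a4.1 a3
    exact hw' t a5 c0 hc0 (by rw [← this]; exact a4.2)
  filter_upwards [hD, e1, e2, e3, e4] with t hD e1 e2 e3 e4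
  have hbij : Set.BijOn (fun c => Θ t (g c t)) Z (𝒮 t) := by
    refine ⟨fun c hc => (e2 c hc hD (e1 c hc)).1, ?_, fun w hw => ?_⟩
    · intro c hc c' hc' h
      by_contra hne
      exact e3 c hc c' hc' hne (H4 t hD _ _ (e1 c hc) (e1 c' hc') h)
    · obtain ⟨c, hc, h⟩ := e4 w hw
      exact ⟨c, hc, h⟩
  refine ⟨hbij.image_eq ▸ hZ.image _, ?_⟩
  exact (finsum_mem_eq_of_bijOn _ hbij fun c hc => ((e2 c hc hD (e1 c hc)).2).symm).symm

/-- finiteness lemma -/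
theorem finite_lemma {E : Type*} [NormedAddCommGroup E] [NormedSpace ℝ E] [FiniteDimensional ℝ E]
    (Ψ : E → E) (hΨ : ContDiff ℝ 1 Ψ) (Z : Set E) (hZ0 : ∀ c ∈ Z, Ψ c = 0)
    (H1 : ∀ c0 ∈ Z, ∀ δ : E, HasDerivAt (fun s : ℝ => Ψ (c0 + s • δ)) 0 0 → δ = 0)
    (H2 : ∀ (l : Ultrafilter E), Z ∈ l → ∃ c0 ∈ Z, (l : Filter E) ≤ nhds c0) : Z.Finite := by
  have hcomp : IsCompact Z := isCompact_iff_ultrafilter_le_nhds'.2 fun l hl => H2 l hl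
  refine hcomp.finite ?_
  refine IsDiscrete.of_nhdsWithin fun c hc => ?_
  obtain ⟨U, hU, hU1, -⟩ := local_inv (fun p : ℝ × E => Ψ p.2) (hΨ.comp contDiff_snd) 0 c (hZ0 c hc) (H1 c hc)
  have h1 : ∀ᶠ c' in nhds c, ((0:ℝ), c') ∈ U :=
    ((Continuous.prodMk_right (0:ℝ)).tendsto c).eventually hU
  have h2 : ∀ᶠ c' in nhdsWithin c Z, c' = c := by
    filter_upwards [nhdsWithin_le_nhds h1, eventually_mem_nhdsWithin] with c' h hZ
    exact hU1 0 c' c h (mem_of_mem_nhds hU) (hZ0 _ hZ) (hZ0 _ hc)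
  exact Filter.le_pure_iff.2 h2

end

noncomputable section
set_option linter.unusedSectionVars false
set_option linter.unusedVariables false

lemma ultra_conv {T F : Type*} [NormedAddCommGroup F] [ProperSpace F] (l : Ultrafilter T) (f : T → F) (B : ℝ)
    (h : ∀ᶠ t in l, ‖f t‖ ≤ B) : ∃ f0, Filter.Tendsto f l (nhds f0) := by
  have hc := (isCompact_closedBall (0:F) B).ultrafilter_le_nhds (l.map f) (by
    rw [Filter.le_principal_iff]
    change f ⁻¹' _ ∈ l
    filter_upwards [h] with t ht
    simpa using ht)
  obtain ⟨f0, -, hf0⟩ := hc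
  exact ⟨f0, hf0⟩

variable {ι : Type*} [Fintype ι]

lemma bp_limit (μ : ι → ℕ) (S : Finset ι) (y d : ι → ℂ) :
    bp μ (fun i => if i ∈ S then 1 else 0) (fun i => if i ∈ S then - y i else d i) =
      C (∏ i ∈ Sᶜ, d i ^ μ i) * ∏ i ∈ S, (X - C (y i)) ^ μ i := by
  unfold bp
  rw [← Finset.prod_mul_prod_compl S, mul_comm]
  congr 1
  · rw [map_prod]
    refine Finset.prod_congr rfl fun i hi => ?_
    rw [Finset.mem_compl] at hi
    simp [hi]
  · refine Finset.prod_congr rfl fun i hi => ?_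
    simp [hi, sub_eq_add_neg]

/-- weighted mean -/
def wmean (μ : ι → ℕ) (S : Finset ι) (x : ι → ℂ) : ℂ := (∑ i ∈ S, (μ i : ℂ) * x i) / (∑ i ∈ S, (μ i : ℂ))

lemma sum_mu_ne (μ : ι → ℕ) (hμ : ∀ i, 1 ≤ μ i) (S : Finset ι) (hS : S.Nonempty) : (∑ i ∈ S, (μ i : ℂ)) ≠ 0 := by
  have : (∑ i ∈ S, μ i) ≠ 0 := by
    have := Finset.sum_pos (f := μ) (fun i _ => (hμ i : 0 < μ i)) hS
    omega
  exact_mod_cast this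

lemma wmean_spec (μ : ι → ℕ) (hμ : ∀ i, 1 ≤ μ i) (S : Finset ι) (hS : S.Nonempty) (x : ι → ℂ) :
    ∑ i ∈ S, (μ i : ℂ) * (x i - wmean μ S x) = 0 := by
  simp only [mul_sub, Finset.sum_sub_distrib]
  rw [← Finset.sum_mul, wmean, mul_div_cancel₀ _ (sum_mu_ne μ hμ S hS), sub_self]

lemma wmean_unique (μ : ι → ℕ) (hμ : ∀ i, 1 ≤ μ i) (S : Finset ι) (hS : S.Nonempty) (x : ι → ℂ) (p : ℂ)
    (h : ∑ i ∈ S, (μ i : ℂ) * (x i - p) = 0) : p = wmean μ S x := by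
  simp only [mul_sub, Finset.sum_sub_distrib] at h
  rw [← Finset.sum_mul] at h
  rw [wmean, eq_div_iff (sum_mu_ne μ hμ S hS)]
  linear_combination -h

lemma wmean_const (μ : ι → ℕ) (hμ : ∀ i, 1 ≤ μ i) (S : Finset ι) (hS : S.Nonempty) (x : ι → ℂ) (p : ℂ)
    (h : ∀ i ∈ S, x i = p) : wmean μ S x = p := by
  refine (wmean_unique μ hμ S hS x p ?_).symm
  exact Finset.sum_eq_zero fun i hi => by rw [h i hi]; simp

lemma tendsto_wmean {T : Type*} {l : Filter T} (μ : ι → ℕ) (S : Finset ι) {x : T → ι → ℂ} {x0 : ι → ℂ}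
    (hx : Filter.Tendsto x l (nhds x0)) : Filter.Tendsto (fun t => wmean μ S (x t)) l (nhds (wmean μ S x0)) := by
  unfold wmean
  refine Filter.Tendsto.div_const (tendsto_finsetSum _ fun i _ => Filter.Tendsto.const_mul _ ?_) _
  exact (continuous_apply i).tendsto _ |>.comp hx

/-- blow-up vector -/
def yraw (S : Finset ι) (x : ι → ℂ) (X0 : ℂ) : ι → ℂ := fun i => if i ∈ S then x i - X0 else 0

/-- Blow-up bound -/
lemma blow_bound {T : Type*} (l : Ultrafilter T) (μ : ι → ℕ) (hμ : ∀ i, 1 ≤ μ i) (S : Finset ι) (hS : S.Nonempty)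
    (c : ℂ) (hc : c ≠ 0) (x : T → ι → ℂ) (X0 : T → ℂ) (d : ι → ℂ) (V : T → ℝ)
    (hmean : ∀ t, ∑ i ∈ S, (μ i : ℂ) * (x t i - X0 t) = 0)
    (hout : ∀ i ∉ S, d i ≠ 0 ∧ Filter.Tendsto (fun t => X0 t - x t i) l (nhds (d i)) ∧
      Filter.Tendsto (fun t => ‖yraw S (x t) (X0 t)‖) l (nhds 0))
    (hV : ∀ᶠ t in l, ∀ i ∈ S, ∀ j ∈ S, ‖c * (primX μ (x t) (x t i) - primX μ (x t) (x t j))‖ ≤ V t) :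
    ∃ K : ℝ, 0 ≤ K ∧ ∀ᶠ t in l, ‖yraw S (x t) (X0 t)‖ ^ ((∑ i ∈ S, μ i) + 1) ≤ K * V t := by
  by_contra hcon
  push Not at hcon
  have hcon' : ∀ K : ℝ, 0 ≤ K → ∀ᶠ t in l, K * V t < ‖yraw S (x t) (X0 t)‖ ^ ((∑ i ∈ S, μ i) + 1) := by
    intro K hK
    have := hcon K hK
    simpa using this
  set ρ : T → ℝ := fun t => ‖yraw S (x t) (X0 t)‖ with hρ
  set m := ∑ i ∈ S, μ i with hm
  have hρ0 : ∀ᶠ t in l, 0 < ρ t := by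
    filter_upwards [hcon' 0 le_rfl] with t ht
    rw [zero_mul] at ht
    by_contra h
    have h2 : ρ t = 0 := le_antisymm (not_lt.1 h) (norm_nonneg _)
    change 0 < ρ t ^ (m+1) at ht
    rw [h2] at ht; simp at ht
  set y : T → ι → ℂ := fun t => ((ρ t)⁻¹ : ℝ) • yraw S (x t) (X0 t) with hy
  have hy1 : ∀ᶠ t in l, ‖y t‖ = 1 := by
    filter_upwards [hρ0] with t ht
    rw [hy, norm_smul, norm_inv, Real.norm_of_nonneg ht.le]
    exact inv_mul_cancel₀ ht.ne'
  obtain ⟨y0, hy0⟩ := ultra_conv l y 1 (hy1.mono fun t ht => ht.le)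
  have hy0n : ‖y0‖ = 1 := by
    have h1 := (continuous_norm.tendsto y0).comp hy0
    have h2 : Filter.Tendsto (norm ∘ y) l (nhds 1) := by
      refine Filter.Tendsto.congr' ?_ tendsto_const_nhds
      filter_upwards [hy1] with t ht using ht.symm
    exact tendsto_nhds_unique h1 h2
  have hcoord : ∀ i, Filter.Tendsto (fun t => y t i) l (nhds (y0 i)) := fun i => ((continuous_apply i).tendsto _).comp hy0
  have hyout : ∀ i ∉ S, y0 i = 0 := by
    intro i hi
    have : (fun t => y t i) = fun _ => 0 := by funext t; simp [hy, yraw, hi]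
    have h1 := hcoord i
    rw [this] at h1
    exact tendsto_nhds_unique h1 tendsto_const_nhds
  have hxy : ∀ᶠ t in l, ∀ i ∈ S, x t i = X0 t + (ρ t : ℂ) * y t i := by
    filter_upwards [hρ0] with t ht i hi
    have : (ρ t : ℂ) ≠ 0 := by exact_mod_cast ht.ne'
    simp [hy, yraw, hi]
    field_simp
    ring
  have hsum0 : ∑ i ∈ S, (μ i : ℂ) * y0 i = 0 := by
    have h1 : Filter.Tendsto (fun t => ∑ i ∈ S, (μ i : ℂ) * y t i) l (nhds (∑ i ∈ S, (μ i : ℂ) * y0 i)) :=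
      tendsto_finsetSum _ fun i _ => (hcoord i).const_mul _
    have h2 : (fun t => ∑ i ∈ S, (μ i : ℂ) * y t i) = fun _ => 0 := by
      funext t
      have h3 : ∑ i ∈ S, (μ i : ℂ) * y t i = ((ρ t)⁻¹ : ℝ) * ∑ i ∈ S, (μ i : ℂ) * (x t i - X0 t) := by
        rw [Finset.mul_sum]
        refine Finset.sum_congr rfl fun i hi => ?_
        simp [hy, yraw, hi]; ring
      rw [h3, hmean t, mul_zero]
    rw [h2] at h1
    exact tendsto_nhds_unique h1 tendsto_const_nhds
  set a0 : ι → ℂ := fun i => if i ∈ S then 1 else 0 with ha0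
  set b0 : ι → ℂ := fun i => if i ∈ S then - y0 i else d i with hb0
  have ha : Filter.Tendsto (fun t => (fun i => if i ∈ S then (1:ℂ) else (ρ t : ℂ))) l (nhds a0) := by
    rw [tendsto_pi_nhds]
    intro i
    by_cases hi : i ∈ S
    · simp [ha0, hi]
    · simp only [ha0, hi, if_false]
      have := (Complex.continuous_ofReal.tendsto 0).comp (hout i hi).2.2
      rw [Complex.ofReal_zero] at this
      exact this
  have hb : Filter.Tendsto (fun t => (fun i => if i ∈ S then - y t i else X0 t - x t i)) l (nhds b0) := by
    rw [tendsto_pi_nhds]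
    intro i
    by_cases hi : i ∈ S
    · simp only [hb0, hi, if_true]; exact (hcoord i).neg
    · simp only [hb0, hi, if_false]; exact (hout i hi).2.1
  have hlim : ∀ i ∈ S, Filter.Tendsto (fun t => prim μ (fun i => if i ∈ S then (1:ℂ) else (ρ t : ℂ))
      (fun i => if i ∈ S then - y t i else X0 t - x t i) (y t i)) l (nhds (prim μ a0 b0 (y0 i))) :=
    fun i _ => tendsto_prim μ ha hb (hcoord i)
  have heq : ∀ i ∈ S, ∀ j ∈ S, prim μ a0 b0 (y0 i) = prim μ a0 b0 (y0 j) := by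
    intro i hi j hj
    have h1 := (hlim i hi).sub (hlim j hj)
    have h2 : Filter.Tendsto (fun t => prim μ (fun i => if i ∈ S then (1:ℂ) else (ρ t : ℂ))
      (fun i => if i ∈ S then - y t i else X0 t - x t i) (y t i) - prim μ (fun i => if i ∈ S then (1:ℂ) else (ρ t : ℂ))
      (fun i => if i ∈ S then - y t i else X0 t - x t i) (y t j)) l (nhds 0) := by
      rw [Metric.tendsto_nhds]
      intro ε hε
      have hcn : 0 < ‖c‖ := norm_pos_iff.2 hc
      filter_upwards [hcon' ((ε * ‖c‖)⁻¹) (by positivity), hρ0, hxy, hV] with t h3 h4 h5 h6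
      have h7 := h6 i hi j hj
      rw [dist_zero_right]
      have b1 := blow_identity μ S (x t) (y t) (X0 t) (ρ t) (y t i) (h5)
      have b2 := blow_identity μ S (x t) (y t) (X0 t) (ρ t) (y t j) (h5)
      rw [← h5 i hi] at b1
      rw [← h5 j hj] at b2
      set P1 := prim μ (fun i => if i ∈ S then (1:ℂ) else (ρ t : ℂ))
        (fun i => if i ∈ S then - y t i else X0 t - x t i) (y t i)
      set P2 := prim μ (fun i => if i ∈ S then (1:ℂ) else (ρ t : ℂ))
        (fun i => if i ∈ S then - y t i else X0 t - x t i) (y t j)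
      have h8 : primX μ (x t) (x t i) - primX μ (x t) (x t j) = (ρ t : ℂ) ^ (m+1) * (P1 - P2) := by
        linear_combination b1 - b2
      rw [h8, norm_mul, norm_mul, norm_pow, Complex.norm_real, Real.norm_of_nonneg h4.le] at h7
      have h9 : (ε * ‖c‖)⁻¹ * V t < ρ t ^ (m+1) := h3
      have hp : 0 < ρ t ^ (m+1) := by positivity
      have h10 : V t < ρ t ^ (m+1) * (ε * ‖c‖) := by
        rw [inv_mul_lt_iff₀ (by positivity)] at h9
        linarith
      have h11 : (‖c‖ * ρ t ^ (m+1)) * ‖P1 - P2‖ < (‖c‖ * ρ t ^ (m+1)) * ε := by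
        calc _ = ‖c‖ * (ρ t ^ (m+1) * ‖P1 - P2‖) := by ring
          _ ≤ V t := h7
          _ < _ := h10
          _ = _ := by ring
      exact lt_of_mul_lt_mul_left h11 (by positivity)
    exact sub_eq_zero.1 (tendsto_nhds_unique h1 h2)
  have hall := all_eq_lemma S μ y0 (fun i _ => hμ i) (∏ i ∈ Sᶜ, d i ^ μ i)
    (Finset.prod_ne_zero_iff.2 fun i hi => pow_ne_zero _ (hout i (by simpa using hi)).1)
    (antider (bp μ a0 b0)) (by rw [derivative_antider, ha0, hb0, bp_limit]) (prim μ a0 b0 (y0 hS.choose))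
    (fun i hi => heq i hi _ hS.choose_spec)
  have hy00 : y0 = 0 := by
    funext i
    by_cases hi : i ∈ S
    · have h1 : ∑ j ∈ S, (μ j : ℂ) * y0 j = (∑ j ∈ S, (μ j : ℂ)) * y0 i := by
        rw [Finset.sum_mul]
        exact Finset.sum_congr rfl fun j hj => by rw [hall j hj i hi]
      rw [hsum0] at h1
      rcases mul_eq_zero.1 h1.symm with h | h
      · exact absurd h (sum_mu_ne μ hμ S hS)
      · exact h
    · exact hyout i hi
  rw [hy00] at hy0n
  simp at hy0n

/-- labelled solutions, recorded by their critical points -/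
def Sol (c : ℝ) (μ : ι → ℕ) (v : ι → ℝ) : Set (ι → ℂ) :=
  {x | Function.Injective x ∧ ∑ i, (μ i : ℂ) * x i = 0 ∧
    (∃ τ : Equiv.Perm ι, (∀ i, μ (τ i) = μ i) ∧ (∀ i, v (τ i) = v i) ∧
      ∀ i, x (τ i) = (starRingEnd ℂ) (x i)) ∧
    ∃ C0 : ℂ, ∀ i, C0 + c * primX μ x (x i) = v i}

lemma Sol.bounded {T : Type*} (l : Ultrafilter T) (μ : ι → ℕ) (hμ : ∀ i, 1 ≤ μ i) (c : ℝ) (hc : c ≠ 0)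
    (v : T → ι → ℝ) (B : ℝ) (hB : ∀ᶠ t in l, ‖v t‖ ≤ B) (x : T → ι → ℂ) (hx : ∀ᶠ t in l, x t ∈ Sol c μ (v t)) :
    ∃ x0, Filter.Tendsto x l (nhds x0) := by
  rcases isEmpty_or_nonempty ι with hι | hι
  · exact ⟨0, by rw [tendsto_pi_nhds]; intro i; exact hι.elim i⟩
  have hne : (Finset.univ : Finset ι).Nonempty := Finset.univ_nonempty
  -- replace x by zero outside the good set
  obtain ⟨K, hK, hKe⟩ := blow_bound l μ hμ Finset.univ hne (c:ℂ) (by exact_mod_cast hc)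
    (fun t => if x t ∈ Sol c μ (v t) then x t else 0) (fun _ => 0) 0 (fun _ => 2 * B)
    (by
      intro t
      simp only [sub_zero]
      split_ifs with h
      · exact h.2.1
      · simp)
    (by intro i hi; simp at hi)
    (by
      filter_upwards [hB, hx] with t h1 h2 i _ j _
      rw [if_pos h2]
      obtain ⟨-, -, -, C0, hC⟩ := h2
      have e : (c:ℂ) * (primX μ (x t) (x t i) - primX μ (x t) (x t j)) = ((v t i - v t j : ℝ) : ℂ) := by
        push_cast
        linear_combination hC i - hC j
      rw [e, Complex.norm_real]
      have a1 := norm_le_pi_norm (v t) i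
      have a2 := norm_le_pi_norm (v t) j
      have := norm_sub_le (v t i) (v t j)
      linarith)
  refine ultra_conv l x (max 1 (K * (2*B))) ?_
  filter_upwards [hx, hKe] with t h1 h2
  simp only [if_pos h1] at h2
  have e : yraw Finset.univ (x t) 0 = x t := by funext i; simp [yraw]
  rw [e] at h2
  by_cases h3 : ‖x t‖ ≤ 1
  · exact h3.trans (le_max_left _ _)
  · push Not at h3
    refine le_trans ?_ (le_max_right _ _)
    exact (le_self_pow₀ h3.le (by omega)).trans h2

lemma tendsto_yraw {T : Type*} {l : Filter T} (S : Finset ι) {x : T → ι → ℂ} {x0 : ι → ℂ} {X0 : T → ℂ} {p : ℂ}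
    (hx : Filter.Tendsto x l (nhds x0)) (hX : Filter.Tendsto X0 l (nhds p)) (hp : ∀ i ∈ S, x0 i = p) :
    Filter.Tendsto (fun t => ‖yraw S (x t) (X0 t)‖) l (nhds 0) := by
  have : Filter.Tendsto (fun t => yraw S (x t) (X0 t)) l (nhds 0) := by
    rw [tendsto_pi_nhds]
    intro i
    unfold yraw
    by_cases hi : i ∈ S
    · simp only [hi, if_true]
      have h1 := (((continuous_apply i).tendsto _).comp hx).sub hX
      rw [hp i hi, sub_self] at h1
      exact h1
    · simp only [hi, if_false]; exact tendsto_const_nhds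
  have h2 := (continuous_norm.tendsto _).comp this
  rw [norm_zero] at h2
  exact h2

/-- cluster bound -/
lemma cluster_bound {T : Type*} (l : Ultrafilter T) (μ : ι → ℕ) (hμ : ∀ i, 1 ≤ μ i) (c : ℝ) (hc : c ≠ 0)
    (v : T → ι → ℝ) (x : T → ι → ℂ) (hx : ∀ᶠ t in l, x t ∈ Sol c μ (v t)) (x0 : ι → ℂ)
    (hx0 : Filter.Tendsto x l (nhds x0)) (S : Finset ι) (hS : S.Nonempty) (p : ℂ)
    (hp : ∀ i, i ∈ S ↔ x0 i = p) (V : T → ℝ) (hV : ∀ᶠ t in l, ∀ i ∈ S, ∀ j ∈ S, |v t i - v t j| ≤ V t) :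
    ∃ K : ℝ, 0 ≤ K ∧ ∀ᶠ t in l, ‖yraw S (x t) (wmean μ S (x t))‖ ^ ((∑ i ∈ S, μ i) + 1) ≤ K * V t := by
  have hw : Filter.Tendsto (fun t => wmean μ S (x t)) l (nhds p) := by
    have := tendsto_wmean μ S hx0
    rwa [wmean_const μ hμ S hS x0 p fun i hi => (hp i).1 hi] at this
  refine blow_bound l μ hμ S hS (c:ℂ) (by exact_mod_cast hc) x (fun t => wmean μ S (x t)) (fun i => p - x0 i) V
    (fun t => wmean_spec μ hμ S hS (x t)) ?_ ?_
  · intro i hi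
    refine ⟨?_, ?_, ?_⟩
    · rw [hp] at hi
      exact sub_ne_zero.2 fun h => hi h.symm
    · exact hw.sub (((continuous_apply i).tendsto _).comp hx0)
    · exact tendsto_yraw S hx0 hw fun i hi => (hp i).1 hi
  · filter_upwards [hx, hV] with t h1 h2 i hi j hj
    obtain ⟨-, -, -, C0, hC⟩ := h1
    have e : (c:ℂ) * (primX μ (x t) (x t i) - primX μ (x t) (x t j)) = ((v t i - v t j : ℝ) : ℂ) := by
      push_cast
      linear_combination hC i - hC j
    rw [e, Complex.norm_real]
    exact h2 i hi j hj

/-- no collision -/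
lemma no_collision {T : Type*} (l : Ultrafilter T) (μ : ι → ℕ) (hμ : ∀ i, 1 ≤ μ i) (c : ℝ) (hc : c ≠ 0)
    (v : T → ι → ℝ) (x : T → ι → ℂ) (hx : ∀ᶠ t in l, x t ∈ Sol c μ (v t)) (x0 : ι → ℂ)
    (hx0 : Filter.Tendsto x l (nhds x0))
    (hv : ∀ i j, x0 i = x0 j → ∀ᶠ t in l, v t i = v t j) : Function.Injective x0 := by
  intro i j hij
  set S : Finset ι := Finset.univ.filter fun k => x0 k = x0 i with hS
  have hmem : ∀ k, k ∈ S ↔ x0 k = x0 i := by intro k; simp [hS]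
  obtain ⟨K, hK, hKe⟩ := cluster_bound l μ hμ c hc v x hx x0 hx0 S ⟨i, by simp [hS]⟩ (x0 i) hmem (fun _ => 0) (by
    have : ∀ᶠ t in l, ∀ a ∈ (S : Set ι), ∀ b ∈ (S : Set ι), v t a = v t b := by
      rw [Filter.eventually_all_finite S.finite_toSet]
      intro a ha
      rw [Filter.eventually_all_finite S.finite_toSet]
      intro b hb
      exact hv a b (((hmem a).1 ha).trans ((hmem b).1 hb).symm)
    filter_upwards [this] with t ht a ha b hb
    rw [ht a ha b hb]; simp)
  obtain ⟨t, h1, h2⟩ := (hx.and hKe).exists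
  rw [mul_zero] at h2
  have h3 : ‖yraw S (x t) (wmean μ S (x t))‖ = 0 := by
    by_contra h
    have h4 : 0 < ‖yraw S (x t) (wmean μ S (x t))‖ := lt_of_le_of_ne (norm_nonneg _) (Ne.symm h)
    have := pow_pos h4 ((∑ i ∈ S, μ i) + 1)
    linarith
  rw [norm_eq_zero] at h3
  have hi : x t i = wmean μ S (x t) := by
    have := congrFun h3 i
    simp only [yraw, (hmem i).2 rfl, if_true] at this
    exact sub_eq_zero.1 this
  have hj : x t j = wmean μ S (x t) := by
    have := congrFun h3 j
    simp only [yraw, (hmem j).2 hij.symm, if_true] at this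
    exact sub_eq_zero.1 this
  exact h1.1 (hi.trans hj.symm)

end

noncomputable section
set_option linter.unusedSectionVars false
set_option linter.unusedVariables false

section blowequal
variable {ι : Type*} [Fintype ι]

lemma prim_scale (μ : ι → ℕ) (a b d : ι → ℂ) (z : ℂ) :
    prim μ (fun i => d i * a i) (fun i => d i * b i) z = (∏ i, d i ^ μ i) * prim μ a b z := by
  have h1 : bp μ (fun i => d i * a i) (fun i => d i * b i) = C (∏ i, d i ^ μ i) * bp μ a b := by
    unfold bp
    rw [map_prod, ← Finset.prod_mul_distrib]
    refine Finset.prod_congr rfl fun i _ => ?_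
    rw [C_pow, ← mul_pow]
    congr 1
    simp only [C_mul]; ring
  have h2 : antider (bp μ (fun i => d i * a i) (fun i => d i * b i)) = C (∏ i, d i ^ μ i) * antider (bp μ a b) := by
    rw [h1]
    ext j
    cases j with
    | zero => simp [antider_coeff_zero]
    | succ j => rw [antider_coeff_succ, coeff_C_mul, coeff_C_mul, antider_coeff_succ]; ring
  unfold prim
  rw [h2, eval_mul, eval_C]

lemma blow_equal {T : Type*} (l : Ultrafilter T) (μ : ι → ℕ) (hμ : ∀ i, 1 ≤ μ i) (S : Finset ι) (hS : S.Nonempty)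
    (x : T → ι → ℂ) (X0 : T → ℂ)
    (hmean : ∀ t, ∑ i ∈ S, (μ i : ℂ) * (x t i - X0 t) = 0)
    (hout : ∀ i ∉ S, (∀ᶠ t in l, X0 t - x t i ≠ 0) ∧
      Filter.Tendsto (fun t => ‖yraw S (x t) (X0 t)‖ / ‖X0 t - x t i‖) l (nhds 0))
    (hV : ∀ᶠ t in l, ∀ i ∈ S, ∀ j ∈ S, primX μ (x t) (x t i) = primX μ (x t) (x t j)) :
    ∀ᶠ t in l, yraw S (x t) (X0 t) = 0 := by
  by_contra hcon
  rw [← Ultrafilter.eventually_not] at hcon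
  set ρ : T → ℝ := fun t => ‖yraw S (x t) (X0 t)‖ with hρ
  set m := ∑ i ∈ S, μ i with hm
  have hρ0 : ∀ᶠ t in l, 0 < ρ t := by
    filter_upwards [hcon] with t ht
    exact norm_pos_iff.2 ht
  set y : T → ι → ℂ := fun t => ((ρ t)⁻¹ : ℝ) • yraw S (x t) (X0 t) with hy
  have hy1 : ∀ᶠ t in l, ‖y t‖ = 1 := by
    filter_upwards [hρ0] with t ht
    rw [hy, norm_smul, norm_inv, Real.norm_of_nonneg ht.le]
    exact inv_mul_cancel₀ ht.ne'
  obtain ⟨y0, hy0⟩ := ultra_conv l y 1 (hy1.mono fun t ht => ht.le)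
  have hy0n : ‖y0‖ = 1 := by
    have h1 := (continuous_norm.tendsto y0).comp hy0
    have h2 : Filter.Tendsto (norm ∘ y) l (nhds 1) := by
      refine Filter.Tendsto.congr' ?_ tendsto_const_nhds
      filter_upwards [hy1] with t ht using ht.symm
    exact tendsto_nhds_unique h1 h2
  have hcoord : ∀ i, Filter.Tendsto (fun t => y t i) l (nhds (y0 i)) := fun i => ((continuous_apply i).tendsto _).comp hy0
  have hyout : ∀ i ∉ S, y0 i = 0 := by
    intro i hi
    have : (fun t => y t i) = fun _ => 0 := by funext t; simp [hy, yraw, hi]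
    have h1 := hcoord i
    rw [this] at h1
    exact tendsto_nhds_unique h1 tendsto_const_nhds
  have hxy : ∀ᶠ t in l, ∀ i ∈ S, x t i = X0 t + (ρ t : ℂ) * y t i := by
    filter_upwards [hρ0] with t ht i hi
    have : (ρ t : ℂ) ≠ 0 := by exact_mod_cast ht.ne'
    simp [hy, yraw, hi]
    field_simp
    ring
  have hsum0 : ∑ i ∈ S, (μ i : ℂ) * y0 i = 0 := by
    have h1 : Filter.Tendsto (fun t => ∑ i ∈ S, (μ i : ℂ) * y t i) l (nhds (∑ i ∈ S, (μ i : ℂ) * y0 i)) :=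
      tendsto_finsetSum _ fun i _ => (hcoord i).const_mul _
    have h2 : (fun t => ∑ i ∈ S, (μ i : ℂ) * y t i) = fun _ => 0 := by
      funext t
      have h3 : ∑ i ∈ S, (μ i : ℂ) * y t i = ((ρ t)⁻¹ : ℝ) * ∑ i ∈ S, (μ i : ℂ) * (x t i - X0 t) := by
        rw [Finset.mul_sum]
        refine Finset.sum_congr rfl fun i hi => ?_
        simp [hy, yraw, hi]; ring
      rw [h3, hmean t, mul_zero]
    rw [h2] at h1
    exact tendsto_nhds_unique h1 tendsto_const_nhds
  set a0 : ι → ℂ := fun i => if i ∈ S then 1 else 0 with ha0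
  set b0 : ι → ℂ := fun i => if i ∈ S then - y0 i else 1 with hb0
  set at' : T → ι → ℂ := fun t i => if i ∈ S then (1:ℂ) else (ρ t : ℂ) / (X0 t - x t i) with hat
  set bt' : T → ι → ℂ := fun t i => if i ∈ S then - y t i else 1 with hbt
  have ha : Filter.Tendsto at' l (nhds a0) := by
    rw [tendsto_pi_nhds]
    intro i
    by_cases hi : i ∈ S
    · simp [ha0, hat, hi]
    · simp only [ha0, hat, hi, if_false]
      rw [tendsto_zero_iff_norm_tendsto_zero]
      refine (hout i hi).2.congr fun t => ?_
      rw [norm_div, Complex.norm_real, Real.norm_of_nonneg (norm_nonneg _)]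
  have hb : Filter.Tendsto bt' l (nhds b0) := by
    rw [tendsto_pi_nhds]
    intro i
    by_cases hi : i ∈ S
    · simp only [hb0, hbt, hi, if_true]; exact (hcoord i).neg
    · simp only [hb0, hbt, hi, if_false]; exact tendsto_const_nhds
  have hlim : ∀ i ∈ S, Filter.Tendsto (fun t => prim μ (at' t) (bt' t) (y t i)) l (nhds (prim μ a0 b0 (y0 i))) :=
    fun i _ => tendsto_prim μ ha hb (hcoord i)
  have hne : ∀ᶠ t in l, ∀ i ∈ ((Sᶜ : Finset ι) : Set ι), X0 t - x t i ≠ 0 := by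
    rw [Filter.eventually_all_finite (Finset.finite_toSet _)]
    intro i hi
    exact (hout i (by simpa using hi)).1
  have heq : ∀ i ∈ S, ∀ j ∈ S, prim μ a0 b0 (y0 i) = prim μ a0 b0 (y0 j) := by
    intro i hi j hj
    refine tendsto_nhds_unique_of_eventuallyEq (hlim i hi) (hlim j hj) ?_
    filter_upwards [hρ0, hxy, hV, hne] with t h4 h5 h6 h7
    have b1 := blow_identity μ S (x t) (y t) (X0 t) (ρ t) (y t i) (h5)
    have b2 := blow_identity μ S (x t) (y t) (X0 t) (ρ t) (y t j) (h5)
    rw [← h5 i hi] at b1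
    rw [← h5 j hj] at b2
    set dd : ι → ℂ := fun i => if i ∈ S then 1 else X0 t - x t i with hdd
    have e1 : (fun i => if i ∈ S then (1:ℂ) else (ρ t : ℂ)) = fun i => dd i * at' t i := by
      funext i
      by_cases hi : i ∈ S
      · simp [hdd, hat, hi]
      · have := h7 i (by simpa using hi)
        simp only [hdd, hat, hi, if_false]; field_simp
    have e2 : (fun i => if i ∈ S then - y t i else X0 t - x t i) = fun i => dd i * bt' t i := by
      funext i
      by_cases hi : i ∈ S
      · simp [hdd, hbt, hi]
      · simp [hdd, hbt, hi]
    rw [e1, e2, prim_scale] at b1 b2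
    have h8 := h6 i hi j hj
    have hd0 : (∏ i, dd i ^ μ i) ≠ 0 := by
      refine Finset.prod_ne_zero_iff.2 fun i _ => pow_ne_zero _ ?_
      by_cases hi : i ∈ S
      · simp [hdd, hi]
      · have := h7 i (by simpa using hi)
        simpa only [hdd, hi, if_false]
    have hr : (ρ t : ℂ) ^ (m+1) ≠ 0 := pow_ne_zero _ (by exact_mod_cast h4.ne')
    have h9 : (ρ t : ℂ) ^ (m+1) * ((∏ i, dd i ^ μ i) * prim μ (at' t) (bt' t) (y t i)) =
      (ρ t : ℂ) ^ (m+1) * ((∏ i, dd i ^ μ i) * prim μ (at' t) (bt' t) (y t j)) := by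
      rw [← b1, ← b2, h8]
    exact mul_left_cancel₀ hd0 (mul_left_cancel₀ hr h9)
  have hall := all_eq_lemma S μ y0 (fun i _ => hμ i) (∏ i ∈ Sᶜ, (fun _ => (1:ℂ)) i ^ μ i)
    (by simp)
    (antider (bp μ a0 b0)) (by rw [derivative_antider, ha0, hb0]; exact bp_limit μ S y0 fun _ => 1) (prim μ a0 b0 (y0 hS.choose))
    (fun i hi => heq i hi _ hS.choose_spec)
  have hy00 : y0 = 0 := by
    funext i
    by_cases hi : i ∈ S
    · have h1 : ∑ j ∈ S, (μ j : ℂ) * y0 j = (∑ j ∈ S, (μ j : ℂ)) * y0 i := by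
        rw [Finset.sum_mul]
        exact Finset.sum_congr rfl fun j hj => by rw [hall j hj i hi]
      rw [hsum0] at h1
      rcases mul_eq_zero.1 h1.symm with h | h
      · exact absurd h (sum_mu_ne μ hμ S hS)
      · exact h
    · exact hyout i hi
  rw [hy00] at hy0n
  simp at hy0n
end blowequal

/-- degeneration data -/
structure GDat (ι K : Type*) [Fintype ι] [Fintype K] where
  pr : ι → K
  mu : ι → ℕ
  vb : K → ℝ
  v1 : ι → ℝ
  c : ℝ
  p : K → ℕ
  M : ℕ
  hne : Nonempty K
  surj : Function.Surjective pr
  hmu : ∀ i, 1 ≤ mu i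
  hc : c ≠ 0
  hp1 : ∀ k, 1 ≤ p k
  hp : ∀ k, p k * ((∑ i ∈ Finset.univ.filter (fun i => pr i = k), mu i) + 1) = M

/-- coordinates -/
abbrev GE (ι K : Type*) := (K → ℂ) × ℂ × (ι → ℂ) × (K → ℂ)

namespace GDat
variable {ι K : Type*} [Fintype ι] [Fintype K] (d : GDat ι K)

def fib (k : K) : Finset ι := Finset.univ.filter (fun i => d.pr i = k)

lemma mem_fib (k : K) (i : ι) : i ∈ d.fib k ↔ d.pr i = k := by simp [fib]

def mb (k : K) : ℕ := ∑ i ∈ d.fib k, d.mu i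

def v (τ : ℝ) (i : ι) : ℝ := d.vb (d.pr i) + τ ^ d.M * d.v1 i

def xh (τ : ℝ) (X : K → ℂ) (y : ι → ℂ) (i : ι) : ℂ := X (d.pr i) + (τ:ℂ) ^ d.p (d.pr i) * y i

def aa (τ : ℝ) (k : K) (j : ι) : ℂ := if j ∈ d.fib k then 1 else (τ:ℂ) ^ d.p k

def bb (τ : ℝ) (X : K → ℂ) (y : ι → ℂ) (k : K) (j : ι) : ℂ :=
  if j ∈ d.fib k then - y j else X k - d.xh τ X y j

def Psi (q : ℝ × GE ι K) : GE ι K :=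
  (fun k => q.2.2.1 + d.c * primX d.mu (d.xh q.1 q.2.1 q.2.2.2.1) (q.2.1 k) - d.vb k - (q.1:ℂ) ^ d.M * q.2.2.2.2 k,
   ∑ i, (d.mu i : ℂ) * q.2.1 (d.pr i),
   fun i => q.2.2.2.2 (d.pr i) + d.c * prim d.mu (d.aa q.1 (d.pr i)) (d.bb q.1 q.2.1 q.2.2.2.1 (d.pr i)) (q.2.2.2.1 i) - d.v1 i,
   fun k => ∑ i ∈ d.fib k, (d.mu i : ℂ) * q.2.2.2.1 i)

lemma mb_pos (k : K) : 1 ≤ d.mb k := by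
  obtain ⟨i, hi⟩ := d.surj k
  exact (d.hmu i).trans (Finset.single_le_sum (f := d.mu) (fun _ _ => Nat.zero_le _) ((d.mem_fib k i).2 hi))

lemma pow_p (τ : ℂ) (k : K) : (τ ^ d.p k) ^ (d.mb k + 1) = τ ^ d.M := by
  rw [← pow_mul]; congr 1; exact d.hp k

lemma fib_nonempty (k : K) : (d.fib k).Nonempty := by
  obtain ⟨i, hi⟩ := d.surj k
  exact ⟨i, (d.mem_fib k i).2 hi⟩

lemma contDiff_coord {V κ : Type*} [NormedAddCommGroup V] [NormedSpace ℝ V] [Fintype κ] {f : V → κ → ℂ} (hf : ContDiff ℝ 1 f) (k : κ) :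
    ContDiff ℝ 1 fun x => f x k := (contDiff_apply ℝ ℂ k).comp hf

lemma contDiff_Psi : ContDiff ℝ 1 d.Psi := by
  have hX : ContDiff ℝ 1 (fun q : ℝ × GE ι K => q.2.1) := contDiff_fst.comp contDiff_snd
  have hC : ContDiff ℝ 1 (fun q : ℝ × GE ι K => q.2.2.1) := contDiff_fst.comp (contDiff_snd.comp contDiff_snd)
  have hy : ContDiff ℝ 1 (fun q : ℝ × GE ι K => q.2.2.2.1) :=
    contDiff_fst.comp (contDiff_snd.comp (contDiff_snd.comp contDiff_snd))
  have hk : ContDiff ℝ 1 (fun q : ℝ × GE ι K => q.2.2.2.2) :=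
    contDiff_snd.comp (contDiff_snd.comp (contDiff_snd.comp contDiff_snd))
  have hτ : ContDiff ℝ 1 (fun q : ℝ × GE ι K => (q.1 : ℂ)) := Complex.ofRealCLM.contDiff.comp contDiff_fst
  have hxh : ContDiff ℝ 1 (fun q : ℝ × GE ι K => d.xh q.1 q.2.1 q.2.2.2.1) := by
    rw [contDiff_pi]
    intro i
    exact (contDiff_coord hX _).add ((hτ.pow _).mul (contDiff_coord hy i))
  refine ContDiff.prodMk ?_ (ContDiff.prodMk ?_ (ContDiff.prodMk ?_ ?_))
  · rw [contDiff_pi]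
    intro k
    refine ((hC.add (contDiff_const.mul ?_)).sub contDiff_const).sub ((hτ.pow _).mul (contDiff_coord hk k))
    refine ContDiff.prim' _ contDiff_const ?_ (contDiff_coord hX k)
    rw [contDiff_pi]
    intro i
    exact (contDiff_coord hxh i).neg
  · exact ContDiff.sum fun i _ => contDiff_const.mul (contDiff_coord hX _)
  · rw [contDiff_pi]
    intro i
    refine ((contDiff_coord hk _).add (contDiff_const.mul ?_)).sub contDiff_const
    refine ContDiff.prim' _ ?_ ?_ (contDiff_coord hy i)
    · rw [contDiff_pi]
      intro j
      unfold aa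
      split_ifs
      · exact contDiff_const
      · exact hτ.pow _
    · rw [contDiff_pi]
      intro j
      unfold bb
      split_ifs
      · exact (contDiff_coord hy j).neg
      · exact (contDiff_coord hX _).sub (contDiff_coord hxh j)
  · rw [contDiff_pi]
    intro k
    exact ContDiff.sum fun i _ => contDiff_const.mul (contDiff_coord hy i)

/-- key identity -/
lemma key (τ : ℝ) (X : K → ℂ) (C0 : ℂ) (y : ι → ℂ) (Ck : K → ℂ) (i : ι) :
    C0 + d.c * primX d.mu (d.xh τ X y) (d.xh τ X y i) - d.v τ i =
      (d.Psi (τ, X, C0, y, Ck)).1 (d.pr i) + (τ:ℂ) ^ d.M * (d.Psi (τ, X, C0, y, Ck)).2.2.1 i := by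
  have h := blow_identity d.mu (d.fib (d.pr i)) (d.xh τ X y) y (X (d.pr i)) ((τ:ℂ) ^ d.p (d.pr i)) (y i)
    (by
      intro j hj
      rw [mem_fib] at hj
      unfold xh; rw [hj])
  have h2 := d.pow_p (τ:ℂ) (d.pr i)
  unfold mb at h2
  rw [h2] at h
  have e : X (d.pr i) + (τ:ℂ) ^ d.p (d.pr i) * y i = d.xh τ X y i := rfl
  rw [e] at h
  simp only [Psi]
  unfold aa bb v
  push_cast
  linear_combination (d.c : ℂ) * h

lemma sum_xh (τ : ℝ) (X : K → ℂ) (C0 : ℂ) (y : ι → ℂ) (Ck : K → ℂ) (h : d.Psi (τ, X, C0, y, Ck) = 0) :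
    ∑ i, (d.mu i : ℂ) * d.xh τ X y i = 0 := by
  have h2 : ∑ i, (d.mu i : ℂ) * X (d.pr i) = 0 := congrArg (fun q : GE ι K => q.2.1) h
  have h4 : ∀ k, ∑ i ∈ d.fib k, (d.mu i : ℂ) * y i = 0 := fun k => congrFun (congrArg (fun q : GE ι K => q.2.2.2) h) k
  have e : ∑ i, (d.mu i : ℂ) * d.xh τ X y i = ∑ i, (d.mu i : ℂ) * X (d.pr i) + ∑ i, (τ:ℂ) ^ d.p (d.pr i) * ((d.mu i : ℂ) * y i) := by
    rw [← Finset.sum_add_distrib]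
    exact Finset.sum_congr rfl fun i _ => by unfold xh; ring
  rw [e, h2, zero_add, ← Finset.sum_fiberwise Finset.univ d.pr]
  refine Finset.sum_eq_zero fun k _ => ?_
  have : ∑ i ∈ d.fib k, (τ:ℂ) ^ d.p (d.pr i) * ((d.mu i : ℂ) * y i) = (τ:ℂ) ^ d.p k * ∑ i ∈ d.fib k, ((d.mu i : ℂ) * y i) := by
    rw [Finset.mul_sum]
    exact Finset.sum_congr rfl fun i hi => by rw [(d.mem_fib k i).1 hi]
  rw [h4, mul_zero] at this
  exact this

/-- injectivity of the parametrization -/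
lemma H4 (τ : ℝ) (hτ : 0 < τ) (c c' : GE ι K) (h : d.Psi (τ, c) = 0) (h' : d.Psi (τ, c') = 0)
    (hx : d.xh τ c.1 c.2.2.1 = d.xh τ c'.1 c'.2.2.1) : c = c' := by
  obtain ⟨X, C0, y, Ck⟩ := c
  obtain ⟨X', C0', y', Ck'⟩ := c'
  simp only at hx
  have hτ' : ∀ n, (τ:ℂ)^n ≠ 0 := fun n => pow_ne_zero _ (by exact_mod_cast hτ.ne')
  have mean : ∀ (X : K → ℂ) (C0 : ℂ) (y : ι → ℂ) (Ck : K → ℂ) (h : d.Psi (τ, X, C0, y, Ck) = 0) (k : K), X k = wmean d.mu (d.fib k) (d.xh τ X y) := by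
    intro X C0 y Ck h k
    have h4 : ∑ i ∈ d.fib k, (d.mu i : ℂ) * y i = 0 := congrFun (congrArg (fun q : GE ι K => q.2.2.2) h) k
    symm
    unfold wmean
    rw [div_eq_iff (sum_mu_ne d.mu d.hmu _ (d.fib_nonempty k))]
    have : ∑ i ∈ d.fib k, (d.mu i : ℂ) * d.xh τ X y i = ∑ i ∈ d.fib k, (X k * d.mu i + (τ:ℂ) ^ d.p k * ((d.mu i : ℂ) * y i)) :=
      Finset.sum_congr rfl fun i hi => by rw [mem_fib] at hi; unfold xh; rw [hi]; ring
    rw [this, Finset.sum_add_distrib, ← Finset.mul_sum, ← Finset.mul_sum, h4]; ring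
  have hX : X = X' := by
    funext k
    rw [mean X C0 y Ck h k, mean X' C0' y' Ck' h' k, hx]
  subst hX
  have hy : y = y' := by
    funext i
    have := congrFun hx i
    unfold xh at this
    exact mul_left_cancel₀ (hτ' _) (add_left_cancel this)
  subst hy
  have hk : Ck = Ck' := by
    funext k
    obtain ⟨i, rfl⟩ := d.surj k
    have h3 := congrFun (congrArg (fun q : GE ι K => q.2.2.1) h) i
    have h3' := congrFun (congrArg (fun q : GE ι K => q.2.2.1) h') i
    simp only [Psi, Prod.snd_zero, Prod.fst_zero, Pi.zero_apply] at h3 h3'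
    linear_combination h3 - h3'
  subst hk
  obtain ⟨k⟩ := d.hne
  · have h1 := congrFun (congrArg (fun q : GE ι K => q.1) h) k
    have h1' := congrFun (congrArg (fun q : GE ι K => q.1) h') k
    simp only [Psi, Prod.fst_zero, Pi.zero_apply] at h1 h1'
    have : C0 = C0' := by linear_combination h1 - h1'
    rw [this]

end GDat
end

noncomputable section
set_option linter.unusedSectionVars false
set_option linter.unusedVariables false

namespace GDat
variable {ι K : Type*} [Fintype ι] [Fintype K] (d : GDat ι K)

lemma fac_pos (k : K) : d.p k ≠ 0 := by have := d.hp1 k; omega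
lemma M_pos : d.M ≠ 0 := by
  obtain ⟨k⟩ := d.hne
  rw [← d.hp k]
  exact Nat.mul_ne_zero (d.fac_pos k) (by omega)

lemma xh_zero (X : K → ℂ) (y : ι → ℂ) : d.xh 0 X y = X ∘ d.pr := by
  funext i; simp [xh, d.fac_pos]

lemma aa_zero (k : K) : d.aa 0 k = fun j => if j ∈ d.fib k then 1 else 0 := by
  funext j; simp [aa, d.fac_pos]

lemma prod_fib (X : K → ℂ) : ∏ i, (Polynomial.X - C (X (d.pr i))) ^ d.mu i = ∏ k, (Polynomial.X - C (X k)) ^ d.mb k := by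
  rw [← Finset.prod_fiberwise Finset.univ d.pr]
  refine Finset.prod_congr rfl fun k _ => ?_
  unfold mb
  rw [← Finset.prod_pow_eq_pow_sum]
  refine Finset.prod_congr rfl fun i hi => ?_
  rw [(Finset.mem_filter.1 hi).2]

lemma primX_fib (X : K → ℂ) (z : ℂ) : primX d.mu (X ∘ d.pr) z = (antider (∏ k, (Polynomial.X - C (X k)) ^ d.mb k)).eval z := by
  unfold primX prim
  rw [bp_one, ← prod_fib]; rfl

lemma prim_fib (X : K → ℂ) (y : ι → ℂ) (k : K) (z : ℂ) : prim d.mu (d.aa 0 k) (d.bb 0 X y k) z =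
    (∏ i ∈ (d.fib k)ᶜ, (X k - X (d.pr i)) ^ d.mu i) * (antider (∏ i ∈ d.fib k, (Polynomial.X - C (y i)) ^ d.mu i)).eval z := by
  have e : d.bb 0 X y k = fun i => if i ∈ d.fib k then - y i else X k - X (d.pr i) := by
    funext i; unfold bb; rw [xh_zero]; rfl
  have h2 : ∀ (a : ℂ) (p : ℂ[X]), antider (C a * p) = C a * antider p := by
    intro a p
    ext j
    cases j with
    | zero => simp [antider_coeff_zero]
    | succ j => rw [antider_coeff_succ, coeff_C_mul, coeff_C_mul, antider_coeff_succ]; ring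
  unfold prim
  rw [e, aa_zero, bp_limit, h2, eval_mul, eval_C]

lemma outer_ne (X : K → ℂ) (hX : Function.Injective X) (k : K) : (∏ i ∈ (d.fib k)ᶜ, (X k - X (d.pr i)) ^ d.mu i) ≠ 0 := by
  refine Finset.prod_ne_zero_iff.2 fun i hi => pow_ne_zero _ (sub_ne_zero.2 fun h => ?_)
  rw [Finset.mem_compl, mem_fib] at hi
  exact hi (hX h).symm

lemma H1 (X : K → ℂ) (C0 : ℂ) (y : ι → ℂ) (Ck : K → ℂ) (hX : Function.Injective X)
    (hy : ∀ i j, d.pr i = d.pr j → y i = y j → i = j) (δ : GE ι K)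
    (h : HasDerivAt (fun s : ℝ => d.Psi (0, (X, C0, y, Ck) + s • δ)) 0 0) : δ = 0 := by
  obtain ⟨dX, dC, dy, dk⟩ := δ
  have hcC : (d.c : ℂ) ≠ 0 := by exact_mod_cast d.hc
  have h1 : ∀ k, HasDerivAt (fun s : ℝ => (d.Psi (0, (X, C0, y, Ck) + s • (dX, dC, dy, dk))).1 k) 0 0 := by
    intro k
    exact (hasDerivAt_pi.1 (h.fst)) k
  have h2 : HasDerivAt (fun s : ℝ => (d.Psi (0, (X, C0, y, Ck) + s • (dX, dC, dy, dk))).2.1) 0 0 := h.snd.fst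
  have h3 : ∀ i, HasDerivAt (fun s : ℝ => (d.Psi (0, (X, C0, y, Ck) + s • (dX, dC, dy, dk))).2.2.1 i) 0 0 := by
    intro k
    exact (hasDerivAt_pi.1 (h.snd.snd.fst)) k
  have h4 : ∀ k, HasDerivAt (fun s : ℝ => (d.Psi (0, (X, C0, y, Ck) + s • (dX, dC, dy, dk))).2.2.2 k) 0 0 := by
    intro k
    exact (hasDerivAt_pi.1 (h.snd.snd.snd)) k
  simp only [Psi, Prod.fst_add, Prod.snd_add, Prod.smul_fst, Prod.smul_snd, Pi.add_apply, Pi.smul_apply, Complex.real_smul, smul_eq_mul] at h1 h2 h3 h4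
  have hlinsum : ∀ (S : Finset ι) (u w : ι → ℂ), HasDerivAt (fun s : ℝ => ∑ i ∈ S, (d.mu i : ℂ) * (u i + s * w i)) 0 0 →
      ∑ i ∈ S, (d.mu i : ℂ) * w i = 0 := by
    intro S u w hh
    have h1 : HasDerivAt (fun s : ℝ => (s:ℂ)) 1 0 := by
      simpa using (hasDerivAt_id (0:ℝ)).ofReal_comp
    have : HasDerivAt (fun s : ℝ => ∑ i ∈ S, (d.mu i : ℂ) * (u i + s * w i)) (∑ i ∈ S, (d.mu i : ℂ) * w i) 0 := by
      refine HasDerivAt.fun_sum fun i _ => ?_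
      have := ((h1.mul_const (w i)).const_add (u i)).const_mul (d.mu i : ℂ)
      simpa using this
    exact this.unique hh
  have e2 := hlinsum _ _ _ h2
  have e4 := fun k => hlinsum _ _ _ (h4 k)
  obtain ⟨f1, f2⟩ := jac_lemma (Finset.univ : Finset K) ⟨d.hne.some, Finset.mem_univ _⟩ d.mb X dX (fun k _ => d.mb_pos k) hX.injOn
    (d.c : ℂ) hcC C0 dC (by
      rw [← e2, ← Finset.sum_fiberwise Finset.univ d.pr]
      refine Finset.sum_congr rfl fun k _ => ?_
      unfold mb
      push_cast
      rw [Finset.sum_mul]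
      refine Finset.sum_congr rfl fun i hi => ?_
      rw [(Finset.mem_filter.1 hi).2])
    (by
      intro k _
      have := (h1 k).add_const ((d.vb k : ℂ))
      refine this.congr_of_eventuallyEq (Filter.Eventually.of_forall fun s => ?_)
      simp only [Complex.ofReal_zero, zero_pow d.M_pos, zero_mul, sub_zero]
      rw [xh_zero]
      have e := d.primX_fib (X + s • dX) (X k + s * dX k)
      rw [e]
      simp only [Pi.add_apply, Pi.smul_apply, Complex.real_smul]
      ring)
  have hdX : dX = 0 := funext fun k => f1 k (Finset.mem_univ k)
  subst hdX
  subst f2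
  have key : ∀ k, (∀ i ∈ d.fib k, dy i = 0) ∧ dk k = 0 := by
    intro k
    refine jac_lemma (d.fib k) (d.fib_nonempty k) d.mu y dy (fun i _ => d.hmu i) ?_
      ((d.c : ℂ) * (∏ i ∈ (d.fib k)ᶜ, (X k - X (d.pr i)) ^ d.mu i)) (mul_ne_zero hcC (d.outer_ne X hX k)) (Ck k) (dk k) (e4 k) ?_
    · intro i hi j hj hij
      exact hy i j (((d.mem_fib k i).1 hi).trans ((d.mem_fib k j).1 hj).symm) hij
    · intro i hi
      have hk := (d.mem_fib k i).1 hi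
      have := (h3 i).add_const ((d.v1 i : ℂ))
      refine this.congr_of_eventuallyEq (Filter.Eventually.of_forall fun s => ?_)
      simp only [smul_zero, add_zero]
      rw [hk, prim_fib]
      simp only [Pi.add_apply, Pi.smul_apply, Complex.real_smul]
      ring
  have hdy : dy = 0 := funext fun i => (key (d.pr i)).1 i ((d.mem_fib _ i).2 rfl)
  have hdk : dk = 0 := funext fun k => (key k).2
  rw [hdy, hdk]; rfl

/-- limit configurations -/
def Z0 (B : Set (K → ℂ)) : Set (GE ι K) :=
  {q | q.1 ∈ B ∧ Function.Injective q.1 ∧ d.Psi (0, q) = 0 ∧ (∀ i j, d.pr i = d.pr j → q.2.2.1 i = q.2.2.1 j → i = j) ∧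
    ∃ σ : Equiv.Perm ι, (∀ i, d.mu (σ i) = d.mu i) ∧ (∀ i, d.vb (d.pr (σ i)) = d.vb (d.pr i)) ∧
      (∀ i, d.v1 (σ i) = d.v1 i) ∧ (∀ i, q.1 (d.pr (σ i)) = (starRingEnd ℂ) (q.1 (d.pr i))) ∧
      ∀ i, q.2.2.1 (σ i) = (starRingEnd ℂ) (q.2.2.1 i)}

end GDat
end

noncomputable section
set_option linter.unusedSectionVars false
set_option linter.unusedVariables false

section conj
variable {ι : Type*} [Fintype ι]

lemma antider_map_conj (p : ℂ[X]) : antider (p.map (starRingEnd ℂ)) = (antider p).map (starRingEnd ℂ) := by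
  ext j
  cases j with
  | zero => simp [antider_coeff_zero]
  | succ j => rw [antider_coeff_succ, coeff_map, coeff_map, antider_coeff_succ]; simp

lemma prim_relabel {κ : Type*} [Fintype κ] (μ : ι → ℕ) (a b : ι → ℂ) (σ : κ ≃ ι) (z : ℂ) :
    prim (μ ∘ σ) (a ∘ σ) (b ∘ σ) z = prim μ a b z := by
  unfold prim
  congr 2
  unfold bp
  exact Equiv.prod_comp σ (fun i => (C (a i) * X + C (b i)) ^ μ i)

lemma prim_conj (μ : ι → ℕ) (a b : ι → ℂ) (z : ℂ) :
    prim μ (fun i => (starRingEnd ℂ) (a i)) (fun i => (starRingEnd ℂ) (b i)) ((starRingEnd ℂ) z) = (starRingEnd ℂ) (prim μ a b z) := by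
  unfold prim
  have : bp μ (fun i => (starRingEnd ℂ) (a i)) (fun i => (starRingEnd ℂ) (b i)) = (bp μ a b).map (starRingEnd ℂ) := by
    unfold bp
    rw [Polynomial.map_prod]
    simp
  rw [this, antider_map_conj, eval_map, eval₂_hom]

lemma prim_conj_perm (μ : ι → ℕ) (a b : ι → ℂ) (z : ℂ) (σ : Equiv.Perm ι) (hσ : ∀ i, μ (σ i) = μ i) :
    prim μ (fun i => (starRingEnd ℂ) (a (σ i))) (fun i => (starRingEnd ℂ) (b (σ i))) ((starRingEnd ℂ) z) = (starRingEnd ℂ) (prim μ a b z) := by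
  rw [← prim_conj, ← prim_relabel μ (fun i => (starRingEnd ℂ) (a i)) (fun i => (starRingEnd ℂ) (b i)) σ]
  have : μ ∘ σ = μ := funext hσ
  rw [this]
  rfl

/-- sign -/
def sgn (e : ι → ι → ℕ) (x : ι → ℂ) : ℤ :=
  ∏ i, ∏ j, if (x i).im = 0 ∧ (x j).im = 0 ∧ (x i).re < (x j).re then (-1) ^ e i j else 1
end conj

namespace GDat
variable {ι K : Type*} [Fintype ι] [Fintype K] (d : GDat ι K)

def sgn0 (e : ι → ι → ℕ) (q : GE ι K) : ℤ :=
  ∏ i, ∏ j, if ((q.1 (d.pr i)).im = 0 ∧ (q.2.2.1 i).im = 0) ∧ ((q.1 (d.pr j)).im = 0 ∧ (q.2.2.1 j).im = 0) ∧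
    ((q.1 (d.pr i)).re < (q.1 (d.pr j)).re ∨ (d.pr i = d.pr j ∧ (q.2.2.1 i).re < (q.2.2.1 j).re)) then (-1) ^ e i j else 1

lemma ext_of_Xy (τ : ℝ) (X : K → ℂ) (C0 C0' : ℂ) (y : ι → ℂ) (Ck Ck' : K → ℂ) (h : d.Psi (τ, X, C0, y, Ck) = 0)
    (h' : d.Psi (τ, X, C0', y, Ck') = 0) : C0 = C0' ∧ Ck = Ck' := by
  have hk : Ck = Ck' := by
    funext k
    obtain ⟨i, rfl⟩ := d.surj k
    have h3 := congrFun (congrArg (fun q : GE ι K => q.2.2.1) h) i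
    have h3' := congrFun (congrArg (fun q : GE ι K => q.2.2.1) h') i
    simp only [Psi, Prod.snd_zero, Prod.fst_zero, Pi.zero_apply] at h3 h3'
    linear_combination h3 - h3'
  subst hk
  obtain ⟨k⟩ := d.hne
  have h1 := congrFun (congrArg (fun q : GE ι K => q.1) h) k
  have h1' := congrFun (congrArg (fun q : GE ι K => q.1) h') k
  simp only [Psi, Prod.fst_zero, Pi.zero_apply] at h1 h1'
  exact ⟨by linear_combination h1 - h1', rfl⟩

def J (σ : Equiv.Perm ι) (ρ : Equiv.Perm K) (q : GE ι K) : GE ι K :=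
  (fun k => (starRingEnd ℂ) (q.1 (ρ k)), (starRingEnd ℂ) q.2.1, fun i => (starRingEnd ℂ) (q.2.2.1 (σ i)),
    fun k => (starRingEnd ℂ) (q.2.2.2 (ρ k)))

lemma continuous_J (σ : Equiv.Perm ι) (ρ : Equiv.Perm K) : Continuous (J σ ρ : GE ι K → GE ι K) := by
  unfold J
  have hc : Continuous (starRingEnd ℂ) := Complex.continuous_conj
  fun_prop

lemma exists_rho (X : K → ℂ) (hX : Function.Injective X) (σ : Equiv.Perm ι)
    (h : ∀ i, X (d.pr (σ i)) = (starRingEnd ℂ) (X (d.pr i))) : ∃ ρ : Equiv.Perm K, ∀ i, d.pr (σ i) = ρ (d.pr i) := by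
  choose g hg using d.surj
  have h1 : ∀ k, X (d.pr (σ (g k))) = (starRingEnd ℂ) (X k) := fun k => by rw [h, hg]
  have hinj : Function.Injective (fun k => d.pr (σ (g k))) := by
    intro k k' hk
    have : (starRingEnd ℂ) (X k) = (starRingEnd ℂ) (X k') := by rw [← h1, ← h1]; exact congrArg X hk
    exact hX ((starRingEnd ℂ).injective this)
  refine ⟨Equiv.ofBijective _ (Finite.injective_iff_bijective.1 hinj), fun i => ?_⟩
  apply hX
  simp only [Equiv.ofBijective_apply]
  rw [h, h1]

/-- label symmetries -/
structure Sym (σ : Equiv.Perm ι) (ρ : Equiv.Perm K) : Prop where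
  pr : ∀ i, d.pr (σ i) = ρ (d.pr i)
  mu : ∀ i, d.mu (σ i) = d.mu i
  vb : ∀ k, d.vb (ρ k) = d.vb k
  v1 : ∀ i, d.v1 (σ i) = d.v1 i

variable {d} {σ : Equiv.Perm ι} {ρ : Equiv.Perm K}

lemma Sym.mem_fib (h : d.Sym σ ρ) (k : K) (i : ι) : σ i ∈ d.fib (ρ k) ↔ i ∈ d.fib k := by
  rw [d.mem_fib, d.mem_fib, h.pr]; exact ρ.injective.eq_iff

lemma Sym.sum_fib (h : d.Sym σ ρ) (k : K) (f : ι → ℂ) : ∑ i ∈ d.fib (ρ k), f i = ∑ i ∈ d.fib k, f (σ i) := by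
  symm
  refine Finset.sum_bij (fun i _ => σ i) (fun i hi => (h.mem_fib k i).2 hi) (fun i _ j _ h => σ.injective h) ?_ (fun _ _ => rfl)
  intro i hi
  refine ⟨σ.symm i, ?_, by simp⟩
  rw [← h.mem_fib]; simpa using hi

lemma Sym.p (h : d.Sym σ ρ) (k : K) : d.p (ρ k) = d.p k := by
  have h1 : d.mb (ρ k) = d.mb k := by
    have := h.sum_fib k (fun i => (d.mu i : ℂ))
    simp only [h.mu] at this
    unfold mb
    exact_mod_cast this
  have h2 := d.hp (ρ k)
  have h3 := d.hp k
  change d.p (ρ k) * (d.mb (ρ k) + 1) = _ at h2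
  change d.p k * (d.mb k + 1) = _ at h3
  rw [h1, ← h3] at h2
  exact Nat.eq_of_mul_eq_mul_right (by omega) h2

lemma Sym.xh (h : d.Sym σ ρ) (τ : ℝ) (q : GE ι K) : d.xh τ (J σ ρ q).1 (J σ ρ q).2.2.1 = fun i => (starRingEnd ℂ) (d.xh τ q.1 q.2.2.1 (σ i)) := by
  funext i
  unfold GDat.xh J
  simp only [map_add, map_mul, map_pow, Complex.conj_ofReal]
  rw [h.pr, h.p]

lemma Sym.Psi (h : d.Sym σ ρ) (τ : ℝ) (q : GE ι K) : d.Psi (τ, J σ ρ q) = J σ ρ (d.Psi (τ, q)) := by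
  have hxJ := h.xh τ q
  refine Prod.ext ?_ (Prod.ext ?_ (Prod.ext ?_ ?_))
  · funext k
    simp only [GDat.Psi]
    rw [hxJ]
    simp only [J, map_sub, map_add, map_mul, map_pow, Complex.conj_ofReal, h.vb]
    congr 3
    congr 1
    unfold primX
    rw [← prim_conj_perm _ _ _ _ σ h.mu]
    simp
  · simp only [GDat.Psi, J]
    rw [← Equiv.sum_comp σ (fun i => (d.mu i : ℂ) * q.1 (d.pr i)), map_sum]
    refine Finset.sum_congr rfl fun i _ => ?_
    rw [map_mul, h.mu, h.pr]; simp
  · funext i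
    have e2 : d.bb τ (J σ ρ q).1 (J σ ρ q).2.2.1 (d.pr i) = fun j => (starRingEnd ℂ) (d.bb τ q.1 q.2.2.1 (ρ (d.pr i)) (σ j)) := by
      funext j
      unfold bb
      simp only [h.mem_fib, hxJ]
      split_ifs <;> simp [J]
    have e1 : d.aa τ (d.pr i) = fun j => (starRingEnd ℂ) (d.aa τ (ρ (d.pr i)) (σ j)) := by
      funext j
      unfold aa
      simp only [h.mem_fib, h.p]
      split_ifs <;> simp
    have e3 := prim_conj_perm d.mu (d.aa τ (ρ (d.pr i))) (d.bb τ q.1 q.2.2.1 (ρ (d.pr i))) (q.2.2.1 (σ i)) σ h.mu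
    rw [← e1, ← e2] at e3
    simp only [GDat.Psi]
    change (starRingEnd ℂ) (q.2.2.2 (ρ (d.pr i))) + _ * prim d.mu _ _ ((starRingEnd ℂ) (q.2.2.1 (σ i))) - _ = (starRingEnd ℂ) _
    rw [e3]
    simp only [map_sub, map_add, map_mul, Complex.conj_ofReal, h.v1, h.pr]
  · funext k
    simp only [GDat.Psi, J]
    rw [h.sum_fib, map_sum]
    refine Finset.sum_congr rfl fun i _ => ?_
    rw [map_mul, h.mu]; simp

end GDat
end

noncomputable section
set_option linter.unusedSectionVars false
set_option linter.unusedVariables false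

namespace GDat
variable {ι K : Type*} [Fintype ι] [Fintype K] (d : GDat ι K)

lemma continuous_xh : Continuous (fun q : ℝ × GE ι K => d.xh q.1 q.2.1 q.2.2.2.1) := by
  rw [continuous_pi_iff]
  intro i
  unfold xh
  have : Continuous (fun q : ℝ × GE ι K => (q.1:ℂ)) := Complex.continuous_ofReal.comp continuous_fst
  fun_prop

lemma real_iff {ι : Type*} (x : ι → ℂ) (hx : Function.Injective x) (σ : Equiv.Perm ι)
    (h : ∀ i, x (σ i) = (starRingEnd ℂ) (x i)) (i : ι) : (x i).im = 0 ↔ σ i = i := by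
  rw [← Complex.conj_eq_iff_im, ← h, hx.eq_iff]

lemma H3 (B : Set (K → ℂ)) (P : Set (ι → ℂ)) (hP : ∀ X ∈ B, P ∈ nhds (X ∘ d.pr)) (e : ι → ι → ℕ)
    (q0 : GE ι K) (hq0 : q0 ∈ d.Z0 B) :
    ∀ᶠ p in nhds ((0:ℝ), q0), p.1 ∈ Set.Ioi (0:ℝ) → d.Psi p = 0 →
      d.xh p.1 p.2.1 p.2.2.2.1 ∈ {x | x ∈ Sol d.c d.mu (d.v p.1) ∧ x ∈ P} ∧ sgn e (d.xh p.1 p.2.1 p.2.2.2.1) = d.sgn0 e q0 := by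
  obtain ⟨hB, hinj, hPsi, hyinj, σ, s1, s2, s3, s4, s5⟩ := hq0
  obtain ⟨ρ, hρ⟩ := d.exists_rho q0.1 hinj σ s4
  have hsym : d.Sym σ ρ := ⟨hρ, s1, fun k => by obtain ⟨i, rfl⟩ := d.surj k; rw [← hρ, s2], s3⟩
  have hJX : (J σ ρ q0).1 = q0.1 := by
    funext k
    obtain ⟨i, rfl⟩ := d.surj k
    simp only [J]
    rw [← hρ, s4]; simp
  have hJy : (J σ ρ q0).2.2.1 = q0.2.2.1 := by
    funext i
    simp only [J]
    rw [s5]; simp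
  have hJ0 : J σ ρ q0 = q0 := by
    have h1 : d.Psi (0, J σ ρ q0) = 0 := by
      rw [hsym.Psi, hPsi]
      ext <;> simp [J]
    have h2 := d.ext_of_Xy 0 q0.1 q0.2.1 (J σ ρ q0).2.1 q0.2.2.1 q0.2.2.2 (J σ ρ q0).2.2.2 hPsi
      (by rw [← hJX, ← hJy]; exact h1)
    exact Prod.ext hJX (Prod.ext h2.1.symm (Prod.ext hJy h2.2.symm))
  obtain ⟨U, hU, hUq, -⟩ := local_inv d.Psi d.contDiff_Psi 0 q0 hPsi (fun δ h => d.H1 q0.1 q0.2.1 q0.2.2.1 q0.2.2.2 hinj hyinj δ h)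
  have e1 : ∀ᶠ p in nhds ((0:ℝ), q0), p ∈ U := hU
  have e2 : ∀ᶠ p : ℝ × GE ι K in nhds ((0:ℝ), q0), (p.1, J σ ρ p.2) ∈ U := by
    have hc : Continuous (fun p : ℝ × GE ι K => (p.1, J σ ρ p.2)) := continuous_fst.prodMk ((continuous_J σ ρ).comp continuous_snd)
    have := hc.tendsto ((0:ℝ), q0)
    simp only [hJ0] at this
    exact this.eventually hU
  have hxc := d.continuous_xh.tendsto ((0:ℝ), q0)
  simp only [xh_zero] at hxc
  have e3 : ∀ᶠ p : ℝ × GE ι K in nhds ((0:ℝ), q0), d.xh p.1 p.2.1 p.2.2.2.1 ∈ P := hxc.eventually (hP _ hB)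
  have hxci : ∀ i, Filter.Tendsto (fun p : ℝ × GE ι K => d.xh p.1 p.2.1 p.2.2.2.1 i) (nhds ((0:ℝ), q0)) (nhds (q0.1 (d.pr i))) :=
    fun i => ((continuous_apply i).tendsto _).comp hxc
  have hyci : ∀ i, Filter.Tendsto (fun p : ℝ × GE ι K => p.2.2.2.1 i) (nhds ((0:ℝ), q0)) (nhds (q0.2.2.1 i)) := by
    intro i
    have : Continuous (fun p : ℝ × GE ι K => p.2.2.2.1 i) := by fun_prop
    exact this.tendsto _
  have e4 : ∀ᶠ p : ℝ × GE ι K in nhds ((0:ℝ), q0), ∀ i j, d.pr i ≠ d.pr j → d.xh p.1 p.2.1 p.2.2.2.1 i ≠ d.xh p.1 p.2.1 p.2.2.2.1 j := by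
    rw [Filter.eventually_all]; intro i; rw [Filter.eventually_all]; intro j
    by_cases hij : d.pr i = d.pr j
    · simp [hij]
    · filter_upwards [((hxci i).sub (hxci j)).eventually_ne (sub_ne_zero.2 fun h => hij (hinj h))] with p hp _ using sub_ne_zero.1 hp
  have e5 : ∀ᶠ p : ℝ × GE ι K in nhds ((0:ℝ), q0), ∀ i j, q0.2.2.1 i ≠ q0.2.2.1 j → p.2.2.2.1 i ≠ p.2.2.2.1 j := by
    rw [Filter.eventually_all]; intro i; rw [Filter.eventually_all]; intro j
    by_cases hij : q0.2.2.1 i = q0.2.2.1 j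
    · simp [hij]
    · filter_upwards [((hyci i).sub (hyci j)).eventually_ne (sub_ne_zero.2 hij)] with p hp _ using sub_ne_zero.1 hp
  have e6 : ∀ᶠ p : ℝ × GE ι K in nhds ((0:ℝ), q0), ∀ i j, (q0.1 (d.pr i)).re < (q0.1 (d.pr j)).re →
      (d.xh p.1 p.2.1 p.2.2.2.1 i).re < (d.xh p.1 p.2.1 p.2.2.2.1 j).re := by
    rw [Filter.eventually_all]; intro i; rw [Filter.eventually_all]; intro j
    by_cases hij : (q0.1 (d.pr i)).re < (q0.1 (d.pr j)).re
    · filter_upwards [(((Complex.continuous_re.tendsto _).comp (hxci i)).eventually_lt ((Complex.continuous_re.tendsto _).comp (hxci j)) hij)] with p hp _ using hp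
    · simp [hij]
  have e7 : ∀ᶠ p : ℝ × GE ι K in nhds ((0:ℝ), q0), ∀ i j, (q0.2.2.1 i).re < (q0.2.2.1 j).re →
      (p.2.2.2.1 i).re < (p.2.2.2.1 j).re := by
    rw [Filter.eventually_all]; intro i; rw [Filter.eventually_all]; intro j
    by_cases hij : (q0.2.2.1 i).re < (q0.2.2.1 j).re
    · filter_upwards [(((Complex.continuous_re.tendsto _).comp (hyci i)).eventually_lt ((Complex.continuous_re.tendsto _).comp (hyci j)) hij)] with p hp _ using hp
    · simp [hij]
  filter_upwards [e1, e2, e3, e4, e5, e6, e7] with p e1 e2 e3 e4 e5 e6 e7 hτ hp0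
  obtain ⟨τ, q⟩ := p
  simp only at e1 e2 e3 e4 e5 e6 e7 hp0 ⊢
  have hτ : 0 < τ := hτ
  have hJ : J σ ρ q = q := hUq τ _ _ e2 e1 (by rw [hsym.Psi, hp0]; ext <;> simp [J]) hp0
  have hconj : ∀ i, d.xh τ q.1 q.2.2.1 (σ i) = (starRingEnd ℂ) (d.xh τ q.1 q.2.2.1 i) := by
    intro i
    have := congrFun (hsym.xh τ q) i
    rw [hJ] at this
    rw [this]; simp
  have hxinj : Function.Injective (d.xh τ q.1 q.2.2.1) := by
    intro i j hij
    by_cases hpr : d.pr i = d.pr j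
    · by_contra hne
      have h1 : q0.2.2.1 i ≠ q0.2.2.1 j := fun h => hne (hyinj i j hpr h)
      refine e5 i j h1 ?_
      unfold xh at hij
      rw [hpr] at hij
      exact mul_left_cancel₀ (pow_ne_zero _ (by exact_mod_cast hτ.ne')) (add_left_cancel hij)
    · exact absurd hij (e4 i j hpr)
  refine ⟨⟨⟨hxinj, d.sum_xh τ q.1 q.2.1 q.2.2.1 q.2.2.2 hp0, ⟨σ, s1, fun i => by unfold v; rw [s2, s3], hconj⟩, q.2.1, fun i => ?_⟩, e3⟩, ?_⟩
  · have := d.key τ q.1 q.2.1 q.2.2.1 q.2.2.2 i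
    have hp0' : d.Psi (τ, q.1, q.2.1, q.2.2.1, q.2.2.2) = 0 := hp0
    rw [hp0'] at this
    simp at this
    linear_combination this
  · unfold sgn sgn0
    refine Finset.prod_congr rfl fun i _ => Finset.prod_congr rfl fun j _ => ?_
    have hr0 : ∀ i, ((q0.1 (d.pr i)).im = 0 ∧ (q0.2.2.1 i).im = 0) ↔ σ i = i := by
      intro i
      rw [← Complex.conj_eq_iff_im, ← Complex.conj_eq_iff_im, ← s4, ← s5, hinj.eq_iff]
      exact ⟨fun h => hyinj _ _ h.1 h.2, fun h => by rw [h]; exact ⟨rfl, rfl⟩⟩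
    refine if_congr ?_ rfl rfl
    rw [real_iff _ hxinj σ hconj, real_iff _ hxinj σ hconj, hr0, hr0]
    refine and_congr_right fun hi => and_congr_right fun hj => ?_
    have ri := (hr0 i).2 hi
    have rj := (hr0 j).2 hj
    by_cases hpr : d.pr i = d.pr j
    · have t1 : ∀ a b, d.pr a = d.pr b → ((d.xh τ q.1 q.2.2.1 a).re < (d.xh τ q.1 q.2.2.1 b).re ↔ (q.2.2.1 a).re < (q.2.2.1 b).re) := by
        intro a b hab
        unfold xh
        rw [hab, ← Complex.ofReal_pow]
        simp only [Complex.add_re, Complex.re_ofReal_mul]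
        have : 0 < τ ^ d.p (d.pr b) := by positivity
        constructor
        · intro h; nlinarith
        · intro h; nlinarith
      rw [t1 i j hpr, hpr]
      simp only [lt_irrefl, false_or, true_and]
      refine ⟨fun h => ?_, fun h => e7 i j h⟩
      by_contra hn
      rcases lt_or_eq_of_le (not_lt.1 hn) with h2 | h2
      · exact absurd (e7 j i h2) (not_lt.2 h.le)
      · have : i = j := hyinj i j hpr (Complex.ext h2.symm (ri.2.trans rj.2.symm))
        rw [this] at h; exact lt_irrefl _ h
    · simp only [hpr, false_and, or_false]
      refine ⟨fun h => ?_, fun h => e6 i j h⟩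
      by_contra hn
      rcases lt_or_eq_of_le (not_lt.1 hn) with h2 | h2
      · exact absurd (e6 j i h2) (not_lt.2 h.le)
      · exact hpr (hinj (Complex.ext h2.symm (ri.1.trans rj.1.symm)))

end GDat
end

noncomputable section
set_option linter.unusedSectionVars false
set_option linter.unusedVariables false

namespace GDat
variable {ι K : Type*} [Fintype ι] [Fintype K] (d : GDat ι K)

lemma ultra_const {T A : Type*} [Finite A] (l : Ultrafilter T) (P : T → A → Prop) (h : ∀ᶠ t in l, ∃ a, P t a) : ∃ a, ∀ᶠ t in l, P t a := by
  by_contra hcon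
  push Not at hcon
  have : ∀ a, ∀ᶠ t in l, ¬ P t a := fun a => hcon a
  rw [← Filter.eventually_all] at this
  obtain ⟨t, ⟨a, ha⟩, h2⟩ := (h.and this).exists
  exact h2 a ha

lemma H2 (B : Set (K → ℂ)) (P : Set (ι → ℂ))
    (hB : ∀ X ∈ B, Function.Injective X)
    (hcl : ∀ (l : Ultrafilter ℝ), (l : Filter ℝ) ≤ nhdsWithin 0 (Set.Ioi 0) → ∀ (x : ℝ → ι → ℂ) (x0 : ι → ℂ),
      (∀ᶠ t in l, x t ∈ Sol d.c d.mu (d.v t) ∧ x t ∈ P) → Filter.Tendsto x l (nhds x0) → ∃ X ∈ B, x0 = X ∘ d.pr)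
    (l : Ultrafilter ℝ) (hl : (l : Filter ℝ) ≤ nhdsWithin 0 (Set.Ioi 0)) (w : ℝ → ι → ℂ)
    (hw : ∀ᶠ t in l, w t ∈ Sol d.c d.mu (d.v t) ∧ w t ∈ P) :
    ∃ q0 ∈ d.Z0 B, ∃ q : ℝ → GE ι K, Filter.Tendsto q l (nhds q0) ∧
      ∀ᶠ t in l, d.Psi (t, q t) = 0 ∧ d.xh t (q t).1 (q t).2.2.1 = w t := by
  have hpos : ∀ᶠ t in l, (0:ℝ) < t := hl eventually_mem_nhdsWithin
  have ht0 : Filter.Tendsto (fun t : ℝ => t) l (nhds 0) := (hl.trans nhdsWithin_le_nhds)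
  have ht0c : Filter.Tendsto (fun t : ℝ => (t:ℂ)) l (nhds 0) := by
    have := (Complex.continuous_ofReal.tendsto 0).comp ht0
    rw [Complex.ofReal_zero] at this
    exact this
  have hsmall : ∀ᶠ t in l, (t:ℝ) ≤ 1 := ht0.eventually (eventually_le_nhds (by norm_num))
  have hwS : ∀ᶠ t in l, w t ∈ Sol d.c d.mu (d.v t) := hw.mono fun t h => h.1
  set BB : ℝ := ∑ i, (|d.vb (d.pr i)| + |d.v1 i|) with hBB
  have hBB1 : ∀ i, |d.vb (d.pr i)| + |d.v1 i| ≤ BB := fun i =>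
    Finset.single_le_sum (f := fun i => |d.vb (d.pr i)| + |d.v1 i|) (fun _ _ => by positivity) (Finset.mem_univ i)
  have hBB0 : 0 ≤ BB := Finset.sum_nonneg fun _ _ => by positivity
  have hvB : ∀ᶠ t in l, ‖d.v t‖ ≤ BB := by
    filter_upwards [hpos, hsmall] with t h1 h2
    rw [pi_norm_le_iff_of_nonneg hBB0]
    intro i
    unfold v
    refine (norm_add_le _ _).trans (le_trans ?_ (hBB1 i))
    rw [norm_mul, Real.norm_eq_abs, Real.norm_eq_abs (d.v1 i)]
    have : ‖t ^ d.M‖ ≤ 1 := by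
      rw [norm_pow, Real.norm_of_nonneg h1.le]; exact pow_le_one₀ h1.le h2
    nlinarith [abs_nonneg (d.v1 i)]
  obtain ⟨x0, hx0⟩ := Sol.bounded l d.mu d.hmu d.c d.hc d.v BB hvB w hwS
  obtain ⟨X0, hX0B, hx0X⟩ := hcl l hl w x0 hw hx0
  have hX0inj := hB X0 hX0B
  -- cluster means
  set X : ℝ → K → ℂ := fun t k => wmean d.mu (d.fib k) (w t) with hX
  have hx0f : ∀ k i, i ∈ d.fib k ↔ x0 i = X0 k := by
    intro k i
    rw [mem_fib, hx0X]; exact hX0inj.eq_iff.symm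
  have hXlim : Filter.Tendsto X l (nhds X0) := by
    rw [tendsto_pi_nhds]
    intro k
    have := tendsto_wmean d.mu (d.fib k) hx0
    rwa [wmean_const d.mu d.hmu _ (d.fib_nonempty k) x0 (X0 k) fun i hi => (hx0f k i).1 hi] at this
  set y : ℝ → ι → ℂ := fun t i => (w t i - X t (d.pr i)) / (t:ℂ) ^ d.p (d.pr i) with hy
  have hybd : ∃ R, ∀ᶠ t in l, ‖y t‖ ≤ R := by
    have h1 : ∀ k, ∃ R : ℝ, 0 ≤ R ∧ ∀ᶠ t in l, ∀ i ∈ d.fib k, ‖y t i‖ ≤ R := by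
      intro k
      obtain ⟨Kc, hK, hKe⟩ := cluster_bound l d.mu d.hmu d.c d.hc d.v w hwS x0 hx0 (d.fib k) (d.fib_nonempty k) (X0 k) (hx0f k)
        (fun t => t ^ d.M * (2 * BB)) (by
          filter_upwards [hpos] with t h1 i hi j hj
          rw [mem_fib] at hi hj
          unfold v
          rw [hi, hj]
          have e : d.vb k + t ^ d.M * d.v1 i - (d.vb k + t ^ d.M * d.v1 j) = t ^ d.M * (d.v1 i - d.v1 j) := by ring
          rw [e, abs_mul, abs_of_pos (pow_pos h1 _)]
          refine mul_le_mul_of_nonneg_left ?_ (pow_pos h1 _).le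
          have a1 := abs_sub (d.v1 i) (d.v1 j)
          have a2 := hBB1 i
          have a3 := hBB1 j
          have a4 := abs_nonneg (d.vb (d.pr i))
          have a5 := abs_nonneg (d.vb (d.pr j))
          linarith)
      refine ⟨max 1 (Kc * (2*BB)), le_trans zero_le_one (le_max_left _ _), ?_⟩
      filter_upwards [hKe, hpos] with t h1 h2 i hi
      have hpr := (d.mem_fib k i).1 hi
      by_cases h3 : ‖y t i‖ ≤ 1
      · exact h3.trans (le_max_left _ _)
      push Not at h3
      refine le_trans ?_ (le_max_right _ _)
      refine (le_self_pow₀ h3.le (show d.mb k + 1 ≠ 0 by omega)).trans ?_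
      have h4 : ‖y t i‖ = ‖w t i - X t k‖ / t ^ d.p k := by
        simp only [hy]
        rw [hpr, norm_div, norm_pow, Complex.norm_real, Real.norm_of_nonneg h2.le]
      have h5 : ‖w t i - X t k‖ ≤ ‖yraw (d.fib k) (w t) (wmean d.mu (d.fib k) (w t))‖ := by
        have := norm_le_pi_norm (yraw (d.fib k) (w t) (wmean d.mu (d.fib k) (w t))) i
        simpa only [yraw, hi, if_true] using this
      have hM : (t ^ d.p k) ^ (d.mb k + 1) = t ^ d.M := by
        rw [← pow_mul]; congr 1; exact d.hp k
      rw [h4, div_pow, hM, div_le_iff₀ (pow_pos h2 _)]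
      calc ‖w t i - X t k‖ ^ (d.mb k + 1) ≤ ‖yraw (d.fib k) (w t) (wmean d.mu (d.fib k) (w t))‖ ^ (d.mb k + 1) :=
            pow_le_pow_left₀ (norm_nonneg _) h5 _
        _ ≤ Kc * (t ^ d.M * (2*BB)) := h1
        _ = _ := by ring
    choose R hR0 hR using h1
    refine ⟨∑ k, R k, ?_⟩
    filter_upwards [Filter.eventually_all.2 hR] with t ht
    rw [pi_norm_le_iff_of_nonneg (Finset.sum_nonneg fun k _ => hR0 k)]
    intro i
    exact (ht (d.pr i) i ((d.mem_fib _ i).2 rfl)).trans (Finset.single_le_sum (f := R) (fun k _ => hR0 k) (Finset.mem_univ _))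
  obtain ⟨R, hR⟩ := hybd
  obtain ⟨y0, hy0⟩ := ultra_conv l y R hR
  have hxh : ∀ᶠ t in l, d.xh t (X t) (y t) = w t := by
    filter_upwards [hpos] with t ht
    funext i
    unfold xh
    simp only [hy]
    have : (t:ℂ) ^ d.p (d.pr i) ≠ 0 := pow_ne_zero _ (by exact_mod_cast ht.ne')
    field_simp; ring
  choose sec hsec using d.surj
  set i0 := sec d.hne.some
  set Cc : ℝ → ℂ := fun t => d.v t i0 - d.c * primX d.mu (w t) (w t i0) with hCc
  set Ck : ℝ → K → ℂ := fun t k => d.v1 (sec k) - d.c * prim d.mu (d.aa t k) (d.bb t (X t) (y t) k) (y t (sec k)) with hCk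
  have hxhlim : Filter.Tendsto (fun t => d.xh t (X t) (y t)) l (nhds x0) := hx0.congr' (hxh.mono fun t h => h.symm)
  have hCc' : ∃ C0, Filter.Tendsto Cc l (nhds C0) := by
    refine ⟨d.v 0 i0 - d.c * primX d.mu x0 (x0 i0), ?_⟩
    refine Filter.Tendsto.sub ?_ (Filter.Tendsto.const_mul _ ?_)
    · refine (Complex.continuous_ofReal.tendsto _).comp ?_
      unfold v
      exact tendsto_const_nhds.add (((continuous_pow d.M).tendsto _ |>.comp ht0).mul tendsto_const_nhds)
    · refine tendsto_prim _ tendsto_const_nhds ?_ (((continuous_apply i0).tendsto _).comp hx0)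
      exact (Filter.Tendsto.neg hx0 :)
  obtain ⟨C0, hC0⟩ := hCc'
  have hyi : ∀ i, Filter.Tendsto (fun t => y t i) l (nhds (y0 i)) := fun i => ((continuous_apply i).tendsto _).comp hy0
  have hXk : ∀ k, Filter.Tendsto (fun t => X t k) l (nhds (X0 k)) := fun k => ((continuous_apply k).tendsto _).comp hXlim
  have haa : ∀ k, Filter.Tendsto (fun t => d.aa t k) l (nhds (d.aa 0 k)) := by
    intro k
    rw [tendsto_pi_nhds]
    intro j
    unfold aa
    split_ifs
    · exact tendsto_const_nhds
    · have := ((continuous_pow (d.p k)).tendsto (0:ℂ)).comp ht0c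
      rw [← Complex.ofReal_zero] at this
      exact this
  have hbb : ∀ k, Filter.Tendsto (fun t => d.bb t (X t) (y t) k) l (nhds (d.bb 0 X0 y0 k)) := by
    intro k
    rw [tendsto_pi_nhds]
    intro j
    unfold bb
    split_ifs
    · exact (hyi j).neg
    · rw [xh_zero, ← hx0X]
      exact (hXk k).sub (((continuous_apply j).tendsto _).comp hxhlim)
  have hCk' : Filter.Tendsto Ck l (nhds fun k => d.v1 (sec k) - d.c * prim d.mu (d.aa 0 k) (d.bb 0 X0 y0 k) (y0 (sec k))) := by
    rw [tendsto_pi_nhds]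
    intro k
    exact tendsto_const_nhds.sub ((tendsto_prim _ (haa k) (hbb k) (hyi _)).const_mul _)
  set Ck0 : K → ℂ := fun k => d.v1 (sec k) - d.c * prim d.mu (d.aa 0 k) (d.bb 0 X0 y0 k) (y0 (sec k))
  have hq : Filter.Tendsto (fun t => (X t, Cc t, y t, Ck t)) l (nhds (X0, C0, y0, Ck0)) :=
    hXlim.prodMk_nhds (hC0.prodMk_nhds (hy0.prodMk_nhds hCk'))
  have hPsi : ∀ᶠ t in l, d.Psi (t, X t, Cc t, y t, Ck t) = 0 := by
    filter_upwards [hwS, hxh, hpos] with t h1 h2 h3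
    obtain ⟨-, hsum, -, C', hC'⟩ := h1
    have hCC : Cc t = C' := by
      simp only [hCc]
      linear_combination - hC' i0
    have hval : ∀ i, Cc t + d.c * primX d.mu (w t) (w t i) - d.v t i = 0 := by
      intro i; rw [hCC]; linear_combination hC' i
    have hkey := fun i => d.key t (X t) (Cc t) (y t) (Ck t) i
    rw [h2] at hkey
    have g3 : ∀ k, (d.Psi (t, X t, Cc t, y t, Ck t)).2.2.1 (sec k) = 0 := by
      intro k
      simp only [Psi, hCk, hsec]
      ring
    have g1 : ∀ k, (d.Psi (t, X t, Cc t, y t, Ck t)).1 k = 0 := by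
      intro k
      have := hkey (sec k)
      rw [hval, g3, hsec] at this
      simpa using this.symm
    have ht : (t:ℂ) ^ d.M ≠ 0 := pow_ne_zero _ (by exact_mod_cast h3.ne')
    have g3' : ∀ i, (d.Psi (t, X t, Cc t, y t, Ck t)).2.2.1 i = 0 := by
      intro i
      have := hkey i
      rw [hval, g1, zero_add] at this
      exact (mul_eq_zero.1 this.symm).resolve_left ht
    have hwm : ∀ k, ∑ i ∈ d.fib k, (d.mu i : ℂ) * (w t i - X t k) = 0 := fun k => wmean_spec d.mu d.hmu _ (d.fib_nonempty k) (w t)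
    have g2 : (d.Psi (t, X t, Cc t, y t, Ck t)).2.1 = 0 := by
      simp only [Psi]
      have : ∑ i, (d.mu i : ℂ) * (w t i - X t (d.pr i)) = 0 := by
        rw [← Finset.sum_fiberwise Finset.univ d.pr]
        refine Finset.sum_eq_zero fun k _ => ?_
        rw [← hwm k]
        refine Finset.sum_congr rfl fun i hi => ?_
        rw [(Finset.mem_filter.1 hi).2]
      simp only [mul_sub, Finset.sum_sub_distrib, hsum] at this
      simpa using this
    have g4 : ∀ k, (d.Psi (t, X t, Cc t, y t, Ck t)).2.2.2 k = 0 := by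
      intro k
      simp only [Psi]
      have : ∑ i ∈ d.fib k, (d.mu i : ℂ) * y t i = (∑ i ∈ d.fib k, (d.mu i : ℂ) * (w t i - X t k)) / (t:ℂ) ^ d.p k := by
        rw [Finset.sum_div]
        refine Finset.sum_congr rfl fun i hi => ?_
        simp only [hy]
        rw [(d.mem_fib k i).1 hi]; ring
      rw [this, hwm, zero_div]
    exact Prod.ext (funext g1) (Prod.ext g2 (Prod.ext (funext g3') (funext g4)))
  have hPsi0 : d.Psi (0, X0, C0, y0, Ck0) = 0 := by
    have h1 : Filter.Tendsto (fun t => d.Psi (t, X t, Cc t, y t, Ck t)) l (nhds (d.Psi (0, X0, C0, y0, Ck0))) :=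
      (d.contDiff_Psi.continuous.tendsto _).comp (ht0.prodMk_nhds hq)
    exact tendsto_nhds_unique_of_eventuallyEq h1 tendsto_const_nhds hPsi
  refine ⟨(X0, C0, y0, Ck0), ⟨hX0B, hX0inj, hPsi0, ?_, ?_⟩, fun t => (X t, Cc t, y t, Ck t), hq, hPsi.and hxh⟩
  · -- no collisions
    intro a b hab hyab
    simp only at hyab
    set S : Finset ι := Finset.univ.filter fun i => d.pr i = d.pr a ∧ y0 i = y0 a with hS
    have hSm : ∀ i, i ∈ S ↔ d.pr i = d.pr a ∧ y0 i = y0 a := by intro i; simp [hS]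
    have hSne : S.Nonempty := ⟨a, (hSm a).2 ⟨rfl, rfl⟩⟩
    set k := d.pr a with hk
    -- normalized mean
    have hv1 : ∀ i ∈ S, d.v1 i = d.v1 a := by
      intro i hi
      obtain ⟨h1, h2⟩ := (hSm i).1 hi
      have g := congrFun (congrArg (fun q : GE ι K => q.2.2.1) hPsi0) i
      have g' := congrFun (congrArg (fun q : GE ι K => q.2.2.1) hPsi0) a
      simp only [Psi, Prod.snd_zero, Prod.fst_zero, Pi.zero_apply] at g g'
      rw [h1, h2] at g
      have : (d.v1 i : ℂ) = d.v1 a := by linear_combination g' - g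
      exact_mod_cast this
    have hm : Filter.Tendsto (fun t => wmean d.mu S (y t)) l (nhds (y0 a)) := by
      have := tendsto_wmean d.mu S hy0
      rwa [wmean_const d.mu d.hmu S hSne y0 (y0 a) fun i hi => ((hSm i).1 hi).2] at this
    have hyr : Filter.Tendsto (fun t => ‖yraw S (y t) (wmean d.mu S (y t))‖) l (nhds 0) :=
      tendsto_yraw S hy0 hm fun i hi => ((hSm i).1 hi).2
    have hrel : ∀ᶠ t in l, (∀ i, d.pr i = k → w t i = X t k + (t:ℂ) ^ d.p k * y t i) ∧
        wmean d.mu S (w t) = X t k + (t:ℂ) ^ d.p k * wmean d.mu S (y t) := by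
      filter_upwards [hxh] with t ht
      have h1 : ∀ i, d.pr i = k → w t i = X t k + (t:ℂ) ^ d.p k * y t i := by
        intro i hi
        rw [← ht]; unfold xh; rw [hi]
      refine ⟨h1, ?_⟩
      refine (wmean_unique d.mu d.hmu S hSne (w t) _ ?_).symm
      have h2 := wmean_spec d.mu d.hmu S hSne (y t)
      have : ∑ i ∈ S, (d.mu i : ℂ) * (w t i - (X t k + (t:ℂ) ^ d.p k * wmean d.mu S (y t))) = (t:ℂ) ^ d.p k * ∑ i ∈ S, (d.mu i : ℂ) * (y t i - wmean d.mu S (y t)) := by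
        rw [Finset.mul_sum]
        refine Finset.sum_congr rfl fun i hi => ?_
        rw [h1 i ((hSm i).1 hi).1]; ring
      rw [this, h2, mul_zero]
    have hyw : ∀ᶠ t in l, yraw S (w t) (wmean d.mu S (w t)) = ((t:ℂ) ^ d.p k) • yraw S (y t) (wmean d.mu S (y t)) := by
      filter_upwards [hrel] with t ⟨h1, h2⟩
      funext i
      simp only [yraw, Pi.smul_apply, smul_eq_mul]
      split_ifs with hi
      · rw [h1 i ((hSm i).1 hi).1, h2]; ring
      · simp
    have hw0 : Filter.Tendsto (fun t => wmean d.mu S (w t)) l (nhds (X0 k)) := by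
      have := tendsto_wmean d.mu S hx0
      rwa [wmean_const d.mu d.hmu S hSne x0 (X0 k) fun i hi => (hx0f k i).1 ((d.mem_fib k i).2 ((hSm i).1 hi).1)] at this
    have hbe := blow_equal l d.mu d.hmu S hSne w (fun t => wmean d.mu S (w t)) (fun t => wmean_spec d.mu d.hmu S hSne (w t)) (by
      intro i hi
      by_cases hik : d.pr i = k
      · have hne : y0 a - y0 i ≠ 0 := sub_ne_zero.2 fun h => hi ((hSm i).2 ⟨hik, h.symm⟩)
        have hlim : Filter.Tendsto (fun t => wmean d.mu S (y t) - y t i) l (nhds (y0 a - y0 i)) := hm.sub (hyi i)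
        have hdiff : ∀ᶠ t in l, wmean d.mu S (w t) - w t i = (t:ℂ) ^ d.p k * (wmean d.mu S (y t) - y t i) := by
          filter_upwards [hrel] with t ⟨h1, h2⟩
          rw [h1 i hik, h2]; ring
        constructor
        · filter_upwards [hdiff, hlim.eventually_ne hne, hpos] with t h1 h2 h3
          rw [h1]
          exact mul_ne_zero (pow_ne_zero _ (by exact_mod_cast h3.ne')) h2
        · have h5 : Filter.Tendsto (fun t => ‖yraw S (y t) (wmean d.mu S (y t))‖ / ‖wmean d.mu S (y t) - y t i‖) l (nhds (0 / ‖y0 a - y0 i‖)) :=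
            hyr.div hlim.norm (norm_ne_zero_iff.2 hne)
          rw [zero_div] at h5
          refine h5.congr' ?_
          filter_upwards [hdiff, hyw, hpos] with t h1 h2 h3
          rw [h1, h2, norm_smul, norm_mul]
          have : ‖(t:ℂ) ^ d.p k‖ ≠ 0 := norm_ne_zero_iff.2 (pow_ne_zero _ (by exact_mod_cast h3.ne'))
          rw [mul_div_mul_left _ _ this]
      · have hne : X0 k - x0 i ≠ 0 := sub_ne_zero.2 fun h => hik ((d.mem_fib k i).1 ((hx0f k i).2 h.symm))
        have hlim : Filter.Tendsto (fun t => wmean d.mu S (w t) - w t i) l (nhds (X0 k - x0 i)) := hw0.sub (((continuous_apply i).tendsto _).comp hx0)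
        refine ⟨hlim.eventually_ne hne, ?_⟩
        have h6 := tendsto_yraw S hx0 hw0 fun i hi => (hx0f k i).1 ((d.mem_fib k i).2 ((hSm i).1 hi).1)
        have h5 := h6.div hlim.norm (norm_ne_zero_iff.2 hne)
        rwa [zero_div] at h5)
      (by
        filter_upwards [hwS] with t h1 i hi j hj
        obtain ⟨-, -, -, C', hC'⟩ := h1
        have hc' : (d.c : ℂ) ≠ 0 := by exact_mod_cast d.hc
        have hvv : d.v t i = d.v t j := by
          unfold v
          rw [((hSm i).1 hi).1, ((hSm j).1 hj).1, hv1 i hi, hv1 j hj]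
        have e := hC' i
        rw [hvv, ← hC' j] at e
        exact mul_left_cancel₀ hc' (add_left_cancel e))
    obtain ⟨t, h1, h2⟩ := (hbe.and hwS).exists
    have hi : w t a = wmean d.mu S (w t) := by
      have := congrFun h1 a
      simp only [yraw, (hSm a).2 ⟨rfl, rfl⟩, if_true] at this
      exact sub_eq_zero.1 this
    have hj : w t b = wmean d.mu S (w t) := by
      have := congrFun h1 b
      simp only [yraw, (hSm b).2 ⟨hab.symm, hyab.symm⟩, if_true] at this
      exact sub_eq_zero.1 this
    exact h2.1 (hi.trans hj.symm)
  · -- symmetry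
    obtain ⟨σ, hσ⟩ := ultra_const l (fun t (σ : Equiv.Perm ι) => (∀ i, d.mu (σ i) = d.mu i) ∧ (∀ i, d.v t (σ i) = d.v t i) ∧
      ∀ i, w t (σ i) = (starRingEnd ℂ) (w t i)) (hwS.mono fun t h => h.2.2.1)
    have hwi : ∀ i, Filter.Tendsto (fun t => w t i) l (nhds (x0 i)) := fun i => ((continuous_apply i).tendsto _).comp hx0
    have s4 : ∀ i, X0 (d.pr (σ i)) = (starRingEnd ℂ) (X0 (d.pr i)) := by
      intro i
      have h1 := hwi (σ i)
      have h2 := (Complex.continuous_conj.tendsto _).comp (hwi i)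
      rw [hx0X] at h1 h2
      exact tendsto_nhds_unique_of_eventuallyEq h1 h2 (hσ.mono fun t h => h.2.2 i)
    have s1 : ∀ i, d.mu (σ i) = d.mu i := by
      obtain ⟨t, ht⟩ := hσ.exists
      exact ht.1
    have s2 : ∀ i, d.vb (d.pr (σ i)) = d.vb (d.pr i) := by
      intro i
      have hv : ∀ i, Filter.Tendsto (fun t => d.v t i) l (nhds (d.vb (d.pr i))) := by
        intro i
        have := (tendsto_const_nhds (x := d.vb (d.pr i))).add (((continuous_pow d.M).tendsto _ |>.comp ht0).mul (tendsto_const_nhds (x := d.v1 i)))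
        simp only [zero_pow d.M_pos, zero_mul, add_zero] at this
        exact this
      exact tendsto_nhds_unique_of_eventuallyEq (hv (σ i)) (hv i) (hσ.mono fun t h => h.2.1 i)
    have s3 : ∀ i, d.v1 (σ i) = d.v1 i := by
      intro i
      obtain ⟨t, ht, hp⟩ := (hσ.and hpos).exists
      have := ht.2.1 i
      unfold v at this
      rw [s2] at this
      exact mul_left_cancel₀ (pow_pos hp d.M).ne' (add_left_cancel this)
    obtain ⟨ρ, hρ⟩ := d.exists_rho X0 hX0inj σ s4
    have hsym : d.Sym σ ρ := ⟨hρ, s1, fun k => by obtain ⟨i, rfl⟩ := d.surj k; rw [← hρ, s2], s3⟩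
    refine ⟨σ, s1, s2, s3, s4, fun i => ?_⟩
    refine tendsto_nhds_unique_of_eventuallyEq (hyi (σ i)) ((Complex.continuous_conj.tendsto _).comp (hyi i)) ?_
    filter_upwards [hσ] with t ht
    have hXc : X t (ρ (d.pr i)) = (starRingEnd ℂ) (X t (d.pr i)) := by
      simp only [hX]
      unfold wmean
      rw [hsym.sum_fib, hsym.sum_fib]
      simp only [s1, ht.2.2, map_div₀, map_sum, map_mul, map_natCast]
    simp only [hy, Function.comp]
    rw [hρ, ht.2.2, hXc, hsym.p]
    simp

/-- general degeneration theorem -/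
theorem main (B : Set (K → ℂ)) (P : Set (ι → ℂ)) (e : ι → ι → ℕ)
    (hB : ∀ X ∈ B, Function.Injective X) (hP : ∀ X ∈ B, P ∈ nhds (X ∘ d.pr))
    (hcl : ∀ (l : Ultrafilter ℝ), (l : Filter ℝ) ≤ nhdsWithin 0 (Set.Ioi 0) → ∀ (x : ℝ → ι → ℂ) (x0 : ι → ℂ),
      (∀ᶠ t in l, x t ∈ Sol d.c d.mu (d.v t) ∧ x t ∈ P) → Filter.Tendsto x l (nhds x0) → ∃ X ∈ B, x0 = X ∘ d.pr)
    (hfin : (d.Z0 B).Finite) :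
    ∀ᶠ t in nhdsWithin (0:ℝ) (Set.Ioi 0), ({x | x ∈ Sol d.c d.mu (d.v t) ∧ x ∈ P}).Finite ∧
      ∑ᶠ x ∈ {x | x ∈ Sol d.c d.mu (d.v t) ∧ x ∈ P}, sgn e x = ∑ᶠ q ∈ d.Z0 B, d.sgn0 e q :=
  count_lemma d.Psi d.contDiff_Psi 0 (Set.Ioi 0) (fun t q => d.xh t q.1 q.2.2.1) (d.Z0 B) hfin (fun q hq => hq.2.2.1)
    (fun t => {x | x ∈ Sol d.c d.mu (d.v t) ∧ x ∈ P}) (fun _ x => sgn e x) (d.sgn0 e)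
    (fun q hq δ h => d.H1 q.1 q.2.1 q.2.2.1 q.2.2.2 hq.2.1 hq.2.2.2.1 δ h)
    (fun l hl w hw => d.H2 B P hB hcl l hl w hw)
    (fun q hq => d.H3 B P hP e q hq)
    (fun t ht c c' h h' hx => d.H4 t ht c c' h h' hx)

end GDat
end

noncomputable section
set_option linter.unusedSectionVars false
set_option linter.unusedVariables false
set_option linter.unusedSimpArgs false

section solfin
variable {ι : Type*} [Fintype ι]

lemma primX_eq_antider (μ : ι → ℕ) (x : ι → ℂ) (z : ℂ) :
    primX μ x z = (antider (∏ i, (X - C (x i)) ^ μ i)).eval z := by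
  unfold primX prim
  rw [bp_one]

lemma tendsto_primX {T : Type*} {l : Filter T} (μ : ι → ℕ) {x : T → ι → ℂ} {x0 : ι → ℂ} (hx : Filter.Tendsto x l (nhds x0))
    {z : T → ℂ} {z0 : ℂ} (hz : Filter.Tendsto z l (nhds z0)) :
    Filter.Tendsto (fun t => primX μ (x t) (z t)) l (nhds (primX μ x0 z0)) := by
  unfold primX
  exact tendsto_prim _ tendsto_const_nhds (Filter.Tendsto.neg hx :) hz

/-- limits of solutions have the same critical values, hence the limit equation -/
lemma Sol.limit_eq {T : Type*} (l : Ultrafilter T) (μ : ι → ℕ) (c : ℝ)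
    (v : T → ι → ℝ) (v0 : ι → ℝ) (hv0 : Filter.Tendsto v l (nhds v0)) (x : T → ι → ℂ) (hx : ∀ᶠ t in l, x t ∈ Sol c μ (v t))
    (x0 : ι → ℂ) (hx0 : Filter.Tendsto x l (nhds x0)) :
    (∑ i, (μ i : ℂ) * x0 i = 0) ∧
    (∃ τ : Equiv.Perm ι, (∀ i, μ (τ i) = μ i) ∧ (∀ i, v0 (τ i) = v0 i) ∧ (∀ i, x0 (τ i) = (starRingEnd ℂ) (x0 i)) ∧
      ∀ᶠ t in l, ∀ i, v t (τ i) = v t i) ∧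
    ∃ C0 : ℂ, ∀ i, C0 + c * primX μ x0 (x0 i) = v0 i := by
  have hxi : ∀ i, Filter.Tendsto (fun t => x t i) l (nhds (x0 i)) := fun i => ((continuous_apply i).tendsto _).comp hx0
  have hvi : ∀ i, Filter.Tendsto (fun t => v t i) l (nhds (v0 i)) := fun i => ((continuous_apply i).tendsto _).comp hv0
  have hvc : ∀ i, Filter.Tendsto (fun t => (v t i : ℂ)) l (nhds (v0 i : ℂ)) := fun i => (Complex.continuous_ofReal.tendsto _).comp (hvi i)
  have hpi : ∀ i, Filter.Tendsto (fun t => (c:ℂ) * primX μ (x t) (x t i)) l (nhds (c * primX μ x0 (x0 i))) :=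
    fun i => (tendsto_primX μ hx0 (hxi i)).const_mul _
  refine ⟨?_, ?_, ?_⟩
  · have h1 : Filter.Tendsto (fun t => ∑ i, (μ i : ℂ) * x t i) l (nhds (∑ i, (μ i : ℂ) * x0 i)) :=
      tendsto_finsetSum _ fun i _ => (hxi i).const_mul _
    exact tendsto_nhds_unique_of_eventuallyEq h1 tendsto_const_nhds (hx.mono fun t h => h.2.1)
  · obtain ⟨σ, hσ⟩ := GDat.ultra_const l (fun t (σ : Equiv.Perm ι) => (∀ i, μ (σ i) = μ i) ∧ (∀ i, v t (σ i) = v t i) ∧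
      ∀ i, x t (σ i) = (starRingEnd ℂ) (x t i)) (hx.mono fun t h => h.2.2.1)
    refine ⟨σ, ?_, fun i => ?_, fun i => ?_, hσ.mono fun t h => h.2.1⟩
    · obtain ⟨t, ht⟩ := hσ.exists
      exact ht.1
    · exact tendsto_nhds_unique_of_eventuallyEq (hvi (σ i)) (hvi i) (hσ.mono fun t h => h.2.1 i)
    · exact tendsto_nhds_unique_of_eventuallyEq (hxi (σ i)) ((Complex.continuous_conj.tendsto _).comp (hxi i)) (hσ.mono fun t h => h.2.2 i)
  · rcases isEmpty_or_nonempty ι with hι | hι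
    · exact ⟨0, fun i => hι.elim i⟩
    obtain ⟨i0⟩ := hι
    refine ⟨v0 i0 - c * primX μ x0 (x0 i0), fun i => ?_⟩
    have h1 := ((hvc i0).sub (hpi i0)).add (hpi i)
    refine tendsto_nhds_unique_of_eventuallyEq h1 (hvc i) (hx.mono fun t h => ?_)
    obtain ⟨C0, hC⟩ := h.2.2.2
    simp only
    rw [← hC i, ← hC i0]; ring

lemma Sol.limit {T : Type*} (l : Ultrafilter T) (μ : ι → ℕ) (hμ : ∀ i, 1 ≤ μ i) (c : ℝ) (hc : c ≠ 0)
    (v : T → ι → ℝ) (v0 : ι → ℝ) (hv0 : Filter.Tendsto v l (nhds v0)) (x : T → ι → ℂ) (hx : ∀ᶠ t in l, x t ∈ Sol c μ (v t))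
    (hv : ∀ i j, v0 i = v0 j → ∀ᶠ t in l, v t i = v t j) :
    ∃ x0 ∈ Sol c μ v0, Filter.Tendsto x l (nhds x0) := by
  obtain ⟨x0, hx0⟩ := Sol.bounded l μ hμ c hc v (‖v0‖ + 1) (by
    have := (continuous_norm.tendsto v0).comp hv0
    exact this.eventually (eventually_le_nhds (by linarith))) x hx
  obtain ⟨h1, ⟨τ, t1, t2, t3, -⟩, C0, hC⟩ := Sol.limit_eq l μ c v v0 hv0 x hx x0 hx0
  refine ⟨x0, ⟨?_, h1, ⟨τ, t1, t2, t3⟩, C0, hC⟩, hx0⟩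
  refine no_collision l μ hμ c hc v x hx x0 hx0 fun i j hij => hv i j ?_
  have := hC i
  rw [hij, hC j] at this
  exact_mod_cast this.symm

lemma Sol.finite (μ : ι → ℕ) (hμ : ∀ i, 1 ≤ μ i) (c : ℝ) (hc : c ≠ 0) (v : ι → ℝ) : (Sol c μ v).Finite := by
  rcases isEmpty_or_nonempty ι with hι | hι
  · exact Set.toFinite _
  have hne : (Finset.univ : Finset ι).Nonempty := Finset.univ_nonempty
  have i0 := hι.some
  set Ψ : (ι → ℂ) × ℂ → (ι → ℂ) × ℂ := fun q => (fun i => q.2 + c * primX μ q.1 (q.1 i) - v i, ∑ i, (μ i : ℂ) * q.1 i) with hΨ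
  set Z : Set ((ι → ℂ) × ℂ) := {q | q.1 ∈ Sol c μ v ∧ ∀ i, q.2 + c * primX μ q.1 (q.1 i) = v i} with hZ
  have hZfin : Z.Finite := by
    refine finite_lemma Ψ ?_ Z ?_ ?_ ?_
    · have hX : ContDiff ℝ 1 (fun q : (ι → ℂ) × ℂ => q.1) := contDiff_fst
      refine ContDiff.prodMk ?_ ?_
      · rw [contDiff_pi]
        intro i
        refine (contDiff_snd.add (contDiff_const.mul ?_)).sub contDiff_const
        refine ContDiff.prim' _ contDiff_const ?_ (GDat.contDiff_coord hX i)
        rw [contDiff_pi]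
        intro j
        exact (GDat.contDiff_coord hX j).neg
      · exact ContDiff.sum fun i _ => contDiff_const.mul (GDat.contDiff_coord hX _)
    · intro q hq
      refine Prod.ext ?_ hq.1.2.1
      funext i
      simp only [hΨ, hq.2 i, sub_self]; rfl
    · rintro ⟨x, C0⟩ hq ⟨dx, dC⟩ h
      have h1 : ∀ i, HasDerivAt (fun s : ℝ => (Ψ ((x, C0) + s • (dx, dC))).1 i) 0 0 := fun i => (hasDerivAt_pi.1 h.fst) i
      have h2 : HasDerivAt (fun s : ℝ => (Ψ ((x, C0) + s • (dx, dC))).2) 0 0 := h.snd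
      simp only [hΨ, Prod.fst_add, Prod.snd_add, Prod.smul_fst, Prod.smul_snd, Pi.add_apply, Pi.smul_apply, Complex.real_smul, smul_eq_mul] at h1 h2
      have hs : HasDerivAt (fun s : ℝ => (s:ℂ)) 1 0 := by
        simpa using (hasDerivAt_id (0:ℝ)).ofReal_comp
      have e2 : ∑ i, (μ i : ℂ) * dx i = 0 := by
        have : HasDerivAt (fun s : ℝ => ∑ i, (μ i : ℂ) * (x i + s * dx i)) (∑ i, (μ i : ℂ) * dx i) 0 := by
          refine HasDerivAt.fun_sum fun i _ => ?_
          have := ((hs.mul_const (dx i)).const_add (x i)).const_mul (μ i : ℂ)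
          simpa using this
        exact this.unique h2
      obtain ⟨f1, f2⟩ := jac_lemma Finset.univ hne μ x dx (fun i _ => hμ i) hq.1.1.injOn (c:ℂ) (by exact_mod_cast hc) C0 dC e2 (by
        intro i _
        have := (h1 i).add_const (v i : ℂ)
        refine this.congr_of_eventuallyEq (Filter.Eventually.of_forall fun s => ?_)
        simp only [primX_eq_antider, Pi.add_apply, Pi.smul_apply, Complex.real_smul]
        ring)
      exact Prod.ext (funext fun i => f1 i (Finset.mem_univ i)) f2
    · intro l hl
      have hl' : ∀ᶠ q in l, q ∈ Z := hl
      obtain ⟨x0, hx0, hlim⟩ := Sol.limit l μ hμ c hc (fun _ => v) v tendsto_const_nhds (fun q => q.1) (hl'.mono fun q h => h.1)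
        (fun i j h => Filter.Eventually.of_forall fun _ => h)
      obtain ⟨C0, hC0⟩ := hx0.2.2.2
      refine ⟨(x0, C0), ⟨hx0, hC0⟩, ?_⟩
      have h2 : Filter.Tendsto (fun q : (ι → ℂ) × ℂ => q.2) l (nhds C0) := by
        have h3 : Filter.Tendsto (fun q : (ι → ℂ) × ℂ => (v i0 : ℂ) - c * primX μ q.1 (q.1 i0)) l (nhds (v i0 - c * primX μ x0 (x0 i0))) :=
          tendsto_const_nhds.sub ((tendsto_primX μ hlim (((continuous_apply i0).tendsto _).comp hlim)).const_mul _)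
        have e3 : (v i0 : ℂ) - c * primX μ x0 (x0 i0) = C0 := by rw [← hC0 i0]; ring
        rw [e3] at h3
        refine h3.congr' (hl'.mono fun q h => ?_)
        simp only
        rw [← h.2 i0]; ring
      have := hlim.prodMk_nhds h2
      exact this
  refine (hZfin.image Prod.fst).subset fun x hx => ?_
  obtain ⟨C0, hC0⟩ := hx.2.2.2
  exact ⟨(x, C0), ⟨hx, hC0⟩, rfl⟩

/-- signed count -/
def NN (c : ℝ) (μ : ι → ℕ) (v : ι → ℝ) (e : ι → ι → ℕ) : ℤ := ∑ᶠ x ∈ Sol c μ v, sgn e x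

/-- degeneration data from a projection -/
def mkG {K : Type*} [Fintype K] [Nonempty K] (pr : ι → K) (hs : Function.Surjective pr) (μ : ι → ℕ) (hμ : ∀ i, 1 ≤ μ i) (c : ℝ) (hc : c ≠ 0)
    (vb : K → ℝ) (v1 : ι → ℝ) : GDat ι K where
  pr := pr
  mu := μ
  vb := vb
  v1 := v1
  c := c
  p k := ∏ k' ∈ Finset.univ.erase k, ((∑ i ∈ Finset.univ.filter (fun i => pr i = k'), μ i) + 1)
  M := ∏ k', ((∑ i ∈ Finset.univ.filter (fun i => pr i = k'), μ i) + 1)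
  hne := inferInstance
  surj := hs
  hmu := hμ
  hc := hc
  hp1 k := Nat.one_le_iff_ne_zero.2 (Finset.prod_ne_zero_iff.2 fun _ _ => by omega)
  hp k := by rw [mul_comm]; exact Finset.mul_prod_erase _ (fun k' => (∑ i ∈ Finset.univ.filter (fun i => pr i = k'), μ i) + 1) (Finset.mem_univ k)

lemma tendsto_root (M : ℕ) (hM : M ≠ 0) : Filter.Tendsto (fun s : ℝ => s ^ ((M:ℝ)⁻¹)) (nhdsWithin 0 (Set.Ioi 0)) (nhdsWithin 0 (Set.Ioi 0)) := by
  refine tendsto_nhdsWithin_iff.2 ⟨?_, ?_⟩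
  · have : ContinuousAt (fun s : ℝ => s ^ ((M:ℝ)⁻¹)) 0 := Real.continuousAt_rpow_const _ _ (Or.inr (by positivity))
    have h := this.tendsto
    rw [Real.zero_rpow (by positivity)] at h
    exact h.mono_left nhdsWithin_le_nhds
  · filter_upwards [self_mem_nhdsWithin] with s hs
    exact Real.rpow_pos_of_pos hs _

lemma NN_local (μ : ι → ℕ) (hμ : ∀ i, 1 ≤ μ i) (c : ℝ) (hc : c ≠ 0) (e : ι → ι → ℕ) (v w : ι → ℝ)
    (h : ∀ i j, v i = v j → w i = w j) :
    ∀ᶠ s in nhdsWithin (0:ℝ) (Set.Ioi 0), NN c μ (fun i => v i + s * w i) e = NN c μ v e := by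
  rcases isEmpty_or_nonempty ι with hι | hι
  · refine Filter.Eventually.of_forall fun s => ?_
    congr 1
    exact Subsingleton.elim _ _
  set d := mkG (id : ι → ι) Function.surjective_id μ hμ c hc v w with hd
  set B : Set (ι → ℂ) := {X | Function.Injective X} with hB
  have hfib : ∀ k, d.fib k = {k} := by intro k; ext i; simp [GDat.mem_fib, hd, mkG]
  have hpr : d.pr = id := rfl
  have hmu' : d.mu = μ := rfl
  -- description of Z0
  set F : (ι → ℂ) → GE ι ι := fun x => (x, v hι.some - c * primX μ x (x hι.some), 0,
    fun k => w k - c * prim μ (d.aa 0 k) (d.bb 0 x 0 k) 0) with hF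
  have hZ : d.Z0 B = F '' Sol c μ v := by
    ext q
    obtain ⟨x, C0, y, Ck⟩ := q
    constructor
    · rintro ⟨hqB, hinj, hPsi, -, σ, s1, s2, s3, s4, s5⟩
      have hy : y = 0 := by
        funext k
        have h4 : ∑ i ∈ d.fib k, (d.mu i : ℂ) * y i = 0 := congrFun (congrArg (fun q : GE ι ι => q.2.2.2) hPsi) k
        rw [hfib, Finset.sum_singleton] at h4
        rcases mul_eq_zero.1 h4 with h | h
        · have := hμ k
          have h' : μ k = 0 := by exact_mod_cast h
          omega
        · exact h
      subst hy
      have h1 : ∀ k, C0 + c * primX μ x (x k) = v k := by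
        intro k
        have h1 := congrFun (congrArg (fun q : GE ι ι => q.1) hPsi) k
        simp only [GDat.Psi, GDat.xh_zero, Prod.fst_zero, Pi.zero_apply, Complex.ofReal_zero, zero_pow d.M_pos, zero_mul, sub_zero] at h1
        exact sub_eq_zero.1 h1
      have h2 : ∑ i, (μ i : ℂ) * x i = 0 := congrArg (fun q : GE ι ι => q.2.1) hPsi
      refine ⟨x, ⟨hinj, h2, ⟨σ, s1, s2, s4⟩, C0, h1⟩, ?_⟩
      refine Prod.ext rfl (Prod.ext ?_ (Prod.ext rfl ?_))
      · simp only [hF]; rw [← h1 hι.some]; ring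
      · funext k
        have h3 := congrFun (congrArg (fun q : GE ι ι => q.2.2.1) hPsi) k
        simp only [GDat.Psi, Prod.snd_zero, Prod.fst_zero, Pi.zero_apply] at h3
        have h3' : Ck k + c * prim μ (d.aa 0 k) (d.bb 0 x 0 k) 0 - w k = 0 := h3
        simp only [hF]
        linear_combination -h3'
    · rintro ⟨x', hx', heq⟩
      obtain ⟨hinj, h2, ⟨σ, s1, s2, s4⟩, C0', h1⟩ := hx'
      have hC : v hι.some - c * primX μ x' (x' hι.some) = C0' := by rw [← h1]; ring
      simp only [hF, hC, Prod.mk.injEq] at heq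
      obtain ⟨rfl, rfl, rfl, rfl⟩ := heq
      refine ⟨hinj, hinj, ?_, fun i j hij _ => hij, σ, s1, s2, fun i => h _ _ (s2 i), s4, fun i => by simp⟩
      refine Prod.ext ?_ (Prod.ext h2 (Prod.ext ?_ ?_))
      · funext k
        simp only [GDat.Psi, GDat.xh_zero, Prod.fst_zero, Pi.zero_apply, Complex.ofReal_zero, zero_pow d.M_pos, zero_mul, sub_zero]
        exact sub_eq_zero.2 (h1 k)
      · funext k
        simp only [GDat.Psi, Prod.snd_zero, Prod.fst_zero, Pi.zero_apply]
        simp [hd, mkG]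
      · funext k
        simp only [GDat.Psi, Prod.snd_zero, Prod.fst_zero, Pi.zero_apply]
        simp
  have hFinj : Set.InjOn F (Sol c μ v) := fun a _ b _ hab => congrArg (fun q : GE ι ι => q.1) hab
  have hmain := d.main B Set.univ e (fun X hX => hX) (fun X _ => Filter.univ_mem) (by
    intro l hl x x0 hx hx0
    refine ⟨x0, ?_, rfl⟩
    have ht0 : Filter.Tendsto (fun t : ℝ => t) l (nhds 0) := (hl.trans nhdsWithin_le_nhds)
    have hv : Filter.Tendsto d.v l (nhds v) := by
      rw [tendsto_pi_nhds]; intro i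
      have := (tendsto_const_nhds (x := d.vb (d.pr i))).add (((continuous_pow d.M).tendsto _ |>.comp ht0).mul (tendsto_const_nhds (x := d.v1 i)))
      simp only [zero_pow d.M_pos, zero_mul, add_zero] at this
      exact this
    obtain ⟨x1, hx1, hlim⟩ := Sol.limit l μ hμ c hc d.v v hv x (hx.mono fun t h => h.1) (fun i j hij => Filter.Eventually.of_forall fun t => by
      simp only [GDat.v]
      show v i + t ^ d.M * w i = v j + t ^ d.M * w j
      rw [hij, h i j hij])
    rw [tendsto_nhds_unique hx0 hlim]
    exact hx1.1) (by rw [hZ]; exact (Sol.finite μ hμ c hc v).image _)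
  have hrhs : ∑ᶠ q ∈ d.Z0 B, d.sgn0 e q = NN c μ v e := by
    rw [hZ, finsum_mem_image hFinj]
    unfold NN
    refine finsum_mem_congr rfl fun x hx => ?_
    unfold GDat.sgn0 sgn
    refine Finset.prod_congr rfl fun i _ => Finset.prod_congr rfl fun j _ => ?_
    simp [hF, hpr]
  rw [hrhs] at hmain
  filter_upwards [(tendsto_root d.M d.M_pos).eventually hmain, self_mem_nhdsWithin] with s hs hs0
  rw [← hs.2]
  unfold NN
  have : d.v (s ^ ((d.M:ℝ)⁻¹)) = fun i => v i + s * w i := by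
    funext i
    unfold GDat.v
    rw [Real.rpow_inv_natCast_pow (le_of_lt hs0) d.M_pos]
    rfl
  rw [this]
  simp only [Set.mem_univ, and_true]
  rfl

/-- the count only depends on the order type of the values -/
theorem NN_order (μ : ι → ℕ) (hμ : ∀ i, 1 ≤ μ i) (c : ℝ) (hc : c ≠ 0) (e : ι → ι → ℕ) (v0 v1 : ι → ℝ)
    (h : ∀ i j, v0 i < v0 j ↔ v1 i < v1 j) : NN c μ v0 e = NN c μ v1 e := by
  set g : ℝ → ℤ := fun s => NN c μ (fun i => v0 i + s * (v1 i - v0 i)) e with hg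
  have heq : ∀ s ∈ Set.Icc (0:ℝ) 1, ∀ i j, v0 i + s * (v1 i - v0 i) = v0 j + s * (v1 j - v0 j) → v1 i - v0 i = v1 j - v0 j := by
    intro s hs i j hij
    rcases lt_trichotomy (v0 i) (v0 j) with h1 | h1 | h1
    · have h2 := (h i j).1 h1
      exfalso
      rcases eq_or_lt_of_le hs.1 with h3 | h3
      · rw [← h3] at hij; linarith
      · nlinarith [mul_pos h3 (sub_pos.2 h2), mul_nonneg (sub_nonneg.2 hs.2) (sub_pos.2 h1).le]
    · have h2 : v1 i = v1 j := by
        rcases lt_trichotomy (v1 i) (v1 j) with h2 | h2 | h2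
        · exact absurd ((h i j).2 h2) (by simp [h1])
        · exact h2
        · exact absurd ((h j i).2 h2) (by simp [h1])
      rw [h1, h2]
    · have h2 := (h j i).1 h1
      exfalso
      rcases eq_or_lt_of_le hs.1 with h3 | h3
      · rw [← h3] at hij; linarith
      · nlinarith [mul_pos h3 (sub_pos.2 h2), mul_nonneg (sub_nonneg.2 hs.2) (sub_pos.2 h1).le]
  have hcont : ContinuousOn g (Set.Icc 0 1) := by
    intro s hs
    refine ContinuousAt.continuousWithinAt ?_
    refine (Filter.EventuallyEq.tendsto (?_ : g =ᶠ[nhds s] fun _ => g s))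
    have h1 := NN_local μ hμ c hc e (fun i => v0 i + s * (v1 i - v0 i)) (fun i => v1 i - v0 i) (heq s hs)
    have h2 := NN_local μ hμ c hc e (fun i => v0 i + s * (v1 i - v0 i)) (fun i => -(v1 i - v0 i)) (fun i j hij => by rw [heq s hs i j hij])
    rw [eventually_nhdsWithin_iff, Metric.eventually_nhds_iff] at h1 h2
    obtain ⟨δ1, hδ1, h1⟩ := h1
    obtain ⟨δ2, hδ2, h2⟩ := h2
    refine Metric.eventually_nhds_iff.2 ⟨min δ1 δ2, lt_min hδ1 hδ2, fun s' hs' => ?_⟩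
    rw [Real.dist_eq] at hs'
    rcases lt_trichotomy s s' with h3 | h3 | h3
    · have := h1 (y := s' - s) (by rw [Real.dist_eq, sub_zero]; exact hs'.trans_le (min_le_left _ _)) (sub_pos.2 h3)
      simp only [hg]
      rw [← this]
      congr 1; funext i; ring
    · rw [h3]
    · have := h2 (y := s - s') (by rw [Real.dist_eq, sub_zero, abs_sub_comm]; exact hs'.trans_le (min_le_right _ _)) (sub_pos.2 h3)
      simp only [hg]
      rw [← this]
      congr 1; funext i; ring
  have := isPreconnected_Icc.constant hcont (x := 0) (y := 1) (by simp) (by simp)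
  simp only [hg] at this
  convert this using 2
  · funext i; ring
  · funext i; ring

end solfin
end

noncomputable section
set_option linter.unusedSectionVars false
set_option linter.unusedVariables false
set_option linter.unusedSimpArgs false

lemma mult_lemma2 {κ : Type*} (S : Finset κ) (μ : κ → ℕ) (y : κ → ℂ) (R : ℂ[X]) (hR : R ≠ 0)
    (G : ℂ[X]) (hG : derivative G = R * ∏ i ∈ S, (X - C (y i)) ^ μ i)
    (h0 : ∀ i ∈ S, G.eval (y i) = 0) :
    ∃ Q : ℂ[X], G = (∏ i ∈ S, (X - C (y i)) ^ μ i) * Q ∧ ∀ i ∈ S, Q.eval (y i) = 0 := by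
  set W := ∏ i ∈ S, (X - C (y i)) ^ μ i with hW
  have hWm : W.Monic := Polynomial.monic_prod_of_monic _ _ fun i _ => (Polynomial.monic_X_sub_C _).pow _
  have hW0 : W ≠ 0 := hWm.ne_zero
  have hG0 : G ≠ 0 := by
    rintro rfl
    simp at hG
    rcases hG with h | h
    · exact hR h
    · exact hW0 h
  have hm : ∀ i ∈ S, W.rootMultiplicity (y i) + 1 ≤ G.rootMultiplicity (y i) := by
    intro i hi
    have h1 := Polynomial.derivative_rootMultiplicity_of_root (p := G) (t := y i) (h0 i hi)
    rw [hG, Polynomial.rootMultiplicity_mul (mul_ne_zero hR hW0)] at h1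
    have h2 : 0 < G.rootMultiplicity (y i) := (Polynomial.rootMultiplicity_pos hG0).2 (h0 i hi)
    omega
  have hdvd : W ∣ G := by
    have hs : W.Splits := IsAlgClosed.splits W
    have hle : W.roots ≤ G.roots := by
      rw [Multiset.le_iff_count]
      intro z
      rw [Polynomial.count_roots, Polynomial.count_roots]
      by_cases hz : ∃ i ∈ S, y i = z
      · obtain ⟨i, hi, rfl⟩ := hz
        have := hm i hi
        omega
      · have : W.rootMultiplicity z = 0 := by
          rw [Polynomial.rootMultiplicity_eq_zero]
          rw [hW, Polynomial.IsRoot, Polynomial.eval_prod, Finset.prod_eq_zero_iff]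
          rintro ⟨i, hi, h⟩
          simp at h
          exact hz ⟨i, hi, by linear_combination - h.1⟩
        omega
    have h3 := (Multiset.prod_X_sub_C_dvd_iff_le_roots hG0 W.roots).2 hle
    have h4 : W = (W.roots.map fun a => X - C a).prod := by
      have := hs.eq_prod_roots
      rw [hWm.leadingCoeff, C_1, one_mul] at this
      exact this
    rw [h4]; exact h3
  obtain ⟨Q, hQ⟩ := hdvd
  refine ⟨Q, hQ, fun i hi => ?_⟩
  have hQ0 : Q ≠ 0 := by rintro rfl; simp at hQ; exact hG0 hQ
  have h5 := hm i hi
  rw [hQ, Polynomial.rootMultiplicity_mul (mul_ne_zero hW0 hQ0)] at h5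
  have : 0 < Q.rootMultiplicity (y i) := by omega
  exact (Polynomial.rootMultiplicity_pos hQ0).1 this

lemma derivative_two (α β k : ℂ) (p q : ℕ) :
    derivative (C k * (X - C α) ^ (p+1) * (X - C β) ^ (q+1)) =
      (C k * (X - C α) ^ p * (X - C β) ^ q) * ((p+1 : ℂ[X]) * (X - C β) + (q+1 : ℂ[X]) * (X - C α)) := by
  rw [derivative_mul, derivative_mul, derivative_C, derivative_pow, derivative_pow, derivative_X_sub_C, derivative_X_sub_C]
  simp only [Nat.add_sub_cancel]
  push_cast
  simp only [map_add, map_natCast, map_one]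
  ring

lemma two_root {κ : Type*} (S : Finset κ) (μ : κ → ℕ) (y : κ → ℂ) (c ξ : ℂ) (hc : c ≠ 0)
    (G : ℂ[X]) (hG : derivative G = (C c * (X - C ξ)) * ∏ i ∈ S, (X - C (y i)) ^ μ i)
    (h0 : ∀ i ∈ S, G.eval (y i) = 0) (hξ : G.eval ξ ≠ 0) :
    ∃ α β γ : ℂ, γ ≠ 0 ∧ (∀ i ∈ S, y i ≠ α → y i = β) ∧ ∃ p q : ℕ,
      p = ∑ i ∈ S.filter (fun i => y i = α), μ i ∧ q = ∑ i ∈ S.filter (fun i => y i ≠ α), μ i ∧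
      ξ = α + (p+1) * γ ∧ β = α + (p + q + 2) * γ ∧ G = C (c/(p+q+2)) * (X - C α) ^ (p+1) * (X - C β) ^ (q+1) := by
  have hR : C c * (X - C ξ) ≠ 0 := mul_ne_zero (C_ne_zero.2 hc) (X_sub_C_ne_zero _)
  obtain ⟨Q, hQ, hQ0⟩ := mult_lemma2 S μ y _ hR G hG h0
  set W := ∏ i ∈ S, (X - C (y i)) ^ μ i with hW
  have hWm : W.Monic := Polynomial.monic_prod_of_monic _ _ fun i _ => (Polynomial.monic_X_sub_C _).pow _
  have hWd : W.natDegree = ∑ i ∈ S, μ i := natDegree_prodS S μ y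
  set N := ∑ i ∈ S, μ i with hN
  have hdG : (derivative G).natDegree = N + 1 := by
    rw [hG, natDegree_mul hR hWm.ne_zero, natDegree_C_mul hc, natDegree_X_sub_C, hWd, add_comm]
  have hGd : G.natDegree = N + 2 := by
    have := Polynomial.natDegree_derivative G
    omega
  have hG0 : G ≠ 0 := by rintro rfl; simp at hGd
  have hQne : Q ≠ 0 := by rintro rfl; simp at hQ; exact hG0 hQ
  have hQd : Q.natDegree = 2 := by
    have : G.natDegree = W.natDegree + Q.natDegree := by rw [hQ]; exact natDegree_mul hWm.ne_zero hQne
    omega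
  have hcard : Q.roots.card = 2 := by
    rw [← hQd]; exact ((IsAlgClosed.splits Q).natDegree_eq_card_roots).symm
  obtain ⟨α, β, hαβ⟩ := Multiset.card_eq_two.1 hcard
  have hQs : Q = C Q.leadingCoeff * ((X - C α) * (X - C β)) := by
    have := (IsAlgClosed.splits Q).eq_prod_roots
    rw [hαβ] at this
    simpa using this
  set lq := Q.leadingCoeff with hlq
  have hlq0 : lq ≠ 0 := leadingCoeff_ne_zero.2 hQne
  have hyab : ∀ i ∈ S, y i ≠ α → y i = β := by
    intro i hi hne
    have := hQ0 i hi
    rw [hQs] at this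
    simp only [eval_mul, eval_C, eval_sub, eval_X, mul_eq_zero] at this
    rcases this with h | h | h
    · exact absurd h hlq0
    · exact absurd (sub_eq_zero.1 h) hne
    · exact sub_eq_zero.1 h
  set p := ∑ i ∈ S.filter (fun i => y i = α), μ i with hp
  set q := ∑ i ∈ S.filter (fun i => y i ≠ α), μ i with hq
  have hpq : p + q = N := Finset.sum_filter_add_sum_filter_not S _ μ
  have hWpq : W = (X - C α) ^ p * (X - C β) ^ q := by
    rw [hW, ← Finset.prod_filter_mul_prod_filter_not S (fun i => y i = α), hp, hq, ← Finset.prod_pow_eq_pow_sum, ← Finset.prod_pow_eq_pow_sum]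
    congr 1
    · exact Finset.prod_congr rfl fun i hi => by rw [(Finset.mem_filter.1 hi).2]
    · exact Finset.prod_congr rfl fun i hi => by rw [hyab i (Finset.mem_filter.1 hi).1 (Finset.mem_filter.1 hi).2]
  have hGpq : G = C lq * (X - C α) ^ (p+1) * (X - C β) ^ (q+1) := by
    rw [hQ, hQs, hWpq]; ring
  have hder := derivative_two α β lq p q
  rw [← hGpq, hG, hWpq] at hder
  have hcan : C c * (X - C ξ) = C lq * ((p+1 : ℂ[X]) * (X - C β) + (q+1 : ℂ[X]) * (X - C α)) := by
    have hne : (X - C α) ^ p * (X - C β) ^ q ≠ 0 := mul_ne_zero (pow_ne_zero _ (X_sub_C_ne_zero _)) (pow_ne_zero _ (X_sub_C_ne_zero _))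
    refine mul_right_cancel₀ hne ?_
    rw [hder]; ring
  have e0 := congrArg (eval 0) hcan
  have e1 := congrArg (eval 1) hcan
  simp at e0 e1
  have hc1 : c = lq * (p + q + 2) := by linear_combination e1 - e0
  have hn : ((p:ℂ) + q + 2) ≠ 0 := by exact_mod_cast (by omega : p + q + 2 ≠ 0)
  have hlq' : lq = c / (p+q+2) := by rw [hc1]; field_simp
  have hx : (p + q + 2) * ξ = (p+1) * β + (q+1) * α := by
    refine mul_left_cancel₀ hlq0 ?_
    linear_combination (-1) * e0 - ξ * hc1
  have hαβ' : α ≠ β := by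
    intro h
    have : ξ = α := by
      refine mul_left_cancel₀ hn ?_
      rw [hx, ← h]; ring
    apply hξ
    rw [hGpq, this]; simp
  refine ⟨α, β, (β - α)/(p+q+2), div_ne_zero (sub_ne_zero.2 hαβ'.symm) hn, hyab, p, q, rfl, rfl, ?_, ?_, ?_⟩
  · field_simp
    linear_combination hx
  · field_simp; ring
  · rw [← hlq']; exact hGpq

section nn
variable {ι κ : Type*} [Fintype ι] [Fintype κ]

lemma primX_relabel (μ : ι → ℕ) (x : ι → ℂ) (σ : κ ≃ ι) (z : ℂ) : primX (μ ∘ σ) (x ∘ σ) z = primX μ x z := by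
  unfold primX
  rw [← prim_relabel μ _ _ σ]
  rfl

lemma mem_Sol_relabel (c : ℝ) (μ : ι → ℕ) (v : ι → ℝ) (σ : κ ≃ ι) (x : ι → ℂ) :
    x ∘ σ ∈ Sol c (μ ∘ σ) (v ∘ σ) ↔ x ∈ Sol c μ v := by
  unfold Sol
  simp only [Set.mem_ofPred_eq]
  refine and_congr (σ.injective_comp x) (and_congr ?_ (and_congr ?_ ?_))
  · rw [← Equiv.sum_comp σ (fun i => (μ i : ℂ) * x i)]; rfl
  · constructor
    · rintro ⟨τ, t1, t2, t3⟩
      refine ⟨(σ.symm.trans τ).trans σ, fun i => ?_, fun i => ?_, fun i => ?_⟩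
      · simpa using t1 (σ.symm i)
      · simpa using t2 (σ.symm i)
      · simpa using t3 (σ.symm i)
    · rintro ⟨τ, t1, t2, t3⟩
      refine ⟨(σ.trans τ).trans σ.symm, fun i => ?_, fun i => ?_, fun i => ?_⟩
      · simpa using t1 (σ i)
      · simpa using t2 (σ i)
      · simpa using t3 (σ i)
  · refine exists_congr fun C0 => ?_
    simp only [primX_relabel, Function.comp]
    exact (Equiv.forall_congr_right (q := fun i => C0 + (c:ℂ) * primX μ x (x i) = v i) σ)

lemma sgn_relabel (e : ι → ι → ℕ) (x : ι → ℂ) (σ : κ ≃ ι) : sgn (fun i j => e (σ i) (σ j)) (x ∘ σ) = sgn e x := by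
  unfold sgn
  rw [← Equiv.prod_comp σ]
  refine Finset.prod_congr rfl fun i _ => ?_
  rw [← Equiv.prod_comp σ]
  rfl

lemma NN_relabel (c : ℝ) (μ : ι → ℕ) (v : ι → ℝ) (e : ι → ι → ℕ) (σ : κ ≃ ι) :
    NN c (fun i => μ (σ i)) (fun i => v (σ i)) (fun i j => e (σ i) (σ j)) = NN c μ v e := by
  unfold NN
  symm
  refine finsum_mem_eq_of_bijOn (fun x => x ∘ σ) ⟨fun x hx => (mem_Sol_relabel c μ v σ x).2 hx, ?_, ?_⟩ ?_
  · intro x _ y _ h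
    exact σ.surjective.injective_comp_right h
  · intro x hx
    refine ⟨x ∘ σ.symm, ?_, ?_⟩
    · rw [← mem_Sol_relabel c μ v σ]
      have : (x ∘ σ.symm) ∘ σ = x := by funext i; simp
      rw [this]; exact hx
    · funext i; simp
  · intro x hx
    exact (sgn_relabel e x σ).symm

lemma primX_scale (μ : ι → ℕ) (x : ι → ℂ) (a : ℂ) (z : ℂ) :
    primX μ (fun i => a * x i) (a * z) = a ^ ((∑ i, μ i) + 1) * primX μ x z := by
  rw [primX_eq_antider, primX_eq_antider]
  by_cases ha : a = 0
  · subst ha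
    rw [zero_mul, antider_eval_zero, zero_pow (by omega), zero_mul]
  set G := (antider (∏ i, (X - C (a * x i)) ^ μ i)).comp (C a * X) with hG
  set H := C (a ^ ((∑ i, μ i) + 1)) * antider (∏ i, (X - C (x i)) ^ μ i) with hH
  have hd : derivative G = derivative H := by
    rw [hG, derivative_comp, derivative_antider, hH, derivative_C_mul, derivative_C_mul, derivative_antider]
    simp only [derivative_mul, derivative_C, derivative_X, zero_mul, zero_add, mul_one, prod_comp, pow_comp, sub_comp, X_comp, C_comp]
    rw [pow_succ, C_mul, ← Finset.prod_pow_eq_pow_sum]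
    have : ∀ i, (C a * X - C (a * x i)) ^ μ i = C a ^ μ i * (X - C (x i)) ^ μ i := by
      intro i; rw [← mul_pow, C_mul]; ring
    simp only [this, Finset.prod_mul_distrib]
    rw [map_prod]
    simp only [map_pow]
    ring
  have := eval_sub_eq_of_derivative_eq hd z 0
  simp only [hG, hH, eval_comp, eval_mul, eval_C, eval_X, mul_zero, antider_eval_zero, sub_zero] at this
  exact this

lemma NN_scale (c : ℝ) (μ : ι → ℕ) (v : ι → ℝ) (e : ι → ι → ℕ) (a : ℝ) (ha : 0 < a) :
    NN (c * a ^ ((∑ i, μ i) + 1)) μ v e = NN c μ v e := by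
  have hac : (a:ℂ) ≠ 0 := by exact_mod_cast ha.ne'
  have key : ∀ x : ι → ℂ, (fun i => (a:ℂ) * x i) ∈ Sol c μ v ↔ x ∈ Sol (c * a ^ ((∑ i, μ i) + 1)) μ v := by
    intro x
    unfold Sol
    simp only [Set.mem_ofPred_eq]
    refine and_congr ?_ (and_congr ?_ (and_congr ?_ ?_))
    · constructor
      · intro h i j hij
        exact h (by simp only [hij])
      · intro h i j hij
        exact h (mul_left_cancel₀ hac hij)
    · have : ∑ i, (μ i : ℂ) * (a * x i) = a * ∑ i, (μ i : ℂ) * x i := by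
        rw [Finset.mul_sum]; exact Finset.sum_congr rfl fun i _ => by ring
      rw [this, mul_eq_zero]; simp [hac]
    · refine exists_congr fun τ => and_congr Iff.rfl (and_congr Iff.rfl (forall_congr' fun i => ?_))
      rw [map_mul, Complex.conj_ofReal]
      exact ⟨fun h => mul_left_cancel₀ hac h, fun h => by rw [h]⟩
    · refine exists_congr fun C0 => forall_congr' fun i => ?_
      rw [primX_scale]
      push_cast
      rw [mul_assoc]
  unfold NN
  refine finsum_mem_eq_of_bijOn (fun x i => (a:ℂ) * x i) ⟨fun x hx => (key x).2 hx, ?_, ?_⟩ ?_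
  · intro x _ y _ h
    funext i
    exact mul_left_cancel₀ hac (congrFun h i)
  · intro x hx
    have : (fun i => (a:ℂ) * ((a:ℂ)⁻¹ * x i)) = x := by funext i; field_simp
    refine ⟨fun i => (a:ℂ)⁻¹ * x i, ?_, this⟩
    rw [← key, this]; exact hx
  · intro x hx
    unfold sgn
    refine Finset.prod_congr rfl fun i _ => Finset.prod_congr rfl fun j _ => ?_
    have : ((x i).im = 0 ∧ (x j).im = 0 ∧ (x i).re < (x j).re) ↔ ((a * x i).im = 0 ∧ (a * x j).im = 0 ∧ (a * x i).re < (a * x j).re) := by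
      simp [ha, ha.ne']
    simp only [this]

lemma NN_sign (c c' : ℝ) (h : 0 < c * c') (μ : ι → ℕ) (v : ι → ℝ) (e : ι → ι → ℕ) : NN c μ v e = NN c' μ v e := by
  have hc : c ≠ 0 := by rintro rfl; simp at h
  have hpos : 0 < c' / c := by
    rw [div_eq_mul_inv, ← div_eq_mul_inv]
    have : c' / c = c * c' / (c * c) := by field_simp
    rw [this]; exact div_pos h (mul_self_pos.2 hc)
  set n := (∑ i, μ i) + 1 with hn
  have := NN_scale c μ v e ((c'/c) ^ ((n:ℝ)⁻¹)) (Real.rpow_pos_of_pos hpos _)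
  rw [← this, ← hn, Real.rpow_inv_natCast_pow hpos.le (by omega)]
  congr 1
  field_simp

end nn
end

noncomputable section
set_option linter.unusedSectionVars false
set_option linter.unusedVariables false
set_option linter.unusedSimpArgs false

section t3
variable {ι : Type*} [Fintype ι]

def Rset (star : ι) (L : Finset ι) : Finset ι := Finset.univ.erase star \ L
def aL (μ : ι → ℕ) (L : Finset ι) : ℕ := (∑ i ∈ L, μ i) + 1
def bL (μ : ι → ℕ) (star : ι) (L : Finset ι) : ℕ := (∑ i ∈ Rset star L, μ i) + 1

/-- conclusion of limit analysis -/
def LimConc (μ : ι → ℕ) (star : ι) (L : Finset ι) (σ : ℝ) (x0 : ι → ℂ) : Prop :=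
  ∃ γ : ℝ, 0 < γ ∧ σ * (aL μ L * γ) ^ (aL μ L) * (-(bL μ star L * γ)) ^ (bL μ star L) = -1 ∧
    x0 star = (((aL μ L : ℝ) - bL μ star L) * γ : ℝ) ∧
    (∀ i ∈ L, x0 i = (-(bL μ star L * γ) : ℝ)) ∧ ∀ i ∈ Rset star L, x0 i = ((aL μ L * γ) : ℝ)

lemma t3_fin (μ : ι → ℕ) (star : ι) (L : Finset ι) (hL : L ⊆ Finset.univ.erase star) (σ : ℝ) (x0 : ι → ℂ)
    (hsepL : ∀ i ∈ L, (x0 i).re ≤ (x0 star).re) (hsepR : ∀ i ∈ Rset star L, (x0 star).re ≤ (x0 i).re)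
    (γ : ℝ) (hγ : 0 < γ) (p q : ℕ)
    (h1 : ∀ i ∈ Finset.univ.erase star, x0 i ≠ ((-((q+1) * γ) : ℝ) : ℂ) → x0 i = (((p+1) * γ : ℝ) : ℂ))
    (hp : p = ∑ i ∈ (Finset.univ.erase star).filter (fun i => x0 i = ((-((q+1) * γ) : ℝ) : ℂ)), μ i)
    (hq : q = ∑ i ∈ (Finset.univ.erase star).filter (fun i => x0 i ≠ ((-((q+1) * γ) : ℝ) : ℂ)), μ i)
    (hξ : x0 star = (((p:ℝ) - q) * γ : ℝ))
    (he : σ * ((p+1) * γ) ^ (p+1) * (-((q+1) * γ)) ^ (q+1) = -1) : LimConc μ star L σ x0 := by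
  have hα : -(((q:ℝ)+1) * γ) < ((p:ℝ) - q) * γ := by
    have : (0:ℝ) ≤ p := Nat.cast_nonneg p
    nlinarith
  have hβ : ((p:ℝ) - q) * γ < ((p:ℝ)+1) * γ := by
    have : (0:ℝ) ≤ q := Nat.cast_nonneg q
    nlinarith
  have f1 : (Finset.univ.erase star).filter (fun i => x0 i = ((-((q+1) * γ) : ℝ) : ℂ)) = L := by
    ext i
    rw [Finset.mem_filter]
    constructor
    · rintro ⟨hi, hx⟩
      by_contra hiL
      have := hsepR i (by simp only [Rset, Finset.mem_sdiff]; exact ⟨hi, hiL⟩)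
      rw [hx, hξ, Complex.ofReal_re, Complex.ofReal_re] at this
      linarith
    · intro hi
      refine ⟨hL hi, ?_⟩
      by_contra hx
      have h2 := h1 i (hL hi) hx
      have := hsepL i hi
      rw [h2, hξ, Complex.ofReal_re, Complex.ofReal_re] at this
      linarith
  have f2 : (Finset.univ.erase star).filter (fun i => x0 i ≠ ((-((q+1) * γ) : ℝ) : ℂ)) = Rset star L := by
    rw [← f1]
    ext i
    simp only [Rset, Finset.mem_sdiff, Finset.mem_filter]
    tauto
  rw [f1] at hp
  rw [f2] at hq
  have ha : (aL μ L : ℝ) = p + 1 := by unfold aL; rw [← hp]; push_cast; ring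
  have hb : (bL μ star L : ℝ) = q + 1 := by unfold bL; rw [← hq]; push_cast; ring
  have ha' : aL μ L = p + 1 := by unfold aL; rw [← hp]
  have hb' : bL μ star L = q + 1 := by unfold bL; rw [← hq]
  refine ⟨γ, hγ, ?_, ?_, ?_, ?_⟩
  · rw [ha, hb, ha', hb']; exact he
  · rw [ha, hb, hξ]; congr 1; ring
  · intro i hi
    rw [hb]
    rw [← f1] at hi
    exact (Finset.mem_filter.1 hi).2
  · intro i hi
    rw [ha]
    rw [← f2] at hi
    exact h1 i (Finset.mem_filter.1 hi).1 (Finset.mem_filter.1 hi).2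

set_option maxHeartbeats 1000000 in
lemma t3_limit (μ : ι → ℕ) (star : ι) (hstar : μ star = 1) (L : Finset ι) (hL : L ⊆ Finset.univ.erase star)
    (σ : ℝ) (hσ : σ = 1 ∨ σ = -1) (x0 : ι → ℂ)
    (hsepL : ∀ i ∈ L, (x0 i).re ≤ (x0 star).re) (hsepR : ∀ i ∈ Rset star L, (x0 star).re ≤ (x0 i).re)
    (hsum : ∑ i, (μ i : ℂ) * x0 i = 0) (τ : Equiv.Perm ι) (hτ : ∀ i, x0 (τ i) = (starRingEnd ℂ) (x0 i)) (hτs : τ star = star)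
    (C0 : ℂ) (hC : ∀ i, C0 + ((σ * ((∑ i, μ i) + 1 : ℕ) : ℝ) : ℂ) * primX μ x0 (x0 i) = if i = star then -1 else 0)
    (hreal : σ = 1 ∨ Odd ((∑ i, μ i) + 1) ∨ ∃ i0, i0 ≠ star ∧ τ i0 = i0) : LimConc μ star L σ x0 := by
  set S := Finset.univ.erase star with hS
  have hreal' : ∀ i, τ i = i → (x0 i).im = 0 := by
    intro i hi
    have := hτ i
    rw [hi] at this
    exact Complex.conj_eq_iff_im.1 this.symm
  have hσ0 : σ ≠ 0 := by rcases hσ with h | h <;> rw [h] <;> norm_num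
  set c : ℂ := ((σ * ((∑ i, μ i) + 1 : ℕ) : ℝ) : ℂ) with hc
  have hc0 : c ≠ 0 := by
    rw [hc]
    norm_cast
    exact mul_ne_zero hσ0 (by positivity)
  have hsumS : ∑ i, μ i = (∑ i ∈ S, μ i) + 1 := by
    rw [hS, ← hstar]; exact (Finset.sum_erase_add _ _ (Finset.mem_univ star)).symm
  set G : ℂ[X] := C C0 + C c * antider (∏ i, (X - C (x0 i)) ^ μ i) with hG
  have hGe : ∀ z, G.eval z = C0 + c * primX μ x0 z := by
    intro z
    rw [primX_eq_antider, hG]; simp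
  obtain ⟨α, β, γ, hγ0, hyab, p, q, hp, hq, hξ, hβ, hGf⟩ := two_root S μ x0 c (x0 star) hc0 G (by
      rw [hG, derivative_add, derivative_C, zero_add, derivative_C_mul, derivative_antider, ← Finset.mul_prod_erase _ _ (Finset.mem_univ star), hstar, pow_one]
      ring)
    (by
      intro i hi
      rw [hGe, hC, if_neg (Finset.ne_of_mem_erase hi)])
    (by rw [hGe, hC, if_pos rfl]; norm_num)
  have hpqS : p + q = ∑ i ∈ S, μ i := by rw [hp, hq]; exact Finset.sum_filter_add_sum_filter_not S _ μ
  have hn : ((p:ℂ) + q + 1) ≠ 0 := by exact_mod_cast (by omega : p + q + 1 ≠ 0)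
  have hcs : c / (p+q+2) = σ := by
    have h1 : (∑ i, μ i) + 1 = p + q + 2 := by omega
    rw [hc, h1]
    have : ((p:ℂ) + q + 2) ≠ 0 := by exact_mod_cast (by omega : p + q + 2 ≠ 0)
    push_cast
    field_simp
  rw [hcs] at hGf
  have hα : α = -((q+1) * γ) := by
    have h1 : x0 star + (p * α + q * β) = 0 := by
      rw [← hsum, ← Finset.add_sum_erase _ _ (Finset.mem_univ star), hstar, Nat.cast_one, one_mul, ← hS,
        ← Finset.sum_filter_add_sum_filter_not S (fun i => x0 i = α)]
      congr 2
      · rw [hp]; push_cast; rw [Finset.sum_mul]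
        exact Finset.sum_congr rfl fun i hi => by rw [(Finset.mem_filter.1 hi).2]
      · rw [hq]; push_cast; rw [Finset.sum_mul]
        exact Finset.sum_congr rfl fun i hi => by rw [hyab i (Finset.mem_filter.1 hi).1 (Finset.mem_filter.1 hi).2]
    refine mul_left_cancel₀ hn ?_
    linear_combination h1 - hξ - q * hβ
  have hβ' : β = (p+1) * γ := by rw [hβ, hα]; ring
  have hξ' : x0 star = (p - q) * γ := by rw [hξ, hα]; ring
  have hval : (σ:ℂ) * ((p+1) * γ) ^ (p+1) * (-((q+1) * γ)) ^ (q+1) = -1 := by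
    have h1 := hC star
    rw [if_pos rfl, ← hGe, hGf] at h1
    simp only [eval_mul, eval_C, eval_pow, eval_sub, eval_X] at h1
    rw [← h1, hξ', hα, hβ']
    congr 2
    · congr 1; ring
    · congr 1; ring
  have hp1 : ((p:ℂ)+1) ≠ 0 := by exact_mod_cast (by omega : p + 1 ≠ 0)
  have hq1 : ((q:ℂ)+1) ≠ 0 := by exact_mod_cast (by omega : q + 1 ≠ 0)
  have hmem : ∀ i ∈ S, x0 i = -((q+1) * γ) ∨ x0 i = (p+1) * γ := by
    intro i hi
    by_cases h : x0 i = α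
    · left; rw [h, hα]
    · right; rw [hyab i hi h, hβ']
  have hξim : ((p:ℝ) - q) * γ.im = 0 := by
    have := hreal' star hτs
    rw [hξ'] at this
    simpa using this
  have hγim : γ.im = 0 := by
    by_cases hpq : p = q
    · rcases hreal with h | h | ⟨i0, hi0, hi0'⟩
      · have hcj : (starRingEnd ℂ) γ = γ ∨ (starRingEnd ℂ) γ = - γ := by
          rcases S.eq_empty_or_nonempty with hSe | ⟨i, hi⟩
          · have hp0 : p = 0 := by rw [hp, hSe]; simp
            have hq0 : q = 0 := by omega
            rw [h, hp0, hq0] at hval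
            simp at hval
            have : γ * γ = 1 := hval
            rcases mul_self_eq_one_iff.1 this with h | h
            · left; rw [h]; simp
            · left; rw [h]; simp
          · have hi' : τ i ∈ S := by
              rw [hS, Finset.mem_erase] at hi ⊢
              refine ⟨fun h' => hi.1 ?_, Finset.mem_univ _⟩
              exact τ.injective (h'.trans hτs.symm)
            have h1 := hτ i
            rw [← hpq] at hmem
            rcases hmem i hi with h2 | h2 <;> rcases hmem _ hi' with h3 | h3 <;> rw [h3, h2] at h1 <;>
              simp only [map_neg, map_mul, map_add, map_natCast, map_one] at h1
            · left; exact mul_left_cancel₀ hp1 (by linear_combination h1)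
            · right; exact mul_left_cancel₀ hp1 (by linear_combination h1)
            · right; exact mul_left_cancel₀ hp1 (by linear_combination -h1)
            · left; exact mul_left_cancel₀ hp1 (by linear_combination -h1)
        rcases hcj with h2 | h2
        · exact Complex.conj_eq_iff_im.1 h2
        · exfalso
          have hre : γ.re = 0 := by
            have := congrArg Complex.re h2
            simp at this; linarith
          have hg : γ = (γ.im : ℂ) * Complex.I := by
            apply Complex.ext <;> simp [hre]
          rw [h, ← hpq, Complex.ofReal_one, one_mul, ← mul_pow] at hval
          have h3 : (((p:ℂ)+1) * γ) * (-((p+1)*γ)) = (((p+1)*γ.im)^2 : ℝ) := by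
            have h4 : γ ^ 2 = -(γ.im:ℂ) ^ 2 := by
              conv_lhs => rw [hg]
              rw [mul_pow, Complex.I_sq]; ring
            push_cast
            linear_combination (-((p:ℂ)+1)^2) * h4
          rw [h3] at hval
          have h4 : ((((p+1)*γ.im)^2)^(p+1) : ℝ) = -1 := by exact_mod_cast hval
          have : (0:ℝ) ≤ ((((p+1)*γ.im)^2)^(p+1) : ℝ) := by positivity
          linarith
      · exfalso
        have h1 : (∑ i, μ i) + 1 = p + q + 2 := by omega
        rw [h1, hpq] at h
        rcases h with ⟨k, hk⟩
        omega
      · have h1 := hreal' i0 hi0'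
        have hp1' : ((p:ℝ)+1) ≠ 0 := by positivity
        have hq1' : ((q:ℝ)+1) ≠ 0 := by positivity
        rcases hmem i0 (Finset.mem_erase.2 ⟨hi0, Finset.mem_univ _⟩) with h2 | h2 <;> rw [h2] at h1
        · have h3 : ((q:ℝ)+1) * γ.im = 0 := by simpa using h1
          exact (mul_eq_zero.1 h3).resolve_left hq1'
        · have h3 : ((p:ℝ)+1) * γ.im = 0 := by simpa using h1
          exact (mul_eq_zero.1 h3).resolve_left hp1'
    · exact (mul_eq_zero.1 hξim).resolve_left (sub_ne_zero.2 (by exact_mod_cast hpq))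
  obtain ⟨g, rfl⟩ : ∃ g : ℝ, γ = g := ⟨γ.re, Complex.ext rfl (by simpa using hγim)⟩
  have hg0 : g ≠ 0 := by exact_mod_cast hγ0
  have hvalR : σ * ((p+1) * g) ^ (p+1) * (-((q+1) * g)) ^ (q+1) = -1 := by exact_mod_cast hval
  have hne : ((-((q+1) * g) : ℝ) : ℂ) ≠ (((p+1) * g : ℝ) : ℂ) := by
    intro h
    have h' : -(((q:ℝ)+1) * g) = ((p:ℝ)+1) * g := by exact_mod_cast h
    have : ((p:ℝ)+q+2) * g = 0 := by linarith
    rcases mul_eq_zero.1 this with h | h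
    · have : (0:ℝ) < (p:ℝ)+q+2 := by positivity
      linarith
    · exact hg0 h
  have hαr : α = ((-((q+1) * g) : ℝ) : ℂ) := by rw [hα]; push_cast; ring
  have hβr : β = (((p+1) * g : ℝ) : ℂ) := by rw [hβ']; push_cast; ring
  rw [hαr] at hp hq hyab
  rw [hβr] at hyab
  rcases lt_or_gt_of_ne hg0 with h | h
  · have e1 : ((-((p+1) * -g) : ℝ) : ℂ) = (((p+1) * g : ℝ) : ℂ) := by push_cast; ring
    have e2 : ((((q:ℝ)+1) * -g : ℝ) : ℂ) = ((-((q+1) * g) : ℝ) : ℂ) := by push_cast; ring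
    have hiff : ∀ i ∈ S, (x0 i = (((p+1) * g : ℝ) : ℂ) ↔ x0 i ≠ ((-((q+1) * g) : ℝ) : ℂ)) := by
      intro i hi
      constructor
      · intro h h'
        exact hne (h'.symm.trans h)
      · exact hyab i hi
    refine t3_fin μ star L hL σ x0 hsepL hsepR (-g) (by linarith) q p ?_ ?_ ?_ ?_ ?_
    · intro i hi hx
      rw [e1] at hx
      rw [e2]
      by_contra h'
      exact hx (hyab i hi h')
    · rw [e1, ← hS]; refine hq.trans ?_
      congr 1
      exact Finset.filter_congr fun i hi => (hiff i hi).symm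
    · rw [e1, ← hS]; refine hp.trans ?_
      congr 1
      exact Finset.filter_congr fun i hi => by rw [ne_eq, hiff i hi, not_not]
    · rw [hξ']; push_cast; ring
    · have e3 : ((q:ℝ)+1) * -g = -((q+1)*g) := by ring
      have e4 : -(((p:ℝ)+1) * -g) = ((p+1)*g) := by ring
      rw [e3, e4, ← hvalR]; ring
  · exact t3_fin μ star L hL σ x0 hsepL hsepR g h p q hyab hp hq (by rw [hξ']; push_cast; ring) hvalR

end t3
end

noncomputable section
set_option linter.unusedSectionVars false
set_option linter.unusedVariables false
set_option linter.unusedSimpArgs false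

namespace GDat
variable {ι K : Type*} [Fintype ι] [Fintype K] (d : GDat ι K)

/-- the fibre as a type -/
abbrev Fk (k : K) : Type _ := {i : ι // d.pr i = k}

def kap (X : K → ℝ) (k : K) : ℝ := ∏ i ∈ (d.fib k)ᶜ, (X k - X (d.pr i)) ^ d.mu i

lemma kap_cast (X : K → ℝ) (k : K) : ((d.kap X k : ℝ) : ℂ) = ∏ i ∈ (d.fib k)ᶜ, ((X k : ℂ) - (X (d.pr i) : ℂ)) ^ d.mu i := by
  unfold kap; push_cast; rfl

lemma prim_Fk (X : K → ℝ) (y : ι → ℂ) (k : K) (z : ℂ) :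
    prim d.mu (d.aa 0 k) (d.bb 0 (fun k => (X k : ℂ)) y k) z =
      (d.kap X k : ℂ) * primX (fun i : d.Fk k => d.mu i) (fun i : d.Fk k => y i) z := by
  rw [prim_fib, kap_cast, primX_eq_antider]
  congr 3
  exact Finset.prod_subtype (d.fib k) (fun i => d.mem_fib k i) (fun i => (Polynomial.X - C (y i)) ^ d.mu i)

lemma sum_Fk (f : ι → ℂ) (k : K) : ∑ i ∈ d.fib k, f i = ∑ i : d.Fk k, f i :=
  Finset.sum_subtype (d.fib k) (fun i => d.mem_fib k i) f

def SolK (X : K → ℝ) (k : K) : Set (d.Fk k → ℂ) :=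
  Sol (d.c * d.kap X k) (fun i : d.Fk k => d.mu i) (fun i : d.Fk k => d.v1 i)

def asm (p : ∀ k, d.Fk k → ℂ) : ι → ℂ := fun i => p (d.pr i) ⟨i, rfl⟩

lemma asm_val (p : ∀ k, d.Fk k → ℂ) (k : K) (i : d.Fk k) : d.asm p i = p k i := by
  obtain ⟨i, rfl⟩ := i; rfl

lemma asm_restrict (p : ∀ k, d.Fk k → ℂ) (k : K) : (fun i : d.Fk k => d.asm p i) = p k := by
  funext i; exact d.asm_val p k i

def liftq (X : K → ℝ) (C0 : ℂ) (p : ∀ k, d.Fk k → ℂ) : GE ι K :=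
  (fun k => (X k : ℂ), C0, d.asm p, fun k => d.v1 (Function.surjInv d.surj k) -
    d.c * prim d.mu (d.aa 0 k) (d.bb 0 (fun k => (X k : ℂ)) (d.asm p) k) (d.asm p (Function.surjInv d.surj k)))

lemma Z0_eq (X : K → ℝ) (hX : Function.Injective X) (hsum : ∑ i, (d.mu i : ℂ) * (X (d.pr i) : ℂ) = 0)
    (C0 : ℂ) (hC : ∀ k, C0 + d.c * primX d.mu (fun i => (X (d.pr i) : ℂ)) (X k) = d.vb k) :
    d.Z0 {fun k => (X k : ℂ)} = d.liftq X C0 '' {p | ∀ k, p k ∈ d.SolK X k} := by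
  have hXc : Function.Injective (fun k => (X k : ℂ)) := fun a b h => hX (Complex.ofReal_injective h)
  have hconj : ∀ k, (starRingEnd ℂ) (X k : ℂ) = X k := fun k => Complex.conj_ofReal _
  ext q
  obtain ⟨X', C0', y, Ck⟩ := q
  constructor
  · rintro ⟨hqB, hinj, hPsi, hyinj, σ, s1, s2, s3, s4, s5⟩
    have hqB' : X' = fun k => (X k : ℂ) := hqB
    subst hqB'
    have hpσ : ∀ i, d.pr (σ i) = d.pr i := by
      intro i
      have h1 := s4 i
      simp only [hconj] at h1
      exact hX (by exact_mod_cast h1)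
    set p : ∀ k, d.Fk k → ℂ := fun k i => y i with hp
    have hasm : d.asm p = y := rfl
    have h3 : ∀ i, Ck (d.pr i) + d.c * prim d.mu (d.aa 0 (d.pr i)) (d.bb 0 (fun k => (X k : ℂ)) y (d.pr i)) (y i) - d.v1 i = 0 := by
      intro i
      have h3 := congrFun (congrArg (fun q : GE ι K => q.2.2.1) hPsi) i
      exact h3
    refine ⟨p, ?_, ?_⟩
    · intro k
      refine ⟨?_, ?_, ?_, Ck k, ?_⟩
      · intro i j hij
        exact Subtype.ext (hyinj i j (i.2.trans j.2.symm) hij)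
      · have h4 : ∑ i ∈ d.fib k, (d.mu i : ℂ) * y i = 0 := congrFun (congrArg (fun q : GE ι K => q.2.2.2) hPsi) k
        rw [d.sum_Fk] at h4
        exact h4
      · refine ⟨σ.subtypePerm (fun i => by rw [hpσ]), fun i => s1 i, fun i => s3 i, fun i => s5 i⟩
      · rintro ⟨i, rfl⟩
        have := h3 i
        rw [prim_Fk] at this
        push_cast
        linear_combination this
    · have h1 : ∀ k, C0' + d.c * primX d.mu (fun i => (X (d.pr i) : ℂ)) (X k) = d.vb k := by
        intro k
        have h1 := congrFun (congrArg (fun q : GE ι K => q.1) hPsi) k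
        simp only [GDat.Psi, GDat.xh_zero, Prod.fst_zero, Pi.zero_apply, Complex.ofReal_zero, zero_pow d.M_pos, zero_mul, sub_zero] at h1
        exact sub_eq_zero.1 h1
      refine Prod.ext rfl (Prod.ext ?_ (Prod.ext hasm ?_))
      · have := h1 d.hne.some
        have h2 := hC d.hne.some
        show C0 = C0'
        linear_combination h2 - this
      · funext k
        have := h3 (Function.surjInv d.surj k)
        rw [Function.surjInv_eq d.surj k] at this
        simp only [liftq, hasm]
        linear_combination -this
  · rintro ⟨p, hp, heq⟩
    rw [← heq]
    clear heq
    have hp' : ∀ k, p k ∈ d.SolK X k := hp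
    choose hpi hps hpt hpc using hp'
    choose τ ht1 ht2 ht3 using hpt
    choose Cp hCp using hpc
    refine ⟨rfl, hXc, ?_, ?_, ?_⟩
    · refine Prod.ext ?_ (Prod.ext hsum (Prod.ext ?_ ?_))
      · funext k
        simp only [GDat.Psi, GDat.xh_zero, Prod.fst_zero, Pi.zero_apply, Complex.ofReal_zero, zero_pow d.M_pos, zero_mul, sub_zero, liftq]
        exact sub_eq_zero.2 (hC k)
      · funext i
        simp only [GDat.Psi, Prod.snd_zero, Prod.fst_zero, Pi.zero_apply, liftq]
        rw [prim_Fk, prim_Fk, d.asm_restrict]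
        have h1 := hCp (d.pr i) ⟨i, rfl⟩
        have h2 := hCp (d.pr i) ⟨Function.surjInv d.surj (d.pr i), Function.surjInv_eq d.surj _⟩
        have e1 : d.asm p i = p (d.pr i) ⟨i, rfl⟩ := rfl
        have e2 : d.asm p (Function.surjInv d.surj (d.pr i)) = p (d.pr i) ⟨Function.surjInv d.surj (d.pr i), Function.surjInv_eq d.surj _⟩ :=
          d.asm_val p _ ⟨Function.surjInv d.surj (d.pr i), Function.surjInv_eq d.surj _⟩
        rw [e1, e2]
        push_cast at h1 h2
        linear_combination h1 - h2
      · funext k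
        simp only [GDat.Psi, Prod.snd_zero, Prod.fst_zero, Pi.zero_apply, liftq]
        rw [d.sum_Fk, ← hps k]
        refine Finset.sum_congr rfl fun i _ => ?_
        rw [d.asm_val]
    · intro i j hij hy
      have hy' : d.asm p i = d.asm p j := hy
      have e1 : d.asm p j = p (d.pr i) ⟨j, hij.symm⟩ := d.asm_val p _ ⟨j, hij.symm⟩
      have := hpi (d.pr i) (show p (d.pr i) ⟨i, rfl⟩ = p (d.pr i) ⟨j, hij.symm⟩ from hy'.trans e1)
      exact congrArg Subtype.val this
    · have hσ : ∃ σ : Equiv.Perm ι, ∀ i, σ i = (τ (d.pr i) ⟨i, rfl⟩).1 :=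
        ⟨(Equiv.sigmaFiberEquiv d.pr).permCongr (Equiv.sigmaCongrRight τ), fun i => rfl⟩
      obtain ⟨σ, hσ⟩ := hσ
      have hpσ : ∀ i, d.pr (σ i) = d.pr i := fun i => by rw [hσ]; exact (τ (d.pr i) ⟨i, rfl⟩).2
      refine ⟨σ, ?_, ?_, ?_, ?_, ?_⟩
      · intro i; rw [hσ]; exact ht1 _ _
      · intro i; rw [hpσ]
      · intro i; rw [hσ]; exact ht2 _ _
      · intro i; rw [hpσ]; exact (hconj _).symm
      · intro i
        show d.asm p (σ i) = _
        rw [hσ, d.asm_val]; exact ht3 _ _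

lemma prod_cancel (σ : Equiv.Perm ι) (e : ι → ι → ℕ) (he : ∀ i j, e (σ i) (σ j) = e i j) (y : ι → ℂ)
    (hy : ∀ i, y (σ i) = (starRingEnd ℂ) (y i)) (hσσ : ∀ i, σ (σ i) = i) (Q : ι → ι → Prop) (hQ : ∀ i j, Q (σ i) (σ j) ↔ Q i j) :
    ∏ i, ∏ j, (if Q i j ∧ ¬ ((y i).im = 0 ∧ (y j).im = 0) then (-1 : ℤ) ^ e i j else 1) = 1 := by
  rw [← Fintype.prod_prod_type' (fun i j => (if Q i j ∧ ¬ ((y i).im = 0 ∧ (y j).im = 0) then (-1 : ℤ) ^ e i j else 1))]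
  have him : ∀ i, (y (σ i)).im = 0 ↔ (y i).im = 0 := by intro i; rw [hy]; simp
  refine Finset.prod_involution (fun ij _ => (σ ij.1, σ ij.2)) ?_ ?_ ?_ ?_
  · rintro ⟨i, j⟩ _
    simp only [hQ, him, he]
    split_ifs
    · rw [← mul_pow]; simp
    · simp
  · rintro ⟨i, j⟩ _ h heq
    simp only [Prod.mk.injEq] at heq
    apply h
    have h1 : (y i).im = 0 := by
      have := hy i; rw [heq.1] at this; exact Complex.conj_eq_iff_im.1 this.symm
    have h2 : (y j).im = 0 := by
      have := hy j; rw [heq.2] at this; exact Complex.conj_eq_iff_im.1 this.symm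
    simp [h1, h2]
  · intro _ _; exact Finset.mem_univ _
  · rintro ⟨i, j⟩ _; simp [hσσ]

lemma sgn0_eq (X : K → ℝ) (hX : Function.Injective X) (e : ι → ι → ℕ)
    (he : ∀ i i' j j', d.mu i = d.mu i' → d.vb (d.pr i) = d.vb (d.pr i') → d.v1 i = d.v1 i' →
      d.mu j = d.mu j' → d.vb (d.pr j) = d.vb (d.pr j') → d.v1 j = d.v1 j' → e i j = e i' j')
    (q : GE ι K) (hq : q ∈ d.Z0 {fun k => (X k : ℂ)}) :
    d.sgn0 e q = (∏ i, ∏ j, if X (d.pr i) < X (d.pr j) then (-1) ^ e i j else 1) *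
      ∏ k, sgn (fun i j : d.Fk k => e i j) (fun i : d.Fk k => q.2.2.1 i) := by
  obtain ⟨X', C0', y, Ck⟩ := q
  obtain ⟨hqB, hinj, hPsi, hyinj, σ, s1, s2, s3, s4, s5⟩ := hq
  have hqB' : X' = fun k => (X k : ℂ) := hqB
  subst hqB'
  have hconj : ∀ k, (starRingEnd ℂ) (X k : ℂ) = X k := fun k => Complex.conj_ofReal _
  have hpσ : ∀ i, d.pr (σ i) = d.pr i := by
    intro i
    have h1 := s4 i
    simp only [hconj] at h1
    exact hX (by exact_mod_cast h1)
  have hσσ : ∀ i, σ (σ i) = i := by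
    intro i
    apply hyinj
    · rw [hpσ, hpσ]
    · have h1 := s5 (σ i)
      have h2 := s5 i
      simp only at h1 h2
      show y (σ (σ i)) = y i
      rw [h1, h2, Complex.conj_conj]
  have hcan := prod_cancel σ e (fun i j => he _ _ _ _ (s1 i) (s2 i) (s3 i) (s1 j) (s2 j) (s3 j)) y s5 hσσ
    (fun i j => X (d.pr i) < X (d.pr j)) (fun i j => by rw [hpσ, hpσ])
  have hfibre : (∏ k, sgn (fun i j : d.Fk k => e i j) (fun i : d.Fk k => y i)) =
      ∏ i, ∏ j, if d.pr i = d.pr j ∧ (y i).im = 0 ∧ (y j).im = 0 ∧ (y i).re < (y j).re then (-1) ^ e i j else 1 := by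
    unfold sgn
    rw [← Fintype.prod_sigma', ← (Equiv.sigmaFiberEquiv d.pr).prod_comp]
    refine Finset.prod_congr rfl ?_
    rintro ⟨k, i⟩ _
    obtain ⟨i, rfl⟩ := i
    show _ = ∏ j, if d.pr i = d.pr j ∧ (y i).im = 0 ∧ (y j).im = 0 ∧ (y i).re < (y j).re then (-1:ℤ) ^ e i j else 1
    rw [← Finset.prod_subtype (d.fib (d.pr i)) (fun j => d.mem_fib (d.pr i) j)
      (fun j => if (y i).im = 0 ∧ (y j).im = 0 ∧ (y i).re < (y j).re then (-1:ℤ) ^ e i j else 1)]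
    unfold fib
    rw [Finset.prod_filter]
    refine Finset.prod_congr rfl fun j _ => ?_
    by_cases h : d.pr i = d.pr j
    · simp [h]
    · rw [if_neg (fun h' => h h'.symm), if_neg (fun h' => h h'.1)]
  rw [hfibre]
  refine (mul_one _).symm.trans ((congrArg (fun a => d.sgn0 e (fun k => (X k : ℂ), C0', y, Ck) * a) hcan.symm).trans ?_)
  unfold sgn0
  simp only
  rw [← Finset.prod_mul_distrib, ← Finset.prod_mul_distrib]
  refine Finset.prod_congr rfl fun i _ => ?_
  rw [← Finset.prod_mul_distrib, ← Finset.prod_mul_distrib]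
  refine Finset.prod_congr rfl fun j _ => ?_
  simp only [Complex.ofReal_im, Complex.ofReal_re, true_and]
  by_cases h : d.pr i = d.pr j
  · simp [h]
  · by_cases h1 : X (d.pr i) < X (d.pr j)
    · simp only [h, h1, true_and, false_and, or_false, and_true, if_true, if_false, mul_one]
      by_cases h2 : (y i).im = 0 ∧ (y j).im = 0
      · simp [h2]
      · simp [h2]
    · simp [h, h1]

lemma liftq_injOn (X : K → ℝ) (C0 : ℂ) : Function.Injective (d.liftq X C0) := by
  intro p p' h
  have h1 : d.asm p = d.asm p' := congrArg (fun q : GE ι K => q.2.2.1) h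
  funext k i
  exact (d.asm_val p k i).symm.trans ((congrFun h1 i).trans (d.asm_val p' k i))

lemma finsum_pi (A : ∀ k, Set (d.Fk k → ℂ)) (hA : ∀ k, (A k).Finite) (f : ∀ k, (d.Fk k → ℂ) → ℤ) :
    {p : ∀ k, d.Fk k → ℂ | ∀ k, p k ∈ A k}.Finite ∧
    ∑ᶠ p ∈ {p : ∀ k, d.Fk k → ℂ | ∀ k, p k ∈ A k}, ∏ k, f k (p k) = ∏ k, ∑ᶠ x ∈ A k, f k x := by
  have h1 : {p : ∀ k, d.Fk k → ℂ | ∀ k, p k ∈ A k} = ↑(Fintype.piFinset fun k => (hA k).toFinset) := by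
    ext p; simp
  rw [h1]
  refine ⟨Finset.finite_toSet _, ?_⟩
  rw [finsum_mem_coe_finset, ← Finset.prod_univ_sum]
  refine Finset.prod_congr rfl fun k _ => ?_
  rw [finsum_mem_eq_finite_toFinset_sum _ (hA k)]

theorem Z0_sum (X : K → ℝ) (hX : Function.Injective X) (hsum : ∑ i, (d.mu i : ℂ) * (X (d.pr i) : ℂ) = 0)
    (C0 : ℂ) (hC : ∀ k, C0 + d.c * primX d.mu (fun i => (X (d.pr i) : ℂ)) (X k) = d.vb k) (e : ι → ι → ℕ)
    (he : ∀ i i' j j', d.mu i = d.mu i' → d.vb (d.pr i) = d.vb (d.pr i') → d.v1 i = d.v1 i' →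
      d.mu j = d.mu j' → d.vb (d.pr j) = d.vb (d.pr j') → d.v1 j = d.v1 j' → e i j = e i' j') :
    (d.Z0 {fun k => (X k : ℂ)}).Finite ∧ ∑ᶠ q ∈ d.Z0 {fun k => (X k : ℂ)}, d.sgn0 e q =
      (∏ i, ∏ j, if X (d.pr i) < X (d.pr j) then (-1) ^ e i j else 1) *
      ∏ k, NN (d.c * d.kap X k) (fun i : d.Fk k => d.mu i) (fun i : d.Fk k => d.v1 i) (fun i j : d.Fk k => e i j) := by
  have hk : ∀ k, d.kap X k ≠ 0 := by
    intro k
    refine Finset.prod_ne_zero_iff.2 fun i hi => pow_ne_zero _ (sub_ne_zero.2 fun h => ?_)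
    rw [Finset.mem_compl, mem_fib] at hi
    exact hi (hX h).symm
  have hfin : ∀ k, (d.SolK X k).Finite := fun k => Sol.finite (fun i : d.Fk k => d.mu i) (fun i => d.hmu i) _ (mul_ne_zero d.hc (hk k)) _
  obtain ⟨f1, f2⟩ := d.finsum_pi (d.SolK X) hfin (fun k => sgn (fun i j : d.Fk k => e i j))
  have hZ := d.Z0_eq X hX hsum C0 hC
  refine ⟨by rw [hZ]; exact f1.image _, ?_⟩
  rw [finsum_mem_congr rfl (fun q hq => d.sgn0_eq X hX e he q hq)]
  refine (mul_finsum_mem' (s := d.Z0 {fun k => (X k : ℂ)}) (f := fun q => ∏ k, sgn (fun i j : d.Fk k => e i j) (fun i : d.Fk k => q.2.2.1 i))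
    _ (by rw [hZ]; exact f1.image _)).symm.trans ?_
  congr 1
  rw [hZ, finsum_mem_image (d.liftq_injOn X C0).injOn]
  unfold NN
  rw [show (∏ k, ∑ᶠ x ∈ Sol (d.c * d.kap X k) (fun i : d.Fk k => d.mu i) (fun i : d.Fk k => d.v1 i), sgn (fun i j : d.Fk k => e i j) x) =
    ∏ k, ∑ᶠ x ∈ d.SolK X k, sgn (fun i j : d.Fk k => e i j) x from rfl, ← f2]
  refine finsum_mem_congr rfl fun p _ => Finset.prod_congr rfl fun k _ => ?_
  congr 1
  exact d.asm_restrict p k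

end GDat
end

noncomputable section
set_option linter.unusedSectionVars false
set_option linter.unusedVariables false
set_option linter.unusedSimpArgs false

lemma NN_subsingleton {ι : Type*} [Fintype ι] [Subsingleton ι] (c : ℝ) (μ : ι → ℕ) (hμ : ∀ i, 1 ≤ μ i) (v : ι → ℝ)
    (e : ι → ι → ℕ) : NN c μ v e = 1 := by
  have h : Sol c μ v = {0} := by
    ext x
    simp only [Set.mem_singleton_iff]
    constructor
    · rintro ⟨-, h, -⟩
      funext i
      have h1 : (Finset.univ : Finset ι) = {i} := by ext j; simp [Subsingleton.elim j i]
      rw [h1, Finset.sum_singleton] at h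
      rcases mul_eq_zero.1 h with h | h
      · have := hμ i
        have h' : μ i = 0 := by exact_mod_cast h
        omega
      · exact h
    · rintro rfl
      refine ⟨Function.injective_of_subsingleton _, by simp, ⟨1, by simp, by simp, by simp⟩, ?_⟩
      rcases isEmpty_or_nonempty ι with hι | ⟨⟨i0⟩⟩
      · exact ⟨0, fun i => hι.elim i⟩
      · refine ⟨v i0 - c * primX μ 0 0, fun i => ?_⟩
        rw [Subsingleton.elim i i0]; simp
  unfold NN
  rw [h, finsum_mem_singleton]
  unfold sgn
  simp

/-- counting on a finite subset of labels -/
def NF {Λ : Type*} (c : ℝ) (μ : Λ → ℕ) (v : Λ → ℝ) (e : Λ → Λ → ℕ) (S : Finset Λ) : ℤ :=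
  NN c (fun i : S => μ i) (fun i : S => v i) (fun i j : S => e i j)

section t3
variable {ι : Type*} [Fintype ι]

def fcl (star : ι) (L : Finset ι) (i : ι) : Fin 3 := if i = star then 1 else if i ∈ L then 0 else 2

abbrev Kcl (star : ι) (L : Finset ι) : Type := {s : Fin 3 // ∃ i, fcl star L i = s}

def prcl (star : ι) (L : Finset ι) (i : ι) : Kcl star L := ⟨fcl star L i, i, rfl⟩

def Xv (a b γ : ℝ) : Fin 3 → ℝ := ![-(b * γ), (a - b) * γ, a * γ]

lemma Xv_mono (a b γ : ℝ) (ha : 0 < a) (hb : 0 < b) (hγ : 0 < γ) : StrictMono (Xv a b γ) := by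
  have h1 := mul_pos ha hγ
  have h2 := mul_pos hb hγ
  intro i j hij
  fin_cases i <;> fin_cases j <;> simp [Xv] at hij ⊢ <;> nlinarith

lemma exists_gamma (a b : ℕ) (ha : 0 < a) (hb : 0 < b) (σ : ℝ) (h : σ * (-1) ^ b = -1) :
    ∃ γ : ℝ, 0 < γ ∧ σ * (a * γ) ^ a * (-(b * γ)) ^ b = -1 := by
  have hw : (0:ℝ) < (a:ℝ) ^ a * (b:ℝ) ^ b := by positivity
  refine ⟨(((a:ℝ) ^ a * (b:ℝ) ^ b)⁻¹) ^ (((a + b : ℕ):ℝ)⁻¹), by positivity, ?_⟩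
  set γ := (((a:ℝ) ^ a * (b:ℝ) ^ b)⁻¹) ^ (((a + b : ℕ):ℝ)⁻¹) with hγ
  have h1 : γ ^ (a + b) = ((a:ℝ) ^ a * (b:ℝ) ^ b)⁻¹ := Real.rpow_inv_natCast_pow (by positivity) (by omega)
  have : σ * (a * γ) ^ a * (-(b * γ)) ^ b = (σ * (-1) ^ b) * ((a:ℝ) ^ a * (b:ℝ) ^ b * γ ^ (a + b)) := by
    rw [neg_eq_neg_one_mul, mul_pow, mul_pow, mul_pow, pow_add]; ring
  rw [this, h1, mul_inv_cancel₀ hw.ne', h, mul_one]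

lemma gamma_unique (a b : ℕ) (ha : 0 < a) (hb : 0 < b) (σ : ℝ) (γ γ' : ℝ) (hγ : 0 < γ) (hγ' : 0 < γ')
    (h : σ * (a * γ) ^ a * (-(b * γ)) ^ b = -1) (h' : σ * (a * γ') ^ a * (-(b * γ')) ^ b = -1) : γ = γ' := by
  have hw : (0:ℝ) < (a:ℝ) ^ a * (b:ℝ) ^ b := by positivity
  have key : ∀ γ : ℝ, σ * (a * γ) ^ a * (-(b * γ)) ^ b = (σ * (-1) ^ b * ((a:ℝ) ^ a * (b:ℝ) ^ b)) * γ ^ (a + b) := by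
    intro γ
    rw [neg_eq_neg_one_mul, mul_pow, mul_pow, mul_pow, pow_add]; ring
  rw [key] at h h'
  have h0 : (σ * (-1) ^ b * ((a:ℝ) ^ a * (b:ℝ) ^ b)) ≠ 0 := by
    intro h0; rw [h0] at h; norm_num at h
  have h1 : γ ^ (a + b) = γ' ^ (a + b) := mul_left_cancel₀ h0 (h.trans h'.symm)
  exact (pow_left_inj₀ hγ.le hγ'.le (by omega)).1 h1

lemma gamma_sign (a b : ℕ) (ha : 0 < a) (hb : 0 < b) (σ : ℝ) (hσ : σ = 1 ∨ σ = -1) (γ : ℝ) (hγ : 0 < γ)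
    (h : σ * (a * γ) ^ a * (-(b * γ)) ^ b = -1) : σ * (-1) ^ b = -1 := by
  have hw : (0:ℝ) < (a:ℝ) ^ a * (b:ℝ) ^ b * γ ^ (a + b) := by positivity
  have key : σ * (a * γ) ^ a * (-(b * γ)) ^ b = (σ * (-1) ^ b) * ((a:ℝ) ^ a * (b:ℝ) ^ b * γ ^ (a + b)) := by
    rw [neg_eq_neg_one_mul, mul_pow, mul_pow, mul_pow, pow_add]; ring
  rw [key] at h
  have h1 : σ * (-1) ^ b = 1 ∨ σ * (-1) ^ b = -1 := by
    rcases hσ with h | h <;> rcases neg_one_pow_eq_or ℝ b with h' | h' <;> rw [h, h'] <;> norm_num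
  rcases h1 with h1 | h1
  · rw [h1] at h; linarith
  · exact h1

lemma prod_split (star : ι) (L : Finset ι) (hL : L ⊆ Finset.univ.erase star) {M : Type*} [CommMonoid M] (g : ι → M) :
    ∏ i, g i = g star * ((∏ i ∈ L, g i) * ∏ i ∈ Rset star L, g i) := by
  rw [← Finset.mul_prod_erase Finset.univ g (Finset.mem_univ star), ← Finset.prod_sdiff hL, mul_comm (∏ i ∈ L, g i)]
  rfl

lemma sum_split (star : ι) (L : Finset ι) (hL : L ⊆ Finset.univ.erase star) {M : Type*} [AddCommMonoid M] (g : ι → M) :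
    ∑ i, g i = g star + ((∑ i ∈ L, g i) + ∑ i ∈ Rset star L, g i) := by
  rw [← Finset.add_sum_erase Finset.univ g (Finset.mem_univ star), ← Finset.sum_sdiff hL, add_comm (∑ i ∈ L, g i)]
  rfl

lemma fcl_star (star : ι) (L : Finset ι) : fcl star L star = 1 := by simp [fcl]
lemma fcl_L (star : ι) (L : Finset ι) (hL : L ⊆ Finset.univ.erase star) (i : ι) (hi : i ∈ L) : fcl star L i = 0 := by
  have : i ≠ star := Finset.ne_of_mem_erase (hL hi)
  simp [fcl, this, hi]
lemma fcl_R (star : ι) (L : Finset ι) (i : ι) (hi : i ∈ Rset star L) : fcl star L i = 2 := by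
  simp only [Rset, Finset.mem_sdiff, Finset.mem_erase] at hi
  simp [fcl, hi.1.1, hi.2]

/-- sign exponent -/
def sL (e : ι → ι → ℕ) (star : ι) (L : Finset ι) : ℕ :=
  (∑ i ∈ L, ∑ j ∈ Rset star L, e i j) + (∑ i ∈ L, e i star) + ∑ j ∈ Rset star L, e star j

lemma prod_sL (e : ι → ι → ℕ) (star : ι) (L : Finset ι) (hL : L ⊆ Finset.univ.erase star) :
    (∏ i, ∏ j, if fcl star L i < fcl star L j then (-1 : ℤ) ^ e i j else 1) = (-1) ^ sL e star L := by
  have hin : ∀ i, (∏ j, if fcl star L i < fcl star L j then (-1 : ℤ) ^ e i j else 1) =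
      (if fcl star L i < 1 then (-1 : ℤ) ^ e i star else 1) * ((∏ j ∈ L, if fcl star L i < 0 then (-1 : ℤ) ^ e i j else 1) *
        ∏ j ∈ Rset star L, if fcl star L i < 2 then (-1 : ℤ) ^ e i j else 1) := by
    intro i
    rw [prod_split star L hL, fcl_star]
    congr 2
    · exact Finset.prod_congr rfl fun j hj => by rw [fcl_L star L hL j hj]
    · exact Finset.prod_congr rfl fun j hj => by rw [fcl_R star L j hj]
  simp only [hin]
  rw [prod_split star L hL, fcl_star]
  have h1 : ∏ i ∈ L, ((if fcl star L i < 1 then (-1 : ℤ) ^ e i star else 1) * ((∏ j ∈ L, if fcl star L i < 0 then (-1 : ℤ) ^ e i j else 1) *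
        ∏ j ∈ Rset star L, if fcl star L i < 2 then (-1 : ℤ) ^ e i j else 1)) = ∏ i ∈ L, ((-1) ^ e i star * ∏ j ∈ Rset star L, (-1 : ℤ) ^ e i j) := by
    refine Finset.prod_congr rfl fun i hi => ?_
    rw [fcl_L star L hL i hi]; simp
  have h2 : ∏ i ∈ Rset star L, ((if fcl star L i < 1 then (-1 : ℤ) ^ e i star else 1) * ((∏ j ∈ L, if fcl star L i < 0 then (-1 : ℤ) ^ e i j else 1) *
        ∏ j ∈ Rset star L, if fcl star L i < 2 then (-1 : ℤ) ^ e i j else 1)) = 1 := by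
    refine Finset.prod_eq_one fun i hi => ?_
    rw [fcl_R star L i hi]; simp
  rw [h1, h2]
  simp only [Finset.prod_mul_distrib, Finset.prod_pow_eq_pow_sum, sL, pow_add]
  simp [Finset.prod_pow_eq_pow_sum]
  ring

lemma prod_NN_K (star : ι) (L : Finset ι) (hL : L ⊆ Finset.univ.erase star) (μ : ι → ℕ) (hμ : ∀ i, 1 ≤ μ i) (v : ι → ℝ) (e : ι → ι → ℕ)
    (σ : ℝ) (C : Kcl star L → ℝ) (h0 : ∀ k, k.1 = 0 → 0 < C k * (-1)) (h2 : ∀ k, k.1 = 2 → 0 < C k * σ) :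
    ∏ k, NN (C k) (fun i : {i // prcl star L i = k} => μ i) (fun i : {i // prcl star L i = k} => v i) (fun i j : {i // prcl star L i = k} => e i j) =
     NF (-1) μ v e L * NF σ μ v e (Rset star L) := by
  set h : Fin 3 → ℤ := ![NF (-1) μ v e L, 1, NF σ μ v e (Rset star L)] with hh
  have hcases : ∀ i, (i = star ∧ fcl star L i = 1) ∨ (i ∈ L ∧ fcl star L i = 0) ∨ (i ∈ Rset star L ∧ fcl star L i = 2) := by
    intro i
    by_cases h1 : i = star
    · left; exact ⟨h1, by rw [h1, fcl_star]⟩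
    · by_cases h2 : i ∈ L
      · right; left; exact ⟨h2, fcl_L star L hL i h2⟩
      · right; right
        have : i ∈ Rset star L := by simp [Rset, h1, h2]
        exact ⟨this, fcl_R star L i this⟩
  have hf0 : ∀ i, fcl star L i = 0 ↔ i ∈ L := by
    intro i
    refine ⟨fun h => ?_, fcl_L star L hL i⟩
    rcases hcases i with h1 | h1 | h1
    · rw [h1.2] at h; exact absurd h (by decide)
    · exact h1.1
    · rw [h1.2] at h; exact absurd h (by decide)
  have hf2 : ∀ i, fcl star L i = 2 ↔ i ∈ Rset star L := by
    intro i
    refine ⟨fun h => ?_, fcl_R star L i⟩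
    rcases hcases i with h1 | h1 | h1
    · rw [h1.2] at h; exact absurd h (by decide)
    · rw [h1.2] at h; exact absurd h (by decide)
    · exact h1.1
  have hf1 : ∀ i, fcl star L i = 1 ↔ i = star := by
    intro i
    refine ⟨fun h => ?_, by rintro rfl; exact fcl_star _ _⟩
    rcases hcases i with h1 | h1 | h1
    · exact h1.1
    · rw [h1.2] at h; exact absurd h (by decide)
    · rw [h1.2] at h; exact absurd h (by decide)
  have e1 : ∀ k : Kcl star L, NN (C k) (fun i : {i // prcl star L i = k} => μ i) (fun i : {i // prcl star L i = k} => v i) (fun i j : {i // prcl star L i = k} => e i j) = h k.1 := by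
    rintro ⟨s, hs⟩
    have hiff : ∀ i, prcl star L i = ⟨s, hs⟩ ↔ fcl star L i = s := by intro i; simp [prcl]
    have : s = 0 ∨ s = 1 ∨ s = 2 := by omega
    rcases this with rfl | rfl | rfl
    · rw [NN_sign _ (-1) (h0 _ rfl)]
      show _ = NF (-1) μ v e L
      unfold NF
      exact (NN_relabel (-1) (fun i : L => μ i) (fun i : L => v i) (fun i j : L => e i j)
        (Equiv.subtypeEquivRight (fun i => (hiff i).trans (hf0 i))))
    · have : Subsingleton {i // prcl star L i = ⟨1, hs⟩} := ⟨fun i j => Subtype.ext (by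
        rw [(hf1 i.1).1 ((hiff i.1).1 i.2), (hf1 j.1).1 ((hiff j.1).1 j.2)])⟩
      exact NN_subsingleton _ (fun i : {i // prcl star L i = ⟨1, hs⟩} => μ i) (fun i => hμ i) _ _
    · rw [NN_sign _ σ (h2 _ rfl)]
      show _ = NF σ μ v e (Rset star L)
      unfold NF
      exact (NN_relabel σ (fun i : Rset star L => μ i) (fun i : Rset star L => v i) (fun i j : Rset star L => e i j)
        (Equiv.subtypeEquivRight (fun i => (hiff i).trans (hf2 i))))
  rw [Finset.prod_congr rfl fun k _ => e1 k]
  have hempty : ∀ (c : ℝ) (S : Finset ι), S = ∅ → NF c μ v e S = 1 := by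
    rintro c S rfl
    exact NN_subsingleton _ (fun i : (∅ : Finset ι) => μ i) (fun i => hμ i) _ _
  have e2 : ∏ k : Kcl star L, h k.1 = ∏ s, h s := by
    rw [← Finset.prod_subtype (Finset.univ.filter (fun s => ∃ i, fcl star L i = s)) (fun s => by simp) h, Finset.prod_filter]
    refine Finset.prod_congr rfl fun s _ => ?_
    split_ifs with hs
    · rfl
    · push Not at hs
      have : s = 0 ∨ s = 1 ∨ s = 2 := by omega
      rcases this with rfl | rfl | rfl
      · symm; apply hempty
        exact Finset.eq_empty_of_forall_notMem fun i hi => hs i ((hf0 i).2 hi)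
      · rfl
      · symm; apply hempty
        exact Finset.eq_empty_of_forall_notMem fun i hi => hs i ((hf2 i).2 hi)
  rw [e2, Fin.prod_univ_three]
  simp [hh]

end t3
end

noncomputable section
set_option linter.unusedSectionVars false
set_option linter.unusedVariables false
set_option linter.unusedSimpArgs false

section t3
variable {ι : Type*} [Fintype ι]

def PL (star : ι) (L : Finset ι) : Set (ι → ℂ) := {x | ∀ i, i ≠ star → ((x i).re < (x star).re ↔ i ∈ L)}

def vs (v : ι → ℝ) (star : ι) (s : ℝ) : ι → ℝ := fun i => if i = star then -1 else s * v i

def TL (σ : ℝ) (μ : ι → ℕ) (v : ι → ℝ) (e : ι → ι → ℕ) (star : ι) (L : Finset ι) : ℤ :=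
  if σ * (-1) ^ (bL μ star L) = -1 then (-1) ^ sL e star L * (NF (-1) μ v e L * NF σ μ v e (Rset star L)) else 0

def dcl (star : ι) (L : Finset ι) (μ : ι → ℕ) (hμ : ∀ i, 1 ≤ μ i) (c : ℝ) (hc : c ≠ 0) (v : ι → ℝ) : GDat ι (Kcl star L) :=
  haveI : Nonempty (Kcl star L) := ⟨prcl star L star⟩
  mkG (prcl star L) (by rintro ⟨s, i, rfl⟩; exact ⟨i, rfl⟩) μ hμ c hc (fun k => if k.1 = 1 then -1 else 0)
    (fun i => if i = star then 0 else v i)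

lemma fcl_cases (star : ι) (L : Finset ι) (hL : L ⊆ Finset.univ.erase star) (i : ι) :
    (i = star ∧ fcl star L i = 1) ∨ (i ∈ L ∧ fcl star L i = 0) ∨ (i ∈ Rset star L ∧ fcl star L i = 2) := by
  by_cases h1 : i = star
  · left; exact ⟨h1, by rw [h1, fcl_star]⟩
  · by_cases h2 : i ∈ L
    · right; left; exact ⟨h2, fcl_L star L hL i h2⟩
    · right; right
      have : i ∈ Rset star L := by simp [Rset, h1, h2]
      exact ⟨this, fcl_R star L i this⟩

lemma fcl_one (star : ι) (L : Finset ι) (i : ι) : fcl star L i = 1 ↔ i = star := by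
  unfold fcl; split_ifs <;> simp_all

lemma aL_bL (μ : ι → ℕ) (star : ι) (hstar : μ star = 1) (L : Finset ι) (hL : L ⊆ Finset.univ.erase star) :
    (∑ i, μ i) + 1 = aL μ L + bL μ star L := by
  rw [sum_split star L hL, hstar]; unfold aL bL; ring

/-- the unperturbed polynomial -/
lemma t3_C0 (μ : ι → ℕ) (star : ι) (hstar : μ star = 1) (L : Finset ι) (hL : L ⊆ Finset.univ.erase star) (σ γ : ℝ)
    (h : σ * (aL μ L * γ) ^ (aL μ L) * (-(bL μ star L * γ)) ^ (bL μ star L) = -1) :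
    ∃ C0 : ℂ, ∀ s : Fin 3, C0 + ((σ * ((∑ i, μ i) + 1 : ℕ) : ℝ) : ℂ) *
      primX μ (fun i => (Xv (aL μ L) (bL μ star L) γ (fcl star L i) : ℂ)) (Xv (aL μ L) (bL μ star L) γ s) = ((if s = 1 then -1 else 0 : ℝ) : ℂ) := by
  rw [aL_bL μ star hstar L hL]
  set p := ∑ i ∈ L, μ i with hp
  set q := ∑ i ∈ Rset star L, μ i with hq
  have ha : aL μ L = p + 1 := rfl
  have hb : bL μ star L = q + 1 := rfl
  rw [ha, hb] at h ⊢
  set α : ℂ := ((-((q+1:ℕ) * γ) : ℝ) : ℂ) with hα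
  set β : ℂ := (((p+1:ℕ) * γ : ℝ) : ℂ) with hβ
  set ξ : ℂ := ((((p+1:ℕ) - (q+1:ℕ):ℝ) * γ : ℝ) : ℂ) with hξ
  set P0 : ℂ[X] := C (σ:ℂ) * (X - C α) ^ (p+1) * (X - C β) ^ (q+1) with hP0
  set xx : ι → ℂ := fun i => (Xv ((p+1:ℕ):ℝ) ((q+1:ℕ):ℝ) γ (fcl star L i) : ℂ) with hxx
  have hX0 : xx star = ξ := by rw [hxx]; simp only [fcl_star]; rfl
  have hXL : ∀ i ∈ L, xx i = α := by intro i hi; rw [hxx]; simp only [fcl_L star L hL i hi]; rfl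
  have hXR : ∀ i ∈ Rset star L, xx i = β := by intro i hi; rw [hxx]; simp only [fcl_R star L i hi]; rfl
  set c : ℂ := ((σ * ((p + 1 + (q + 1) : ℕ)) : ℝ) : ℂ) with hc
  have hprod : ∏ i, (X - C (xx i)) ^ μ i = (X - C ξ) * ((X - C α) ^ p * (X - C β) ^ q) := by
    rw [prod_split star L hL, hX0, hstar, pow_one,
      Finset.prod_congr rfl (fun i hi => by rw [hXL i hi] : ∀ i ∈ L, (X - C (xx i)) ^ μ i = (X - C α) ^ μ i),
      Finset.prod_congr rfl (fun i hi => by rw [hXR i hi] : ∀ i ∈ Rset star L, (X - C (xx i)) ^ μ i = (X - C β) ^ μ i),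
      Finset.prod_pow_eq_pow_sum, Finset.prod_pow_eq_pow_sum]
  have hder : derivative P0 = derivative (C c * antider (∏ i, (X - C (xx i)) ^ μ i)) := by
    rw [hP0, derivative_two, derivative_C_mul, derivative_antider, hprod]
    have : (p+1 : ℂ[X]) * (X - C β) + (q+1 : ℂ[X]) * (X - C α) = C ((p + 1 + (q+1) : ℕ):ℂ) * (X - C ξ) := by
      rw [hα, hβ, hξ]
      have e1 : (p+1 : ℂ[X]) = C ((p:ℂ)+1) := by simp
      have e2 : (q+1 : ℂ[X]) = C ((q:ℂ)+1) := by simp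
      rw [e1, e2]
      simp only [mul_sub, ← C_mul]
      have : C ((p:ℂ)+1) * X + C ((q:ℂ)+1) * X = C ((p + 1 + (q+1) : ℕ):ℂ) * (X:ℂ[X]) := by
        rw [← add_mul, ← C_add]; congr 2; push_cast; ring
      rw [← this]
      have h2 : C (((p:ℂ)+1) * (((p+1:ℕ) * γ : ℝ) : ℂ)) + C (((q:ℂ)+1) * ((-((q+1:ℕ) * γ) : ℝ) : ℂ)) =
        C (((p + 1 + (q+1) : ℕ):ℂ) * ((((p+1:ℕ) - (q+1:ℕ):ℝ) * γ : ℝ) : ℂ)) := by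
        rw [← C_add]; congr 1; push_cast; ring
      rw [← h2]; ring
    rw [this, hc]
    push_cast
    simp only [C_mul]
    ring
  refine ⟨P0.eval 0 - c * primX μ xx 0, fun s => ?_⟩
  have hev := fun z => eval_sub_eq_of_derivative_eq hder z 0
  simp only [eval_mul, eval_C] at hev
  have hs : ∀ z, P0.eval 0 - c * primX μ xx 0 + c * primX μ xx z = P0.eval z := by
    intro z
    rw [primX_eq_antider, primX_eq_antider]
    linear_combination -(hev z)
  rw [hs]
  have : s = 0 ∨ s = 1 ∨ s = 2 := by omega
  rcases this with rfl | rfl | rfl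
  · have : ((Xv ((p+1:ℕ):ℝ) ((q+1:ℕ):ℝ) γ 0 : ℝ) : ℂ) = α := rfl
    rw [this, hP0]; simp
  · have : ((Xv ((p+1:ℕ):ℝ) ((q+1:ℕ):ℝ) γ 1 : ℝ) : ℂ) = ξ := rfl
    rw [this, hP0, if_pos rfl, ← h]
    simp only [eval_mul, eval_pow, eval_sub, eval_X, eval_C]
    rw [hα, hβ, hξ]
    push_cast
    congr 2
    · congr 1; ring
    · ring
  · have : ((Xv ((p+1:ℕ):ℝ) ((q+1:ℕ):ℝ) γ 2 : ℝ) : ℂ) = β := rfl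
    rw [this, hP0]; simp

lemma t3_sum (μ : ι → ℕ) (star : ι) (hstar : μ star = 1) (L : Finset ι) (hL : L ⊆ Finset.univ.erase star) (γ : ℝ) :
    ∑ i, (μ i : ℂ) * (Xv (aL μ L) (bL μ star L) γ (fcl star L i) : ℂ) = 0 := by
  rw [sum_split star L hL, fcl_star, hstar,
    Finset.sum_congr rfl (fun i hi => by rw [fcl_L star L hL i hi] : ∀ i ∈ L, (μ i : ℂ) * (Xv (aL μ L) (bL μ star L) γ (fcl star L i) : ℂ) = μ i * (Xv (aL μ L) (bL μ star L) γ 0 : ℂ)),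
    Finset.sum_congr rfl (fun i hi => by rw [fcl_R star L i hi] : ∀ i ∈ Rset star L, (μ i : ℂ) * (Xv (aL μ L) (bL μ star L) γ (fcl star L i) : ℂ) = μ i * (Xv (aL μ L) (bL μ star L) γ 2 : ℂ)),
    ← Finset.sum_mul, ← Finset.sum_mul]
  have h1 : (∑ i ∈ L, (μ i:ℂ)) = aL μ L - 1 := by unfold aL; push_cast; ring
  have h2 : (∑ i ∈ Rset star L, (μ i:ℂ)) = bL μ star L - 1 := by unfold bL; push_cast; ring
  rw [h1, h2]
  simp [Xv]
  ring

/-- signs of the outer factors -/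
lemma t3_kap (μ : ι → ℕ) (hμ : ∀ i, 1 ≤ μ i) (star : ι) (hstar : μ star = 1) (L : Finset ι) (hL : L ⊆ Finset.univ.erase star) (σ : ℝ) (hσ : σ = 1 ∨ σ = -1)
    (c : ℝ) (hc : c ≠ 0) (hcσ : 0 < c * σ) (v : ι → ℝ) (γ : ℝ) (hγ : 0 < γ) (hs : σ * (-1) ^ (bL μ star L) = -1) (k : Kcl star L) :
    (k.1 = 0 → 0 < (dcl star L μ hμ c hc v).c * (dcl star L μ hμ c hc v).kap (fun k => Xv (aL μ L) (bL μ star L) γ k.1) k * (-1)) ∧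
    (k.1 = 2 → 0 < (dcl star L μ hμ c hc v).c * (dcl star L μ hμ c hc v).kap (fun k => Xv (aL μ L) (bL μ star L) γ k.1) k * σ) := by
  have ha : (0:ℝ) < aL μ L := by unfold aL; positivity
  have hb : (0:ℝ) < bL μ star L := by unfold bL; positivity
  have hm := Xv_mono _ _ γ ha hb hγ
  set d := dcl star L μ hμ c hc v with hd
  have hdm : d.mu = μ := rfl
  have hdc : d.c = c := rfl
  have hdp : ∀ i, (d.pr i).1 = fcl star L i := fun i => rfl
  rw [hdc]
  have hkey : d.kap (fun k => Xv (aL μ L) (bL μ star L) γ k.1) k = ∏ i, if fcl star L i = k.1 then 1 else (Xv (aL μ L) (bL μ star L) γ k.1 - Xv (aL μ L) (bL μ star L) γ (fcl star L i)) ^ μ i := by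
    unfold GDat.kap
    rw [← Finset.prod_subset (Finset.subset_univ ((d.fib k)ᶜ))]
    · refine Finset.prod_congr rfl fun i hi => ?_
      rw [Finset.mem_compl, GDat.mem_fib] at hi
      have hne : ¬ fcl star L i = k.1 := fun h => hi (Subtype.ext h)
      rw [if_neg hne]
      rfl
    · intro i _ hi
      rw [Finset.mem_compl, not_not, GDat.mem_fib] at hi
      have hee : fcl star L i = k.1 := by rw [← hi]; rfl
      rw [if_pos hee]
  rw [hkey]
  constructor
  · intro hk
    rw [hk, prod_split star L hL, fcl_star, hstar, pow_one, if_neg (by decide),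
      Finset.prod_eq_one (fun i hi => by rw [if_pos (fcl_L star L hL i hi)]), one_mul,
      Finset.prod_congr rfl (fun i hi => by rw [fcl_R star L i hi, if_neg (by decide)] : ∀ i ∈ Rset star L, (if fcl star L i = 0 then (1:ℝ) else (Xv (aL μ L) (bL μ star L) γ 0 - Xv (aL μ L) (bL μ star L) γ (fcl star L i)) ^ μ i) = (Xv (aL μ L) (bL μ star L) γ 0 - Xv (aL μ L) (bL μ star L) γ 2) ^ μ i),
      Finset.prod_pow_eq_pow_sum]
    have h1 : 0 < Xv (aL μ L) (bL μ star L) γ 1 - Xv (aL μ L) (bL μ star L) γ 0 := sub_pos.2 (hm (by decide))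
    have h2 : 0 < Xv (aL μ L) (bL μ star L) γ 2 - Xv (aL μ L) (bL μ star L) γ 0 := sub_pos.2 (hm (by decide))
    set u := Xv (aL μ L) (bL μ star L) γ 1 - Xv (aL μ L) (bL μ star L) γ 0 with hu
    set w := Xv (aL μ L) (bL μ star L) γ 2 - Xv (aL μ L) (bL μ star L) γ 0 with hw
    have e1 : Xv (aL μ L) (bL μ star L) γ 0 - Xv (aL μ L) (bL μ star L) γ 1 = -u := by rw [hu]; ring
    have e2 : Xv (aL μ L) (bL μ star L) γ 0 - Xv (aL μ L) (bL μ star L) γ 2 = (-1) * w := by rw [hw]; ring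
    rw [e1, e2, mul_pow]
    have h3 : σ * (-1:ℝ) ^ (∑ i ∈ Rset star L, μ i) = 1 := by
      unfold bL at hs; rw [pow_succ] at hs; linarith
    have h4 : (-1:ℝ) ^ (∑ i ∈ Rset star L, μ i) = σ := by
      rcases hσ with h | h <;> rw [h] at h3 ⊢ <;> linarith
    rw [h4]
    have : 0 < (c * σ) * (u * w ^ (∑ i ∈ Rset star L, μ i)) := by positivity
    linarith
  · intro hk
    rw [hk, prod_split star L hL, fcl_star, hstar, pow_one, if_neg (by decide),
      Finset.prod_eq_one (fun i hi => by rw [if_pos (fcl_R star L i hi)] : ∀ i ∈ Rset star L, (if fcl star L i = 2 then (1:ℝ) else _) = 1), mul_one,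
      Finset.prod_congr rfl (fun i hi => by rw [fcl_L star L hL i hi, if_neg (by decide)] : ∀ i ∈ L, (if fcl star L i = 2 then (1:ℝ) else (Xv (aL μ L) (bL μ star L) γ 2 - Xv (aL μ L) (bL μ star L) γ (fcl star L i)) ^ μ i) = (Xv (aL μ L) (bL μ star L) γ 2 - Xv (aL μ L) (bL μ star L) γ 0) ^ μ i),
      Finset.prod_pow_eq_pow_sum]
    have h1 : 0 < Xv (aL μ L) (bL μ star L) γ 2 - Xv (aL μ L) (bL μ star L) γ 1 := sub_pos.2 (hm (by decide))
    have h2 : 0 < Xv (aL μ L) (bL μ star L) γ 2 - Xv (aL μ L) (bL μ star L) γ 0 := sub_pos.2 (hm (by decide))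
    rw [mul_right_comm]
    positivity

end t3
end

noncomputable section
set_option linter.unusedSectionVars false
set_option linter.unusedVariables false
set_option linter.unusedSimpArgs false

section t3
variable {ι : Type*} [Fintype ι]

lemma NF_congr_v {Λ : Type*} (c : ℝ) (μ : Λ → ℕ) (v v' : Λ → ℝ) (e : Λ → Λ → ℕ) (S : Finset Λ) (h : ∀ i ∈ S, v i = v' i) :
    NF c μ v e S = NF c μ v' e S := by
  unfold NF
  congr 1
  funext i
  exact h i i.2

lemma PL_nhds (star : ι) (L : Finset ι) (hL : L ⊆ Finset.univ.erase star) (X : Fin 3 → ℝ) (hX : StrictMono X) :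
    PL star L ∈ nhds (fun i => (X (fcl star L i) : ℂ)) := by
  have h : ∀ i, ∀ᶠ x : ι → ℂ in nhds (fun i => (X (fcl star L i) : ℂ)), i ≠ star → ((x i).re < (x star).re ↔ i ∈ L) := by
    intro i
    have hci : ∀ j, Filter.Tendsto (fun x : ι → ℂ => (x j).re) (nhds (fun i => (X (fcl star L i) : ℂ))) (nhds (X (fcl star L j))) := by
      intro j
      have : Continuous (fun x : ι → ℂ => (x j).re) := Complex.continuous_re.comp (continuous_apply j)
      have h2 := this.tendsto (fun i => (X (fcl star L i) : ℂ))
      simpa using h2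
    rcases fcl_cases star L hL i with ⟨h, h'⟩ | ⟨h, h'⟩ | ⟨h, h'⟩
    · exact Filter.Eventually.of_forall fun x hx => absurd h hx
    · have hlt : X (fcl star L i) < X (fcl star L star) := by rw [h', fcl_star]; exact hX (by decide)
      filter_upwards [(hci i).eventually_lt (hci star) hlt] with x hx _
      exact ⟨fun _ => h, fun _ => hx⟩
    · have hlt : X (fcl star L star) < X (fcl star L i) := by rw [h', fcl_star]; exact hX (by decide)
      filter_upwards [(hci star).eventually_lt (hci i) hlt] with x hx _
      refine ⟨fun h2 => absurd h2 (not_lt.2 hx.le), fun h2 => ?_⟩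
      simp only [Rset, Finset.mem_sdiff] at h
      exact absurd h2 h.2
  have := Filter.eventually_all.2 h
  exact this

theorem t3_L (μ : ι → ℕ) (hμ : ∀ i, 1 ≤ μ i) (star : ι) (hstar : μ star = 1) (L : Finset ι) (hL : L ⊆ Finset.univ.erase star)
    (σ : ℝ) (hσ : σ = 1 ∨ σ = -1) (v : ι → ℝ) (e : ι → ι → ℕ)
    (he : ∀ i i' j j', μ i = μ i' → v i = v i' → μ j = μ j' → v j = v j' → e i j = e i' j')
    (hreal : σ = 1 ∨ Odd ((∑ i, μ i) + 1) ∨ ∃ i0, i0 ≠ star ∧ ∀ j, j ≠ star → v j = v i0 → j = i0) :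
    ∀ᶠ s in nhdsWithin (0:ℝ) (Set.Ioi 0), ∑ᶠ x ∈ {x | x ∈ Sol (σ * ((∑ i, μ i) + 1 : ℕ)) μ (vs v star s) ∧ x ∈ PL star L}, sgn e x = TL σ μ v e star L := by
  have hσ0 : σ ≠ 0 := by rcases hσ with h | h <;> rw [h] <;> norm_num
  have hσσ : σ * σ = 1 := by rcases hσ with h | h <;> rw [h] <;> norm_num
  have hn0 : (0:ℝ) < (((∑ i, μ i) + 1 : ℕ) : ℝ) := by positivity
  set c : ℝ := σ * ((∑ i, μ i) + 1 : ℕ) with hcdef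
  have hc : c ≠ 0 := mul_ne_zero hσ0 hn0.ne'
  set d := dcl star L μ hμ c hc v with hd
  have hM := d.M_pos
  have hpr : d.pr = prcl star L := rfl
  have ha : (0:ℝ) < aL μ L := by unfold aL; positivity
  have hb : (0:ℝ) < bL μ star L := by unfold bL; positivity
  have ha' : 0 < aL μ L := by unfold aL; positivity
  have hb' : 0 < bL μ star L := by unfold bL; positivity
  have hdv : ∀ t, d.v t = vs v star (t ^ d.M) := by
    intro t
    funext i
    show (if fcl star L i = 1 then (-1:ℝ) else 0) + t ^ d.M * (if i = star then 0 else v i) = _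
    simp only [fcl_one]
    unfold vs
    split_ifs <;> simp
  -- description of limits
  have hlim : ∀ l : Ultrafilter ℝ, (l : Filter ℝ) ≤ nhdsWithin 0 (Set.Ioi 0) → ∀ (x : ℝ → ι → ℂ) (x0 : ι → ℂ),
      (∀ᶠ t in l, x t ∈ Sol d.c d.mu (d.v t) ∧ x t ∈ PL star L) → Filter.Tendsto x l (nhds x0) → LimConc μ star L σ x0 := by
    intro l hl x x0 hx hx0
    have ht0 : Filter.Tendsto (fun t : ℝ => t) l (nhds 0) := (hl.trans nhdsWithin_le_nhds)
    have hv : Filter.Tendsto d.v l (nhds (fun i => if i = star then -1 else 0)) := by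
      rw [tendsto_pi_nhds]; intro i
      have := (tendsto_const_nhds (x := d.vb (d.pr i))).add (((continuous_pow d.M).tendsto _ |>.comp ht0).mul (tendsto_const_nhds (x := d.v1 i)))
      simp only [zero_pow d.M_pos, zero_mul, add_zero] at this
      have h2 : d.vb (d.pr i) = if i = star then -1 else 0 := by
        show (if fcl star L i = 1 then (-1:ℝ) else 0) = _
        simp only [fcl_one]
      rw [h2] at this
      have h3 : (fun x => d.v x i) = fun x => d.vb (d.pr i) + x ^ d.M * d.v1 i := rfl
      rw [h3, h2]
      exact this
    obtain ⟨hsum, ⟨τ, t1, t2, t3, t4⟩, C0, hC⟩ := Sol.limit_eq l μ c d.v _ hv x (hx.mono fun t h => h.1) x0 hx0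
    have hre : ∀ i, Filter.Tendsto (fun t => (x t i).re) l (nhds (x0 i).re) := fun i =>
      (Complex.continuous_re.tendsto _).comp ((tendsto_pi_nhds.1 hx0) i)
    have hτs : τ star = star := by
      have := t2 star
      rw [if_pos rfl] at this
      by_contra h
      rw [if_neg h] at this; norm_num at this
    refine t3_limit μ star hstar L hL σ hσ x0 ?_ ?_ hsum τ t3 hτs C0 ?_ ?_
    · intro i hi
      refine le_of_tendsto_of_tendsto (hre i) (hre star) (hx.mono fun t h => ?_)
      exact le_of_lt ((h.2 i (Finset.ne_of_mem_erase (hL hi))).2 hi)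
    · intro i hi
      simp only [Rset, Finset.mem_sdiff, Finset.mem_erase] at hi
      refine le_of_tendsto_of_tendsto (hre star) (hre i) (hx.mono fun t h => ?_)
      exact not_lt.1 fun h2 => hi.2 ((h.2 i hi.1.1).1 h2)
    · intro i
      have := hC i
      rw [this]
      split_ifs <;> simp
    · rcases hreal with h | h | ⟨i0, h1, h2⟩
      · exact Or.inl h
      · exact Or.inr (Or.inl h)
      · refine Or.inr (Or.inr ⟨i0, h1, ?_⟩)
        have hpos : ∀ᶠ t in (l : Filter ℝ), 0 < t := hl self_mem_nhdsWithin
        obtain ⟨t, ht, ht'⟩ := (t4.and hpos).exists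
        have hne : τ i0 ≠ star := fun h => h1 (τ.injective (h.trans hτs.symm))
        have h3 := ht i0
        rw [hdv] at h3
        simp only [vs, if_neg hne, if_neg h1] at h3
        exact h2 _ hne (mul_left_cancel₀ (pow_pos ht' _).ne' h3)
  suffices hmain : ∀ᶠ t in nhdsWithin (0:ℝ) (Set.Ioi 0), ∑ᶠ x ∈ {x | x ∈ Sol d.c d.mu (d.v t) ∧ x ∈ PL star L}, sgn e x = TL σ μ v e star L by
    filter_upwards [(tendsto_root d.M d.M_pos).eventually hmain, self_mem_nhdsWithin] with s hs hs0
    rw [hdv, Real.rpow_inv_natCast_pow (le_of_lt hs0) d.M_pos] at hs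
    exact hs
  by_cases hcase : σ * (-1) ^ (bL μ star L) = -1
  · obtain ⟨γ, hγ, hγe⟩ := exists_gamma (aL μ L) (bL μ star L) ha' hb' σ hcase
    have hmono := Xv_mono _ _ γ ha hb hγ
    set X : Kcl star L → ℝ := fun k => Xv (aL μ L) (bL μ star L) γ k.1 with hX
    have hXinj : Function.Injective X := fun k k' h => Subtype.ext (hmono.injective h)
    obtain ⟨C0, hC0⟩ := t3_C0 μ star hstar L hL σ γ hγe
    obtain ⟨hfin, hval⟩ := d.Z0_sum X hXinj (t3_sum μ star hstar L hL γ) C0 (fun k => hC0 k.1) e (by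
      intro i i' j j' h1 h2 h3 h4 h5 h6
      have key : ∀ i i', d.vb (d.pr i) = d.vb (d.pr i') → d.v1 i = d.v1 i' → v i = v i' := by
        intro i i' h2 h3
        have h2' : (if fcl star L i = 1 then (-1:ℝ) else 0) = (if fcl star L i' = 1 then (-1:ℝ) else 0) := h2
        have h3' : (if i = star then (0:ℝ) else v i) = if i' = star then (0:ℝ) else v i' := h3
        simp only [fcl_one] at h2'
        by_cases g1 : i = star <;> by_cases g2 : i' = star
        · rw [g1, g2]
        · rw [if_pos g1, if_neg g2] at h2'; norm_num at h2'
        · rw [if_neg g1, if_pos g2] at h2'; norm_num at h2'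
        · rwa [if_neg g1, if_neg g2] at h3'
      exact he i i' j j' h1 (key _ _ h2 h3) h4 (key _ _ h5 h6))
    have hm := d.main {fun k => (X k : ℂ)} (PL star L) e (by
        rintro Y hY; rw [Set.mem_singleton_iff] at hY; subst hY
        exact fun k k' h => hXinj (Complex.ofReal_injective h)) (by
        rintro Y hY; rw [Set.mem_singleton_iff] at hY; subst hY
        exact PL_nhds star L hL _ hmono) (by
        intro l hl x x0 hx hx0
        obtain ⟨γ', hγ', hγe', h1, h2, h3⟩ := hlim l hl x x0 hx hx0
        have := gamma_unique _ _ ha' hb' σ γ γ' hγ hγ' hγe hγe'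
        subst this
        refine ⟨_, rfl, ?_⟩
        funext i
        show x0 i = ((Xv (aL μ L) (bL μ star L) γ (fcl star L i) : ℝ) : ℂ)
        rcases fcl_cases star L hL i with ⟨h, h'⟩ | ⟨h, h'⟩ | ⟨h, h'⟩
        · rw [h', h, h1]; rfl
        · rw [h', h2 i h]; rfl
        · rw [h', h3 i h]; rfl) hfin
    filter_upwards [hm] with t ht
    rw [ht.2, hval]
    unfold TL
    rw [if_pos hcase]
    congr 1
    · rw [← prod_sL e star L hL]
      refine Finset.prod_congr rfl fun i _ => Finset.prod_congr rfl fun j _ => ?_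
      have : X (d.pr i) < X (d.pr j) ↔ fcl star L i < fcl star L j := hmono.lt_iff_lt
      simp only [this]
    · have hk := t3_kap μ hμ star hstar L hL σ hσ c hc (by rw [hcdef]; nlinarith) v γ hγ hcase
      have := prod_NN_K star L hL μ hμ d.v1 e σ (fun k => d.c * d.kap X k) (fun k => (hk k).1) (fun k => (hk k).2)
      have h2 : ∀ i ∈ L, d.v1 i = v i := by
        intro i hi
        show (if i = star then (0:ℝ) else v i) = v i
        rw [if_neg (Finset.ne_of_mem_erase (hL hi))]
      have h3 : ∀ i ∈ Rset star L, d.v1 i = v i := by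
        intro i hi
        simp only [Rset, Finset.mem_sdiff, Finset.mem_erase] at hi
        show (if i = star then (0:ℝ) else v i) = v i
        rw [if_neg hi.1.1]
      rw [NF_congr_v _ _ _ _ _ _ h2, NF_congr_v _ _ _ _ _ _ h3] at this
      rw [← this]
      refine Finset.prod_congr rfl fun k _ => ?_
      exact congrArg (fun I => @NN {i // prcl star L i = k} I (d.c * d.kap X k) (fun i => μ i) (fun i => d.v1 i) (fun i j => e i j))
        (Subsingleton.elim _ _)
  · have hZ : d.Z0 ∅ = ∅ := by ext q; simp [GDat.Z0]
    have hm := d.main ∅ (PL star L) e (by simp) (by simp) (by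
        intro l hl x x0 hx hx0
        obtain ⟨γ', hγ', hγe', h1, h2, h3⟩ := hlim l hl x x0 hx hx0
        exact absurd (gamma_sign _ _ ha' hb' σ hσ γ' hγ' hγe') hcase) (by rw [hZ]; exact Set.finite_empty)
    filter_upwards [hm] with t ht
    rw [ht.2, hZ, finsum_mem_empty]
    unfold TL
    rw [if_neg hcase]

theorem T3 (μ : ι → ℕ) (hμ : ∀ i, 1 ≤ μ i) (star : ι) (hstar : μ star = 1)
    (σ : ℝ) (hσ : σ = 1 ∨ σ = -1) (v : ι → ℝ) (hv : ∀ i, i ≠ star → v star < v i) (e : ι → ι → ℕ)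
    (he : ∀ i i' j j', μ i = μ i' → v i = v i' → μ j = μ j' → v j = v j' → e i j = e i' j')
    (hreal : σ = 1 ∨ Odd ((∑ i, μ i) + 1) ∨ ∃ i0, i0 ≠ star ∧ ∀ j, j ≠ star → v j = v i0 → j = i0) :
    NN σ μ v e = ∑ L ∈ (Finset.univ.erase star).powerset, TL σ μ v e star L := by
  have hσ0 : σ ≠ 0 := by rcases hσ with h | h <;> rw [h] <;> norm_num
  have hσσ : σ * σ = 1 := by rcases hσ with h | h <;> rw [h] <;> norm_num
  have hn0 : (0:ℝ) < (((∑ i, μ i) + 1 : ℕ) : ℝ) := by positivity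
  set c : ℝ := σ * ((∑ i, μ i) + 1 : ℕ) with hcdef
  have hc : c ≠ 0 := mul_ne_zero hσ0 hn0.ne'
  rw [NN_sign σ c (by rw [hcdef]; nlinarith)]
  have h1 : ∀ᶠ s in nhdsWithin (0:ℝ) (Set.Ioi 0), ∀ L ∈ (Finset.univ.erase star).powerset,
      ∑ᶠ x ∈ {x | x ∈ Sol c μ (vs v star s) ∧ x ∈ PL star L}, sgn e x = TL σ μ v e star L := by
    rw [Filter.eventually_all_finset]
    intro L hL
    exact t3_L μ hμ star hstar L (Finset.mem_powerset.1 hL) σ hσ v e he hreal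
  have h2 : ∀ᶠ s in nhdsWithin (0:ℝ) (Set.Ioi 0), ∀ i, -1 < s * v i := by
    rw [Filter.eventually_all]
    intro i
    have : Filter.Tendsto (fun s : ℝ => s * v i) (nhdsWithin 0 (Set.Ioi 0)) (nhds (0 * v i)) :=
      ((continuous_id.mul continuous_const).tendsto 0).mono_left nhdsWithin_le_nhds
    exact this.eventually (lt_mem_nhds (by rw [zero_mul]; norm_num))
  obtain ⟨s, hs1, hs2, hs0⟩ := (h1.and (h2.and self_mem_nhdsWithin)).exists
  have hs0 : 0 < s := hs0
  rw [NN_order μ hμ c hc e v (vs v star s) (by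
    intro i j
    unfold vs
    by_cases hi : i = star <;> by_cases hj : j = star
    · simp [hi, hj]
    · rw [if_pos hi, if_neg hj, hi]; exact ⟨fun _ => hs2 j, fun _ => hv j hj⟩
    · rw [if_neg hi, if_pos hj, hj]
      exact ⟨fun h => absurd h (not_lt.2 (hv i hi).le), fun h => absurd h (not_lt.2 (hs2 i).le)⟩
    · rw [if_neg hi, if_neg hj]; exact (mul_lt_mul_iff_right₀ hs0).symm)]
  have hfin := Sol.finite μ hμ c hc (vs v star s)
  unfold NN
  set g : (ι → ℂ) → Finset ι := fun x => Finset.univ.filter (fun i => i ≠ star ∧ (x i).re < (x star).re) with hg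
  have hgP : ∀ x L, L ∈ (Finset.univ.erase star).powerset → (g x = L ↔ x ∈ PL star L) := by
    intro x L hL
    rw [Finset.mem_powerset] at hL
    constructor
    · intro h i hi
      rw [← h]; simp [hg, hi]
    · intro h
      ext i
      simp only [hg, Finset.mem_filter, Finset.mem_univ, true_and]
      constructor
      · rintro ⟨h1, h2⟩; exact (h i h1).1 h2
      · intro h1
        have := Finset.ne_of_mem_erase (hL h1)
        exact ⟨this, (h i this).2 h1⟩
  rw [finsum_mem_eq_finite_toFinset_sum _ hfin, ← Finset.sum_fiberwise_of_maps_to (t := (Finset.univ.erase star).powerset) (g := g) (by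
    intro x _
    rw [Finset.mem_powerset]
    intro i hi
    simp only [hg, Finset.mem_filter] at hi
    simp [hi.2.1])]
  refine Finset.sum_congr rfl fun L hL => ?_
  rw [← hs1 L hL]
  rw [← finsum_mem_coe_finset]
  refine finsum_mem_congr ?_ fun _ _ => rfl
  ext x
  simp only [Finset.coe_filter, Set.Finite.mem_toFinset, Set.mem_ofPred_eq, hgP x L hL]

end t3
end

noncomputable section
set_option linter.unusedSectionVars false
set_option linter.unusedVariables false
set_option linter.unusedSimpArgs false

/-- parity weight of a pair of critical points -/
def eE {Λ : Type*} (μ : Λ → ℕ) (v : Λ → ℝ) (x y : Λ) : ℕ :=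
  μ y + if v x = v y then μ y + 1 + (if μ y < μ x then 1 else 0) else 0

lemma eE_inv {Λ : Type*} (μ : Λ → ℕ) (v : Λ → ℝ) (i i' j j' : Λ) (h1 : μ i = μ i') (h2 : v i = v i') (h3 : μ j = μ j')
    (h4 : v j = v j') : eE μ v i j = eE μ v i' j' := by
  unfold eE; rw [h1, h2, h3, h4]

section amb
variable {Λ : Type*}

lemma NF_equiv (c : ℝ) (hc : c ≠ 0) (μ : Λ → ℕ) (hμ : ∀ i, 1 ≤ μ i) (v : Λ → ℝ) (S T : Finset Λ) (f : S ≃ T)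
    (h1 : ∀ i, μ (f i) = μ i) (h2 : ∀ i j, v (f i) < v (f j) ↔ v i < v j) :
    NF c μ v (eE μ v) S = NF c μ v (eE μ v) T := by
  unfold NF
  rw [← NN_relabel c (fun i : T => μ i) (fun i : T => v i) (fun i j : T => eE μ v i j) f]
  have heq : ∀ i j, v (f i) = v (f j) ↔ v i = v j := by
    intro i j
    have a := h2 i j
    have b := h2 j i
    constructor
    · intro h
      rcases lt_trichotomy (v i) (v j) with g | g | g
      · exact absurd (a.2 g) (by rw [h]; exact lt_irrefl _)
      · exact g
      · exact absurd (b.2 g) (by rw [h]; exact lt_irrefl _)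
    · intro h
      rcases lt_trichotomy (v (f i)) (v (f j)) with g | g | g
      · exact absurd (a.1 g) (by rw [h]; exact lt_irrefl _)
      · exact g
      · exact absurd (b.1 g) (by rw [h]; exact lt_irrefl _)
  have e1 : (fun i : S => μ (f i)) = fun i : S => μ i := by funext i; exact h1 i
  have e2 : (fun i j : S => eE μ v (f i) (f j)) = fun i j : S => eE μ v i j := by
    funext i j
    unfold eE
    simp only [h1, heq]
  rw [e1, e2]
  exact NN_order (fun i : S => μ i) (fun i => hμ i) c hc (fun i j : S => eE μ v i j) (fun i : S => v i) (fun i : S => v (f i)) (fun i j => (h2 i j).symm)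

lemma NF_map (c : ℝ) (μ : Λ → ℕ) (v : Λ → ℝ) (e : Λ → Λ → ℕ) (T : Finset Λ) (L : Finset T) :
    NF c (fun i : T => μ i) (fun i : T => v i) (fun i j : T => e i j) L = NF c μ v e (L.map (Function.Embedding.subtype _)) := by
  unfold NF
  set f : L ≃ (L.map (Function.Embedding.subtype (· ∈ T))) := 
    Equiv.ofBijective (fun i => ⟨i.1.1, Finset.mem_map_of_mem (Function.Embedding.subtype _) i.2⟩) (by
      constructor
      · intro i j h
        have := congrArg Subtype.val h
        exact Subtype.ext (Subtype.ext this)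
      · rintro ⟨x, hx⟩
        obtain ⟨y, hy, rfl⟩ := Finset.mem_map.1 hx
        exact ⟨⟨y, hy⟩, rfl⟩) with hf
  exact NN_relabel c (fun i : L.map (Function.Embedding.subtype (· ∈ T)) => μ i) (fun i : L.map (Function.Embedding.subtype (· ∈ T)) => v i)
    (fun i j : L.map (Function.Embedding.subtype (· ∈ T)) => e i j) f

theorem T3F [DecidableEq Λ] (μ : Λ → ℕ) (hμ : ∀ i, 1 ≤ μ i) (T : Finset Λ) (star : Λ) (hsT : star ∉ T) (hstar : μ star = 1)
    (σ : ℝ) (hσ : σ = 1 ∨ σ = -1) (v : Λ → ℝ) (hv : ∀ i ∈ T, v star < v i)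
    (hreal : σ = 1 ∨ Odd ((∑ i ∈ T, μ i) + 2) ∨ ∃ i0 ∈ T, ∀ j ∈ T, v j = v i0 → j = i0) :
    NF σ μ v (eE μ v) (insert star T) = ∑ L ∈ T.powerset, 
      if σ * (-1) ^ ((∑ i ∈ T \ L, μ i) + 1) = -1 then 
        (-1) ^ ((∑ i ∈ L, ∑ j ∈ T \ L, eE μ v i j) + (∑ i ∈ L, eE μ v i star) + ∑ j ∈ T \ L, eE μ v star j) * 
          (NF (-1) μ v (eE μ v) L * NF σ μ v (eE μ v) (T \ L)) else 0 := by
  set T' := insert star T with hT'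
  set st : T' := ⟨star, Finset.mem_insert_self _ _⟩ with hst
  have hne : ∀ i : T', i ≠ st ↔ i.1 ∈ T := by
    rintro ⟨i, hi⟩
    rw [Ne, Subtype.ext_iff]
    simp only [hst]
    rw [hT', Finset.mem_insert] at hi
    constructor
    · intro h; exact hi.resolve_left h
    · intro h h'; exact hsT (h' ▸ h)
  have hsum : (∑ i : T', μ i) + 1 = (∑ i ∈ T, μ i) + 2 := by
    rw [Finset.sum_coe_sort T' μ, hT', Finset.sum_insert hsT, hstar]; ring
  have hmain := T3 (fun i : T' => μ i) (fun i => hμ i) st hstar σ hσ (fun i : T' => v i) (fun i hi => hv i ((hne i).1 hi))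
    (fun i j : T' => eE μ v i j) (fun i i' j j' h1 h2 h3 h4 => eE_inv μ v i i' j j' h1 h2 h3 h4) (by
      rcases hreal with h | h | ⟨i0, h, h'⟩
      · exact Or.inl h
      · right; left; rw [hsum]; exact h
      · right; right
        refine ⟨⟨i0, Finset.mem_insert_of_mem h⟩, (hne _).2 h, fun j hj hj' => Subtype.ext (h' j ((hne j).1 hj) hj')⟩)
  show NN σ _ _ _ = _
  rw [hmain]
  set emb := Function.Embedding.subtype (· ∈ T') with hemb
  have himg : (Finset.univ.erase st).map emb = T := by
    ext x
    simp only [Finset.mem_map, Finset.mem_erase, Finset.mem_univ, and_true]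
    constructor
    · rintro ⟨y, hy, rfl⟩; exact (hne y).1 hy
    · intro hx; exact ⟨⟨x, Finset.mem_insert_of_mem hx⟩, (hne _).2 hx, rfl⟩
  rw [← himg]
  have hpow : ((Finset.univ.erase st).map emb).powerset = (Finset.univ.erase st).powerset.map (Finset.mapEmbedding emb).toEmbedding := by
    ext A
    rw [Finset.mem_powerset, Finset.subset_map_iff, Finset.mem_map]
    constructor
    · rintro ⟨u, hu, rfl⟩; exact ⟨u, Finset.mem_powerset.2 hu, rfl⟩
    · rintro ⟨u, hu, rfl⟩; exact ⟨u, Finset.mem_powerset.1 hu, rfl⟩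
  rw [hpow, Finset.sum_map]
  refine Finset.sum_congr (by congr!) fun L hL => ?_
  rw [Finset.mem_powerset] at hL
  unfold TL bL sL
  simp only [NF_map]
  have hR : (Finset.univ.erase st).map emb \ L.map emb = (Rset st L).map emb := by
    ext x
    simp only [Rset, Finset.mem_sdiff, Finset.mem_map, Finset.mem_erase, Finset.mem_univ, and_true]
    constructor
    · rintro ⟨⟨y, hy, rfl⟩, h2⟩; exact ⟨y, ⟨hy, fun h => h2 ⟨y, h, rfl⟩⟩, rfl⟩
    · rintro ⟨y, ⟨hy, h2⟩, rfl⟩; exact ⟨⟨y, hy, rfl⟩, fun ⟨z, hz, hz'⟩ => h2 (emb.injective hz' ▸ hz)⟩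
  have hmapL : (Finset.mapEmbedding emb).toEmbedding L = L.map emb := rfl
  rw [hmapL, hR]
  simp only [Finset.sum_map]
  rfl

end amb
end

noncomputable section
set_option linter.unusedSectionVars false
set_option linter.unusedVariables false
set_option linter.unusedSimpArgs false

section rec
variable {U : Type*}

def ME (w : U → ℕ) : U ⊕ ℕ → ℕ := Sum.elim w (fun _ => 1)
def VE (vU : U → ℝ) (K : ℝ) : U ⊕ ℕ → ℝ := Sum.elim vU (fun j => -(K + j))

def cc (w : U → ℕ) (vU : U → ℝ) (K σ : ℝ) (S : Finset U) (m : ℕ) : ℤ :=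
  NF σ (ME w) (VE vU K) (eE (ME w) (VE vU K)) (S.disjSum (Finset.range m))

def BB (w : U → ℕ) (vU : U → ℝ) (S T : Finset U) : ℕ := (∑ i ∈ S, ∑ j ∈ T, eE w vU i j) + S.card * ∑ j ∈ T, w j

lemma ME_pos (w : U → ℕ) (hw : ∀ i, 1 ≤ w i) : ∀ i, 1 ≤ ME w i := by
  rintro (i | j)
  · exact hw i
  · exact le_refl 1

lemma cc_card (w : U → ℕ) (hw : ∀ i, 1 ≤ w i) (vU : U → ℝ) (K : ℝ) (hK : ∀ i, -K < vU i) (σ : ℝ) (hσ : σ ≠ 0) (S : Finset U) (A : Finset ℕ) :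
    NF σ (ME w) (VE vU K) (eE (ME w) (VE vU K)) (S.disjSum A) = cc w vU K σ S A.card := by
  unfold cc
  symm
  set g : ℕ → ℕ := fun j => if h : j < A.card then A.orderEmbOfFin rfl ⟨j, h⟩ else 0 with hg
  have hgA : ∀ j, j < A.card → g j ∈ A := by
    intro j hj; simp only [hg, dif_pos hj]; exact Finset.orderEmbOfFin_mem _ _ _
  have hglt : ∀ a b, a < A.card → b < A.card → (g a < g b ↔ a < b) := by
    intro a b ha hb
    simp only [hg, dif_pos ha, dif_pos hb]
    rw [OrderEmbedding.lt_iff_lt]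
    exact Iff.rfl
  have hgsurj : ∀ x ∈ A, ∃ j, j < A.card ∧ g j = x := by
    intro x hx
    have : x ∈ Set.range (A.orderEmbOfFin rfl) := by rw [Finset.range_orderEmbOfFin]; exact hx
    obtain ⟨j, hj⟩ := this
    refine ⟨j, j.2, ?_⟩
    simp only [hg, dif_pos j.2]; exact hj
  have hmem : ∀ x : U ⊕ ℕ, x ∈ S.disjSum (Finset.range A.card) → Sum.map id g x ∈ S.disjSum A := by
    rintro (i | j) h
    · simpa using h
    · simp only [Finset.inr_mem_disjSum, Finset.mem_range] at h
      simpa using hgA j h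
  have hbound : ∀ i (j : ℕ), VE vU K (Sum.inr j) < VE vU K (Sum.inl i) := by
    intro i j
    show -(K + (j:ℝ)) < vU i
    have := hK i
    have h2 : (0:ℝ) ≤ j := by positivity
    linarith
  refine NF_equiv σ hσ _ (ME_pos w hw) _ _ _ (Equiv.ofBijective (fun x => ⟨Sum.map id g x.1, hmem x.1 x.2⟩) ⟨?_, ?_⟩) ?_ ?_
  · rintro ⟨x, hx⟩ ⟨y, hy⟩ h
    have h' : Sum.map id g x = Sum.map id g y := congrArg Subtype.val h
    apply Subtype.ext
    rcases x with i | a <;> rcases y with j | b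
    · simpa using h'
    · simp at h'
    · simp at h'
    · simp only [Finset.inr_mem_disjSum, Finset.mem_range] at hx hy
      have h'' : g a = g b := by simpa using h'
      rcases lt_trichotomy a b with h1 | h1 | h1
      · have := (hglt a b hx hy).2 h1; omega
      · show Sum.inr a = Sum.inr b
        rw [h1]
      · have := (hglt b a hy hx).2 h1; omega
  · rintro ⟨x, hx⟩
    rcases x with i | a
    · exact ⟨⟨Sum.inl i, by simpa using hx⟩, rfl⟩
    · obtain ⟨j, hj, hj'⟩ := hgsurj a (by simpa using hx)
      exact ⟨⟨Sum.inr j, by simpa using hj⟩, Subtype.ext (by simp [hj'])⟩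
  · rintro ⟨x, hx⟩
    rcases x with i | a <;> rfl
  · rintro ⟨x, hx⟩ ⟨y, hy⟩
    rcases x with i | a <;> rcases y with j | b
    · rfl
    · exact ⟨fun h => absurd h (not_lt.2 (hbound i (g b)).le), fun h => absurd h (not_lt.2 (hbound i b).le)⟩
    · exact ⟨fun _ => hbound j a, fun _ => hbound j (g a)⟩
    · simp only [Finset.inr_mem_disjSum, Finset.mem_range] at hx hy
      show -(K + (g a:ℝ)) < -(K + (g b:ℝ)) ↔ -(K + (a:ℝ)) < -(K + (b:ℝ))
      rw [neg_lt_neg_iff, neg_lt_neg_iff, add_lt_add_iff_left, add_lt_add_iff_left, Nat.cast_lt, Nat.cast_lt, hglt b a hy hx]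

lemma sum_powerset_disjSum {M : Type*} [AddCommMonoid M] (S : Finset U) (A : Finset ℕ) (f : Finset (U ⊕ ℕ) → M) :
    ∑ L ∈ (S.disjSum A).powerset, f L = ∑ S' ∈ S.powerset, ∑ A' ∈ A.powerset, f (S'.disjSum A') := by
  rw [← Finset.sum_product']
  refine Finset.sum_bij' (fun L _ => (L.toLeft, L.toRight)) (fun p _ => p.1.disjSum p.2) ?_ ?_ ?_ ?_ ?_
  · intro L hL
    rw [Finset.mem_powerset] at hL
    rw [Finset.mem_product, Finset.mem_powerset, Finset.mem_powerset]
    constructor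
    · intro x hx; rw [Finset.mem_toLeft] at hx; simpa using hL hx
    · intro x hx; rw [Finset.mem_toRight] at hx; simpa using hL hx
  · rintro ⟨p, q⟩ h
    rw [Finset.mem_product, Finset.mem_powerset, Finset.mem_powerset] at h
    rw [Finset.mem_powerset]
    exact Finset.disjSum_mono h.1 h.2
  · intro L _; exact Finset.toLeft_disjSum_toRight
  · rintro ⟨p, q⟩ _; simp
  · intro L _; rw [Finset.toLeft_disjSum_toRight]

lemma disjSum_sdiff (S S' : Finset U) (A A' : Finset ℕ) : S.disjSum A \ S'.disjSum A' = (S \ S').disjSum (A \ A') := by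
  ext (x | x) <;> simp

theorem cc_rec (w : U → ℕ) (hw : ∀ i, 1 ≤ w i) (vU : U → ℝ) (K : ℝ) (hK : ∀ i, -K < vU i) (σ : ℝ) (hσ : σ = 1 ∨ σ = -1) (S : Finset U) (m : ℕ)
    (hreal : σ = 1 ∨ Odd ((∑ i ∈ S, w i) + m) ∨ 1 ≤ m) :
    cc w vU K σ S (m+1) = ∑ S' ∈ S.powerset, ∑ a ∈ Finset.range (m+1), (m.choose a : ℤ) * 
      (if σ * (-1) ^ ((∑ i ∈ S \ S', w i) + (m - a) + 1) = -1 then 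
        -(-1) ^ (BB w vU S' (S \ S')) * (-1) ^ ((S'.card + a + 1) * ((∑ i ∈ S \ S', w i) + (m - a) + 1)) * 
          (cc w vU K (-1) S' a * cc w vU K σ (S \ S') (m - a)) else 0) := by
  have hσ0 : σ ≠ 0 := by rcases hσ with h | h <;> rw [h] <;> norm_num
  have hbound : ∀ i (j : ℕ), VE vU K (Sum.inr j) < VE vU K (Sum.inl i) := by
    intro i j
    show -(K + (j:ℝ)) < vU i
    have := hK i
    have h2 : (0:ℝ) ≤ j := by positivity
    linarith
  have hins : S.disjSum (Finset.range (m+1)) = insert (Sum.inr m) (S.disjSum (Finset.range m)) := by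
    ext (x | x)
    · simp
    · simp; omega
  have hsumT : ∀ (S : Finset U) (A : Finset ℕ), ∑ i ∈ S.disjSum A, ME w i = (∑ i ∈ S, w i) + A.card := by
    intro S A
    rw [Finset.sum_disjSum]; simp [ME]
  conv_lhs => unfold cc
  rw [hins, T3F (ME w) (ME_pos w hw) (S.disjSum (Finset.range m)) (Sum.inr m) (by simp) rfl σ hσ (VE vU K) (by
      rintro (i | j) hi
      · exact hbound i m
      · simp only [Finset.inr_mem_disjSum, Finset.mem_range] at hi
        show -(K + (m:ℝ)) < -(K + (j:ℝ))
        have : (j:ℝ) < m := by exact_mod_cast hi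
        linarith) (by
      rcases hreal with h | h | h
      · exact Or.inl h
      · right; left
        rw [hsumT, Finset.card_range]
        exact h.add_even (by decide)
      · right; right
        refine ⟨Sum.inr 0, by simp; omega, ?_⟩
        rintro (i | j) _ h2
        · exact absurd h2 (hbound i 0).ne'
        · have : -(K + (j:ℝ)) = -(K + ((0:ℕ):ℝ)) := h2
          have : (j:ℝ) = (0:ℕ) := by linarith
          have : j = 0 := by exact_mod_cast this
          rw [this])]
  rw [sum_powerset_disjSum]
  refine Finset.sum_congr rfl fun S' hS' => ?_
  set f : ℕ → ℤ := fun a => (if σ * (-1) ^ ((∑ i ∈ S \ S', w i) + (m - a) + 1) = -1 then 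
        -(-1) ^ (BB w vU S' (S \ S')) * (-1) ^ ((S'.card + a + 1) * ((∑ i ∈ S \ S', w i) + (m - a) + 1)) * 
          (cc w vU K (-1) S' a * cc w vU K σ (S \ S') (m - a)) else 0) with hf
  have hrhs := Finset.sum_powerset_apply_card f (x := Finset.range m)
  simp only [Finset.card_range, nsmul_eq_mul] at hrhs
  rw [← hrhs]
  refine Finset.sum_congr rfl fun A hA => ?_
  rw [Finset.mem_powerset] at hA
  have hcard : (Finset.range m \ A).card = m - A.card := by rw [Finset.card_sdiff_of_subset hA, Finset.card_range]
  have hmemne : ∀ j ∈ A, ¬ (K + (j:ℝ)) = K + m := by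
    intro j hj h
    have := Finset.mem_range.1 (hA hj)
    have h2 : (j:ℝ) = m := by linarith
    have h3 : j = m := by exact_mod_cast h2
    omega
  rw [disjSum_sdiff, hsumT, cc_card w hw vU K hK (-1) (by norm_num), cc_card w hw vU K hK σ hσ0, hcard]
  simp only [hf]
  refine if_congr Iff.rfl ?_ rfl
  congr 1
  have e1 : ∀ (i : U) (j : ℕ), eE (ME w) (VE vU K) (Sum.inl i) (Sum.inr j) = 1 := by
    intro i j
    unfold eE
    rw [if_neg (hbound i j).ne']; rfl
  have e2 : ∀ (i : U) (j : ℕ), eE (ME w) (VE vU K) (Sum.inr j) (Sum.inl i) = w i := by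
    intro i j
    unfold eE
    rw [if_neg (hbound i j).ne]; rfl
  have e3 : ∀ a b : ℕ, a ≠ b → eE (ME w) (VE vU K) (Sum.inr a) (Sum.inr b) = 1 := by
    intro a b hab
    unfold eE
    rw [if_neg]
    · rfl
    · intro h
      have h' : -(K + (a:ℝ)) = -(K + (b:ℝ)) := h
      have : (a:ℝ) = b := by linarith
      exact hab (by exact_mod_cast this)
  have e4 : ∀ i j : U, eE (ME w) (VE vU K) (Sum.inl i) (Sum.inl j) = eE w vU i j := fun i j => rfl
  simp only [Finset.sum_disjSum, e1, e2, e4]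
  have hAA : ∑ a ∈ A, ∑ b ∈ Finset.range m \ A, eE (ME w) (VE vU K) (Sum.inr a) (Sum.inr b) = A.card * (m - A.card) := by
    rw [Finset.sum_congr rfl fun a ha => Finset.sum_congr rfl fun b hb => e3 a b (by
      rintro rfl; exact (Finset.mem_sdiff.1 hb).2 ha)]
    simp [hcard]
  have hA1 : ∑ a ∈ A, eE (ME w) (VE vU K) (Sum.inr a) (Sum.inr m) = A.card := by
    rw [Finset.sum_congr rfl fun a ha => e3 a m (by have := Finset.mem_range.1 (hA ha); omega)]
    simp
  have hA2 : ∑ b ∈ Finset.range m \ A, eE (ME w) (VE vU K) (Sum.inr m) (Sum.inr b) = m - A.card := by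
    rw [Finset.sum_congr rfl fun b hb => e3 m b (by have := Finset.mem_range.1 (Finset.mem_sdiff.1 hb).1; omega)]
    simp [hcard]
  simp only [Finset.sum_add_distrib, hAA, hA1, hA2, Finset.sum_const, smul_eq_mul, mul_one, hcard]
  unfold BB
  set E := ∑ i ∈ S', ∑ j ∈ S \ S', eE w vU i j
  set p := S'.card
  set q := ∑ j ∈ S \ S', w j
  set b := m - A.card
  set a := A.card
  have : (-1:ℤ) ^ (E + p * q) * (-1) ^ ((p + a + 1) * (q + b + 1)) = (-1) ^ (E + p * b + (a * q + a * b) + (p + a) + (q + b)) * (-1) * ((-1) ^ (p * q)) ^ 2 := by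
    ring
  have h2 : ((-1:ℤ) ^ (p * q)) ^ 2 = 1 := by rw [← pow_mul, mul_comm, pow_mul]; simp
  rw [neg_mul, this, h2]; ring

end rec
end

noncomputable section
set_option linter.unusedSectionVars false
set_option linter.unusedVariables false
set_option linter.unusedSimpArgs false

section par
variable {U : Type*} (w : U → ℕ) (vU : U → ℝ) (K : ℝ)

def nn (S : Finset U) (m : ℕ) : ℕ := (∑ i ∈ S, w i) + m + 1
def dl (S : Finset U) : ℤ := (-1) ^ (S.card + ∑ i ∈ S, w i)
def ch (S T : Finset U) : ℤ := (-1) ^ BB w vU S T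
def Fc (S : Finset U) (m : ℕ) : ℤ := if Even (nn w S m) then cc w vU K (-1) S m else 0
def OLc (S : Finset U) (m : ℕ) : ℤ := if Even (nn w S m) then 0 else cc w vU K (-1) S m
def ORc (S : Finset U) (m : ℕ) : ℤ := if Even (nn w S m) then 0 else cc w vU K 1 S m
def Ec (S : Finset U) (m : ℕ) : ℤ := if Even (nn w S m) then cc w vU K 1 S m else 0

variable {w}
lemma nn_add {S S' : Finset U} (h : S' ⊆ S) {m a : ℕ} (ha : a ≤ m) : nn w S (m+1) = nn w S' a + nn w (S \ S') (m - a) := by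
  unfold nn
  rw [← Finset.sum_sdiff h]
  omega

variable (hw : ∀ i, 1 ≤ w i) (hK : ∀ i, -K < vU i)

lemma rec_neg (hw : ∀ i, 1 ≤ w i) (hK : ∀ i, -K < vU i) (S : Finset U) (m : ℕ) (hreal : Odd (nn w S (m+1)) ∨ 1 ≤ m) :
    cc w vU K (-1) S (m+1) = ∑ S' ∈ S.powerset, ∑ a ∈ Finset.range (m+1), (m.choose a : ℤ) * 
      (if Even (nn w (S \ S') (m - a)) then -ch w vU S' (S \ S') * (cc w vU K (-1) S' a * cc w vU K (-1) (S \ S') (m - a)) else 0) := by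
  rw [cc_rec w hw vU K hK (-1) (Or.inr rfl) S m (by
    rcases hreal with h | h
    · right; left
      unfold nn at h
      rw [show (∑ i ∈ S, w i) + (m+1) + 1 = (∑ i ∈ S, w i) + m + 2 by ring, Nat.odd_add] at h
      exact h.2 (by decide)
    · right; right; exact h)]
  refine Finset.sum_congr rfl fun S' hS' => Finset.sum_congr rfl fun a ha => ?_
  congr 1
  have hiff : (-1:ℝ) * (-1) ^ ((∑ i ∈ S \ S', w i) + (m - a) + 1) = -1 ↔ Even (nn w (S \ S') (m - a)) := by
    unfold nn
    rcases Nat.even_or_odd ((∑ i ∈ S \ S', w i) + (m - a) + 1) with h | h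
    · simp [h, h.neg_one_pow]
    · rw [h.neg_one_pow]; simp only [Nat.not_even_iff_odd.2 h, iff_false]; norm_num
  refine if_ctx_congr hiff (fun h => ?_) (fun _ => rfl)
  congr 1
  have : Even ((S'.card + a + 1) * ((∑ i ∈ S \ S', w i) + (m - a) + 1)) := Even.mul_left h _
  rw [this.neg_one_pow, mul_one]; rfl

lemma rec_pos (hw : ∀ i, 1 ≤ w i) (hK : ∀ i, -K < vU i) (S : Finset U) (m : ℕ) :
    cc w vU K 1 S (m+1) = ∑ S' ∈ S.powerset, ∑ a ∈ Finset.range (m+1), (m.choose a : ℤ) * 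
      (if Even (nn w (S \ S') (m - a)) then 0 else -ch w vU S' (S \ S') * (dl w S' * (-1) ^ (nn w S' a)) * (cc w vU K (-1) S' a * cc w vU K 1 (S \ S') (m - a))) := by
  rw [cc_rec w hw vU K hK 1 (Or.inl rfl) S m (Or.inl rfl)]
  refine Finset.sum_congr rfl fun S' hS' => Finset.sum_congr rfl fun a ha => ?_
  congr 1
  by_cases h : Even (nn w (S \ S') (m - a))
  · rw [if_pos h, if_neg]
    unfold nn at h
    rw [h.neg_one_pow]; norm_num
  · rw [if_neg h]
    have h' := Nat.not_even_iff_odd.1 h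
    unfold nn at h'
    rw [if_pos (by rw [h'.neg_one_pow]; norm_num)]
    congr 1
    unfold ch
    rw [mul_comm (S'.card + a + 1), pow_mul, h'.neg_one_pow]
    congr 1
    unfold dl nn
    rw [← pow_add, show S'.card + ∑ i ∈ S', w i + (∑ i ∈ S', w i + a + 1) = (S'.card + a + 1) + 2 * ∑ i ∈ S', w i by ring, pow_add (-1:ℤ) (S'.card + a + 1) (2 * ∑ i ∈ S', w i), pow_mul (-1:ℤ) 2]
    simp

lemma rec_F (hw : ∀ i, 1 ≤ w i) (hK : ∀ i, -K < vU i) (S : Finset U) (m : ℕ) (hm : 1 ≤ m) :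
    Fc w vU K S (m+1) = -∑ S' ∈ S.powerset, ch w vU S' (S \ S') * ∑ a ∈ Finset.range (m+1), (m.choose a : ℤ) * (Fc w vU K S' a * Fc w vU K (S \ S') (m - a)) := by
  rw [← Finset.sum_neg_distrib]
  simp only [Finset.mul_sum, ← Finset.sum_neg_distrib]
  by_cases hn : Even (nn w S (m+1))
  · rw [Fc, if_pos hn, rec_neg vU K hw hK S m (Or.inr hm)]
    refine Finset.sum_congr rfl fun S' hS' => Finset.sum_congr rfl fun a ha => ?_
    have hadd := nn_add (w := w) (Finset.mem_powerset.1 hS') (Nat.lt_succ_iff.1 (Finset.mem_range.1 ha))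
    rw [hadd, Nat.even_add] at hn
    unfold Fc
    by_cases h : Even (nn w (S \ S') (m - a))
    · simp only [h, hn.2 h, if_true]; ring
    · simp only [h, if_false]; ring
  · rw [Fc, if_neg hn]
    symm
    refine Finset.sum_eq_zero fun S' hS' => Finset.sum_eq_zero fun a ha => ?_
    have hadd := nn_add (w := w) (Finset.mem_powerset.1 hS') (Nat.lt_succ_iff.1 (Finset.mem_range.1 ha))
    rw [hadd, Nat.even_add] at hn
    unfold Fc
    by_cases h : Even (nn w (S \ S') (m - a)) <;> by_cases h2 : Even (nn w S' a) <;> simp [h, h2] at hn ⊢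

lemma rec_OL (hw : ∀ i, 1 ≤ w i) (hK : ∀ i, -K < vU i) (S : Finset U) (m : ℕ) :
    OLc w vU K S (m+1) = -∑ S' ∈ S.powerset, ch w vU S' (S \ S') * ∑ a ∈ Finset.range (m+1), (m.choose a : ℤ) * (OLc w vU K S' a * Fc w vU K (S \ S') (m - a)) := by
  rw [← Finset.sum_neg_distrib]
  simp only [Finset.mul_sum, ← Finset.sum_neg_distrib]
  by_cases hn : Even (nn w S (m+1))
  · rw [OLc, if_pos hn]
    symm
    refine Finset.sum_eq_zero fun S' hS' => Finset.sum_eq_zero fun a ha => ?_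
    have hadd := nn_add (w := w) (Finset.mem_powerset.1 hS') (Nat.lt_succ_iff.1 (Finset.mem_range.1 ha))
    rw [hadd, Nat.even_add] at hn
    unfold Fc OLc
    by_cases h : Even (nn w (S \ S') (m - a)) <;> by_cases h2 : Even (nn w S' a) <;> simp [h, h2] at hn ⊢
  · rw [OLc, if_neg hn, rec_neg vU K hw hK S m (Or.inl (Nat.not_even_iff_odd.1 hn))]
    refine Finset.sum_congr rfl fun S' hS' => Finset.sum_congr rfl fun a ha => ?_
    have hadd := nn_add (w := w) (Finset.mem_powerset.1 hS') (Nat.lt_succ_iff.1 (Finset.mem_range.1 ha))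
    rw [hadd, Nat.even_add] at hn
    unfold Fc OLc
    by_cases h : Even (nn w (S \ S') (m - a)) <;> by_cases h2 : Even (nn w S' a) <;> simp [h, h2] at hn ⊢
    ring

lemma rec_OR (hw : ∀ i, 1 ≤ w i) (hK : ∀ i, -K < vU i) (S : Finset U) (m : ℕ) :
    ORc w vU K S (m+1) = -∑ S' ∈ S.powerset, ch w vU S' (S \ S') * ∑ a ∈ Finset.range (m+1), (m.choose a : ℤ) * ((dl w S' * Fc w vU K S' a) * ORc w vU K (S \ S') (m - a)) := by
  rw [← Finset.sum_neg_distrib]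
  simp only [Finset.mul_sum, ← Finset.sum_neg_distrib]
  by_cases hn : Even (nn w S (m+1))
  · rw [ORc, if_pos hn]
    symm
    refine Finset.sum_eq_zero fun S' hS' => Finset.sum_eq_zero fun a ha => ?_
    have hadd := nn_add (w := w) (Finset.mem_powerset.1 hS') (Nat.lt_succ_iff.1 (Finset.mem_range.1 ha))
    rw [hadd, Nat.even_add] at hn
    unfold Fc ORc
    by_cases h : Even (nn w (S \ S') (m - a)) <;> by_cases h2 : Even (nn w S' a) <;> simp [h, h2] at hn ⊢
  · rw [ORc, if_neg hn, rec_pos vU K hw hK S m]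
    refine Finset.sum_congr rfl fun S' hS' => Finset.sum_congr rfl fun a ha => ?_
    have hadd := nn_add (w := w) (Finset.mem_powerset.1 hS') (Nat.lt_succ_iff.1 (Finset.mem_range.1 ha))
    rw [hadd, Nat.even_add] at hn
    unfold Fc ORc
    by_cases h : Even (nn w (S \ S') (m - a)) <;> by_cases h2 : Even (nn w S' a) <;> simp [h, h2, Even.neg_one_pow] at hn ⊢
    ring

lemma rec_E (hw : ∀ i, 1 ≤ w i) (hK : ∀ i, -K < vU i) (S : Finset U) (m : ℕ) :
    Ec w vU K S (m+1) = ∑ S' ∈ S.powerset, ch w vU S' (S \ S') * ∑ a ∈ Finset.range (m+1), (m.choose a : ℤ) * ((dl w S' * OLc w vU K S' a) * ORc w vU K (S \ S') (m - a)) := by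
  simp only [Finset.mul_sum]
  by_cases hn : Even (nn w S (m+1))
  · rw [Ec, if_pos hn, rec_pos vU K hw hK S m]
    refine Finset.sum_congr rfl fun S' hS' => Finset.sum_congr rfl fun a ha => ?_
    have hadd := nn_add (w := w) (Finset.mem_powerset.1 hS') (Nat.lt_succ_iff.1 (Finset.mem_range.1 ha))
    rw [hadd, Nat.even_add] at hn
    unfold OLc ORc
    by_cases h : Even (nn w (S \ S') (m - a)) <;> by_cases h2 : Even (nn w S' a) <;> simp [h, h2] at hn ⊢
    rw [(Nat.not_even_iff_odd.1 h2).neg_one_pow]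
    ring
  · rw [Ec, if_neg hn]
    symm
    refine Finset.sum_eq_zero fun S' hS' => Finset.sum_eq_zero fun a ha => ?_
    have hadd := nn_add (w := w) (Finset.mem_powerset.1 hS') (Nat.lt_succ_iff.1 (Finset.mem_range.1 ha))
    rw [hadd, Nat.even_add] at hn
    unfold OLc ORc
    by_cases h : Even (nn w (S \ S') (m - a)) <;> by_cases h2 : Even (nn w S' a) <;> simp [h, h2] at hn ⊢

lemma dl_mul {S S' : Finset U} (h : S' ⊆ S) : dl w S = dl w S' * dl w (S \ S') := by
  unfold dl
  rw [← Finset.sum_sdiff h, ← Finset.card_sdiff_add_card_eq_card h, ← pow_add]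
  congr 1; ring

lemma dl_sq (S : Finset U) : dl w S * dl w S = 1 := by
  unfold dl; rw [← pow_add, ← two_mul, pow_mul]; simp

variable (w) in
def F1c (S : Finset U) (m : ℕ) : ℤ := dl w S * Fc w vU K S m
variable (w) in
def L1c (S : Finset U) (m : ℕ) : ℤ := dl w S * OLc w vU K S m

lemma rec_F1 (hw : ∀ i, 1 ≤ w i) (hK : ∀ i, -K < vU i) (S : Finset U) (m : ℕ) (hm : 1 ≤ m) :
    F1c w vU K S (m+1) = -∑ S' ∈ S.powerset, ch w vU S' (S \ S') * ∑ a ∈ Finset.range (m+1), (m.choose a : ℤ) * (F1c w vU K S' a * F1c w vU K (S \ S') (m - a)) := by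
  unfold F1c
  rw [rec_F vU K hw hK S m hm, mul_neg, Finset.mul_sum]
  congr 1
  refine Finset.sum_congr rfl fun S' hS' => ?_
  rw [dl_mul (Finset.mem_powerset.1 hS')]
  simp only [Finset.mul_sum]
  refine Finset.sum_congr rfl fun a ha => ?_
  ring

lemma rec_L1 (hw : ∀ i, 1 ≤ w i) (hK : ∀ i, -K < vU i) (S : Finset U) (m : ℕ) :
    L1c w vU K S (m+1) = -∑ S' ∈ S.powerset, ch w vU S' (S \ S') * ∑ a ∈ Finset.range (m+1), (m.choose a : ℤ) * (L1c w vU K S' a * F1c w vU K (S \ S') (m - a)) := by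
  unfold L1c F1c
  rw [rec_OL vU K hw hK S m, mul_neg, Finset.mul_sum]
  congr 1
  refine Finset.sum_congr rfl fun S' hS' => ?_
  rw [dl_mul (Finset.mem_powerset.1 hS')]
  simp only [Finset.mul_sum]
  refine Finset.sum_congr rfl fun a ha => ?_
  ring

lemma F1c_empty_zero : F1c w vU K ∅ 0 = 0 := by
  unfold F1c Fc nn; simp

lemma F1c_empty_one (hw : ∀ i, 1 ≤ w i) : F1c w vU K ∅ 1 = 1 := by
  unfold F1c Fc nn cc dl
  have : Subsingleton (((∅ : Finset U).disjSum (Finset.range 1) : Finset (U ⊕ ℕ))) := by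
    constructor
    rintro ⟨x, hx⟩ ⟨y, hy⟩
    rcases x with x | x <;> rcases y with y | y
    · simp at hx
    · simp at hx
    · simp at hy
    · apply Subtype.ext
      simp at hx hy
      simp [hx, hy]
  simp only [NF]
  rw [NN_subsingleton]
  · simp
  · intro i; exact ME_pos w hw _

lemma ch_add_left (S R T : Finset U) (h : Disjoint S R) : ch w vU (S ∪ R) T = ch w vU S T * ch w vU R T := by
  unfold ch BB
  rw [← pow_add, Finset.sum_union h, Finset.card_union_of_disjoint h]
  congr 1; ring

lemma ch_add_right (S T R : Finset U) (h : Disjoint T R) : ch w vU S (T ∪ R) = ch w vU S T * ch w vU S R := by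
  unfold ch BB
  rw [← pow_add]
  simp only [Finset.sum_union h, Finset.sum_add_distrib]
  congr 1; ring

lemma ch_empty_left (T : Finset U) : ch w vU ∅ T = 1 := by simp [ch, BB]
lemma ch_empty_right (T : Finset U) : ch w vU T ∅ = 1 := by simp [ch, BB]

end par
end

noncomputable section
set_option linter.unusedSectionVars false
set_option linter.unusedVariables false
set_option linter.unusedSimpArgs false

section tanhlink

abbrev PP := MvPolynomial (Fin 2) ℚ
abbrev AA := PowerSeries ℚ

def chS : AA := PowerSeries.mk fun n => if Even n then ((n.factorial : ℚ))⁻¹ else 0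
def shS : AA := PowerSeries.mk fun n => if Even n then 0 else ((n.factorial : ℚ))⁻¹
def dS : Derivation ℚ AA AA := PowerSeries.derivative ℚ

lemma dS_coeff (f : AA) (n : ℕ) : PowerSeries.coeff n (dS f) = PowerSeries.coeff (n+1) f * (n+1) := by
  unfold dS
  rw [PowerSeries.coeff_derivative]

lemma dS_ext {f g : AA} (h : dS f = dS g) (h0 : PowerSeries.constantCoeff f = PowerSeries.constantCoeff g) : f = g :=
  PowerSeries.derivative.ext h h0

lemma dS_X : dS PowerSeries.X = 1 := by
  unfold dS; simp [PowerSeries.derivative_X]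

lemma dS_ch : dS chS = shS := by
  ext n
  rw [dS_coeff]
  simp only [chS, shS, PowerSeries.coeff_mk, Nat.even_add_one]
  by_cases h : Even n
  · simp [h]
  · simp only [h, not_false_eq_true, if_true, if_false, Nat.factorial_succ]
    push_cast
    have := Nat.factorial_ne_zero n
    field_simp

lemma dS_sh : dS shS = chS := by
  ext n
  rw [dS_coeff]
  simp only [chS, shS, PowerSeries.coeff_mk, Nat.even_add_one]
  by_cases h : Even n
  · simp only [h, not_true_eq_false, if_true, if_false, Nat.factorial_succ]
    push_cast
    have := Nat.factorial_ne_zero n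
    field_simp
  · simp [h]

lemma ch0 : PowerSeries.constantCoeff chS = 1 := by
  rw [← PowerSeries.coeff_zero_eq_constantCoeff_apply]; simp [chS]
lemma sh0 : PowerSeries.constantCoeff shS = 0 := by
  rw [← PowerSeries.coeff_zero_eq_constantCoeff_apply]; simp [shS]

def thS : AA := shS * chS⁻¹

lemma ch_ne : chS ≠ 0 := by
  intro h; have := ch0; rw [h] at this; simp at this

lemma ch_th : chS * thS = shS := by
  unfold thS
  rw [mul_left_comm, PowerSeries.mul_inv_cancel _ (by rw [ch0]; exact one_ne_zero), mul_one]

lemma th0 : PowerSeries.constantCoeff thS = 0 := by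
  unfold thS; rw [map_mul, sh0, zero_mul]

lemma dS_th : dS thS = 1 - thS ^ 2 := by
  have h := congrArg dS ch_th
  rw [Derivation.leibniz, dS_ch, dS_sh, smul_eq_mul, smul_eq_mul] at h
  apply mul_left_cancel₀ ch_ne
  rw [mul_sub, pow_two, ← mul_assoc, ch_th]
  linear_combination h

def phi : PP →ₐ[ℚ] AA := MvPolynomial.aeval ![PowerSeries.X, thS]

def dP : Derivation ℚ PP PP := MvPolynomial.mkDerivation ℚ ![1, 1 - MvPolynomial.X 1 ^ 2]

lemma phi_dP (p : PP) : phi (dP p) = dS (phi p) := by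
  induction p using MvPolynomial.induction_on with
  | C a =>
    have h1 : (MvPolynomial.C a : PP) = algebraMap ℚ PP a := rfl
    rw [h1, Derivation.map_algebraMap, map_zero, AlgHom.commutes, Derivation.map_algebraMap]
  | add p q hp hq => simp only [map_add, hp, hq]
  | mul_X p i hp =>
    rw [Derivation.leibniz, map_mul, Derivation.leibniz, map_add]
    simp only [smul_eq_mul, map_mul, hp]
    congr 1
    congr 1
    fin_cases i
    · simp [dP, phi, MvPolynomial.mkDerivation_X, dS_X]
    · simp [dP, phi, MvPolynomial.mkDerivation_X, dS_th]

lemma phi_const (p : PP) : PowerSeries.constantCoeff (phi p) = MvPolynomial.aeval (fun _ => (0:ℚ)) p := by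
  have : ((PowerSeries.constantCoeff (R := ℚ)).comp phi.toRingHom) = (MvPolynomial.aeval (fun _ => (0:ℚ)) : PP →ₐ[ℚ] ℚ).toRingHom := by
    apply MvPolynomial.ringHom_ext
    · intro r
      simp [phi]
    · intro i
      fin_cases i <;> simp [phi, th0]
  exact DFunLike.congr_fun this p

lemma phi_coeff (m : ℕ) (p : PP) : PowerSeries.coeff m (phi p) * (m.factorial : ℚ) = MvPolynomial.aeval (fun _ => (0:ℚ)) (dP^[m] p) := by
  induction m generalizing p with
  | zero => rw [← phi_const]; simp
  | succ m ih =>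
    rw [Function.iterate_succ_apply, ← ih, phi_dP, dS_coeff, Nat.factorial_succ]
    push_cast; ring

lemma real_deriv (p : PP) (q : ℝ) : HasDerivAt (fun q : ℝ => MvPolynomial.aeval ![q, Real.tanh q] p) (MvPolynomial.aeval ![q, Real.tanh q] (dP p)) q := by
  induction p using MvPolynomial.induction_on with
  | C a =>
    have h1 : (MvPolynomial.C a : PP) = algebraMap ℚ PP a := rfl
    rw [h1, Derivation.map_algebraMap, map_zero]
    simp only [AlgHom.commutes]
    exact hasDerivAt_const _ _
  | add p q hp hq => simp only [map_add]; exact hp.add hq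
  | mul_X p i hp =>
    rw [Derivation.leibniz]
    simp only [map_mul, map_add, smul_eq_mul]
    have hX : HasDerivAt (fun q : ℝ => MvPolynomial.aeval ![q, Real.tanh q] (MvPolynomial.X i : PP)) (MvPolynomial.aeval ![q, Real.tanh q] (dP (MvPolynomial.X i))) q := by
      fin_cases i
      · have h2 : (fun q : ℝ => MvPolynomial.aeval ![q, Real.tanh q] (MvPolynomial.X (0 : Fin 2) : PP)) = fun q => q := by
          funext q; simp
        show HasDerivAt (fun q : ℝ => MvPolynomial.aeval ![q, Real.tanh q] (MvPolynomial.X (0 : Fin 2) : PP)) _ _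
        rw [h2]
        refine (hasDerivAt_id' q).congr_deriv ?_
        simp [dP, MvPolynomial.mkDerivation_X]
      · have hc := (Real.cosh_pos q).ne'
        have := (Real.hasDerivAt_sinh q).div (Real.hasDerivAt_cosh q) hc
        have h2 : (fun q : ℝ => MvPolynomial.aeval ![q, Real.tanh q] (MvPolynomial.X (1 : Fin 2) : PP)) = fun q => Real.sinh q / Real.cosh q := by
          funext q; simp [Real.tanh_eq_sinh_div_cosh]
        show HasDerivAt (fun q : ℝ => MvPolynomial.aeval ![q, Real.tanh q] (MvPolynomial.X (1 : Fin 2) : PP)) _ _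
        rw [h2]
        refine this.congr_deriv ?_
        simp [dP, MvPolynomial.mkDerivation_X, Real.tanh_eq_sinh_div_cosh]
        field_simp
    have := hp.mul hX
    refine this.congr_deriv ?_
    ring

lemma real_iter (m : ℕ) (p : PP) : iteratedDeriv m (fun q : ℝ => MvPolynomial.aeval ![q, Real.tanh q] p) = fun q : ℝ => MvPolynomial.aeval ![q, Real.tanh q] (dP^[m] p) := by
  induction m generalizing p with
  | zero => simp
  | succ m ih =>
    rw [iteratedDeriv_succ', Function.iterate_succ_apply, ← ih]
    congr 1
    funext q
    exact (real_deriv p q).deriv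

lemma link (m : ℕ) (p : PP) : iteratedDeriv m (fun q : ℝ => MvPolynomial.aeval ![q, Real.tanh q] p) 0 = ((PowerSeries.coeff m (phi p) * (m.factorial : ℚ) : ℚ) : ℝ) := by
  rw [real_iter, phi_coeff]
  have h : (![0, Real.tanh 0] : Fin 2 → ℝ) = (algebraMap ℚ ℝ) ∘ (fun _ => (0:ℚ)) := by
    funext i; fin_cases i <;> simp
  show MvPolynomial.aeval ![0, Real.tanh 0] (dP^[m] p) = _
  rw [h, MvPolynomial.aeval_algebraMap_apply]
  rfl

end tanhlink
end

noncomputable section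
set_option linter.unusedSectionVars false
set_option linter.unusedVariables false
set_option linter.unusedSimpArgs false

section matalg
variable {ι : Type*} [Fintype ι]

abbrev MA (ι : Type*) := Matrix ι ι AA

def dm (M : MA ι) : MA ι := M.map dS

def cM (M : Matrix ι ι ℚ) : MA ι := M.map (algebraMap ℚ AA)

lemma dm_add (M N : MA ι) : dm (M + N) = dm M + dm N := by
  ext1 i j; simp [dm]
lemma dm_sub (M N : MA ι) : dm (M - N) = dm M - dm N := by
  ext1 i j; simp [dm]
lemma dm_smul (a : AA) (M : MA ι) : dm (a • M) = dS a • M + a • dm M := by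
  ext1 i j; simp [dm]; ring
lemma dm_mul (M N : MA ι) : dm (M * N) = dm M * N + M * dm N := by
  ext1 i j
  simp only [dm, Matrix.map_apply, Matrix.mul_apply, Matrix.add_apply, map_sum, Derivation.leibniz, smul_eq_mul, ← Finset.sum_add_distrib]
  refine Finset.sum_congr rfl fun k _ => ?_
  ring
lemma dm_const (M : Matrix ι ι ℚ) : dm (cM M) = 0 := by
  ext1 i j; simp only [dm, cM, Matrix.map_apply, Derivation.map_algebraMap, Matrix.zero_apply]
lemma dm_sum {κ : Type*} (s : Finset κ) (f : κ → MA ι) : dm (∑ k ∈ s, f k) = ∑ k ∈ s, dm (f k) := by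
  induction s using Finset.induction_on with
  | empty => ext1 i j; simp [dm]
  | insert a s ha ih => rw [Finset.sum_insert ha, Finset.sum_insert ha, dm_add, ih]

def c0 (M : MA ι) : Matrix ι ι ℚ := M.map (PowerSeries.constantCoeff (R := ℚ))
lemma c0_mul (M N : MA ι) : c0 (M * N) = c0 M * c0 N := by
  ext1 i j; simp [c0, Matrix.mul_apply, map_sum]
lemma c0_add (M N : MA ι) : c0 (M + N) = c0 M + c0 N := by
  ext1 i j; simp [c0]
lemma c0_sub (M N : MA ι) : c0 (M - N) = c0 M - c0 N := by
  ext1 i j; simp [c0]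
lemma c0_smul (a : AA) (M : MA ι) : c0 (a • M) = PowerSeries.constantCoeff a • c0 M := by
  ext1 i j; simp [c0]
lemma c0_cM (M : Matrix ι ι ℚ) : c0 (cM M) = M := by
  ext1 i j; simp [c0, cM, PowerSeries.algebraMap_apply]
lemma c0_sum {κ : Type*} (s : Finset κ) (f : κ → MA ι) : c0 (∑ k ∈ s, f k) = ∑ k ∈ s, c0 (f k) := by
  induction s using Finset.induction_on with
  | empty => ext1 i j; simp [c0]
  | insert a s ha ih => rw [Finset.sum_insert ha, Finset.sum_insert ha, c0_add, ih]

lemma dm_ext {M N : MA ι} (h : dm M = dm N) (h0 : c0 M = c0 N) : M = N := by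
  ext1 i j
  exact dS_ext (congrFun (congrFun h i) j) (congrFun (congrFun h0 i) j)

lemma ode_left (F Δ : MA ι) (h : dm Δ = -(F * Δ)) (h0 : c0 Δ = 0) : Δ = 0 := by
  have key : ∀ n, ∀ m ≤ n, ∀ i j, PowerSeries.coeff m (Δ i j) = 0 := by
    intro n
    induction n with
    | zero =>
      intro m hm i j
      obtain rfl : m = 0 := by omega
      have := congrFun (congrFun h0 i) j
      simpa [c0] using this
    | succ n ih =>
      intro m hm i j
      rcases Nat.lt_or_ge n m with hnm | hnm
      · obtain rfl : m = n + 1 := by omega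
        have h1 := congrArg (PowerSeries.coeff n) (congrFun (congrFun h i) j)
        simp only [dm, Matrix.map_apply, dS_coeff, Matrix.neg_apply, Matrix.mul_apply, map_neg, map_sum, PowerSeries.coeff_mul] at h1
        rw [Finset.sum_eq_zero, neg_zero] at h1
        · rcases mul_eq_zero.1 h1 with h2 | h2
          · exact h2
          · exfalso; have : (0:ℚ) < n + 1 := by positivity
            linarith
        · intro k _
          refine Finset.sum_eq_zero fun p hp => ?_
          rw [ih p.2 (by have := Finset.HasAntidiagonal.mem_antidiagonal.1 hp; omega), mul_zero]
      · exact ih m hnm i j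
  ext1 i j
  ext m
  simpa using key m m le_rfl i j

lemma ode_right (F Δ : MA ι) (h : dm Δ = -(Δ * F)) (h0 : c0 Δ = 0) : Δ = 0 := by
  have := ode_left F.transpose Δ.transpose (by
    rw [← Matrix.transpose_mul, ← Matrix.transpose_neg, ← h]; rfl) (by
    have : c0 Δ.transpose = (c0 Δ).transpose := rfl
    rw [this, h0, Matrix.transpose_zero])
  rw [← Matrix.transpose_transpose Δ, this, Matrix.transpose_zero]

def UpM {R : Type*} [CommRing R] (b : ι → ℕ) (M : Matrix ι ι R) : Prop := ∀ i j, b j ≤ b i → M i j = 0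

lemma UpM.pow {R : Type*} [CommRing R] {b : ι → ℕ} {M : Matrix ι ι R} (h : UpM b M) (n : ℕ) : ∀ i j, b j < b i + n → (M ^ n) i j = 0 := by
  induction n with
  | zero => 
    intro i j hij
    rw [pow_zero, Matrix.one_apply_ne]
    rintro rfl; omega
  | succ n ih =>
    intro i j hij
    rw [pow_succ, Matrix.mul_apply]
    refine Finset.sum_eq_zero fun k _ => ?_
    by_cases hk : b k < b i + n
    · rw [ih i k hk, zero_mul]
    · rw [h k j (by omega), mul_zero]

lemma UpM.nil {R : Type*} [CommRing R] {b : ι → ℕ} {M : Matrix ι ι R} (h : UpM b M) : M ^ ((∑ i, b i) + 1) = 0 := by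
  ext i j
  rw [h.pow _ i j]
  · rfl
  · have := Finset.single_le_sum (f := b) (fun _ _ => Nat.zero_le _) (Finset.mem_univ j)
    omega

lemma UpM.add {R : Type*} [CommRing R] {b : ι → ℕ} {M N : Matrix ι ι R} (h : UpM b M) (h' : UpM b N) : UpM b (M + N) := by
  intro i j hij; rw [Matrix.add_apply, h i j hij, h' i j hij, add_zero]
lemma UpM.smul {R : Type*} [CommRing R] {b : ι → ℕ} {M : Matrix ι ι R} (h : UpM b M) (a : R) : UpM b (a • M) := by
  intro i j hij; rw [Matrix.smul_apply, h i j hij, smul_zero]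
lemma UpM.mul {R : Type*} [CommRing R] {b : ι → ℕ} {M N : Matrix ι ι R} (h : UpM b M) (h' : UpM b N) : UpM b (M * N) := by
  intro i j hij
  rw [Matrix.mul_apply]
  refine Finset.sum_eq_zero fun k _ => ?_
  by_cases hk : b k ≤ b i
  · rw [h i k hk, zero_mul]
  · rw [h' k j (by omega), mul_zero]
lemma UpM.sum {R : Type*} [CommRing R] {b : ι → ℕ} {κ : Type*} {s : Finset κ} {f : κ → Matrix ι ι R} (h : ∀ k ∈ s, UpM b (f k)) : UpM b (∑ k ∈ s, f k) := by
  intro i j hij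
  rw [Matrix.sum_apply]
  exact Finset.sum_eq_zero fun k hk => h k hk i j hij
lemma UpM.pow_succ {R : Type*} [CommRing R] {b : ι → ℕ} {M : Matrix ι ι R} (h : UpM b M) (n : ℕ) : UpM b (M ^ (n+1)) := by
  intro i j hij; exact h.pow _ i j (by omega)
lemma UpM.map {R R' : Type*} [CommRing R] [CommRing R'] {b : ι → ℕ} {M : Matrix ι ι R} (h : UpM b M) (f : R →+* R') : UpM b (M.map f) := by
  intro i j hij; rw [Matrix.map_apply, h i j hij, map_zero]

def yv : ℕ → PP × PP
  | 0 => (1, MvPolynomial.X 1)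
  | (j+1) => (MvPolynomial.C (1 / (2 * ((j:ℚ) + 1))) * (MvPolynomial.X 0 * (yv j).2),
      MvPolynomial.C (1 / (2 * ((j:ℚ) + 1))) * (MvPolynomial.X 0 * (yv j).1 - MvPolynomial.C (2 * (j:ℚ) + 1) * (yv j).2))

def yS (j : ℕ) : AA := chS * phi (yv j).1
def vS (j : ℕ) : AA := chS * phi (yv j).2

lemma phi_C (a : ℚ) : phi (MvPolynomial.C a) = PowerSeries.C a := by
  simp only [phi, MvPolynomial.aeval_C, PowerSeries.algebraMap_apply]; rfl
lemma phi_X0 : phi (MvPolynomial.X 0) = PowerSeries.X := by simp [phi]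
lemma phi_X1 : phi (MvPolynomial.X 1) = thS := by simp [phi]

lemma yS_zero : yS 0 = chS := by simp [yS, yv]
lemma vS_zero : vS 0 = shS := by simp [vS, yv, phi_X1, ch_th]
lemma yS_succ (j : ℕ) : PowerSeries.C (2 * ((j:ℚ) + 1)) * yS (j+1) = PowerSeries.X * vS j := by
  have h : PowerSeries.C (2 * ((j:ℚ) + 1)) * PowerSeries.C (1 / (2 * ((j:ℚ) + 1))) = (1 : AA) := by
    rw [← map_mul, ← map_one (PowerSeries.C (R := ℚ))]; congr 1
    have : (j:ℚ) + 1 ≠ 0 := by positivity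
    field_simp
  unfold yS vS
  rw [yv]
  simp only [map_mul phi, phi_C, phi_X0]
  linear_combination (chS * PowerSeries.X * phi (yv j).2) * h
lemma vS_succ (j : ℕ) : PowerSeries.C (2 * ((j:ℚ) + 1)) * vS (j+1) = PowerSeries.X * yS j - PowerSeries.C (2 * (j:ℚ) + 1) * vS j := by
  have h : PowerSeries.C (2 * ((j:ℚ) + 1)) * PowerSeries.C (1 / (2 * ((j:ℚ) + 1))) = (1 : AA) := by
    rw [← map_mul, ← map_one (PowerSeries.C (R := ℚ))]; congr 1
    have : (j:ℚ) + 1 ≠ 0 := by positivity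
    field_simp
  unfold yS vS
  rw [yv]
  simp only [map_mul phi, map_sub phi, phi_C, phi_X0]
  linear_combination (chS * (PowerSeries.X * phi (yv j).1 - PowerSeries.C (2 * (j:ℚ) + 1) * phi (yv j).2)) * h

lemma C_ne (j : ℕ) : (PowerSeries.C (2 * ((j:ℚ) + 1)) : AA) ≠ 0 := by
  intro h
  have : (2 * ((j:ℚ) + 1)) = 0 := by
    have := congrArg (PowerSeries.constantCoeff (R := ℚ)) h
    simpa using this
  have : (0:ℚ) < (2 * ((j:ℚ) + 1)) := by positivity
  linarith

lemma dS_C (a : ℚ) (f : AA) : dS (PowerSeries.C a * f) = PowerSeries.C a * dS f := by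
  rw [Derivation.leibniz, smul_eq_mul, smul_eq_mul]
  have : dS (PowerSeries.C a) = 0 := by unfold dS; simp
  rw [this]; ring

lemma C2 : (PowerSeries.C (2:ℚ) : AA) = 2 := map_ofNat _ 2
lemma CN (j : ℕ) : (PowerSeries.C ((j:ℚ)) : AA) = (j : AA) := map_natCast _ j

lemma dS_yS_of (j : ℕ) (h1 : dS (vS j) = yS j) : dS (yS (j+1)) = vS (j+1) + vS j := by
  apply mul_left_cancel₀ (C_ne j)
  have h2 := vS_succ j
  rw [← dS_C, yS_succ, Derivation.leibniz, h1, dS_X, mul_add, h2, smul_eq_mul, smul_eq_mul]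
  simp only [map_mul, map_add, map_one, CN, C2]
  ring

lemma dS_vS_aux (j : ℕ) : dS (vS j) = yS j ∧ PowerSeries.X * dS (yS j) = PowerSeries.X * vS j + PowerSeries.C (2 * (j:ℚ)) * yS j := by
  induction j with
  | zero =>
    rw [vS_zero, yS_zero, dS_sh, dS_ch]
    simp
  | succ j ih =>
    have h3 := yS_succ j
    refine ⟨?_, ?_⟩
    · apply mul_left_cancel₀ (C_ne j)
      rw [← dS_C, vS_succ, map_sub, dS_C, Derivation.leibniz, ih.1, dS_X, smul_eq_mul, smul_eq_mul, h3, ih.2]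
      simp only [map_mul, map_add, map_one, CN, C2]
      ring
    · rw [dS_yS_of j ih.1]
      push_cast
      rw [h3]; ring

lemma dS_vS (j : ℕ) : dS (vS j) = yS j := (dS_vS_aux j).1
lemma dS_yS (j : ℕ) : dS (yS (j+1)) = vS (j+1) + vS j := dS_yS_of j (dS_vS j)
lemma dS_yS0 : dS (yS 0) = vS 0 := by rw [yS_zero, vS_zero, dS_ch]

lemma cc_yv (j : ℕ) : PowerSeries.constantCoeff (vS j) = 0 ∧ PowerSeries.constantCoeff (yS j) = if j = 0 then 1 else 0 := by
  induction j with
  | zero => rw [vS_zero, yS_zero, ch0, sh0]; simp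
  | succ j ih =>
    have hp : (2 * ((j:ℚ) + 1)) ≠ 0 := by positivity
    have h1 := congrArg (PowerSeries.constantCoeff (R := ℚ)) (yS_succ j)
    have h2 := congrArg (PowerSeries.constantCoeff (R := ℚ)) (vS_succ j)
    simp only [map_mul PowerSeries.constantCoeff, map_sub PowerSeries.constantCoeff, PowerSeries.constantCoeff_C, PowerSeries.constantCoeff_X, zero_mul, ih.1, mul_zero, sub_zero] at h1 h2
    refine ⟨(mul_eq_zero.1 h2).resolve_left hp, ?_⟩
    rw [(mul_eq_zero.1 h1).resolve_left hp, if_neg (Nat.succ_ne_zero j)]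

def YM (N : Matrix ι ι ℚ) (J : ℕ) : MA ι := ∑ j ∈ Finset.range (J+1), yS j • cM N ^ j
def VM (N : Matrix ι ι ℚ) (J : ℕ) : MA ι := ∑ j ∈ Finset.range (J+1), vS j • cM N ^ j

lemma cM_pow (N : Matrix ι ι ℚ) (j : ℕ) : cM N ^ j = cM (N ^ j) := by
  unfold cM
  exact (map_pow (RingHom.mapMatrix (algebraMap ℚ AA)) N j).symm

lemma dm_VM (N : Matrix ι ι ℚ) (J : ℕ) : dm (VM N J) = YM N J := by
  unfold VM YM
  rw [dm_sum]
  refine Finset.sum_congr rfl fun j _ => ?_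
  rw [dm_smul, dS_vS, cM_pow, dm_const, smul_zero, add_zero]

lemma dm_YM (N : Matrix ι ι ℚ) (J : ℕ) (hN : N ^ (J+1) = 0) : dm (YM N J) = (1 + cM N) * VM N J := by
  unfold VM YM
  rw [dm_sum]
  have h1 : ∀ j, dm (yS j • cM N ^ j) = dS (yS j) • cM N ^ j := by
    intro j; rw [dm_smul, cM_pow, dm_const, smul_zero, add_zero]
  simp only [h1]
  rw [Finset.sum_range_succ', dS_yS0]
  simp only [dS_yS, add_smul, Finset.sum_add_distrib]
  rw [add_mul, one_mul]
  rw [Finset.mul_sum, Finset.sum_range_succ' _ J, Finset.sum_range_succ (fun j => cM N * _) J]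
  have h2 : ∀ j, cM N * vS j • cM N ^ j = vS j • cM N ^ (j+1) := by
    intro j; rw [mul_smul_comm, pow_succ']
  simp only [h2]
  have h3 : cM N ^ (J+1) = 0 := by rw [cM_pow, hN]; ext1 i j; simp [cM]
  rw [h3, smul_zero, add_zero]
  abel

lemma c0_one : c0 (1 : MA ι) = 1 := by
  ext1 i j; by_cases h : i = j <;> simp [c0, Matrix.one_apply, h]

lemma c0_VM (N : Matrix ι ι ℚ) (J : ℕ) : c0 (VM N J) = 0 := by
  unfold VM
  rw [c0_sum]
  refine Finset.sum_eq_zero fun j _ => ?_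
  rw [c0_smul, (cc_yv j).1, zero_smul]

lemma c0_YM (N : Matrix ι ι ℚ) (J : ℕ) : c0 (YM N J) = 1 := by
  unfold YM
  rw [c0_sum, Finset.sum_eq_single 0]
  · rw [c0_smul, (cc_yv 0).2, if_pos rfl, one_smul, pow_zero, c0_one]
  · intro j _ hj
    rw [c0_smul, (cc_yv j).2, if_neg hj, zero_smul]
  · intro h; simp at h

lemma comm_pow_YM {N : Matrix ι ι ℚ} (J : ℕ) (M : MA ι) (h : Commute M (cM N)) : Commute M (YM N J) ∧ Commute M (VM N J) := by
  unfold YM VM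
  constructor <;> refine Commute.sum_right _ _ _ fun j _ => ?_ <;> exact (h.pow_right j).smul_right _

end matalg
end

noncomputable section
set_option linter.unusedSectionVars false
set_option linter.unusedVariables false
set_option linter.unusedSimpArgs false

section matmain
variable {ι : Type*} [Fintype ι]

def phM (M : Matrix ι ι PP) : MA ι := M.map phi

lemma phM_mul (M N : Matrix ι ι PP) : phM (M * N) = phM M * phM N := by
  ext1 i j; simp [phM, Matrix.mul_apply, map_sum]
lemma phM_add (M N : Matrix ι ι PP) : phM (M + N) = phM M + phM N := by
  ext1 i j; simp [phM]
lemma phM_smul (a : PP) (M : Matrix ι ι PP) : phM (a • M) = phi a • phM M := by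
  ext1 i j; simp [phM]
lemma phM_one : phM (1 : Matrix ι ι PP) = 1 := by
  ext1 i j; by_cases h : i = j <;> simp [phM, Matrix.one_apply, h]
lemma phM_sum {κ : Type*} (s : Finset κ) (f : κ → Matrix ι ι PP) : phM (∑ k ∈ s, f k) = ∑ k ∈ s, phM (f k) := by
  induction s using Finset.induction_on with
  | empty => ext1 i j; simp [phM]
  | insert a s ha ih => rw [Finset.sum_insert ha, Finset.sum_insert ha, phM_add, ih]
def cP (M : Matrix ι ι ℚ) : Matrix ι ι PP := M.map (algebraMap ℚ PP)
lemma phM_cP (M : Matrix ι ι ℚ) : phM (cP M) = cM M := by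
  ext1 i j; simp only [phM, cP, cM, Matrix.map_apply, AlgHom.commutes]
lemma phM_pow (M : Matrix ι ι PP) (n : ℕ) : phM (M ^ n) = phM M ^ n := by
  induction n with
  | zero => rw [pow_zero, pow_zero, phM_one]
  | succ n ih => rw [pow_succ, pow_succ, phM_mul, ih]

/-- polynomial form of `Y/ch`, `V/ch`. -/
def YP (N : Matrix ι ι ℚ) (J : ℕ) : Matrix ι ι PP := ∑ j ∈ Finset.range (J+1), (yv j).1 • cP N ^ j
def VP (N : Matrix ι ι ℚ) (J : ℕ) : Matrix ι ι PP := ∑ j ∈ Finset.range (J+1), (yv j).2 • cP N ^ j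

lemma YP_phi (N : Matrix ι ι ℚ) (J : ℕ) : chS • phM (YP N J) = YM N J := by
  unfold YP YM
  rw [phM_sum, Finset.smul_sum]
  refine Finset.sum_congr rfl fun j _ => ?_
  rw [phM_smul, phM_pow, phM_cP, smul_smul]; rfl
lemma VP_phi (N : Matrix ι ι ℚ) (J : ℕ) : chS • phM (VP N J) = VM N J := by
  unfold VP VM
  rw [phM_sum, Finset.smul_sum]
  refine Finset.sum_congr rfl fun j _ => ?_
  rw [phM_smul, phM_pow, phM_cP, smul_smul]; rfl

lemma exists_Z (b : ι → ℕ) (N F0 : Matrix ι ι ℚ) (hN : UpM b N) (hF : UpM b F0) (J : ℕ) :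
    ∃ Z : Matrix ι ι PP, (YM N J + VM N J * cM F0) * phM Z = VM N J := by
  have hNP : UpM b (cP N) := hN.map _
  have hFP : UpM b (cP F0) := hF.map _
  set W := YP N J + VP N J * cP F0 with hW
  have hup : UpM b (W - 1) := by
    have : W - 1 = (∑ j ∈ Finset.range J, (yv (j+1)).1 • cP N ^ (j+1)) + ((∑ j ∈ Finset.range J, ((yv (j+1)).2 • (cP N ^ (j+1) * cP F0))) + (yv 0).2 • cP F0) := by
      rw [hW, YP, VP, Finset.sum_range_succ', Finset.sum_range_succ', add_mul, Finset.sum_mul]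
      simp only [pow_zero, smul_mul_assoc, one_mul]
      have : (yv 0).1 = 1 := rfl
      rw [this, one_smul]
      abel
    rw [this]
    refine UpM.add (UpM.sum fun j _ => (hNP.pow_succ j).smul _) (UpM.add (UpM.sum fun j _ => ((hNP.pow_succ j).mul hFP).smul _) (hFP.smul _))
  have hu : IsUnit W := by
    have := IsNilpotent.isUnit_one_add (r := W - 1) ⟨_, hup.nil⟩
    simpa using this
  obtain ⟨u, hu⟩ := hu
  refine ⟨(↑u⁻¹ : Matrix ι ι PP) * VP N J, ?_⟩
  rw [← YP_phi, ← VP_phi, smul_mul_assoc, ← smul_add, smul_mul_assoc]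
  congr 1
  rw [← phM_cP, ← phM_mul, ← phM_add, ← phM_mul]
  congr 1
  rw [← hW, ← hu, ← mul_assoc, Units.mul_inv, one_mul]

theorem alg_main (b : ι → ℕ) (N : Matrix ι ι ℚ) (hN : UpM b N) (F L R E : MA ι) (hF : UpM b (c0 F))
    (h1 : dm F = 1 + cM N - F * F) (h2 : dm L = -(L * F)) (h3 : dm R = -(F * R)) (h4 : dm E = L * R) :
    ∃ Q : Matrix ι ι PP, E = phM Q := by
  set J := ∑ i, b i with hJ
  have hnil : N ^ (J+1) = 0 := hN.nil
  obtain ⟨Z, hZ⟩ := exists_Z b N (c0 F) hN hF J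
  set Y := YM N J with hY
  set V := VM N J with hV
  set F0 := cM (c0 F) with hF0
  set C := (1 + cM N) with hC
  have dY : dm Y = C * V := dm_YM N J hnil
  have dV : dm V = Y := dm_VM N J
  have dC : dm C = 0 := by
    have : (1 : MA ι) = cM 1 := by ext1 i j; by_cases h : i = j <;> simp [cM, Matrix.one_apply, h]
    rw [hC, dm_add, this, dm_const, dm_const, add_zero]
  have dF0 : dm F0 = 0 := dm_const _
  have cC : Commute C (cM N) := (Commute.one_left _).add_left (Commute.refl _)
  have cCY : Commute C Y := (comm_pow_YM J C cC).1
  have cCV : Commute C V := (comm_pow_YM J C cC).2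
  have cNY : Commute (cM N) Y := (comm_pow_YM J (cM N) (Commute.refl _)).1
  have cYV : Commute Y V := (comm_pow_YM J Y cNY.symm).2
  have Y0 : c0 Y = 1 := c0_YM N J
  have V0 : c0 V = 0 := c0_VM N J
  -- conserved quantity
  have hpy : Y * Y - C * (V * V) = 1 := by
    apply dm_ext
    · rw [dm_sub, dm_mul, dm_mul, dm_mul, dC, dY, dV]
      have : dm (1 : MA ι) = 0 := by ext1 i j; by_cases h : i = j <;> simp [dm, Matrix.one_apply, h]
      rw [this, zero_mul, zero_add, ← mul_assoc Y C V, ← cCY.eq, cYV.eq, mul_add, mul_assoc, mul_assoc, cYV.eq]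
      abel
    · rw [c0_sub, c0_mul, c0_mul, c0_mul, Y0, V0, c0_one]; simp
  set G := Y + V * F0 with hG
  set H := Y + F0 * V with hH
  have dG : dm G = C * V + Y * F0 := by
    rw [hG, dm_add, dm_mul, dY, dV, dF0, mul_zero, add_zero]
  have dH : dm H = C * V + F0 * Y := by
    rw [hH, dm_add, dm_mul, dY, dV, dF0, zero_mul, zero_add]
  have ddG : dm (dm G) = C * G := by
    rw [dG, dm_add, dm_mul, dm_mul, dY, dV, dF0, dC, hG, zero_mul, zero_add, mul_zero, add_zero, mul_add, mul_assoc]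
  have ddH : dm (dm H) = H * C := by
    rw [dH, dm_add, dm_mul, dm_mul, dY, dV, dF0, dC, hH, zero_mul, zero_add, zero_mul, zero_add, add_mul _ _ C, cCY.eq, mul_assoc F0 V C, ← cCV.eq]
  have hFG : F * G - dm G = 0 := by
    apply ode_left F
    · rw [dm_sub, dm_mul, ddG, h1]; noncomm_ring
    · rw [dG, c0_sub, hG, c0_mul, c0_add, c0_add, c0_mul, c0_mul, c0_mul, Y0, V0, hF0, c0_cM]; simp
  have hHF : H * F - dm H = 0 := by
    apply ode_right F
    · rw [dm_sub, dm_mul, ddH, h1]; noncomm_ring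
    · rw [dH, c0_sub, hH, c0_mul, c0_add, c0_add, c0_mul, c0_mul, c0_mul, Y0, V0, hF0, c0_cM]; simp
  rw [sub_eq_zero] at hFG hHF
  have hLG : L * G = cM (c0 L) := by
    apply dm_ext
    · rw [dm_mul, h2, dm_const, ← hFG]; noncomm_ring
    · rw [c0_cM, c0_mul, hG, c0_add, c0_mul, Y0, V0]; simp
  have hHR : H * R = cM (c0 R) := by
    apply dm_ext
    · rw [dm_mul, h3, dm_const, ← hHF]; noncomm_ring
    · rw [c0_cM, c0_mul, hH, c0_add, c0_mul, Y0, V0]; simp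
  set z := phM Z with hz
  have hGz : G * dm z = Y - F * V := by
    have := congrArg dm hZ
    rw [dm_mul, dV, ← hFG, mul_assoc, hZ] at this
    rw [← this]; abel
  have hHGz : H * (G * dm z) = 1 := by
    rw [hGz, mul_sub, ← mul_assoc, hHF, dH, hH, ← hpy]
    have := cYV.eq
    rw [add_mul, add_mul, mul_assoc F0 V Y, mul_assoc F0 Y V, this, mul_assoc]
    abel
  have hGzH : (G * dm z) * H = 1 := mul_eq_one_comm.1 hHGz
  refine ⟨cP (c0 E) + cP (c0 L) * Z * cP (c0 R) - cP (c0 L * (c0 z) * c0 R), ?_⟩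
  have hsub : ∀ M N : Matrix ι ι PP, phM (M - N) = phM M - phM N := by
    intro M N; ext1 i j; simp [phM]
  rw [hsub, phM_add, phM_mul, phM_mul, phM_cP, phM_cP, phM_cP, phM_cP]
  apply dm_ext
  · rw [dm_sub, dm_add, dm_mul, dm_mul, dm_const, dm_const, dm_const, dm_const, h4, ← hLG, ← hHR]
    have : L * G * dm z * (H * R) = L * ((G * dm z) * H) * R := by noncomm_ring
    rw [zero_mul, mul_zero, zero_add, add_zero, zero_add, sub_zero, this, hGzH, mul_one]
  · rw [c0_sub, c0_add, c0_mul, c0_mul, c0_cM, c0_cM, c0_cM, c0_cM, add_sub_cancel_right]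

end matmain
end

noncomputable section
set_option linter.unusedSectionVars false
set_option linter.unusedVariables false
set_option linter.unusedSimpArgs false

section mm
variable {U : Type*} [Fintype U] (w : U → ℕ) (vU : U → ℝ)

def gs (c : ℕ → ℤ) : AA := PowerSeries.mk fun n => (c n : ℚ) / n.factorial

lemma gs_coeff (c : ℕ → ℤ) (m : ℕ) : PowerSeries.coeff m (gs c) * (m.factorial : ℚ) = c m := by
  have := Nat.factorial_ne_zero m
  simp only [gs, PowerSeries.coeff_mk]; field_simp

lemma gs_ext {f g : AA} (h : ∀ m, PowerSeries.coeff m f * (m.factorial : ℚ) = PowerSeries.coeff m g * (m.factorial : ℚ)) : f = g := by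
  ext m
  have h0 : (m.factorial : ℚ) ≠ 0 := by exact_mod_cast Nat.factorial_ne_zero m
  exact mul_right_cancel₀ h0 (h m)

lemma dS_gs (c : ℕ → ℤ) : dS (gs c) = gs (fun m => c (m+1)) := by
  apply gs_ext
  intro m
  rw [gs_coeff, dS_coeff, ← gs_coeff c (m+1), Nat.factorial_succ]
  push_cast; ring

lemma gs_mul (c d : ℕ → ℤ) : gs c * gs d = gs (fun m => ∑ a ∈ Finset.range (m+1), (m.choose a : ℤ) * (c a * d (m - a))) := by
  apply gs_ext
  intro m
  rw [gs_coeff, PowerSeries.coeff_mul, Finset.Nat.sum_antidiagonal_eq_sum_range_succ_mk, Finset.sum_mul]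
  push_cast
  refine Finset.sum_congr rfl fun a ha => ?_
  have hle : a ≤ m := Nat.lt_succ_iff.1 (Finset.mem_range.1 ha)
  simp only [gs, PowerSeries.coeff_mk]
  rw [Nat.cast_choose ℚ hle]
  have h1 := Nat.factorial_ne_zero a
  have h2 := Nat.factorial_ne_zero (m - a)
  field_simp

def MM {A : Type*} [CommRing A] (f : Finset U → A) : Matrix (Finset U) (Finset U) A :=
  Matrix.of fun S T => if S ⊆ T then (ch w vU S (T \ S) : A) * f (T \ S) else 0

def cv {A : Type*} [CommRing A] (f g : Finset U → A) (S : Finset U) : A := ∑ S' ∈ S.powerset, (ch w vU S' (S \ S') : A) * (f S' * g (S \ S'))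

lemma MM_mul {A : Type*} [CommRing A] (f g : Finset U → A) : MM w vU f * MM w vU g = MM w vU (cv w vU f g) := by
  ext S T
  rw [Matrix.mul_apply]
  simp only [MM, Matrix.of_apply]
  by_cases h : S ⊆ T
  · rw [if_pos h]
    rw [← Finset.sum_subset (Finset.subset_univ (Finset.Icc S T))]
    · unfold cv
      rw [Finset.mul_sum]
      refine Finset.sum_bij' (fun R _ => R \ S) (fun R _ => S ∪ R) ?_ ?_ ?_ ?_ ?_
      · intro R hR
        rw [Finset.mem_Icc] at hR
        exact Finset.mem_powerset.2 (Finset.sdiff_subset_sdiff hR.2 le_rfl)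
      · intro R hR
        rw [Finset.mem_powerset] at hR
        rw [Finset.mem_Icc]
        exact ⟨Finset.subset_union_left, Finset.union_subset h (hR.trans Finset.sdiff_subset)⟩
      · intro R hR
        rw [Finset.mem_Icc] at hR
        exact Finset.union_sdiff_of_subset hR.1
      · intro R hR
        rw [Finset.mem_powerset] at hR
        ext x
        have := @hR x
        simp only [Finset.mem_sdiff, Finset.mem_union] at this ⊢
        tauto
      · intro R hR
        rw [Finset.mem_Icc] at hR
        obtain ⟨h1, h2⟩ := hR
        have h1' : S ⊆ R := h1
        have h2' : R ⊆ T := h2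
        rw [if_pos h1', if_pos h2']
        have e1 : (T \ S) \ (R \ S) = T \ R := by
          ext x; have := @h1' x; simp only [Finset.mem_sdiff]; tauto
        have e2 : T \ S = (R \ S) ∪ (T \ R) := by
          ext x; have := @h1' x; have := @h2' x; simp only [Finset.mem_sdiff, Finset.mem_union]; tauto
        have e3 : R = S ∪ (R \ S) := (Finset.union_sdiff_of_subset h1').symm
        have d1 : Disjoint (R \ S) (T \ R) := by
          rw [Finset.disjoint_left]; intro x; simp only [Finset.mem_sdiff]; tauto
        have d2 : Disjoint S (R \ S) := Finset.disjoint_sdiff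
        have c1 : ch w vU S (T \ S) = ch w vU S (R \ S) * ch w vU S (T \ R) := by
          rw [← ch_add_right vU _ _ _ d1, ← e2]
        have c2 : ch w vU R (T \ R) = ch w vU S (T \ R) * ch w vU (R \ S) (T \ R) := by
          rw [← ch_add_left vU _ _ _ d2, ← e3]
        rw [e1, c1, c2]
        push_cast
        ring
    · intro R _ hR
      rw [Finset.mem_Icc, not_and_or] at hR
      rcases hR with hR | hR
      · rw [if_neg hR, zero_mul]
      · rw [if_neg (c := R ⊆ T) hR, mul_zero]
  · rw [if_neg h]
    refine Finset.sum_eq_zero fun R _ => ?_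
    by_cases h1 : S ⊆ R
    · rw [if_neg (c := R ⊆ T) (fun h2 => h (h1.trans h2)), mul_zero]
    · rw [if_neg h1, zero_mul]

def ct (f g : Finset U → ℕ → ℤ) (S : Finset U) (m : ℕ) : ℤ :=
  ∑ S' ∈ S.powerset, ch w vU S' (S \ S') * ∑ a ∈ Finset.range (m+1), (m.choose a : ℤ) * (f S' a * g (S \ S') (m - a))

def MG (f : Finset U → ℕ → ℤ) : MA (Finset U) := MM w vU (fun S => gs (f S))

lemma MG_mul (f g : Finset U → ℕ → ℤ) : MG w vU f * MG w vU g = MG w vU (ct w vU f g) := by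
  unfold MG
  rw [MM_mul]
  congr 1
  funext S
  unfold cv
  apply gs_ext
  intro m
  rw [gs_coeff, map_sum, Finset.sum_mul]
  unfold ct
  rw [Int.cast_sum]
  refine Finset.sum_congr rfl fun S' _ => ?_
  rw [gs_mul]
  have : ((ch w vU S' (S \ S') : ℤ) : AA) = PowerSeries.C (ch w vU S' (S \ S') : ℚ) := by simp
  rw [this, PowerSeries.coeff_C_mul, mul_assoc, gs_coeff]
  push_cast; rfl

lemma MG_dm (f : Finset U → ℕ → ℤ) : dm (MG w vU f) = MG w vU (fun S m => f S (m+1)) := by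
  ext1 S T
  simp only [dm, MG, MM, Matrix.map_apply, Matrix.of_apply]
  split_ifs with h
  · have : ((ch w vU S (T \ S) : ℤ) : AA) = PowerSeries.C (ch w vU S (T \ S) : ℚ) := by simp
    rw [this, dS_C, dS_gs]
  · simp

lemma MG_neg (f : Finset U → ℕ → ℤ) : MG w vU (fun S m => - f S m) = - MG w vU f := by
  ext1 S T
  simp only [dm, MG, MM, Matrix.map_apply, Matrix.of_apply, Matrix.neg_apply]
  split_ifs with h
  · rw [← mul_neg]; congr 1
    apply gs_ext; intro m; rw [gs_coeff, map_neg, neg_mul, gs_coeff]; push_cast; rfl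
  · simp

variable {w}
theorem E_poly (K : ℝ) (hw : ∀ i, 1 ≤ w i) (hK : ∀ i, -K < vU i) :
    ∃ Q : PP, ∀ m, PowerSeries.coeff m (phi Q) * (m.factorial : ℚ) = Ec w vU K Finset.univ m := by
  set Cc : Finset U → ℤ := fun S => F1c w vU K S 1 + ct w vU (F1c w vU K) (F1c w vU K) S 0 with hCc
  set N : Matrix (Finset U) (Finset U) ℚ := MM w vU (fun S => (Cc S : ℚ)) - 1 with hN
  have key := alg_main (fun S : Finset U => S.card) N ?_ (MG w vU (F1c w vU K)) (MG w vU (L1c w vU K)) (MG w vU (ORc w vU K)) (MG w vU (Ec w vU K)) ?_ ?_ ?_ ?_ ?_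
  · obtain ⟨Q, hQ⟩ := key
    refine ⟨Q ∅ Finset.univ, fun m => ?_⟩
    have := congrFun (congrFun hQ ∅) Finset.univ
    have h2 : phi (Q ∅ Finset.univ) = MG w vU (Ec w vU K) ∅ Finset.univ := this.symm
    rw [h2]
    simp only [MG, MM, Matrix.of_apply, Finset.empty_subset, if_true, ch_empty_left, Int.cast_one, one_mul, Finset.sdiff_empty]
    rw [gs_coeff]
  · intro S T hTS
    simp only [hN, MM, Matrix.sub_apply, Matrix.of_apply]
    by_cases hST : S ⊆ T
    · obtain rfl := Finset.eq_of_subset_of_card_le hST hTS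
      rw [if_pos le_rfl, Matrix.one_apply_eq, Finset.sdiff_self, ch_empty_right, hCc]
      simp only [F1c_empty_one vU K hw, ct, F1c_empty_zero]
      simp [F1c_empty_zero]
    · rw [if_neg hST, Matrix.one_apply_ne, sub_zero]
      rintro rfl; exact hST le_rfl
  · intro S T hTS
    simp only [c0, MG, MM, Matrix.map_apply, Matrix.of_apply]
    by_cases hST : S ⊆ T
    · obtain rfl := Finset.eq_of_subset_of_card_le hST hTS
      rw [if_pos le_rfl, Finset.sdiff_self, map_mul]
      have : PowerSeries.constantCoeff (gs (F1c w vU K ∅)) = 0 := by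
        have := gs_coeff (F1c w vU K ∅) 0
        rw [F1c_empty_zero] at this
        simpa using this
      rw [this, mul_zero]
    · rw [if_neg hST, map_zero]
  · rw [MG_mul, MG_dm]
    ext1 S T
    rw [hN]
    simp only [cM, MG, MM, Matrix.map_apply, Matrix.of_apply, Matrix.sub_apply, Matrix.add_apply, map_sub]
    have h1 : ∀ x y z : AA, x = y → x + (z - y) = z := by intro x y z h; rw [h]; ring
    rw [h1 _ _ _ (by by_cases h : S = T <;> simp [Matrix.one_apply, h])]
    split_ifs with h
    · rw [map_mul, map_intCast, ← mul_sub]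
      congr 1
      apply gs_ext
      intro m
      rw [gs_coeff, map_sub, sub_mul, gs_coeff]
      rcases m with _ | m
      · simp [hCc]
      · rw [rec_F1 vU K hw hK _ (m+1) (by omega)]
        rw [PowerSeries.algebraMap_apply, PowerSeries.coeff_C, if_neg (by omega)]
        push_cast [ct]
        simp
    · simp
  · rw [MG_mul, MG_dm, ← MG_neg]
    congr 1; funext S m
    exact rec_L1 vU K hw hK S m
  · rw [MG_mul, MG_dm, ← MG_neg]
    congr 1; funext S m
    exact rec_OR vU K hw hK S m
  · rw [MG_mul, MG_dm]
    congr 1; funext S m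
    exact rec_E vU K hw hK S m

end mm
end

noncomputable section
set_option linter.unusedSectionVars false
set_option linter.unusedVariables false
set_option linter.unusedSimpArgs false

section rel
variable {ι : Type*} [Fintype ι]

structure RelP (P : ℝ[X]) (μ : ι → ℕ) (v : ι → ℝ) (x : ι → ℂ) : Prop where
  inj : Function.Injective x
  der : (derivative P).map (algebraMap ℝ ℂ) = C (((∑ i, μ i) + 1 : ℕ) : ℂ) * ∏ i, (X - C (x i)) ^ μ i
  val : ∀ i, (P.map (algebraMap ℝ ℂ)).eval (x i) = (v i : ℂ)

lemma rm_prod (μ : ι → ℕ) (x : ι → ℂ) (z : ℂ) (s : Finset ι) :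
    rootMultiplicity z (∏ i ∈ s, (X - C (x i)) ^ μ i) = ∑ i ∈ s, if z = x i then μ i else 0 := by
  induction s using Finset.induction_on with
  | empty => 
    rw [Finset.prod_empty, Finset.sum_empty, ← C_1, rootMultiplicity_C]
  | insert a s ha ih =>
    rw [Finset.prod_insert ha, Finset.sum_insert ha, rootMultiplicity_mul, ih, ← count_roots ((X - C (x a)) ^ μ a), roots_pow, Multiset.count_nsmul, roots_X_sub_C, Multiset.count_singleton]
    · congr 1; split_ifs <;> simp
    · refine mul_ne_zero (pow_ne_zero _ (X_sub_C_ne_zero _)) (Finset.prod_ne_zero_iff.2 fun i _ => pow_ne_zero _ (X_sub_C_ne_zero _))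

namespace RelP
variable {P : ℝ[X]} {μ : ι → ℕ} {v : ι → ℝ} {x : ι → ℂ}

lemma cne : ((((∑ i, μ i) + 1 : ℕ) : ℂ)) ≠ 0 := Nat.cast_ne_zero.2 (Nat.succ_ne_zero _)

lemma der_ne (h : RelP P μ v x) : (derivative P).map (algebraMap ℝ ℂ) ≠ 0 := by
  rw [h.der]
  exact mul_ne_zero (C_ne_zero.2 cne) (Finset.prod_ne_zero_iff.2 fun i _ => pow_ne_zero _ (X_sub_C_ne_zero _))

lemma rm_der (h : RelP P μ v x) (z : ℂ) : rootMultiplicity z ((derivative P).map (algebraMap ℝ ℂ)) = ∑ i, if z = x i then μ i else 0 := by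
  have := h.der_ne
  rw [h.der] at this ⊢
  rw [rootMultiplicity_mul this, rootMultiplicity_C, zero_add, rm_prod]

lemma rm_der_x (h : RelP P μ v x) (i : ι) : rootMultiplicity (x i) ((derivative P).map (algebraMap ℝ ℂ)) = μ i := by
  rw [h.rm_der, Finset.sum_eq_single i]
  · simp
  · intro j _ hj; rw [if_neg]; intro h'; exact hj (h.inj h').symm
  · simp

lemma sub_ne (h : RelP P μ v x) (w : ℂ) : P.map (algebraMap ℝ ℂ) - C w ≠ 0 := by
  intro h0
  apply h.der_ne
  rw [← derivative_map]
  have := congrArg derivative h0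
  simpa using this

lemma rm_of_val (h : RelP P μ v x) {z w : ℂ} (hz : (P.map (algebraMap ℝ ℂ)).eval z = w) :
    rootMultiplicity z (P.map (algebraMap ℝ ℂ) - C w) = rootMultiplicity z ((derivative P).map (algebraMap ℝ ℂ)) + 1 := by
  have hr : IsRoot (P.map (algebraMap ℝ ℂ) - C w) z := by simp [IsRoot, hz]
  have h1 := derivative_rootMultiplicity_of_root hr
  have h2 := (rootMultiplicity_pos (h.sub_ne w)).2 hr
  rw [derivative_sub, derivative_C, sub_zero, derivative_map] at h1
  omega

lemma rm_x (h : RelP P μ v x) (i : ι) : rootMultiplicity (x i) (P.map (algebraMap ℝ ℂ) - C (v i : ℂ)) = μ i + 1 := by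
  rw [h.rm_of_val (h.val i), h.rm_der_x]

lemma exists_of_two (h : RelP P μ v x) {z w : ℂ} (h2 : 2 ≤ rootMultiplicity z (P.map (algebraMap ℝ ℂ) - C w)) : ∃ i, x i = z ∧ (v i : ℂ) = w := by
  have hz : (P.map (algebraMap ℝ ℂ)).eval z = w := by
    have := (rootMultiplicity_pos (h.sub_ne w)).1 (by omega : 0 < rootMultiplicity z _)
    simpa [IsRoot, sub_eq_zero] using this
  rw [h.rm_of_val hz, h.rm_der] at h2
  by_contra hcon
  push Not at hcon
  rw [Finset.sum_eq_zero] at h2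
  · omega
  · intro i _
    rw [if_neg]
    intro hi
    exact hcon i hi.symm (by rw [← h.val i, ← hi, hz])

lemma ofReal_re {i : ι} (hi : (x i).im = 0) : (((x i).re : ℝ) : ℂ) = x i := by
  apply Complex.ext <;> simp [hi]

lemma rmR (p : ℝ[X]) (r : ℝ) : rootMultiplicity r p = rootMultiplicity (r : ℂ) (p.map (algebraMap ℝ ℂ)) :=
  eq_rootMultiplicity_map (f := algebraMap ℝ ℂ) Complex.ofReal_injective r

lemma map_sub_C (w : ℝ) : (P - C w).map (algebraMap ℝ ℂ) = P.map (algebraMap ℝ ℂ) - C (w : ℂ) := by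
  simp [Polynomial.map_sub]

lemma rmR_x (h : RelP P μ v x) {i : ι} (hi : (x i).im = 0) : rootMultiplicity (x i).re (P - C (v i)) = μ i + 1 := by
  rw [rmR, map_sub_C, ofReal_re hi, h.rm_x]

lemma valR (h : RelP P μ v x) {i : ι} (hi : (x i).im = 0) : P.eval (x i).re = v i := by
  have := h.val i
  rw [← ofReal_re hi, eval_map_algebraMap, ← Complex.coe_algebraMap, aeval_algebraMap_apply] at this
  exact Complex.ofReal_injective (by simpa using this)

lemma existsR_of_two (h : RelP P μ v x) {r w : ℝ} (h2 : 2 ≤ rootMultiplicity r (P - C w)) : ∃ i, (x i).im = 0 ∧ (x i).re = r ∧ v i = w := by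
  rw [rmR, map_sub_C] at h2
  obtain ⟨i, hi, hi'⟩ := h.exists_of_two h2
  exact ⟨i, by rw [hi]; simp, by rw [hi]; simp, Complex.ofReal_injective hi'⟩
end RelP

lemma pos_of_no_roots (f : ℝ[X]) (hf : 0 < f.leadingCoeff) (hr : ∀ r, f.eval r ≠ 0) (y : ℝ) : 0 < f.eval y := by
  rcases Nat.eq_zero_or_pos f.natDegree with h0 | h0
  · rw [eq_C_of_natDegree_eq_zero h0] at hf ⊢
    simpa using hf
  · have ht := Polynomial.tendsto_atTop_of_leadingCoeff_nonneg f (natDegree_pos_iff_degree_pos.1 h0) hf.le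
    obtain ⟨z, hz⟩ := (ht.eventually (Filter.eventually_ge_atTop 0)).exists
    by_contra hneg
    push Not at hneg
    obtain ⟨r, hr'⟩ := mem_range_of_exists_le_of_exists_ge f.continuous ⟨y, hneg⟩ ⟨z, hz⟩
    exact hr r hr'

lemma sign_lemma (n : ℕ) : ∀ (f : ℝ[X]) (hn : f.natDegree = n) (hf : 0 < f.leadingCoeff) (y : ℝ) (hy : f.eval y ≠ 0),
    0 < (-1) ^ ((f.roots.filter (fun r => y < r)).card) * f.eval y := by
  induction n with
  | zero =>
    intro f hn hf y hy
    rw [eq_C_of_natDegree_eq_zero hn] at hf ⊢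
    simpa using hf
  | succ n ih =>
    intro f hn hf y hy
    by_cases hr : ∃ r, f.eval r = 0
    · obtain ⟨r, hr⟩ := hr
      obtain ⟨g, rfl⟩ := dvd_iff_isRoot.2 hr
      have hg0 : g ≠ 0 := by rintro rfl; simp at hf
      have hg : 0 < g.leadingCoeff := by simpa using hf
      have hgd : g.natDegree = n := by
        rw [natDegree_mul (X_sub_C_ne_zero r) hg0, natDegree_X_sub_C] at hn
        omega
      rw [eval_mul] at hy ⊢
      have := ih g hgd hg y (right_ne_zero_of_mul hy)
      rw [roots_mul (mul_ne_zero (X_sub_C_ne_zero r) hg0), roots_X_sub_C, Multiset.filter_add, Multiset.card_add, pow_add]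
      have hyr : y - r ≠ 0 := by simpa using left_ne_zero_of_mul hy
      have h1 : 0 < (-1:ℝ) ^ (Multiset.filter (fun r => y < r) {r}).card * eval y (X - C r) := by
        rw [Multiset.filter_singleton]
        split_ifs with h
        · simp only [Multiset.card_singleton, eval_sub, eval_X, eval_C]; linarith
        · have : r < y := lt_of_le_of_ne (not_lt.1 h) (fun h => hyr (by rw [h, sub_self]))
          simp only [Multiset.empty_eq_zero, Multiset.card_zero, eval_sub, eval_X, eval_C]; linarith
      have := mul_pos h1 this
      linarith [this]
    · push Not at hr
      have hp := pos_of_no_roots f hf hr y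
      have : f.roots = 0 := by
        rw [Multiset.eq_zero_iff_forall_notMem]
        intro r hr'
        exact hr r (isRoot_of_mem_roots hr')
      rw [this]; simpa using hp

end rel
end

noncomputable section
set_option linter.unusedSectionVars false
set_option linter.unusedVariables false
set_option linter.unusedSimpArgs false

lemma filter_gt_eq {s : Multiset ℝ} {a y : ℝ} (hay : a < y) (h : ∀ t ∈ s, a < t → y < t) : s.filter (fun r => y < r) = s.filter (fun r => a < r) := by
  apply Multiset.filter_congr
  intro t ht
  exact ⟨fun h' => hay.trans h', h t ht⟩

lemma parity_lemma (P : ℝ[X]) (hd : 0 < P.natDegree) (hl : 0 < P.leadingCoeff) (a : ℝ) :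
    (-1:ℤ) ^ ((P - C (P.eval a)).roots.filter (fun r => a < r)).card = (-1:ℤ) ^ ((derivative P).roots.filter (fun r => a < r)).card := by
  set f := P - C (P.eval a) with hf
  have hfl : 0 < f.leadingCoeff := by
    rw [hf, leadingCoeff_sub_of_degree_lt]
    · exact hl
    · exact lt_of_le_of_lt degree_C_le (natDegree_pos_iff_degree_pos.1 hd)
  have hf0 : f ≠ 0 := by rintro h; rw [h] at hfl; simp at hfl
  have hdl : 0 < (derivative P).leadingCoeff := by
    have h1 : (derivative P).natDegree = P.natDegree - 1 := natDegree_derivative _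
    rw [leadingCoeff, h1, coeff_derivative, Nat.sub_add_cancel hd]
    have : (0:ℝ) < ((P.natDegree - 1 : ℕ) : ℝ) + 1 := by positivity
    exact mul_pos hl this
  have hd0 : derivative P ≠ 0 := by rintro h; rw [h] at hdl; simp at hdl
  have hev : ∀ T : Finset ℝ, ∀ᶠ y in nhdsWithin a (Set.Ioi a), ∀ t ∈ T, a < t → y < t := by
    intro T
    rw [Filter.eventually_all_finset]
    intro t _
    by_cases hat : a < t
    · filter_upwards [Ioo_mem_nhdsGT hat] with y hy _ using hy.2
    · exact Filter.Eventually.of_forall fun y h => absurd h hat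
  obtain ⟨y, ⟨hy1, hy2⟩, hy3⟩ := (((hev f.roots.toFinset).and (hev (derivative P).roots.toFinset)).and self_mem_nhdsWithin).exists
  have hay : a < y := hy3
  simp only [Multiset.mem_toFinset] at hy1 hy2
  have hfy : f.eval y ≠ 0 := by
    intro h
    exact lt_irrefl _ (hy1 y ((mem_roots hf0).2 h) hay)
  obtain ⟨ξ, ⟨hξ1, hξ2⟩, hξ⟩ := exists_hasDerivAt_eq_slope (fun t => P.eval t) (fun t => (derivative P).eval t) hay P.continuous.continuousOn (fun t _ => P.hasDerivAt t)
  have hdξ : (derivative P).eval ξ ≠ 0 := by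
    intro h
    exact absurd (hy2 ξ ((mem_roots hd0).2 h) hξ1) (not_lt.2 hξ2.le)
  have s1 := sign_lemma _ f rfl hfl y hfy
  have s2 := sign_lemma _ (derivative P) rfl hdl ξ hdξ
  rw [filter_gt_eq hay hy1] at s1
  rw [filter_gt_eq hξ1 (fun t ht h => hξ2.trans (hy2 t ht h))] at s2
  have e1 : f.eval y = (derivative P).eval ξ * (y - a) := by
    rw [hξ, hf]
    have : y - a ≠ 0 := by linarith
    field_simp
    simp
  rw [e1] at s1
  set m1 := (Multiset.filter (fun r => a < r) f.roots).card
  set m2 := (Multiset.filter (fun r => a < r) (derivative P).roots).card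
  have hya : 0 < y - a := by linarith
  have s3 : 0 < (-1:ℝ) ^ m1 * (derivative P).eval ξ := by
    by_contra hcon
    push Not at hcon
    nlinarith
  rcases Nat.even_or_odd m1 with h1 | h1 <;> rcases Nat.even_or_odd m2 with h2 | h2 <;> rw [h1.neg_one_pow] at s3 ⊢ <;> rw [h2.neg_one_pow] at s2 ⊢
  · exfalso; linarith
  · exfalso; linarith

lemma card_filter_roots (p : ℝ[X]) (a : ℝ) : (p.roots.filter (fun r => a < r)).card = ∑ r ∈ p.roots.toFinset.filter (fun r => a < r), rootMultiplicity r p := by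
  rw [← Multiset.toFinset_sum_count_eq, Multiset.toFinset_filter]
  refine Finset.sum_congr rfl fun r hr => ?_
  rw [Multiset.count_filter_of_pos (Finset.mem_filter.1 hr).2, count_roots]

section eps
variable {ι : Type*} [Fintype ι] {P : ℝ[X]} {μ : ι → ℕ} {v : ι → ℝ} {x : ι → ℂ}

def gtS (x : ι → ℂ) (i : ι) : Finset ι := Finset.univ.filter fun j => (x j).im = 0 ∧ (x i).re < (x j).re

lemma RelP.card_der (h : RelP P μ v x) (hμ : ∀ i, 1 ≤ μ i) (i : ι) :
    ((derivative P).roots.filter (fun r => (x i).re < r)).card = ∑ j ∈ gtS x i, μ j := by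
  rw [card_filter_roots]
  have hd0 : derivative P ≠ 0 := by
    intro h0; apply h.der_ne; rw [h0]; simp
  symm
  refine Finset.sum_bij (fun j _ => (x j).re) ?_ ?_ ?_ ?_
  · intro j hj
    simp only [gtS, Finset.mem_filter, Finset.mem_univ, true_and] at hj
    rw [Finset.mem_filter, Multiset.mem_toFinset]
    refine ⟨?_, hj.2⟩
    rw [← Multiset.count_pos, count_roots, RelP.rmR, RelP.ofReal_re hj.1, h.rm_der_x]
    exact hμ j
  · intro j hj k hk hjk
    simp only [gtS, Finset.mem_filter, Finset.mem_univ, true_and] at hj hk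
    apply h.inj
    rw [← RelP.ofReal_re hj.1, ← RelP.ofReal_re hk.1, hjk]
  · intro r hr
    rw [Finset.mem_filter, Multiset.mem_toFinset, ← Multiset.count_pos, count_roots, RelP.rmR, h.rm_der] at hr
    obtain ⟨j, _, hj⟩ := Finset.exists_ne_zero_of_sum_ne_zero hr.1.ne'
    have hj' : (r:ℂ) = x j := by by_contra hne; rw [if_neg hne] at hj; exact hj rfl
    refine ⟨j, ?_, by rw [← hj']; simp⟩
    simp only [gtS, Finset.mem_filter, Finset.mem_univ, true_and]
    rw [← hj']; simpa using hr.2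
  · intro j hj
    simp only [gtS, Finset.mem_filter, Finset.mem_univ, true_and] at hj
    rw [RelP.rmR, RelP.ofReal_re hj.1, h.rm_der_x]

/-- second points of disorders with first point `x i`. -/
def BF (P : ℝ[X]) (μ : ι → ℕ) (v : ι → ℝ) (x : ι → ℂ) (i : ι) : Finset ℝ :=
  ((P - C (v i)).roots.toFinset.filter (fun r => (x i).re < r)).filter fun r => rootMultiplicity r (P - C (v i)) < μ i + 1

lemma RelP.card_BF (h : RelP P μ v x) (hμ : ∀ i, 1 ≤ μ i) (hd : 0 < P.natDegree) (hl : 0 < P.leadingCoeff) (i : ι) (hi : (x i).im = 0) :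
    (-1:ℤ) ^ (BF P μ v x i).card = ∏ j ∈ gtS x i, (-1:ℤ) ^ eE μ v i j := by
  set f := P - C (v i) with hf
  set A := f.roots.toFinset.filter (fun r => (x i).re < r) with hA
  have hpar := parity_lemma P hd hl (x i).re
  rw [h.valR hi, ← hf, h.card_der hμ i, card_filter_roots, ← hA] at hpar
  have hf0 : f ≠ 0 := by
    intro h0; apply h.sub_ne (v i); rw [← RelP.map_sub_C, ← hf, h0]; simp
  have h1 : (-1:ℤ) ^ (BF P μ v x i).card = ∏ r ∈ A, (-1:ℤ) ^ (if rootMultiplicity r f < μ i + 1 then 1 else 0) := by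
    rw [Finset.prod_pow_eq_pow_sum, Finset.sum_ite, Finset.sum_const_zero, add_zero, Finset.sum_const, smul_eq_mul, mul_one]
    rfl
  have h2 : ∏ r ∈ A, (-1:ℤ) ^ (if rootMultiplicity r f < μ i + 1 then 1 else 0) = (∏ r ∈ A, (-1:ℤ) ^ (rootMultiplicity r f)) *
      ∏ r ∈ A.filter (fun r => 2 ≤ rootMultiplicity r f), (-1:ℤ) ^ (rootMultiplicity r f + (if rootMultiplicity r f < μ i + 1 then 1 else 0)) := by
    rw [Finset.prod_filter (fun r => 2 ≤ rootMultiplicity r f), ← Finset.prod_mul_distrib]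
    refine Finset.prod_congr rfl fun r hr => ?_
    split_ifs with ha hb hb
    · rw [pow_add, ← mul_assoc, ← pow_add, ← two_mul, pow_mul]; simp
    · rw [hA, Finset.mem_filter, Multiset.mem_toFinset, ← Multiset.count_pos, count_roots] at hr
      have : rootMultiplicity r f = 1 := by omega
      rw [this]; simp
    · rw [add_zero, ← pow_add, ← two_mul, pow_mul]; simp
    · have := hμ i; omega
  have h3 : ∏ r ∈ A.filter (fun r => 2 ≤ rootMultiplicity r f), (-1:ℤ) ^ (rootMultiplicity r f + (if rootMultiplicity r f < μ i + 1 then 1 else 0))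
      = ∏ j ∈ (gtS x i).filter (fun j => v i = v j), (-1:ℤ) ^ (μ j + 1 + (if μ j < μ i then 1 else 0)) := by
    symm
    have key : ∀ j ∈ (gtS x i).filter (fun j => v i = v j), (x j).im = 0 ∧ (x i).re < (x j).re ∧ v i = v j ∧ rootMultiplicity (x j).re f = μ j + 1 := by
      intro j hj
      simp only [gtS, Finset.mem_filter, Finset.mem_univ, true_and] at hj
      refine ⟨hj.1.1, hj.1.2, hj.2, ?_⟩
      rw [hf, hj.2]; exact h.rmR_x hj.1.1
    refine Finset.prod_bij (fun j _ => (x j).re) ?_ ?_ ?_ ?_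
    · intro j hj
      obtain ⟨k1, k2, k3, k4⟩ := key j hj
      rw [Finset.mem_filter, hA, Finset.mem_filter, Multiset.mem_toFinset, ← Multiset.count_pos, count_roots, k4]
      have := hμ j
      exact ⟨⟨by omega, k2⟩, by omega⟩
    · intro j hj k hk hjk
      apply h.inj
      rw [← RelP.ofReal_re (key j hj).1, ← RelP.ofReal_re (key k hk).1, hjk]
    · intro r hr
      rw [Finset.mem_filter, hA, Finset.mem_filter] at hr
      obtain ⟨j, hj1, hj2, hj3⟩ := h.existsR_of_two hr.2
      refine ⟨j, ?_, hj2⟩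
      simp only [gtS, Finset.mem_filter, Finset.mem_univ, true_and]
      exact ⟨⟨hj1, by rw [hj2]; exact hr.1.2⟩, hj3.symm⟩
    · intro j hj
      rw [(key j hj).2.2.2]
      congr 2
      simp
  rw [h1, h2, h3, Finset.prod_pow_eq_pow_sum, hpar, ← Finset.prod_pow_eq_pow_sum, Finset.prod_filter, ← Finset.prod_mul_distrib]
  refine Finset.prod_congr rfl fun j _ => ?_
  unfold eE
  split_ifs <;> simp [pow_add]

def disEquiv (h : RelP P μ v x) (hμ : ∀ i, 1 ≤ μ i) (hd : 0 < P.natDegree) :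
    (Σ i : {i : ι // (x i).im = 0}, BF P μ v x i.1) → disorders P := fun p =>
  ⟨((x p.1.1).re, p.2.1), by
    have hp := p.2.2
    simp only [BF, Finset.mem_filter, Multiset.mem_toFinset] at hp
    have hv := h.valR p.1.2
    have he : P.eval p.2.1 = v p.1.1 := by
      have := isRoot_of_mem_roots hp.1.1
      simpa [IsRoot, sub_eq_zero] using this
    refine ⟨hp.1.2, by rw [hv, he], ?_⟩
    show rootMultiplicity _ (P - C (P.eval p.2.1)) < rootMultiplicity _ (P - C (P.eval (x p.1.1).re))
    rw [hv, he, h.rmR_x p.1.2]; exact hp.2⟩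

lemma disEquiv_bij (h : RelP P μ v x) (hμ : ∀ i, 1 ≤ μ i) (hd : 0 < P.natDegree) : Function.Bijective (disEquiv h hμ hd) := by
  constructor
  · rintro ⟨⟨i, hi⟩, ⟨r, hr⟩⟩ ⟨⟨j, hj⟩, ⟨s, hs⟩⟩ hpq
    have h1 := congrArg (fun z : disorders P => z.1.1) hpq
    have h2 := congrArg (fun z : disorders P => z.1.2) hpq
    simp only [disEquiv] at h1 h2
    have hij : i = j := by
      apply h.inj
      rw [← RelP.ofReal_re hi, ← RelP.ofReal_re hj, h1]
    subst hij
    subst h2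
    rfl
  · rintro ⟨⟨a, r⟩, hlt, hval, hmul⟩
    simp only at hlt hval hmul
    have hne : ∀ c : ℝ, P - C c ≠ 0 := by
      intro c h0
      rw [sub_eq_zero.1 h0] at hd
      simp at hd
    have h1 : 0 < rootMultiplicity r (P - C (P.eval r)) := (rootMultiplicity_pos (hne _)).2 (by simp)
    obtain ⟨i, hi1, hi2, hi3⟩ := h.existsR_of_two (by omega : 2 ≤ rootMultiplicity a (P - C (P.eval a)))
    refine ⟨⟨⟨i, hi1⟩, ⟨r, ?_⟩⟩, ?_⟩
    · have h2 := h.rmR_x hi1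
      rw [hi2, hi3] at h2
      simp only [BF, Finset.mem_filter, Multiset.mem_toFinset]
      rw [mem_roots (hne _), hi2, hi3]
      refine ⟨⟨by simp [IsRoot, hval], hlt⟩, ?_⟩
      rw [← h2]; rw [← hval] at hmul; exact hmul
    · apply Subtype.ext
      simp only [disEquiv, hi2]

theorem RelP.eps (h : RelP P μ v x) (hμ : ∀ i, 1 ≤ μ i) (hd : 0 < P.natDegree) (hl : 0 < P.leadingCoeff) :
    epsilonP P = sgn (eE μ v) x := by
  unfold epsilonP
  rw [← Nat.card_congr (Equiv.ofBijective _ (disEquiv_bij h hμ hd)), Nat.card_sigma, ← Finset.prod_pow_eq_pow_sum]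
  unfold sgn
  have : ∀ i, (∏ j, if (x i).im = 0 ∧ (x j).im = 0 ∧ (x i).re < (x j).re then (-1:ℤ) ^ eE μ v i j else 1) =
      if (x i).im = 0 then (-1) ^ (BF P μ v x i).card else 1 := by
    intro i
    split_ifs with hi
    · rw [h.card_BF hμ hd hl i hi, gtS, Finset.prod_filter]
      refine Finset.prod_congr rfl fun j _ => ?_
      simp only [hi, true_and]
    · simp [hi]
  simp only [this]
  rw [← Finset.prod_filter, ← Finset.prod_subtype_eq_prod_filter]
  rw [Finset.subtype_univ]
  refine Finset.prod_congr rfl fun i _ => ?_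
  rw [Nat.card_eq_fintype_card, Fintype.card_coe]

end eps
end

noncomputable section
set_option linter.unusedSectionVars false
set_option linter.unusedVariables false
set_option linter.unusedSimpArgs false

section relsol
variable {ι : Type*} [Fintype ι] {P : ℝ[X]} {μ : ι → ℕ} {v : ι → ℝ} {x y : ι → ℂ}

lemma RelP.natDeg (h : RelP P μ v x) : P.natDegree = (∑ i, μ i) + 1 := by
  have := natDegree_of_derivative Finset.univ μ x _ (RelP.cne (μ := μ)) (P.map (algebraMap ℝ ℂ)) (by rw [derivative_map]; exact h.der)
  rwa [natDegree_map_eq_of_injective (algebraMap ℝ ℂ).injective] at this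

lemma RelP.coeff_eq (h : RelP P μ v x) (j : ℕ) : ((P.coeff (j+1) : ℝ) : ℂ) * (j + 1) = (((∑ i, μ i) + 1 : ℕ) : ℂ) * (∏ i, (X - C (x i)) ^ μ i).coeff j := by
  have := congrArg (fun p => p.coeff j) h.der
  simp only [coeff_map, coeff_derivative, coeff_C_mul] at this
  rw [← this]; simp

lemma prod_monic (μ : ι → ℕ) (x : ι → ℂ) : (∏ i, (X - C (x i)) ^ μ i).Monic :=
  monic_prod_of_monic _ _ fun i _ => (monic_X_sub_C _).pow _

lemma RelP.monic (h : RelP P μ v x) : P.Monic := by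
  have h1 := h.coeff_eq (∑ i, μ i)
  have h2 : (∏ i, (X - C (x i)) ^ μ i).coeff (∑ i, μ i) = 1 := by
    have := prod_monic μ x
    rw [Monic, leadingCoeff, natDegree_prodS] at this
    exact this
  rw [h2, mul_one] at h1
  have h3 : ((P.coeff (∑ i, μ i + 1) : ℝ) : ℂ) = 1 := by
    have hc := RelP.cne (μ := μ)
    push_cast at h1 hc
    apply mul_right_cancel₀ hc
    rw [h1, one_mul]
  rw [Monic, leadingCoeff, h.natDeg]
  exact_mod_cast h3

lemma prod_nextCoeff (μ : ι → ℕ) (x : ι → ℂ) : (∏ i, (X - C (x i)) ^ μ i).nextCoeff = - ∑ i, (μ i : ℂ) * x i := by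
  rw [Monic.nextCoeff_prod _ _ fun i _ => (monic_X_sub_C _).pow _, ← Finset.sum_neg_distrib]
  refine Finset.sum_congr rfl fun i _ => ?_
  rw [(monic_X_sub_C _).nextCoeff_pow, nextCoeff_X_sub_C]; simp

lemma RelP.coeff_iff (h : RelP P μ v x) (hμ : ∀ i, 1 ≤ μ i) [hι : Nonempty ι] : P.coeff (∑ i, μ i) = 0 ↔ ∑ i, (μ i : ℂ) * x i = 0 := by
  have hpos : 0 < ∑ i, μ i := Finset.sum_pos (fun i _ => hμ i) Finset.univ_nonempty
  obtain ⟨N, hN⟩ : ∃ N, ∑ i, μ i = N + 1 := ⟨_, (Nat.sub_add_cancel hpos).symm⟩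
  have h1 := h.coeff_eq N
  have h2 : (∏ i, (X - C (x i)) ^ μ i).coeff N = - ∑ i, (μ i : ℂ) * x i := by
    rw [← prod_nextCoeff, nextCoeff_of_natDegree_pos (by rw [natDegree_prodS]; exact hpos), natDegree_prodS, hN]; simp
  rw [h2] at h1
  rw [hN]
  have hN0 : ((N:ℂ) + 1) ≠ 0 := by exact_mod_cast Nat.succ_ne_zero N
  have hc := RelP.cne (μ := μ)
  constructor
  · intro h0
    rw [h0, Complex.ofReal_zero, zero_mul] at h1
    have := (mul_eq_zero.1 h1.symm).resolve_left hc
    simpa using this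
  · intro h0
    rw [h0, neg_zero, mul_zero] at h1
    have := (mul_eq_zero.1 h1).resolve_right hN0
    exact_mod_cast this

lemma RelP.normalized_iff (h : RelP P μ v x) (hμ : ∀ i, 1 ≤ μ i) [hι : Nonempty ι] : IsNormalized ((∑ i, μ i) + 1) P ↔ ∑ i, (μ i : ℂ) * x i = 0 := by
  unfold IsNormalized
  rw [Nat.add_sub_cancel, h.coeff_iff hμ]
  exact ⟨fun h => h.2.2, fun h' => ⟨h.natDeg, h.monic, h'⟩⟩

lemma real_of_conj (G : ℂ[X]) (h : G.map (starRingEnd ℂ) = G) : ∃ P : ℝ[X], P.map (algebraMap ℝ ℂ) = G := by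
  have : G ∈ lifts (algebraMap ℝ ℂ) := by
    rw [lifts_iff_coeff_lifts]
    intro n
    have := congrArg (fun p => p.coeff n) h
    simp only [coeff_map] at this
    obtain ⟨r, hr⟩ := Complex.conj_eq_iff_real.1 this
    exact ⟨r, hr.symm⟩
  rw [mem_lifts] at this
  exact this

lemma map_conj_real (P : ℝ[X]) : (P.map (algebraMap ℝ ℂ)).map (starRingEnd ℂ) = P.map (algebraMap ℝ ℂ) := by
  ext n; simp [coeff_map]

lemma Sol.exists_P (hμ : ∀ i, 1 ≤ μ i) (hx : x ∈ Sol (((∑ i, μ i) + 1 : ℕ) : ℝ) μ v) : ∃ P, IsNormalized ((∑ i, μ i) + 1) P ∧ RelP P μ v x := by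
  obtain ⟨hinj, hsum, ⟨τ, hτ1, hτ2, hτ3⟩, C0, hC⟩ := hx
  rcases isEmpty_or_nonempty ι with hι | hι
  · refine ⟨X, ⟨by simp, monic_X, by simp⟩, hinj, by simp, fun i => hι.elim i⟩
  set G : ℂ[X] := C C0 + C (((∑ i, μ i) + 1 : ℕ) : ℂ) * antider (∏ i, (X - C (x i)) ^ μ i) with hG
  have hGd : derivative G = C (((∑ i, μ i) + 1 : ℕ) : ℂ) * ∏ i, (X - C (x i)) ^ μ i := by
    rw [hG, derivative_add, derivative_C, zero_add, derivative_C_mul, derivative_antider]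
  have hGv : ∀ i, G.eval (x i) = v i := by
    intro i
    rw [← hC i, primX_eq_antider, hG]; simp only [eval_add, eval_C, eval_mul]; simp
  have hGc : G.map (starRingEnd ℂ) = G := by
    have hd : derivative (G.map (starRingEnd ℂ)) = derivative G := by
      rw [derivative_map, hGd, Polynomial.map_mul, Polynomial.map_prod, map_C, map_natCast]
      congr 1
      rw [← Equiv.prod_comp τ (fun i => (X - C (x i)) ^ μ i)]
      refine Finset.prod_congr rfl fun i _ => ?_
      rw [hτ1, hτ3]; simp
    obtain ⟨i⟩ := hι
    have h1 := eq_add_C_of_derivative_eq hd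
    have h2 := congrArg (fun p => p.eval (x (τ i))) h1
    simp only [eval_add, eval_C] at h2
    rw [hGv, hτ2, hτ3, eval_map_apply, hGv, Complex.conj_ofReal] at h2
    have h3 := left_eq_add.1 h2
    rw [h3] at h1
    simpa using h1
  obtain ⟨P, hP⟩ := real_of_conj G hGc
  have hR : RelP P μ v x := ⟨hinj, by rw [← derivative_map, hP, hGd], by rw [hP]; exact hGv⟩
  exact ⟨P, (hR.normalized_iff hμ).2 hsum, hR⟩

lemma RelP.perm (h : RelP P μ v x) (hμ : ∀ i, 1 ≤ μ i) (h' : RelP P μ v y) : ∃ σ : Equiv.Perm ι, (∀ i, μ (σ i) = μ i) ∧ (∀ i, v (σ i) = v i) ∧ ∀ i, y (σ i) = x i := by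
  have : ∀ i, ∃ j, y j = x i ∧ v j = v i := by
    intro i
    have hi := h.rm_x i
    obtain ⟨j, hj, hj'⟩ := h'.exists_of_two (z := x i) (w := (v i : ℂ)) (by rw [hi]; have := hμ i; omega)
    exact ⟨j, hj, Complex.ofReal_injective hj'⟩
  choose s hs1 hs2 using this
  have hs : Function.Injective s := by
    intro i j hij
    apply h.inj
    rw [← hs1, ← hs1, hij]
  refine ⟨Equiv.ofBijective s (Finite.injective_iff_bijective.1 hs), fun i => ?_, hs2, hs1⟩
  show μ (s i) = μ i
  have h1 := h'.rm_der_x (s i)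
  rw [hs1, h.rm_der_x] at h1
  exact h1.symm

lemma RelP.comp (h : RelP P μ v x) (σ : Equiv.Perm ι) (h1 : ∀ i, μ (σ i) = μ i) (h2 : ∀ i, v (σ i) = v i) : RelP P μ v (fun i => x (σ i)) := by
  refine ⟨h.inj.comp σ.injective, ?_, fun i => by rw [h.val, h2]⟩
  rw [h.der, ← Equiv.prod_comp σ (fun i => (X - C (x i)) ^ μ i)]
  simp only [h1]

lemma RelP.conj (h : RelP P μ v x) : RelP P μ v (fun i => (starRingEnd ℂ) (x i)) := by
  refine ⟨(starRingEnd ℂ).injective.comp h.inj, ?_, fun i => ?_⟩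
  · rw [← map_conj_real, h.der, Polynomial.map_mul, Polynomial.map_prod, map_C, map_natCast]
    congr 1
    refine Finset.prod_congr rfl fun i _ => ?_
    simp
  · rw [← map_conj_real, eval_map_apply, h.val, Complex.conj_ofReal]

lemma RelP.mem_Sol (h : RelP P μ v x) (hμ : ∀ i, 1 ≤ μ i) (hn : IsNormalized ((∑ i, μ i) + 1) P) : x ∈ Sol (((∑ i, μ i) + 1 : ℕ) : ℝ) μ v := by
  refine ⟨h.inj, ?_, ?_, ?_⟩
  · rcases isEmpty_or_nonempty ι with hι | hι
    · simp
    · exact (h.normalized_iff hμ).1 hn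
  · obtain ⟨σ, h1, h2, h3⟩ := h.conj.perm hμ h
    exact ⟨σ, h1, h2, h3⟩
  · have hd : derivative (P.map (algebraMap ℝ ℂ)) = derivative (C (((∑ i, μ i) + 1 : ℕ) : ℂ) * antider (∏ i, (X - C (x i)) ^ μ i)) := by
      rw [derivative_map, h.der, derivative_C_mul, derivative_antider]
    refine ⟨(P.map (algebraMap ℝ ℂ)).eval 0, fun i => ?_⟩
    have := eval_sub_eq_of_derivative_eq hd (x i) 0
    rw [h.val, eval_mul, eval_mul, antider_eval_zero, mul_zero, sub_zero, eval_C] at this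
    rw [primX_eq_antider, Complex.ofReal_natCast, ← this]; ring

lemma RelP.unique {Q : ℝ[X]} (h : RelP P μ v x) (h' : RelP Q μ v x) (hP : IsNormalized ((∑ i, μ i) + 1) P) (hQ : IsNormalized ((∑ i, μ i) + 1) Q) : P = Q := by
  have hd : derivative (P.map (algebraMap ℝ ℂ)) = derivative (Q.map (algebraMap ℝ ℂ)) := by
    rw [derivative_map, h.der, derivative_map, h'.der]
  have he := eq_add_C_of_derivative_eq hd
  have : (P.map (algebraMap ℝ ℂ)).eval 0 - (Q.map (algebraMap ℝ ℂ)).eval 0 = 0 := by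
    rcases isEmpty_or_nonempty ι with hι | ⟨⟨i⟩⟩
    · have h1 := hP.2.2
      have h2 := hQ.2.2
      simp at h1 h2
      rw [← coeff_zero_eq_eval_zero, ← coeff_zero_eq_eval_zero, coeff_map, coeff_map, h1, h2, sub_self]
    · have := congrArg (fun p => p.eval (x i)) he
      simp only [eval_add, eval_C] at this
      rw [h.val, h'.val] at this
      exact left_eq_add.1 this
  rw [this, C_0, add_zero] at he
  exact map_injective _ (algebraMap ℝ ℂ).injective he

/-- the prescribed reduced type -/
def rT (μ : ι → ℕ) (v : ι → ℝ) (t : ℝ) : Multiset ℕ := (Finset.univ.filter (fun i => v i = t)).val.map μ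

def RF (P : ℝ[X]) (t : ℝ) : Finset ℂ := (P.map (algebraMap ℝ ℂ) - C (t : ℂ)).roots.toFinset.filter fun z => 2 ≤ rootMultiplicity z (P.map (algebraMap ℝ ℂ) - C (t : ℂ))

lemma redRamType_eq (P : ℝ[X]) (t : ℝ) : redRamType P t = (RF P t).val.map fun z => rootMultiplicity z (P.map (algebraMap ℝ ℂ) - C (t : ℂ)) - 1 := by
  unfold redRamType ramType RF
  rw [Multiset.map_map, Multiset.filter_map, Finset.filter_val]
  congr 1
  apply Multiset.filter_congr
  intro z hz
  simp only [Function.comp]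
  omega

lemma RelP.red (h : RelP P μ v x) (hμ : ∀ i, 1 ≤ μ i) (t : ℝ) : redRamType P t = rT μ v t := by
  rw [redRamType_eq, rT]
  have : RF P t = (Finset.univ.filter (fun i => v i = t)).map ⟨x, h.inj⟩ := by
    ext z
    simp only [RF, Finset.mem_filter, Finset.mem_map, Finset.mem_univ, true_and, Function.Embedding.coeFn_mk, Multiset.mem_toFinset, ← Multiset.count_pos, count_roots]
    constructor
    · rintro ⟨_, h2⟩
      obtain ⟨i, hi, hi'⟩ := h.exists_of_two h2
      exact ⟨i, Complex.ofReal_injective hi', hi⟩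
    · rintro ⟨i, rfl, rfl⟩
      rw [h.rm_x]
      have := hμ i
      omega
  rw [this, Finset.map_val, Multiset.map_map]
  apply Multiset.map_congr rfl
  intro i hi
  have hi' : v i = t := by simpa using hi
  subst hi'
  simp [h.rm_x]

lemma exists_inj_of_map_eq {α : Type*} (f : α → ℕ) (g : ℂ → ℕ) (s : Finset α) : ∀ t : Finset ℂ, s.val.map f = t.val.map g →
    ∃ h : α → ℂ, Set.InjOn h s ∧ ∀ a ∈ s, h a ∈ t ∧ g (h a) = f a := by
  induction s using Finset.induction_on with
  | empty => intro t _; exact ⟨fun _ => 0, by simp, by simp⟩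
  | insert a s ha ih =>
    intro t ht
    rw [Finset.insert_val_of_notMem ha, Multiset.map_cons] at ht
    have h1 : f a ∈ t.val.map g := by rw [← ht]; exact Multiset.mem_cons_self _ _
    obtain ⟨b, hb, hb'⟩ := Multiset.mem_map.1 h1
    have h2 : s.val.map f = (t.erase b).val.map g := by
      rw [← Multiset.cons_erase hb, Multiset.map_cons, hb'] at ht
      rw [Finset.erase_val]
      exact (Multiset.cons_inj_right _).1 ht
    obtain ⟨h, hi, hh⟩ := ih _ h2
    have hne : ∀ c ∈ s, c ≠ a := fun c hc hca => ha (hca ▸ hc)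
    refine ⟨Function.update h a b, ?_, ?_⟩
    · intro c hc d hd hcd
      rw [Finset.coe_insert, Set.mem_insert_iff] at hc hd
      rcases hc with rfl | hc <;> rcases hd with rfl | hd
      · rfl
      · rw [Function.update_self, Function.update_of_ne (hne d hd)] at hcd
        exact absurd hcd.symm (Finset.ne_of_mem_erase (hh d hd).1)
      · rw [Function.update_self, Function.update_of_ne (hne c hc)] at hcd
        exact absurd hcd (Finset.ne_of_mem_erase (hh c hc).1)
      · rw [Function.update_of_ne (hne c hc), Function.update_of_ne (hne d hd)] at hcd
        exact hi hc hd hcd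
    · intro c hc
      rcases Finset.mem_insert.1 hc with rfl | hc
      · rw [Function.update_self]; exact ⟨hb, hb'⟩
      · rw [Function.update_of_ne (hne c hc)]
        exact ⟨Finset.mem_of_mem_erase (hh c hc).1, (hh c hc).2⟩

lemma exists_RelP (hμ : ∀ i, 1 ≤ μ i) (hn : IsNormalized ((∑ i, μ i) + 1) P) (hP : ∀ i, redRamType P (v i) = rT μ v (v i)) : ∃ x, RelP P μ v x := by
  have h1 : ∀ i, ∃ h : ι → ℂ, Set.InjOn h (Finset.univ.filter (fun j => v j = v i) : Finset ι) ∧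
      ∀ a ∈ Finset.univ.filter (fun j => v j = v i), h a ∈ RF P (v i) ∧ rootMultiplicity (h a) (P.map (algebraMap ℝ ℂ) - C (v i : ℂ)) - 1 = μ a := by
    intro i
    have := hP i
    rw [redRamType_eq, rT] at this
    exact exists_inj_of_map_eq _ _ _ _ this.symm
  have h2 : ∀ t : ℝ, ∃ h : ι → ℂ, Set.InjOn h (Finset.univ.filter (fun j => v j = t) : Finset ι) ∧
      ∀ a ∈ Finset.univ.filter (fun j => v j = t), h a ∈ RF P t ∧ rootMultiplicity (h a) (P.map (algebraMap ℝ ℂ) - C (t : ℂ)) - 1 = μ a := by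
    intro t
    by_cases ht : ∃ i, v i = t
    · obtain ⟨i, rfl⟩ := ht; exact h1 i
    · push Not at ht
      refine ⟨fun _ => 0, ?_, ?_⟩
      · intro a ha; simp [ht a] at ha
      · intro a ha; simp [ht a] at ha
  choose h hi hh using h2
  set x : ι → ℂ := fun i => h (v i) i with hx
  have hm : ∀ i, rootMultiplicity (x i) (P.map (algebraMap ℝ ℂ) - C (v i : ℂ)) = μ i + 1 := by
    intro i
    obtain ⟨k1, k2⟩ := hh (v i) i (by simp)
    have := hμ i
    simp only [hx]
    omega
  have hne : ∀ c : ℂ, P.map (algebraMap ℝ ℂ) - C c ≠ 0 := by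
    intro c h0
    have := congrArg natDegree (sub_eq_zero.1 h0)
    rw [natDegree_map_eq_of_injective (algebraMap ℝ ℂ).injective, hn.1, natDegree_C] at this
    omega
  have hval : ∀ i, (P.map (algebraMap ℝ ℂ)).eval (x i) = (v i : ℂ) := by
    intro i
    have := (rootMultiplicity_pos (hne (v i))).1 (by rw [hm i]; omega : 0 < rootMultiplicity (x i) _)
    simpa [IsRoot, sub_eq_zero] using this
  have hinj : Function.Injective x := by
    intro i j hij
    have hv : v i = v j := by
      apply Complex.ofReal_injective
      rw [← hval i, ← hval j, hij]
    apply hi (v i) (by simp) (by simp [hv])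
    simp only [hx] at hij
    rw [hij, hv]
  refine ⟨x, hinj, ?_, hval⟩
  have hdvd : ∏ i, (X - C (x i)) ^ μ i ∣ (derivative P).map (algebraMap ℝ ℂ) := by
    apply Finset.prod_dvd_of_coprime
    · intro i _ j _ hij
      exact (pairwise_coprime_X_sub_C hinj hij).pow
    · intro i _
      have h1 : (X - C (x i)) ^ (μ i + 1) ∣ P.map (algebraMap ℝ ℂ) - C (v i : ℂ) := by
        rw [← hm i]; exact pow_rootMultiplicity_dvd _ _
      have h2 := pow_sub_one_dvd_derivative_of_pow_dvd h1
      rw [derivative_sub, derivative_C, sub_zero, derivative_map, Nat.add_sub_cancel] at h2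
      exact h2
  have hdeg : ((derivative P).map (algebraMap ℝ ℂ)).natDegree = ∑ i, μ i := by
    rw [natDegree_map_eq_of_injective (algebraMap ℝ ℂ).injective, natDegree_derivative, hn.1]; rfl
  have hlc : ((derivative P).map (algebraMap ℝ ℂ)).leadingCoeff = (((∑ i, μ i) + 1 : ℕ) : ℂ) := by
    rw [leadingCoeff, hdeg, coeff_map, coeff_derivative]
    have := hn.2.1
    rw [Monic, leadingCoeff, hn.1] at this
    rw [this]; simp
  rw [← hlc]
  exact eq_leadingCoeff_mul_of_monic_of_dvd_of_natDegree_le (prod_monic μ x) hdvd (by rw [natDegree_prodS, hdeg])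

/-- automorphisms of the labelled index set -/
def AutL (μ : ι → ℕ) (v : ι → ℝ) : Type _ := {σ : Equiv.Perm ι // (∀ i, μ (σ i) = μ i) ∧ ∀ i, v (σ i) = v i}

instance (μ : ι → ℕ) (v : ι → ℝ) : Fintype (AutL μ v) := by unfold AutL; infer_instance

theorem NN_eq_aut (hμ : ∀ i, 1 ≤ μ i) (T : Set ℝ) (hT : ∀ i, v i ∈ T) :
    NN 1 μ v (eE μ v) = (Fintype.card (AutL μ v) : ℤ) *
      ∑ᶠ P ∈ {P : ℝ[X] | IsNormalized ((∑ i, μ i) + 1) P ∧ ∀ t ∈ T, redRamType P t = rT μ v t}, epsilonP P := by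
  rw [NN_sign 1 (((∑ i, μ i) + 1 : ℕ) : ℝ) (by rw [one_mul]; positivity)]
  set S := {P : ℝ[X] | IsNormalized ((∑ i, μ i) + 1) P ∧ ∀ t ∈ T, redRamType P t = rT μ v t} with hS
  have hex : ∀ P ∈ S, ∃ x, RelP P μ v x := fun P hP => exists_RelP hμ hP.1 fun i => hP.2 _ (hT i)
  choose! xP hxP using hex
  have hfin := Sol.finite μ hμ (((∑ i, μ i) + 1 : ℕ) : ℝ) (by positivity) v
  have hSfin : S.Finite := by
    apply Set.Finite.of_injOn (f := xP) (t := Sol (((∑ i, μ i) + 1 : ℕ) : ℝ) μ v) _ _ hfin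
    · intro P hP; exact (hxP P hP).mem_Sol hμ hP.1
    · intro P hP Q hQ hPQ
      have := hxP Q hQ
      rw [← hPQ] at this
      exact (hxP P hP).unique this hP.1 hQ.1
  unfold NN
  rw [finsum_mem_eq_finite_toFinset_sum _ hfin, finsum_mem_eq_finite_toFinset_sum _ hSfin, Finset.mul_sum]
  have h1 : ∑ P ∈ hSfin.toFinset, (Fintype.card (AutL μ v) : ℤ) * epsilonP P = ∑ p ∈ hSfin.toFinset ×ˢ (Finset.univ : Finset (AutL μ v)), epsilonP p.1 := by
    rw [Finset.sum_product]
    refine Finset.sum_congr rfl fun P _ => ?_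
    simp
  rw [h1]
  symm
  refine Finset.sum_bij (fun p _ => fun i => xP p.1 (p.2.1 i)) ?_ ?_ ?_ ?_
  · rintro ⟨P, σ⟩ hp
    simp only [Finset.mem_product, Set.Finite.mem_toFinset, Finset.mem_univ, and_true] at hp ⊢
    exact ((hxP P hp).comp σ.1 σ.2.1 σ.2.2).mem_Sol hμ hp.1
  · rintro ⟨P, σ⟩ hp ⟨Q, σ'⟩ hq hpq
    simp only [Finset.mem_product, Set.Finite.mem_toFinset, Finset.mem_univ, and_true] at hp hq hpq
    have k1 := (hxP P hp).comp σ.1 σ.2.1 σ.2.2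
    have k2 := (hxP Q hq).comp σ'.1 σ'.2.1 σ'.2.2
    rw [← hpq] at k2
    have hPQ := k1.unique k2 hp.1 hq.1
    subst hPQ
    congr 1
    apply Subtype.ext
    ext1 i
    exact (hxP P hp).inj (congrFun hpq i)
  · intro x hx
    rw [Set.Finite.mem_toFinset] at hx
    obtain ⟨P, hn, hP⟩ := Sol.exists_P hμ hx
    have hPS : P ∈ S := ⟨hn, fun t _ => hP.red hμ t⟩
    obtain ⟨σ, k1, k2, k3⟩ := hP.perm hμ (hxP P hPS)
    exact ⟨(P, ⟨σ, k1, k2⟩), Finset.mem_product.2 ⟨hSfin.mem_toFinset.2 hPS, Finset.mem_univ _⟩, funext k3⟩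
  · rintro ⟨P, σ⟩ hp
    simp only [Finset.mem_product, Set.Finite.mem_toFinset, Finset.mem_univ, and_true] at hp ⊢
    have k1 := (hxP P hp).comp σ.1 σ.2.1 σ.2.2
    exact k1.eps hμ (by rw [k1.natDeg]; omega) (by rw [k1.monic.leadingCoeff]; exact one_pos)

end relsol
end

noncomputable section
set_option linter.unusedSectionVars false
set_option linter.unusedVariables false
set_option linter.unusedSimpArgs false

section autcard

lemma AutL_card_congr {α β : Type*} [Fintype α] [Fintype β] (e : α ≃ β) (μ : β → ℕ) (v : β → ℝ) :
    Fintype.card (AutL (fun i => μ (e i)) (fun i => v (e i))) = Fintype.card (AutL μ v) := by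
  apply Fintype.card_congr
  unfold AutL
  refine Equiv.subtypeEquiv e.permCongr fun σ => ?_
  constructor
  · rintro ⟨h1, h2⟩
    exact ⟨fun i => by simpa using h1 (e.symm i), fun i => by simpa using h2 (e.symm i)⟩
  · rintro ⟨h1, h2⟩
    exact ⟨fun i => by simpa using h1 (e i), fun i => by simpa using h2 (e i)⟩

variable {U : Type*} [Fintype U]

lemma AutL_card_sum (w : U → ℕ) (vU : U → ℝ) (K : ℝ) (hK : ∀ i, -K < vU i) (m : ℕ) :
    Fintype.card (AutL (Sum.elim w (fun _ : Fin m => 1)) (Sum.elim vU (fun j : Fin m => -(K + ((j:ℕ):ℝ))))) = Fintype.card (AutL w vU) := by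
  symm
  let f : AutL w vU → AutL (Sum.elim w (fun _ : Fin m => 1)) (Sum.elim vU (fun j : Fin m => -(K + ((j:ℕ):ℝ)))) := fun σ =>
    ⟨Equiv.sumCongr σ.1 1, by rintro (i | j) <;> simp [σ.2.1], by rintro (i | j) <;> simp [σ.2.2]⟩
  apply Fintype.card_of_bijective (f := f)
  constructor
  · intro σ σ' h
    apply Subtype.ext
    ext1 u
    have := congrArg (fun ρ => ρ.1 (Sum.inl u)) h
    simpa [f] using this
  · rintro ⟨ρ, h1, h2⟩
    have hfix : ∀ j, ρ (Sum.inr j) = Sum.inr j := by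
      intro j
      have hj := h2 (Sum.inr j)
      rcases hr : ρ (Sum.inr j) with u | j'
      · rw [hr] at hj
        simp only [Sum.elim_inl, Sum.elim_inr] at hj
        have := hK u
        have h0 : (0:ℝ) ≤ ((j:ℕ):ℝ) := Nat.cast_nonneg _
        linarith
      · rw [hr] at hj
        simp only [Sum.elim_inr, neg_inj, add_right_inj, Nat.cast_inj] at hj
        rw [Fin.ext hj]
    have hmaps : Set.MapsTo ρ (Set.range Sum.inl) (Set.range Sum.inl) := by
      rintro _ ⟨u, rfl⟩
      rcases hr : ρ (Sum.inl u) with u' | j'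
      · exact ⟨u', rfl⟩
      · rw [← hfix j'] at hr
        exact absurd (ρ.injective hr) (by simp)
    obtain ⟨⟨σ, π⟩, hσ⟩ := Equiv.Perm.mem_sumCongrHom_range_of_perm_mapsTo_inl hmaps
    rw [Equiv.Perm.sumCongrHom_apply] at hσ
    subst hσ
    refine ⟨⟨σ, fun i => by simpa using h1 (Sum.inl i), fun i => by simpa using h2 (Sum.inl i)⟩, ?_⟩
    apply Subtype.ext
    ext1 z
    rcases z with u | j
    · simp [f]
    · simp only [f]; rw [hfix j]; simp

def gS (m : ℕ) : U ⊕ Fin m → ↥((Finset.univ : Finset U).disjSum (Finset.range m)) :=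
  fun z => ⟨Sum.map id (fun j : Fin m => (j:ℕ)) z, by rcases z with u | j <;> simp⟩

lemma gS_bij (m : ℕ) : Function.Bijective (gS (U := U) m) := by
  constructor
  · intro a b h
    have := congrArg Subtype.val h
    rcases a with a | a <;> rcases b with b | b <;> simp [gS] at this ⊢ <;> first | exact this | exact Fin.ext this
  · rintro ⟨z, hz⟩
    rcases z with u | j
    · exact ⟨Sum.inl u, rfl⟩
    · exact ⟨Sum.inr ⟨j, by simpa using hz⟩, rfl⟩

lemma AutL_card (w : U → ℕ) (vU : U → ℝ) (K : ℝ) (hK : ∀ i, -K < vU i) (m : ℕ) :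
    Fintype.card (AutL (fun i : ↥((Finset.univ : Finset U).disjSum (Finset.range m)) => ME w i) (fun i : ↥((Finset.univ : Finset U).disjSum (Finset.range m)) => VE vU K i)) = Fintype.card (AutL w vU) := by
  rw [← AutL_card_congr (Equiv.ofBijective _ (gS_bij m)), ← AutL_card_sum w vU K hK m]
  have e1 : (fun i => ME w ((Equiv.ofBijective _ (gS_bij (U := U) m)) i : U ⊕ ℕ)) = Sum.elim w (fun _ : Fin m => 1) := by
    funext i; rcases i with i | i <;> rfl
  have e2 : (fun i => VE vU K ((Equiv.ofBijective _ (gS_bij (U := U) m)) i : U ⊕ ℕ)) = Sum.elim vU (fun j : Fin m => -(K + ((j:ℕ):ℝ))) := by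
    funext i; rcases i with i | i <;> rfl
  rw [e1, e2]

lemma rT_coe (w : U → ℕ) (vU : U → ℝ) (K : ℝ) (m : ℕ) (t : ℝ) :
    rT (fun i : ↥((Finset.univ : Finset U).disjSum (Finset.range m)) => ME w i) (fun i : ↥((Finset.univ : Finset U).disjSum (Finset.range m)) => VE vU K i) t
    = rT w vU t + rT (fun _ : Fin m => 1) (fun j : Fin m => -(K + ((j:ℕ):ℝ))) t := by
  have h : (Finset.univ.filter (fun i : ↥((Finset.univ : Finset U).disjSum (Finset.range m)) => VE vU K i = t)) =
      ((Finset.univ.filter (fun i : U ⊕ Fin m => VE vU K (gS m i) = t)).map (Equiv.ofBijective _ (gS_bij (U := U) m)).toEmbedding) := by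
    ext i
    obtain ⟨z, rfl⟩ := (gS_bij m).2 i
    simp [(gS_bij (U := U) m).1.eq_iff]
  have h2 : (Finset.univ.filter (fun i : U ⊕ Fin m => VE vU K (gS m i) = t)) = (Finset.univ.filter (fun i : U => vU i = t)).disjSum (Finset.univ.filter (fun j : Fin m => -(K + ((j:ℕ):ℝ)) = t)) := by
    ext i; rcases i with i | i <;> simp [VE, gS]
  unfold rT
  rw [h, h2, Finset.map_val, Multiset.map_map, Finset.val_disjSum, Multiset.disjSum, Multiset.map_add, Multiset.map_map, Multiset.map_map]
  rfl
end autcard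

section final
variable {k : ℕ} (lam : Fin k → Multiset ℕ)

abbrev UL : Type := Σ i : Fin k, (lam i).ToType
def wL (u : UL lam) : ℕ := u.2.1
def vL (u : UL lam) : ℝ := -(((u.1 : ℕ) + 1 : ℕ) : ℝ)

lemma vL_gt (u : UL lam) : -((k:ℝ) + 1) < vL lam u := by
  unfold vL
  have : ((u.1:ℕ):ℝ) < k := by exact_mod_cast u.1.2
  push_cast; linarith

lemma wL_pos (hlam : ∀ i, 0 ∉ lam i) (u : UL lam) : 1 ≤ wL lam u := by
  unfold wL
  have h1 : u.2.1 ∈ lam u.1 := Multiset.coe_mem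
  rcases Nat.eq_zero_or_pos u.2.1 with h | h
  · rw [h] at h1; exact absurd h1 (hlam _)
  · exact h

lemma rT_L (i : Fin k) : rT (wL lam) (vL lam) (-(((i:ℕ) + 1 : ℕ) : ℝ)) = lam i := by
  have h : (Finset.univ.filter (fun u => vL lam u = (-(((i:ℕ) + 1 : ℕ) : ℝ)))) = (Finset.univ : Finset (lam i).ToType).map (Function.Embedding.sigmaMk i) := by
    ext ⟨j, a⟩
    simp only [vL, Finset.mem_filter, Finset.mem_univ, true_and, Finset.mem_map, Function.Embedding.sigmaMk_apply, neg_inj, Nat.cast_inj, add_left_inj]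
    constructor
    · intro hj
      have := Fin.ext hj
      subst this
      exact ⟨a, rfl⟩
    · rintro ⟨b, hb⟩
      rw [(Sigma.mk.inj_iff.1 hb).1]
  unfold rT
  rw [h, Finset.map_val, Multiset.map_map]
  exact Multiset.map_univ_coe (lam i)

lemma rT_L0 {t : ℝ} (ht : t ≤ -((k:ℝ) + 1)) : rT (wL lam) (vL lam) t = 0 := by
  unfold rT
  rw [Finset.filter_false_of_mem]
  · rfl
  · intro u _ h
    have := vL_gt lam u
    linarith

lemma rT_F0 (m : ℕ) {K t : ℝ} (ht : -K < t) : rT (fun _ : Fin m => 1) (fun j : Fin m => -(K + ((j:ℕ):ℝ))) t = 0 := by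
  unfold rT
  rw [Finset.filter_false_of_mem]
  · rfl
  · intro j _ h
    have : (0:ℝ) ≤ ((j:ℕ):ℝ) := Nat.cast_nonneg _
    linarith

lemma rT_F (m : ℕ) (K : ℝ) (j : Fin m) : rT (fun _ : Fin m => 1) (fun j : Fin m => -(K + ((j:ℕ):ℝ))) (-(K + ((j:ℕ):ℝ))) = {1} := by
  unfold rT
  have : Finset.univ.filter (fun i : Fin m => -(K + ((i:ℕ):ℝ)) = -(K + ((j:ℕ):ℝ))) = {j} := by
    ext i
    simp [Fin.ext_iff]
  rw [this]; rfl

lemma sum_wL : ∑ u, wL lam u = ∑ i, (lam i).sum := by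
  rw [Fintype.sum_sigma]
  refine Finset.sum_congr rfl fun i _ => ?_
  conv_rhs => rw [← Multiset.map_univ_coe (lam i)]
  rfl

lemma cc_eq (hlam : ∀ i, 0 ∉ lam i) (m : ℕ) : cc (wL lam) (vL lam) ((k:ℝ)+1) 1 Finset.univ m = (Fintype.card (AutL (wL lam) (vL lam)) : ℤ) * sNum lam m := by
  unfold cc NF
  have hμ : ∀ i : ↥((Finset.univ : Finset (UL lam)).disjSum (Finset.range m)), 1 ≤ ME (wL lam) i := fun i => ME_pos _ (wL_pos lam hlam) _
  have hsum : ∑ i : ↥((Finset.univ : Finset (UL lam)).disjSum (Finset.range m)), ME (wL lam) i = m + ∑ i, (lam i).sum := by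
    rw [Finset.sum_coe_sort _ (ME (wL lam)), Finset.sum_disjSum, ← sum_wL]
    simp [ME, add_comm]
  have := NN_eq_aut (v := fun i : ↥((Finset.univ : Finset (UL lam)).disjSum (Finset.range m)) => VE (vL lam) ((k:ℝ)+1) i) hμ
    (Set.range (fun i : Fin k => (-(((i:ℕ) + 1 : ℕ) : ℝ))) ∪ Set.range (fun j : Fin m => -((k + (j:ℕ) + 1 : ℕ) : ℝ))) (by
      rintro ⟨u | j, hz⟩
      · exact Or.inl ⟨u.1, rfl⟩
      · refine Or.inr ⟨⟨j, by simpa using hz⟩, ?_⟩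
        simp only [VE, Sum.elim_inr]; push_cast; ring)
  rw [AutL_card _ _ _ (vL_gt lam), hsum] at this
  refine this.trans ?_
  congr 1
  unfold sNum
  refine finsum_mem_congr (Set.ext fun P => ?_) fun _ _ => rfl
  simp only [Set.mem_ofPred_eq]
  refine and_congr_right fun _ => ?_
  simp only [rT_coe]
  have e1 : ∀ i : Fin k, rT (wL lam) (vL lam) (-(((i:ℕ) + 1 : ℕ) : ℝ)) + rT (fun _ : Fin m => 1) (fun j : Fin m => -((k:ℝ) + 1 + ((j:ℕ):ℝ))) (-(((i:ℕ) + 1 : ℕ) : ℝ)) = lam i := by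
    intro i
    rw [rT_L, rT_F0, add_zero]
    have : ((i:ℕ):ℝ) < k := by exact_mod_cast i.2
    push_cast; linarith
  have e2 : ∀ j : Fin m, rT (wL lam) (vL lam) (-((k + (j:ℕ) + 1 : ℕ) : ℝ)) + rT (fun _ : Fin m => 1) (fun j : Fin m => -((k:ℝ) + 1 + ((j:ℕ):ℝ))) (-((k + (j:ℕ) + 1 : ℕ) : ℝ)) = {1} := by
    intro j
    have : (-((k + (j:ℕ) + 1 : ℕ) : ℝ)) = -((k:ℝ) + 1 + ((j:ℕ):ℝ)) := by push_cast; ring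
    rw [this, rT_F, rT_L0, zero_add]
    have : (0:ℝ) ≤ ((j:ℕ):ℝ) := Nat.cast_nonneg _
    linarith
  constructor
  · intro h
    exact ⟨fun i => (h _ (Or.inl ⟨i, rfl⟩)).trans (e1 i), fun j => (h _ (Or.inr ⟨j, rfl⟩)).trans (e2 j)⟩
  · rintro ⟨h1, h2⟩ t (⟨i, rfl⟩ | ⟨j, rfl⟩)
    · exact (h1 i).trans (e1 i).symm
    · exact (h2 j).trans (e2 j).symm

end final
end

theorem Feven_poly_in_q_tanh (k : ℕ) (lam : Fin k → Multiset ℕ)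
    (hlam : ∀ i, (0 : ℕ) ∉ lam i) :
    ∃ Q : MvPolynomial (Fin 2) ℚ,
      ∀ m : ℕ,
        iteratedDeriv m (fun q : ℝ => (MvPolynomial.aeval ![q, Real.tanh q]) Q) 0
          = (sEven lam m : ℝ) := by
  obtain ⟨Q, hQ⟩ := E_poly (w := wL lam) (vL lam) ((k:ℝ)+1) (wL_pos lam hlam) (vL_gt lam)
  have hA : (Fintype.card (AutL (wL lam) (vL lam)) : ℚ) ≠ 0 := by
    have : Nonempty (AutL (wL lam) (vL lam)) := ⟨⟨1, by simp, by simp⟩⟩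
    exact_mod_cast Fintype.card_ne_zero
  refine ⟨MvPolynomial.C (1 / (Fintype.card (AutL (wL lam) (vL lam)) : ℚ)) * Q, fun m => ?_⟩
  have h1 : Ec (wL lam) (vL lam) ((k:ℝ)+1) Finset.univ m = (Fintype.card (AutL (wL lam) (vL lam)) : ℤ) * sEven lam m := by
    unfold Ec sEven nn
    rw [sum_wL, add_comm (∑ i, (lam i).sum) m, cc_eq lam hlam]
    split_ifs <;> simp
  rw [link]
  have h2 : PowerSeries.coeff m (phi (MvPolynomial.C (1 / (Fintype.card (AutL (wL lam) (vL lam)) : ℚ)) * Q)) * (m.factorial : ℚ) = (sEven lam m : ℚ) := by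
    have h3 : phi (MvPolynomial.C (1 / (Fintype.card (AutL (wL lam) (vL lam)) : ℚ)) * Q) = (1 / (Fintype.card (AutL (wL lam) (vL lam)) : ℚ)) • phi Q := by
      rw [← MvPolynomial.smul_eq_C_mul, map_smul]
    rw [h3, map_smul, smul_eq_mul, mul_assoc, hQ, h1]
    push_cast
    field_simp
  rw [h2]
  simp
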